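/- Let (X_i)_{i≥0} be a stationary Markov chain with invariant measure μ and transition kernel K, and let P_n(f) denote the law of n^{−1/2} Σ_{i=1}^n (f(X_i) − μ(f)). Assume f ∈ C(M,p,μ) for some M > 0 and p ∈ (3,∞], and that Σ_{k>0} k (α_3(k))^{(p−3)/p} < ∞. Then for every concave c : [0,∞) → [0,∞) with c(0) = 0, d_c(P_n(f), G_{σ^2(f)}) = O(c(n^{−1/2})), where G_{σ^2(f)} is the centered Gaussian law with variance σ^2(μ,K,f). -/

import Mathlib

open MeasureTheory ProbabilityTheory Filter Set
open scoped ENNReal NNReal Topology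

noncomputable section

/-- The intermittent (Liverani–Saussol–Vaienti) map `T_γ` on `[0,1]`. -/
def Tmap (γ : ℝ) (x : ℝ) : ℝ :=
  if x < 1/2 then x * (1 + 2 ^ γ * x ^ γ) else 2 * x - 1

/-- `K` is the Perron–Frobenius operator of `T_γ` with respect to `ν`:
`ν(f · g∘T_γ) = ν(K f · g)` for all bounded measurable `f, g`. -/
def IsPFOp (γ : ℝ) (ν : Measure ℝ) (K : (ℝ → ℝ) → ℝ → ℝ) : Prop :=
  ∀ f g : ℝ → ℝ, Measurable f → Measurable g → (∃ C, ∀ x, |f x| ≤ C) →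
    (∃ C, ∀ x, |g x| ≤ C) →
    ∫ x, f x * g (Tmap γ x) ∂ν = ∫ x, (K f) x * g x ∂ν

/-- Birkhoff sums `S_n(f) = ∑_{i=1}^n f ∘ T_γ^i`. -/
def Sn (γ : ℝ) (f : ℝ → ℝ) (n : ℕ) (x : ℝ) : ℝ :=
  ∑ i ∈ Finset.range n, f ((Tmap γ)^[i + 1] x)

/-- The class `H_{α,1}` of `α`-Hölder functions (with constant 1) on `[0,1]`. -/
def Hclass (α : ℝ) : Set (ℝ → ℝ) :=
  {f | ∀ x ∈ Set.Icc (0:ℝ) 1, ∀ y ∈ Set.Icc (0:ℝ) 1, |f x - f y| ≤ |x - y| ^ α}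

/-- `f_t = 1_{(-∞, t]}`. -/
def indic (t : ℝ) : ℝ → ℝ := Set.indicator (Set.Iic t) (fun _ => 1)

/-- Nested operator `K^{(n_1,…,n_k)}(f_1,…,f_k)
= K^{n_1}(f_1 · K^{n_2}(f_2 ⋯ K^{n_k}(f_k)⋯))`, encoded by a list of pairs. -/
def nestedK (K : (ℝ → ℝ) → ℝ → ℝ) : List (ℕ × (ℝ → ℝ)) → ℝ → ℝ
  | [] => fun _ => 1
  | (n, f) :: r => K^[n] (fun x => f x * nestedK K r x)

/-- The list `[(n, f_{t_1}), (n_2, f_{t_2}), …, (n_l, f_{t_l})]`. -/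
def tList (n : ℕ) {l : ℕ} (ns : Fin l → ℕ) (ts : Fin (l + 1) → ℝ) :
    List (ℕ × (ℝ → ℝ)) :=
  (n, indic (ts 0)) :: List.ofFn (fun i : Fin l => (ns i, indic (ts i.succ)))

/-- The coefficient `α_1(n)` for an operator `K` with invariant measure `ν`. -/
def alpha1 (K : (ℝ → ℝ) → ℝ → ℝ) (ν : Measure ℝ) (n : ℕ) : ℝ :=
  ⨆ t : ℝ, ∫ x, |K^[n] (indic t) x - ∫ y, indic t y ∂ν| ∂ν

/-- The dependence coefficient `α_k(n)`. -/
def alphaCoef (K : (ℝ → ℝ) → ℝ → ℝ) (ν : Measure ℝ) (k n : ℕ) : ℝ :=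
  max (alpha1 K ν n)
    (⨆ j : Fin (k - 1), ⨆ ns : {m : Fin (j.1 + 1) → ℕ // ∀ i, 1 ≤ m i},
      ⨆ ts : Fin (j.1 + 2) → ℝ,
        ∫ x, |nestedK K (tList n ns.1 ts) x - ∫ y, nestedK K (tList n ns.1 ts) y ∂ν| ∂ν)

/-- The dependence coefficient `β_1(n)`. -/
def beta1 (K : (ℝ → ℝ) → ℝ → ℝ) (ν : Measure ℝ) (n : ℕ) : ℝ :=
  ∫ x, (⨆ t : ℝ, |K^[n] (indic t) x - ∫ y, indic t y ∂ν|) ∂ν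

/-- The dependence coefficient `β_k(n)`. -/
def betaCoef (K : (ℝ → ℝ) → ℝ → ℝ) (ν : Measure ℝ) (k n : ℕ) : ℝ :=
  max (beta1 K ν n)
    (⨆ j : Fin (k - 1), ⨆ ns : {m : Fin (j.1 + 1) → ℕ // ∀ i, 1 ≤ m i},
      ∫ x, (⨆ ts : Fin (j.1 + 2) → ℝ,
        |nestedK K (tList n ns.1 ts) x - ∫ y, nestedK K (tList n ns.1 ts) y ∂ν|) ∂ν)

/-- The operator associated with a Markov transition kernel: `(Kg)(x) = ∫ g(y) K(x,dy)`. -/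
def Kop (K : Kernel ℝ ℝ) (g : ℝ → ℝ) : ℝ → ℝ := fun x => ∫ y, g y ∂(K x)

/-- The class `Mon(M,p,μ)` of monotonic functions on an open interval, vanishing
elsewhere, with tail condition `μ(|g|>t) ≤ M^p t^{-p}` (for `p < ∞`),
resp. `μ(|g|>M) = 0` (for `p = ∞`). -/
def Mon (M : ℝ) (p : ℝ≥0∞) (μ : Measure ℝ) (g : ℝ → ℝ) : Prop :=
  (∃ I : Set ℝ, IsOpen I ∧ I.OrdConnected ∧ (MonotoneOn g I ∨ AntitoneOn g I) ∧
      ∀ x ∉ I, g x = 0) ∧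
  (if p = ∞ then μ {x | M < |g x|} = 0
   else ∀ t : ℝ, 0 < t →
      μ {x | t < |g x|} ≤ ENNReal.ofReal (M ^ p.toReal * t ^ (-p.toReal)))

/-- The class `C(M,p,μ)`: the closure in `L¹(μ)` of convex-type combinations
`∑ a_i g_i`, `∑ |a_i| ≤ 1`, `g_i ∈ Mon(M,p,μ)`. -/
def ClassC (M : ℝ) (p : ℝ≥0∞) (μ : Measure ℝ) (f : ℝ → ℝ) : Prop :=
  Integrable f μ ∧ ∀ ε : ℝ, 0 < ε → ∃ (n : ℕ) (a : Fin n → ℝ) (g : Fin n → ℝ → ℝ),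
    (∑ i, |a i|) ≤ 1 ∧ (∀ i, Mon M p μ (g i)) ∧
    ∫ x, |f x - ∑ i, a i * g i x| ∂μ < ε

/-- The class `Lip_c` of functions `g` with `|g(x) − g(y)| ≤ c(|x−y|)`. -/
def LipC (c : ℝ → ℝ) : Set (ℝ → ℝ) := {g | ∀ x y : ℝ, |g x - g y| ≤ c |x - y|}

/-- The distance `d_c(P,Q) = sup_{g ∈ Lip_c} |P(g) − Q(g)|`. -/
def dC (c : ℝ → ℝ) (P Q : Measure ℝ) : ℝ :=
  ⨆ g : LipC c, |(∫ x, (g : ℝ → ℝ) x ∂P) - ∫ x, (g : ℝ → ℝ) x ∂Q|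


/-! ### Gaussian smoothing -/

/-- Convolution of `h` with the centered Gaussian law of variance `v`. -/
def gsm (v : ℝ≥0) (h : ℝ → ℝ) (x : ℝ) : ℝ := ∫ y, h (x + y) ∂gaussianReal 0 v

/-- The derivative of `gsm v h`, obtained by differentiating the Gaussian density. -/
def gsmD (v : ℝ≥0) (h : ℝ → ℝ) (x : ℝ) : ℝ := ∫ y, h (x + y) * (y / v) ∂gaussianReal 0 v

lemma integrable_gaussianReal_of_le_exp {v : ℝ≥0} {F : ℝ → ℝ} (hF : Measurable F) {C c : ℝ}
    (h : ∀ y, |F y| ≤ C * Real.exp (c * |y|)) : Integrable F (gaussianReal 0 v) := by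
  have hC : 0 ≤ C := by
    have := (abs_nonneg _).trans (h 0)
    simpa using this
  refine Integrable.mono' (g := fun y => C * (Real.exp (c * y) + Real.exp ((-c) * y)))
    (((integrable_exp_mul_gaussianReal c).add (integrable_exp_mul_gaussianReal (-c))).const_mul C)
    hF.aestronglyMeasurable (ae_of_all _ fun y => ?_)
  refine (h y).trans (mul_le_mul_of_nonneg_left ?_ hC)
  rcases abs_cases y with ⟨h1, _⟩ | ⟨h1, _⟩
  · rw [h1]; linarith [Real.exp_pos (-c * y)]
  · rw [h1]
    have : c * -y = -c * y := by ring
    rw [this]; linarith [Real.exp_pos (c * y)]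

lemma le_two_mul_exp_abs (a b y : ℝ) (ha : 0 ≤ a) (hb : 0 ≤ b) :
    a + b * |y| ≤ (a + b) * Real.exp |y| := by
  have h1 := Real.add_one_le_exp |y|
  have h2 := Real.one_le_exp (abs_nonneg y)
  nlinarith [abs_nonneg y]

lemma integral_gaussianReal_add_eq {v : ℝ≥0} (hv : v ≠ 0) (g : ℝ → ℝ) (x : ℝ) :
    ∫ y, g (x + y) ∂gaussianReal 0 v
      = ∫ y, g y * Real.exp (x * y / v - x ^ 2 / (2 * v)) ∂gaussianReal 0 v := by
  have h1 : ∫ y, g (x + y) ∂gaussianReal 0 v = ∫ y, g y ∂gaussianReal x v := by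
    have h2 := gaussianReal_map_const_add (μ := 0) (v := v) x
    rw [zero_add] at h2
    rw [← h2]
    exact ((Homeomorph.addLeft x).measurableEmbedding.integral_map g).symm
  rw [h1, integral_gaussianReal_eq_integral_smul hv, integral_gaussianReal_eq_integral_smul hv]
  congr 1
  ext y
  simp only [gaussianPDFReal_def, smul_eq_mul]
  have hv' : (v : ℝ) ≠ 0 := by exact_mod_cast hv
  have : Real.exp (-(y - x) ^ 2 / (2 * v))
      = Real.exp (-(y - 0) ^ 2 / (2 * v)) * Real.exp (x * y / v - x ^ 2 / (2 * v)) := by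
    rw [← Real.exp_add]; congr 1; field_simp; ring
  rw [this]; ring

lemma hasDerivAt_gsm {v : ℝ≥0} (hv : v ≠ 0) {h : ℝ → ℝ} (hm : Measurable h) {a b : ℝ}
    (ha : 0 ≤ a) (hb : 0 ≤ b) (hg : ∀ z, |h z| ≤ a + b * |z|) (x : ℝ) :
    HasDerivAt (gsm v h) (gsmD v h x) x := by
  have hv0 : (0 : ℝ) < v := by positivity
  have key : ∀ s, gsm v h (x + s)
      = ∫ y, h (x + y) * Real.exp (s * y / v - s ^ 2 / (2 * v)) ∂gaussianReal 0 v := by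
    intro s
    have := integral_gaussianReal_add_eq hv (fun y => h (x + y)) s
    simp only [gsm]
    rw [← this]
    simp only [add_assoc]
  have hg' : ∀ y, |h (x + y)| ≤ (a + b * |x| + b) * Real.exp |y| := by
    intro y
    refine (hg _).trans (le_trans ?_ (le_two_mul_exp_abs (a + b * |x|) b y (by positivity) hb))
    nlinarith [abs_add_le x y]
  have hmx : Measurable fun y => h (x + y) := hm.comp (measurable_const_add x)
  set A := a + b * |x| + b with hA
  have hA0 : 0 ≤ A := by positivity
  have main := (hasDerivAt_integral_of_dominated_loc_of_deriv_le (μ := gaussianReal 0 v)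
    (F := fun s y => h (x + y) * Real.exp (s * y / v - s ^ 2 / (2 * v)))
    (F' := fun s y => h (x + y) * (Real.exp (s * y / v - s ^ 2 / (2 * v)) * (y / v - s / v)))
    (x₀ := (0:ℝ)) (s := Ioo (-1) 1)
    (bound := fun y => A * Real.exp |y| * (Real.exp (|y| / v) * (2 * Real.exp |y| / v)))
    (Ioo_mem_nhds (by norm_num) (by norm_num))
    (Eventually.of_forall fun s => by
      apply Measurable.aestronglyMeasurable; fun_prop) ?_ ?_ ?_ ?_ ?_).2
  · have h0 : HasDerivAt (fun s => gsm v h (x + s)) (gsmD v h x) 0 := by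
      convert! main using 1
      · ext s; exact key s
      · simp [gsmD]
    have h1 := HasDerivAt.comp x (h₂ := fun s => gsm v h (x + s)) (h := fun z => z - x)
      (h₂' := gsmD v h x) (h' := 1) (by simpa using h0) ((hasDerivAt_id x).sub_const x)
    have h2 : ((fun s => gsm v h (x + s)) ∘ fun z => z - x) = gsm v h := by
      ext z; simp
    rw [h2, mul_one] at h1
    exact h1
  · refine integrable_gaussianReal_of_le_exp (C := A) (c := 1) (by fun_prop) fun y => ?_
    simpa using hg' y
  · apply Measurable.aestronglyMeasurable; fun_prop
  · refine ae_of_all _ fun y s hs => ?_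
    have hs1 : |s| ≤ 1 := abs_le.mpr ⟨hs.1.le, hs.2.le⟩
    rw [Real.norm_eq_abs, abs_mul, abs_mul, Real.abs_exp]
    refine mul_le_mul (hg' y) ?_ (by positivity) (by positivity)
    refine mul_le_mul ?_ ?_ (abs_nonneg _) (by positivity)
    · apply Real.exp_le_exp.mpr
      have h1 : s * y ≤ |y| := by
        calc s * y ≤ |s * y| := le_abs_self _
          _ = |s| * |y| := abs_mul _ _
          _ ≤ 1 * |y| := by gcongr
          _ = |y| := one_mul _
      have h2 : s * y / v ≤ |y| / v := by gcongr
      have h3 : 0 ≤ s ^ 2 / (2 * (v:ℝ)) := by positivity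
      linarith
    · rw [← sub_div, abs_div, abs_of_pos hv0]
      gcongr
      have := Real.add_one_le_exp |y|
      have h2 := Real.one_le_exp (abs_nonneg y)
      calc |y - s| ≤ |y| + |s| := abs_sub _ _
        _ ≤ _ := by linarith
  · refine integrable_gaussianReal_of_le_exp (C := A * (2 / v)) (c := 1 + 1 / v + 1)
      (by fun_prop) fun y => ?_
    rw [abs_of_nonneg (by positivity)]
    apply le_of_eq
    rw [show (1 + 1 / (v:ℝ) + 1) * |y| = |y| + |y| / v + |y| by ring, Real.exp_add, Real.exp_add]
    ring
  · refine ae_of_all _ fun y s _ => ?_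
    have h1 : HasDerivAt (fun s : ℝ => s * y / v - s ^ 2 / (2 * v)) (y / v - s / v) s := by
      have h2 := (((hasDerivAt_id s).mul_const y).div_const (v:ℝ)).sub
        (((hasDerivAt_id s).pow 2).div_const (2 * (v:ℝ)))
      convert! h2 using 1
      simp; field_simp
    exact (h1.exp).const_mul (h (x + y))

lemma measurable_gsm {v : ℝ≥0} {h : ℝ → ℝ} (hm : Measurable h) : Measurable (gsm v h) := by
  have : StronglyMeasurable (Function.uncurry fun x y : ℝ => h (x + y)) := by
    apply Measurable.stronglyMeasurable
    exact hm.comp (measurable_fst.add measurable_snd)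
  exact this.integral_prod_right.measurable

lemma measurable_gsmD {v : ℝ≥0} {h : ℝ → ℝ} (hm : Measurable h) : Measurable (gsmD v h) := by
  have : StronglyMeasurable (Function.uncurry fun x y : ℝ => h (x + y) * (y / v)) := by
    apply Measurable.stronglyMeasurable
    exact (hm.comp (measurable_fst.add measurable_snd)).mul (measurable_snd.div_const _)
  exact this.integral_prod_right.measurable

lemma integral_abs_gaussianReal_le (v : ℝ≥0) : ∫ y, |y| ∂gaussianReal 0 v ≤ √v := by
  have h2 : ∫ y, y ^ 2 ∂gaussianReal 0 v = v := by
    have := variance_id_gaussianReal (μ := 0) (v := v)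
    rw [variance_eq_integral measurable_id.aemeasurable] at this
    simpa using this
  have hi : Integrable (fun y : ℝ => y ^ 2) (gaussianReal 0 v) := by
    have := (memLp_id_gaussianReal (μ := 0) (v := v) 2).integrable_sq
    simpa using this
  have hi1 : Integrable (fun y : ℝ => |y|) (gaussianReal 0 v) := by
    have := (memLp_id_gaussianReal (μ := 0) (v := v) 1)
    simp only [ENNReal.coe_one] at this
    exact (memLp_one_iff_integrable.1 this).abs
  apply Real.le_sqrt_of_sq_le
  have h3 : 0 ≤ ∫ y, (|y| - ∫ z, |z| ∂gaussianReal 0 v) ^ 2 ∂gaussianReal 0 v :=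
    integral_nonneg fun y => sq_nonneg _
  set m := ∫ z, |z| ∂gaussianReal 0 v
  have h4 : ∫ y, (|y| - m) ^ 2 ∂gaussianReal 0 v = v - m ^ 2 := by
    have : ∀ y : ℝ, (|y| - m) ^ 2 = y ^ 2 - (2 * m) * |y| + m ^ 2 := by
      intro y; rw [← sq_abs y]; ring
    simp_rw [this]
    have e1 : Integrable (fun y : ℝ => y ^ 2 - (2 * m) * |y|) (gaussianReal 0 v) :=
      hi.sub (hi1.const_mul (2 * m))
    rw [integral_add e1 (integrable_const (m ^ 2)), integral_sub hi (hi1.const_mul (2 * m)), h2,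
      integral_const_mul, integral_const]
    simp only [probReal_univ, one_smul]
    ring
  rw [h4] at h3
  linarith

lemma abs_gsm_le {v : ℝ≥0} {h : ℝ → ℝ} {C : ℝ} (hC : ∀ z, |h z| ≤ C) (x : ℝ) :
    |gsm v h x| ≤ C := by
  have := norm_integral_le_of_norm_le_const (μ := gaussianReal 0 v) (f := fun y => h (x + y))
    (C := C) (ae_of_all _ fun y => hC _)
  simpa [gsm] using this

lemma integrable_abs_gaussianReal (v : ℝ≥0) :
    Integrable (fun y : ℝ => |y|) (gaussianReal 0 v) := by
  have := (memLp_id_gaussianReal (μ := 0) (v := v) 1)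
  simp only [ENNReal.coe_one] at this
  exact (memLp_one_iff_integrable.1 this).abs

lemma abs_gsmD_le {v : ℝ≥0} (hv : v ≠ 0) {h : ℝ → ℝ} {C : ℝ} (hC : ∀ z, |h z| ≤ C)
    (x : ℝ) : |gsmD v h x| ≤ C / √v := by
  have hv0 : (0 : ℝ) < v := by positivity
  have hC0 : 0 ≤ C := (abs_nonneg _).trans (hC 0)
  have h1 : |gsmD v h x| ≤ ∫ y, C / v * |y| ∂gaussianReal 0 v := by
    refine norm_integral_le_of_norm_le (f := fun y => h (x + y) * (y / v))
      ((integrable_abs_gaussianReal v).const_mul _) (ae_of_all _ fun y => ?_)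
    rw [Real.norm_eq_abs, abs_mul, abs_div, abs_of_pos hv0]
    calc |h (x + y)| * (|y| / v) ≤ C * (|y| / v) := by gcongr; exact hC _
      _ = _ := by ring
  rw [integral_const_mul] at h1
  refine h1.trans ((mul_le_mul_of_nonneg_left (integral_abs_gaussianReal_le v)
    (by positivity)).trans (le_of_eq ?_))
  have h3 := Real.mul_self_sqrt hv0.le
  have h4 : 0 < √(v:ℝ) := Real.sqrt_pos.mpr hv0
  field_simp
  nlinarith

lemma integrable_shift_gaussianReal {v : ℝ≥0} {h : ℝ → ℝ} (hm : Measurable h) {a b : ℝ}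
    (ha : 0 ≤ a) (hb : 0 ≤ b) (hg : ∀ z, |h z| ≤ a + b * |z|) (x : ℝ) :
    Integrable (fun y => h (x + y)) (gaussianReal 0 v) := by
  refine integrable_gaussianReal_of_le_exp (C := a + b * |x| + b) (c := 1)
    (hm.comp (measurable_const_add x)) fun y => ?_
  rw [one_mul]
  refine (hg _).trans (le_trans ?_ (le_two_mul_exp_abs (a + b * |x|) b y (by positivity) hb))
  nlinarith [abs_add_le x y]

lemma lin_growth_of_lipschitz {h : ℝ → ℝ} (hl : ∀ x y, |h x - h y| ≤ |x - y|) (z : ℝ) :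
    |h z| ≤ |h 0| + 1 * |z| := by
  have := hl z 0
  have h2 := abs_sub_abs_le_abs_sub (h z) (h 0)
  rw [sub_zero] at this
  linarith

lemma measurable_of_lipschitz {h : ℝ → ℝ} (hl : ∀ x y, |h x - h y| ≤ |x - y|) :
    Measurable h := by
  have : LipschitzWith 1 h := LipschitzWith.of_dist_le_mul fun x y => by
    simpa [Real.dist_eq] using hl x y
  exact this.continuous.measurable

lemma gsm_lipschitz {v : ℝ≥0} {h : ℝ → ℝ} (hl : ∀ x y, |h x - h y| ≤ |x - y|) (x y : ℝ) :
    |gsm v h x - gsm v h y| ≤ |x - y| := by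
  have hi := fun x => integrable_shift_gaussianReal (v := v) (measurable_of_lipschitz hl)
    (abs_nonneg (h 0)) zero_le_one (lin_growth_of_lipschitz hl) x
  unfold gsm
  rw [← integral_sub (hi x) (hi y)]
  have := norm_integral_le_of_norm_le_const (μ := gaussianReal 0 v)
    (f := fun z => h (x + z) - h (y + z))
    (C := |x - y|) (ae_of_all _ fun z => (hl _ _).trans (by simp))
  simpa using this

lemma abs_deriv_le_of_lipschitz {g : ℝ → ℝ} {d x : ℝ} (hg : HasDerivAt g d x)
    (hl : ∀ x y, |g x - g y| ≤ |x - y|) : |d| ≤ 1 := by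
  have : LipschitzWith 1 g := LipschitzWith.of_dist_le_mul fun x y => by
    simpa [Real.dist_eq] using hl x y
  have h2 := norm_deriv_le_of_lipschitz this (x₀ := x)
  rw [hg.deriv] at h2
  simpa using h2

/-- Differentiation commutes with Gaussian smoothing when the derivative is bounded. -/
lemma hasDerivAt_gsm_of_hasDerivAt {v : ℝ≥0} {g g' : ℝ → ℝ} {C : ℝ}
    (hg : ∀ x, HasDerivAt g (g' x) x) (hm' : Measurable g') (hC : ∀ x, |g' x| ≤ C) (x : ℝ) :
    HasDerivAt (gsm v g) (gsm v g' x) x := by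
  have hcont : Continuous g := continuous_iff_continuousAt.mpr fun x => (hg x).continuousAt
  have hC0 : 0 ≤ C := (abs_nonneg _).trans (hC 0)
  have hlip : ∀ x y, |g x - g y| ≤ C * |x - y| := fun x y => by
    have := convex_univ.norm_image_sub_le_of_norm_hasDerivWithin_le (f := g) (f' := g') (C := C)
      (fun z _ => (hg z).hasDerivWithinAt) (fun z _ => hC z) (mem_univ y) (mem_univ x)
    simpa using this
  have hgr : ∀ z, |g z| ≤ |g 0| + C * |z| := fun z => by
    have := hlip z 0
    have h2 := abs_sub_abs_le_abs_sub (g z) (g 0)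
    rw [sub_zero] at this
    linarith
  refine (hasDerivAt_integral_of_dominated_loc_of_deriv_le (μ := gaussianReal 0 v)
    (F := fun s y => g (s + y)) (F' := fun s y => g' (s + y)) (x₀ := x) (s := univ)
    (bound := fun _ => C) univ_mem ?_ ?_ ?_ ?_ ?_ ?_).2
  · exact Eventually.of_forall fun s =>
      (hcont.measurable.comp (measurable_const_add s)).aestronglyMeasurable
  · exact integrable_shift_gaussianReal hcont.measurable (abs_nonneg _) hC0 hgr x
  · exact (hm'.comp (measurable_const_add x)).aestronglyMeasurable
  · exact ae_of_all _ fun y s _ => hC _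
  · exact integrable_const _
  · exact ae_of_all _ fun y s _ => HasDerivAt.comp_add_const s y (hg (s + y))

lemma gsm_gsm {a b : ℝ≥0} {h : ℝ → ℝ} (hl : ∀ x y, |h x - h y| ≤ |x - y|) (x : ℝ) :
    gsm a (gsm b h) x = gsm (a + b) h x := by
  have hc := gaussianReal_conv_gaussianReal (m₁ := 0) (m₂ := 0) (v₁ := a) (v₂ := b)
  rw [add_zero] at hc
  have hi : Integrable (fun y => h (x + y)) (gaussianReal 0 (a + b)) :=
    integrable_shift_gaussianReal (measurable_of_lipschitz hl)
      (abs_nonneg (h 0)) zero_le_one (lin_growth_of_lipschitz hl) x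
  unfold gsm
  rw [← hc] at hi ⊢
  rw [integral_conv hi]
  simp only [add_assoc]

/-- A thrice differentiable function with the derivative bounds of a Gaussian smoothing of a
1-Lipschitz function at variance `v`. -/
structure SmoothChain (v : ℝ) (u0 u1 u2 u3 : ℝ → ℝ) : Prop where
  d0 : ∀ x, HasDerivAt u0 (u1 x) x
  d1 : ∀ x, HasDerivAt u1 (u2 x) x
  d2 : ∀ x, HasDerivAt u2 (u3 x) x
  b1 : ∀ x, |u1 x| ≤ 1
  b2 : ∀ x, |u2 x| ≤ 2 / √v
  b3 : ∀ x, |u3 x| ≤ 4 / v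
  l3 : ∀ x y, |u3 x - u3 y| ≤ 8 / (v * √v) * |x - y|

lemma exists_smoothChain {v : ℝ≥0} (hv : v ≠ 0) {h : ℝ → ℝ}
    (hl : ∀ x y, |h x - h y| ≤ |x - y|) :
    ∃ u1 u2 u3 : ℝ → ℝ, SmoothChain v (gsm v h) u1 u2 u3 := by
  set a : ℝ≥0 := v / 4 with ha
  have ha0 : a ≠ 0 := by positivity
  have hv0 : (0:ℝ) < v := by positivity
  have hm := measurable_of_lipschitz hl
  have hP : gsm v h = gsm a (gsm a (gsm a (gsm a h))) := by
    have hl2 := gsm_lipschitz (v := a) hl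
    have hl3 := gsm_lipschitz (v := a) hl2
    have e1 : gsm a (gsm a h) = gsm (a + a) h := funext fun x => gsm_gsm hl x
    rw [e1]
    have e2 : gsm a (gsm (a + a) h) = gsm (a + (a + a)) h := funext fun x => gsm_gsm hl x
    rw [e2]
    have e3 : gsm a (gsm (a + (a + a)) h) = gsm (a + (a + (a + a))) h :=
      funext fun x => gsm_gsm hl x
    rw [e3]
    congr 1
    rw [ha]
    apply NNReal.coe_injective
    push_cast
    ring
  have hsq : √(a:ℝ) = √v / 2 := by
    rw [ha]; push_cast
    rw [Real.sqrt_div' _ (by norm_num)]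
    congr 1
    rw [show (4:ℝ) = 2 ^ 2 by norm_num]; exact Real.sqrt_sq (by norm_num)
  set D1 := gsmD a h with hD1
  set D2 := gsmD a D1 with hD2
  set D3 := gsmD a D2 with hD3
  set D4 := gsmD a D3 with hD4
  have m1 : Measurable D1 := measurable_gsmD hm
  have m2 : Measurable D2 := measurable_gsmD m1
  have m3 : Measurable D3 := measurable_gsmD m2
  have d1 : ∀ x, HasDerivAt (gsm a h) (D1 x) x := fun x =>
    hasDerivAt_gsm ha0 hm (abs_nonneg (h 0)) zero_le_one (lin_growth_of_lipschitz hl) x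
  have b1 : ∀ x, |D1 x| ≤ 1 := fun x =>
    abs_deriv_le_of_lipschitz (d1 x) (gsm_lipschitz hl)
  have dgen : ∀ {g : ℝ → ℝ} {C : ℝ}, Measurable g → (∀ x, |g x| ≤ C) → ∀ x,
      HasDerivAt (gsm a g) (gsmD a g x) x := fun {g C} hg hC x =>
    hasDerivAt_gsm ha0 hg ((abs_nonneg _).trans (hC 0)) le_rfl
      (fun z => (hC z).trans (by simp)) x
  have b2 : ∀ x, |D2 x| ≤ 2 / √v := fun x => by
    have := abs_gsmD_le ha0 b1 x
    rw [hsq] at this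
    simpa using this
  have hs0 : 0 < √(v:ℝ) := Real.sqrt_pos.mpr hv0
  have hss : √(v:ℝ) * √v = v := Real.mul_self_sqrt hv0.le
  have b3 : ∀ x, |D3 x| ≤ 4 / v := fun x => by
    have := abs_gsmD_le ha0 b2 x
    rw [hsq] at this
    refine this.trans (le_of_eq ?_)
    rw [div_div_div_eq, mul_comm (2:ℝ) 2, hss]; norm_num
  have b4 : ∀ x, |D4 x| ≤ 8 / (v * √v) := fun x => by
    have := abs_gsmD_le ha0 b3 x
    rw [hsq] at this
    refine this.trans (le_of_eq ?_)
    field_simp; norm_num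
  refine ⟨gsm a (gsm a (gsm a D1)), gsm a (gsm a D2), gsm a D3, ?_, ?_, ?_, ?_, ?_, ?_, ?_⟩
  · intro x
    rw [hP]
    exact hasDerivAt_gsm_of_hasDerivAt (hasDerivAt_gsm_of_hasDerivAt
      (hasDerivAt_gsm_of_hasDerivAt d1 m1 b1) (measurable_gsm m1) (abs_gsm_le b1))
      (measurable_gsm (measurable_gsm m1)) (abs_gsm_le (abs_gsm_le b1)) x
  · intro x
    exact hasDerivAt_gsm_of_hasDerivAt (hasDerivAt_gsm_of_hasDerivAt
      (dgen m1 b1) m2 b2) (measurable_gsm m2) (abs_gsm_le b2) x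
  · intro x
    exact hasDerivAt_gsm_of_hasDerivAt (dgen m2 b2) m3 b3 x
  · exact abs_gsm_le (abs_gsm_le (abs_gsm_le b1))
  · exact abs_gsm_le (abs_gsm_le b2)
  · exact abs_gsm_le b3
  · intro x y
    have := convex_univ.norm_image_sub_le_of_norm_hasDerivWithin_le (f := gsm a D3) (f' := D4)
      (C := 8 / (v * √v))
      (fun z _ => (dgen m3 b3 z).hasDerivWithinAt) (fun z _ => b4 z) (mem_univ y) (mem_univ x)
    simpa using this

lemma SmoothChain.measurable3 {v : ℝ} {u0 u1 u2 u3 : ℝ → ℝ} (h : SmoothChain v u0 u1 u2 u3) :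
    Measurable u1 ∧ Measurable u2 ∧ Measurable u3 := by
  refine ⟨?_, ?_, ?_⟩
  · exact (continuous_iff_continuousAt.mpr fun x => (h.d1 x).continuousAt).measurable
  · exact (continuous_iff_continuousAt.mpr fun x => (h.d2 x).continuousAt).measurable
  · have hK : LipschitzWith (8 / (v * √v)).toNNReal u3 := LipschitzWith.of_dist_le_mul fun x y => by
      rw [Real.dist_eq, Real.dist_eq]
      refine (h.l3 x y).trans (mul_le_mul_of_nonneg_right ?_ (abs_nonneg _))
      exact Real.le_coe_toNNReal _
    exact hK.continuous.measurable

/-- Averaging the third derivative against an independent Gaussian improves its bound. -/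
lemma abs_gsm_third_le {v w : ℝ≥0} (hv : v ≠ 0) {h : ℝ → ℝ}
    (hl : ∀ x y, |h x - h y| ≤ |x - y|) {u1 u2 u3 : ℝ → ℝ}
    (hu : SmoothChain v (gsm v h) u1 u2 u3) (x : ℝ) :
    |gsm w u3 x| ≤ 4 / (v + w) := by
  have hvw : w + v ≠ 0 := by positivity
  obtain ⟨w1, w2, w3, hw⟩ := exists_smoothChain hvw hl
  obtain ⟨m1, m2, m3⟩ := hu.measurable3
  have e0 : gsm w (gsm v h) = gsm (w + v) h := funext fun x => gsm_gsm hl x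
  have e1 : gsm w u1 = w1 := funext fun x => by
    have := hasDerivAt_gsm_of_hasDerivAt (v := w) hu.d0 m1 hu.b1 x
    rw [e0] at this
    exact this.unique (hw.d0 x)
  have e2 : gsm w u2 = w2 := funext fun x => by
    have := hasDerivAt_gsm_of_hasDerivAt (v := w) hu.d1 m2 hu.b2 x
    rw [e1] at this
    exact this.unique (hw.d1 x)
  have e3 : gsm w u3 = w3 := funext fun x => by
    have := hasDerivAt_gsm_of_hasDerivAt (v := w) hu.d2 m3 hu.b3 x
    rw [e2] at this
    exact this.unique (hw.d2 x)
  rw [e3]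
  have := hw.b3 x
  rw [NNReal.coe_add, add_comm (w:ℝ)] at this
  exact this

/-! ### Taylor expansions with a Hölder third derivative -/

lemma abs_le_rpow_succ_of_deriv {F F' : ℝ → ℝ} {K a : ℝ} (ha : 0 ≤ a)
    (hF : ∀ y, HasDerivAt F (F' y) y) (h0 : F 0 = 0) (hb : ∀ y, |F' y| ≤ K * |y| ^ a) (y : ℝ) :
    |F y| ≤ K * |y| ^ (a + 1) := by
  have hK : 0 ≤ K := by
    have := (abs_nonneg _).trans (hb 1)
    simpa using this
  have hsub : ∀ z ∈ uIcc 0 y, |z| ≤ |y| := by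
    intro z hz
    rcases le_total 0 y with h | h
    · rw [uIcc_of_le h] at hz
      rw [abs_of_nonneg hz.1, abs_of_nonneg h]; exact hz.2
    · rw [uIcc_of_ge h] at hz
      rw [abs_of_nonpos hz.2, abs_of_nonpos h]; linarith [hz.1]
  have := (convex_uIcc 0 y).norm_image_sub_le_of_norm_hasDerivWithin_le (f := F) (f' := F')
      (C := K * |y| ^ a) (fun z _ => (hF z).hasDerivWithinAt)
      (fun z hz => (hb z).trans (mul_le_mul_of_nonneg_left
        (Real.rpow_le_rpow (abs_nonneg _) (hsub z hz) ha) hK)) left_mem_uIcc right_mem_uIcc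
  rw [h0, sub_zero, sub_zero, Real.norm_eq_abs, Real.norm_eq_abs, mul_assoc] at this
  refine this.trans (le_of_eq ?_)
  rcases eq_or_ne y 0 with rfl | hy
  · simp [Real.zero_rpow (show a + 1 ≠ 0 by linarith)]
  · rw [Real.rpow_add (abs_pos.mpr hy), Real.rpow_one]

section Taylor

variable {u0 u1 u2 u3 : ℝ → ℝ} {K δ : ℝ}

lemma taylor_one (d2 : ∀ x, HasDerivAt u2 (u3 x) x) (hδ : 0 ≤ δ)
    (hK : ∀ x y, |u3 x - u3 y| ≤ K * |x - y| ^ δ) (x y : ℝ) :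
    |u2 (x + y) - u2 x - y * u3 x| ≤ K * |y| ^ (1 + δ) := by
  rw [add_comm 1 δ]
  refine abs_le_rpow_succ_of_deriv (F := fun y => u2 (x + y) - u2 x - y * u3 x)
    (F' := fun y => u3 (x + y) - u3 x) hδ ?_ (by simp) ?_ y
  · intro y
    have h1 := ((HasDerivAt.comp_const_add x y (d2 (x + y))).sub_const (u2 x)).sub
      ((hasDerivAt_id y).mul_const (u3 x))
    convert! h1 using 1
    simp
  · intro y
    simpa using hK (x + y) x

lemma taylor_two (d1 : ∀ x, HasDerivAt u1 (u2 x) x) (d2 : ∀ x, HasDerivAt u2 (u3 x) x)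
    (hδ : 0 ≤ δ) (hK : ∀ x y, |u3 x - u3 y| ≤ K * |x - y| ^ δ) (x y : ℝ) :
    |u1 (x + y) - u1 x - y * u2 x - y ^ 2 / 2 * u3 x| ≤ K * |y| ^ (2 + δ) := by
  rw [show 2 + δ = 1 + δ + 1 by ring]
  refine abs_le_rpow_succ_of_deriv (F := fun y => u1 (x + y) - u1 x - y * u2 x - y ^ 2 / 2 * u3 x)
    (F' := fun y => u2 (x + y) - u2 x - y * u3 x) (by linarith) ?_ (by simp)
    (taylor_one d2 hδ hK x) y
  intro y
  have h1 := (((HasDerivAt.comp_const_add x y (d1 (x + y))).sub_const (u1 x)).sub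
    ((hasDerivAt_id y).mul_const (u2 x))).sub
    ((((hasDerivAt_id y).pow 2).div_const 2).mul_const (u3 x))
  convert! h1 using 1
  simp

lemma taylor_three (d0 : ∀ x, HasDerivAt u0 (u1 x) x) (d1 : ∀ x, HasDerivAt u1 (u2 x) x)
    (d2 : ∀ x, HasDerivAt u2 (u3 x) x)
    (hδ : 0 ≤ δ) (hK : ∀ x y, |u3 x - u3 y| ≤ K * |x - y| ^ δ) (x y : ℝ) :
    |u0 (x + y) - u0 x - y * u1 x - y ^ 2 / 2 * u2 x - y ^ 3 / 6 * u3 x|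
      ≤ K * |y| ^ (3 + δ) := by
  rw [show 3 + δ = 2 + δ + 1 by ring]
  refine abs_le_rpow_succ_of_deriv
    (F := fun y => u0 (x + y) - u0 x - y * u1 x - y ^ 2 / 2 * u2 x - y ^ 3 / 6 * u3 x)
    (F' := fun y => u1 (x + y) - u1 x - y * u2 x - y ^ 2 / 2 * u3 x) (by linarith) ?_ (by simp)
    (taylor_two d1 d2 hδ hK x) y
  intro y
  have h1 := ((((HasDerivAt.comp_const_add x y (d0 (x + y))).sub_const (u0 x)).sub
    ((hasDerivAt_id y).mul_const (u1 x))).sub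
    ((((hasDerivAt_id y).pow 2).div_const 2).mul_const (u2 x))).sub
    ((((hasDerivAt_id y).pow 3).div_const 6).mul_const (u3 x))
  convert! h1 using 1
  simp only [id, Nat.cast_ofNat]
  ring

end Taylor

lemma SmoothChain.holder {v δ : ℝ} (hv : 0 < v) (hδ : 0 ≤ δ) (hδ1 : δ ≤ 1)
    {u0 u1 u2 u3 : ℝ → ℝ} (h : SmoothChain v u0 u1 u2 u3) (x y : ℝ) :
    |u3 x - u3 y| ≤ 8 * v ^ (-(1 + δ / 2)) * |x - y| ^ δ := by
  set q := |x - y| / √v with hq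
  have hs : 0 < √v := Real.sqrt_pos.mpr hv
  have hq0 : 0 ≤ q := by positivity
  have e : 8 * v ^ (-(1 + δ / 2)) * |x - y| ^ δ = 8 / v * q ^ δ := by
    rw [hq, Real.div_rpow (abs_nonneg _) hs.le, Real.sqrt_eq_rpow, ← Real.rpow_mul hv.le, neg_add,
      Real.rpow_add hv, Real.rpow_neg hv.le, Real.rpow_neg hv.le, Real.rpow_one,
      show 1 / 2 * δ = δ / 2 by ring]
    ring
  rw [e]
  rcases le_total q 1 with hq1 | hq1
  · have h1 : q ≤ q ^ δ := by
      rcases eq_or_lt_of_le hq0 with h0 | h0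
      · rw [← h0]; exact Real.rpow_nonneg le_rfl _
      · simpa using Real.rpow_le_rpow_of_exponent_ge h0 hq1 hδ1
    calc |u3 x - u3 y| ≤ 8 / (v * √v) * |x - y| := h.l3 x y
      _ = 8 / v * q := by rw [hq]; field_simp
      _ ≤ _ := by gcongr
  · have h1 : 1 ≤ q ^ δ := Real.one_le_rpow hq1 hδ
    calc |u3 x - u3 y| ≤ |u3 x| + |u3 y| := abs_sub _ _
      _ ≤ 4 / v + 4 / v := add_le_add (h.b3 x) (h.b3 y)
      _ = 8 / v * 1 := by ring
      _ ≤ _ := by gcongr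

/-- Fourth moment of the standard Gaussian law. -/
def gaussM4 : ℝ := ∫ y, y ^ 4 ∂gaussianReal 0 1

lemma integrable_pow_gaussianReal (v : ℝ≥0) (n : ℕ) :
    Integrable (fun y : ℝ => y ^ n) (gaussianReal 0 v) := by
  refine integrable_gaussianReal_of_le_exp (C := n.factorial) (c := 1) (by fun_prop) fun y => ?_
  rw [abs_pow, one_mul]
  have := Real.pow_div_factorial_le_exp |y| (abs_nonneg y) n
  rw [div_le_iff₀ (by positivity)] at this
  linarith

lemma integral_sq_gaussianReal (v : ℝ≥0) : ∫ y, y ^ 2 ∂gaussianReal 0 v = v := by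
  have := variance_id_gaussianReal (μ := 0) (v := v)
  rw [variance_eq_integral measurable_id.aemeasurable] at this
  simpa using this

lemma integral_pow_three_gaussianReal (v : ℝ≥0) : ∫ y, y ^ 3 ∂gaussianReal 0 v = 0 := by
  have h1 := gaussianReal_map_neg (μ := 0) (v := v)
  rw [neg_zero] at h1
  have h2 : ∫ y, y ^ 3 ∂gaussianReal 0 v = ∫ y, (-y) ^ 3 ∂gaussianReal 0 v := by
    conv_lhs => rw [← h1]
    exact integral_map (by fun_prop) (by fun_prop)
  have h3 : ∀ y : ℝ, (-y) ^ 3 = -y ^ 3 := fun y => by ring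
  simp_rw [h3, integral_neg] at h2
  linarith

lemma integral_pow_four_gaussianReal (v : ℝ≥0) :
    ∫ y, y ^ 4 ∂gaussianReal 0 v = v ^ 2 * gaussM4 := by
  have h1 := gaussianReal_map_const_mul (μ := 0) (v := 1) (√v)
  rw [mul_zero, mul_one] at h1
  have h2 : NNReal.mk (√(v:ℝ) ^ 2) (sq_nonneg _) = v := by
    apply NNReal.coe_injective
    exact Real.sq_sqrt v.2
  rw [h2] at h1
  rw [← h1, integral_map (by fun_prop) (by fun_prop), gaussM4, ← integral_const_mul]
  congr 1
  ext y
  rw [mul_pow, show √(v:ℝ) ^ 4 = (√v ^ 2) ^ 2 by ring, Real.sq_sqrt (NNReal.coe_nonneg v)]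

lemma gaussM4_nonneg : 0 ≤ gaussM4 := integral_nonneg fun y => by positivity

lemma abs_gsm_sub_self_le {w : ℝ≥0} {h : ℝ → ℝ} (hl : ∀ x y, |h x - h y| ≤ |x - y|) (x : ℝ) :
    |gsm w h x - h x| ≤ √w := by
  have hi := integrable_shift_gaussianReal (v := w) (measurable_of_lipschitz hl)
    (abs_nonneg (h 0)) zero_le_one (lin_growth_of_lipschitz hl) x
  have e : gsm w h x - h x = ∫ y, (h (x + y) - h x) ∂gaussianReal 0 w := by
    rw [integral_sub hi (integrable_const _)]; simp [gsm]
  rw [e]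
  refine le_trans ?_ (integral_abs_gaussianReal_le w)
  refine norm_integral_le_of_norm_le (f := fun y => h (x + y) - h x)
    (integrable_abs_gaussianReal w) (ae_of_all _ fun y => ?_)
  simpa using hl (x + y) x

lemma SmoothChain.heat {v : ℝ} (hv : 0 < v) {w : ℝ≥0} {u0 u1 u2 u3 : ℝ → ℝ}
    (h : SmoothChain v u0 u1 u2 u3) (x : ℝ) :
    |gsm w u0 x - u0 x - w / 2 * u2 x| ≤ 8 * gaussM4 / (v * √v) * w ^ 2 := by
  set b := 8 / (v * √v) with hb
  have hs : 0 < √v := Real.sqrt_pos.mpr hv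
  have hK : ∀ x y, |u3 x - u3 y| ≤ b * |x - y| ^ (1:ℝ) := fun x y => by
    rw [Real.rpow_one]; exact h.l3 x y
  have hT := taylor_three h.d0 h.d1 h.d2 zero_le_one hK x
  have hm0 : Continuous u0 := continuous_iff_continuousAt.mpr fun x => (h.d0 x).continuousAt
  have hlip : ∀ x y, |u0 x - u0 y| ≤ |x - y| := fun x y => by
    have := convex_univ.norm_image_sub_le_of_norm_hasDerivWithin_le (f := u0) (f' := u1) (C := 1)
      (fun z _ => (h.d0 z).hasDerivWithinAt) (fun z _ => h.b1 z) (mem_univ y) (mem_univ x)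
    simpa using this
  have hi := integrable_shift_gaussianReal (v := w) (measurable_of_lipschitz hlip)
    (abs_nonneg (u0 0)) zero_le_one (lin_growth_of_lipschitz hlip) x
  have i1 : Integrable (fun y : ℝ => y * u1 x) (gaussianReal 0 w) := by
    simpa using (integrable_pow_gaussianReal w 1).mul_const (u1 x)
  have i2 : Integrable (fun y : ℝ => y ^ 2 / 2 * u2 x) (gaussianReal 0 w) :=
    ((integrable_pow_gaussianReal w 2).div_const 2).mul_const (u2 x)
  have i3 : Integrable (fun y : ℝ => y ^ 3 / 6 * u3 x) (gaussianReal 0 w) :=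
    ((integrable_pow_gaussianReal w 3).div_const 6).mul_const (u3 x)
  have e : gsm w u0 x - u0 x - w / 2 * u2 x = ∫ y, (u0 (x + y) - u0 x - y * u1 x
      - y ^ 2 / 2 * u2 x - y ^ 3 / 6 * u3 x) ∂gaussianReal 0 w := by
    have j0 : Integrable (fun y => u0 (x + y) - u0 x) (gaussianReal 0 w) :=
      hi.sub (integrable_const _)
    have j1 : Integrable (fun y => u0 (x + y) - u0 x - y * u1 x) (gaussianReal 0 w) := j0.sub i1
    have j2 : Integrable (fun y => u0 (x + y) - u0 x - y * u1 x - y ^ 2 / 2 * u2 x)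
      (gaussianReal 0 w) := j1.sub i2
    rw [integral_sub j2 i3, integral_sub j1 i2, integral_sub j0 i1,
      integral_sub hi (integrable_const _), integral_mul_const, integral_mul_const,
      integral_mul_const, integral_div, integral_div, integral_sq_gaussianReal,
      integral_pow_three_gaussianReal, integral_id_gaussianReal]
    simp [gsm]
  rw [e]
  have i4 : Integrable (fun y : ℝ => b * y ^ 4) (gaussianReal 0 w) :=
    (integrable_pow_gaussianReal w 4).const_mul b
  calc |∫ y, (u0 (x + y) - u0 x - y * u1 x
      - y ^ 2 / 2 * u2 x - y ^ 3 / 6 * u3 x) ∂gaussianReal 0 w|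
      ≤ ∫ y, b * y ^ 4 ∂gaussianReal 0 w := by
        refine norm_integral_le_of_norm_le (f := fun y => u0 (x + y) - u0 x - y * u1 x
          - y ^ 2 / 2 * u2 x - y ^ 3 / 6 * u3 x) i4 (ae_of_all _ fun y => ?_)
        rw [Real.norm_eq_abs]
        refine (hT y).trans (le_of_eq ?_)
        rw [show (3:ℝ) + 1 = ((4:ℕ):ℝ) by norm_num, Real.rpow_natCast,
          Even.pow_abs (by decide)]
    _ = 8 * gaussM4 / (v * √v) * w ^ 2 := by
        rw [integral_const_mul, integral_pow_four_gaussianReal, hb]; ring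

/-! ### Bounded random variables -/

section Bounded

variable {Ω : Type*} [MeasurableSpace Ω]

/-- Bounded measurable real random variables. -/
@[fun_prop]
def Bdd (Z : Ω → ℝ) : Prop := Measurable Z ∧ ∃ C, ∀ ω, |Z ω| ≤ C

@[fun_prop]
lemma Bdd.const (c : ℝ) : Bdd (fun _ : Ω => c) := ⟨measurable_const, |c|, fun _ => le_rfl⟩

@[fun_prop]
lemma Bdd.add {f g : Ω → ℝ} (hf : Bdd f) (hg : Bdd g) : Bdd (fun ω => f ω + g ω) := by
  obtain ⟨hf, C, hC⟩ := hf
  obtain ⟨hg, D, hD⟩ := hg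
  exact ⟨hf.add hg, C + D, fun ω => (abs_add_le _ _).trans (add_le_add (hC ω) (hD ω))⟩

@[fun_prop]
lemma Bdd.neg {f : Ω → ℝ} (hf : Bdd f) : Bdd (fun ω => -f ω) := by
  obtain ⟨hf, C, hC⟩ := hf
  exact ⟨hf.neg, C, fun ω => by rw [abs_neg]; exact hC ω⟩

@[fun_prop]
lemma Bdd.sub {f g : Ω → ℝ} (hf : Bdd f) (hg : Bdd g) : Bdd (fun ω => f ω - g ω) := by
  simpa only [sub_eq_add_neg] using hf.add hg.neg

@[fun_prop]
lemma Bdd.mul {f g : Ω → ℝ} (hf : Bdd f) (hg : Bdd g) : Bdd (fun ω => f ω * g ω) := by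
  obtain ⟨hf, C, hC⟩ := hf
  obtain ⟨hg, D, hD⟩ := hg
  exact ⟨hf.mul hg, C * D, fun ω => by
    rw [abs_mul]
    exact mul_le_mul (hC ω) (hD ω) (abs_nonneg _) ((abs_nonneg _).trans (hC ω))⟩

@[fun_prop]
lemma Bdd.div_const {f : Ω → ℝ} (hf : Bdd f) (c : ℝ) : Bdd (fun ω => f ω / c) := by
  simpa only [div_eq_mul_inv] using hf.mul (Bdd.const c⁻¹)

@[fun_prop]
lemma Bdd.pow {f : Ω → ℝ} (hf : Bdd f) (n : ℕ) : Bdd (fun ω => f ω ^ n) := by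
  obtain ⟨hf, C, hC⟩ := hf
  exact ⟨hf.pow_const n, C ^ n, fun ω => by
    rw [abs_pow]; exact pow_le_pow_left₀ (abs_nonneg _) (hC ω) n⟩

@[fun_prop]
lemma Bdd.abs {f : Ω → ℝ} (hf : Bdd f) : Bdd (fun ω => |f ω|) := by
  obtain ⟨hf, C, hC⟩ := hf
  exact ⟨by simpa [Real.norm_eq_abs] using hf.norm, C, fun ω => by rw [abs_abs]; exact hC ω⟩

lemma Bdd.rpow {f : Ω → ℝ} (hf : Bdd f) (h0 : ∀ ω, 0 ≤ f ω) {q : ℝ} (hq : 0 ≤ q) :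
    Bdd (fun ω => f ω ^ q) := by
  obtain ⟨hf, C, hC⟩ := hf
  exact ⟨hf.pow_const q, C ^ q, fun ω => by
    rw [abs_of_nonneg (Real.rpow_nonneg (h0 ω) q)]
    exact Real.rpow_le_rpow (h0 ω) ((le_abs_self _).trans (hC ω)) hq⟩

@[fun_prop]
lemma Bdd.sum {ι : Type*} {f : ι → Ω → ℝ} (s : Finset ι) (hf : ∀ i, Bdd (f i)) :
    Bdd (fun ω => ∑ i ∈ s, f i ω) := by
  classical
  induction s using Finset.induction_on with
  | empty => simpa using Bdd.const (Ω := Ω) 0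
  | insert i s hi ih =>
    simp only [Finset.sum_insert hi]
    exact (hf i).add ih

lemma Bdd.list_prod {ι : Type*} {f : ι → Ω → ℝ} (hf : ∀ i, Bdd (f i)) (l : List ι) :
    Bdd (fun ω => (l.map fun i => f i ω).prod) := by
  induction l with
  | nil => simpa using Bdd.const (Ω := Ω) 1
  | cons i l ih => simpa only [List.map_cons, List.prod_cons] using (hf i).mul ih

lemma Bdd.comp {f : Ω → ℝ} (hf : Bdd f) {u : ℝ → ℝ} (hu : Measurable u) {C : ℝ}
    (hC : ∀ x, |u x| ≤ C) : Bdd (fun ω => u (f ω)) :=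
  ⟨hu.comp hf.1, C, fun _ => hC _⟩

lemma Bdd.comp_lipschitz {f : Ω → ℝ} (hf : Bdd f) {u : ℝ → ℝ} (hu : Measurable u)
    (hl : ∀ x y, |u x - u y| ≤ |x - y|) : Bdd (fun ω => u (f ω)) := by
  obtain ⟨hf, C, hC⟩ := hf
  refine ⟨hu.comp hf, |u 0| + C, fun ω => ?_⟩
  have h1 := hl (f ω) 0
  have h2 := abs_sub_abs_le_abs_sub (u (f ω)) (u 0)
  rw [sub_zero] at h1
  linarith [hC ω]

variable {P : Measure Ω} [IsProbabilityMeasure P]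

lemma Bdd.integrable {f : Ω → ℝ} (hf : Bdd f) : Integrable f P := by
  obtain ⟨hf, C, hC⟩ := hf
  exact Integrable.mono' (integrable_const C) hf.aestronglyMeasurable (ae_of_all _ hC)

lemma E_add {f g : Ω → ℝ} (hf : Bdd f) (hg : Bdd g) :
    ∫ ω, (f ω + g ω) ∂P = ∫ ω, f ω ∂P + ∫ ω, g ω ∂P := integral_add hf.integrable hg.integrable

lemma E_sub {f g : Ω → ℝ} (hf : Bdd f) (hg : Bdd g) :
    ∫ ω, (f ω - g ω) ∂P = ∫ ω, f ω ∂P - ∫ ω, g ω ∂P := integral_sub hf.integrable hg.integrable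

lemma E_mono {f g : Ω → ℝ} (hf : Bdd f) (hg : Bdd g) (h : ∀ ω, f ω ≤ g ω) :
    ∫ ω, f ω ∂P ≤ ∫ ω, g ω ∂P := integral_mono hf.integrable hg.integrable h

lemma E_sum {ι : Type*} {f : ι → Ω → ℝ} (s : Finset ι) (hf : ∀ i, Bdd (f i)) :
    ∫ ω, ∑ i ∈ s, f i ω ∂P = ∑ i ∈ s, ∫ ω, f i ω ∂P :=
  integral_finsetSum s fun i _ => (hf i).integrable

lemma E_const (c : ℝ) : ∫ _, c ∂P = c := by simp

omit [IsProbabilityMeasure P] in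
lemma abs_E_le {f : Ω → ℝ} : |∫ ω, f ω ∂P| ≤ ∫ ω, |f ω| ∂P := abs_integral_le_integral_abs

lemma abs_E_le_of_le {f g : Ω → ℝ} (hg : Bdd g) (h : ∀ ω, |f ω| ≤ g ω) :
    |∫ ω, f ω ∂P| ≤ ∫ ω, g ω ∂P :=
  norm_integral_le_of_norm_le (f := f) hg.integrable (ae_of_all _ h)

lemma E_le_of_abs_le {f : Ω → ℝ} {C : ℝ} (h : ∀ ω, |f ω| ≤ C) : |∫ ω, f ω ∂P| ≤ C := by
  have := norm_integral_le_of_norm_le_const (f := f) (μ := P) (ae_of_all _ h)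
  simpa using this

/-- Covariance of two bounded random variables. -/
def cv (P : Measure Ω) (ξ F : Ω → ℝ) : ℝ := ∫ ω, ξ ω * F ω ∂P - (∫ ω, ξ ω ∂P) * ∫ ω, F ω ∂P

lemma cv_add_right {ξ F G : Ω → ℝ} (hξ : Bdd ξ) (hF : Bdd F) (hG : Bdd G) :
    cv P ξ (fun ω => F ω + G ω) = cv P ξ F + cv P ξ G := by
  simp (disch := fun_prop) only [cv, mul_add, E_add]
  ring

lemma cv_sub_right {ξ F G : Ω → ℝ} (hξ : Bdd ξ) (hF : Bdd F) (hG : Bdd G) :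
    cv P ξ (fun ω => F ω - G ω) = cv P ξ F - cv P ξ G := by
  simp (disch := fun_prop) only [cv, mul_sub, E_sub]
  ring

omit [IsProbabilityMeasure P] in
lemma cv_const_mul_right {ξ F : Ω → ℝ} (c : ℝ) :
    cv P ξ (fun ω => c * F ω) = c * cv P ξ F := by
  simp only [cv, mul_left_comm _ c, integral_const_mul]
  ring

omit [IsProbabilityMeasure P] in
lemma cv_const_mul_left {ξ F : Ω → ℝ} (c : ℝ) :
    cv P (fun ω => c * ξ ω) F = c * cv P ξ F := by
  simp only [cv, mul_assoc c, integral_const_mul]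
  ring

lemma cv_sum_right {ι : Type*} {ξ : Ω → ℝ} {F : ι → Ω → ℝ} (s : Finset ι) (hξ : Bdd ξ)
    (hF : ∀ i, Bdd (F i)) : cv P ξ (fun ω => ∑ i ∈ s, F i ω) = ∑ i ∈ s, cv P ξ (F i) := by
  simp only [cv, Finset.mul_sum]
  rw [E_sum s fun i => hξ.mul (hF i), E_sum s hF, Finset.mul_sum, Finset.sum_sub_distrib]

end Bounded

/-! ### Covariance bounds at a fixed truncation level -/

lemma rpow_add_sub_le {c y s r : ℝ} (hc : 1 ≤ c) (hy : 0 ≤ y) (hs : 1 ≤ s) (hsr : s ≤ r) :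
    (c + y) ^ s - c ^ s ≤ (c + 1) ^ r * (y + y ^ r) := by
  have hc1 : (1:ℝ) ≤ c + 1 := by linarith
  have hyr : 0 ≤ y ^ r := Real.rpow_nonneg hy r
  have hcs : 0 ≤ c ^ s := Real.rpow_nonneg (by linarith) s
  have hmono : (c + 1) ^ s ≤ (c + 1) ^ r := Real.rpow_le_rpow_of_exponent_le hc1 hsr
  have hpos : 0 ≤ (c + 1) ^ s := Real.rpow_nonneg (by linarith) s
  rcases le_total y 1 with h1 | h1
  · have hm : c ∈ Ici (0:ℝ) := mem_Ici.mpr (by linarith)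
    have hm' : c + 1 ∈ Ici (0:ℝ) := mem_Ici.mpr (by linarith)
    have hconv := (convexOn_rpow hs).2 hm hm' (sub_nonneg.mpr h1) hy (by ring)
    simp only [smul_eq_mul] at hconv
    rw [show (1 - y) * c + y * (c + 1) = c + y by ring] at hconv
    nlinarith
  · have h2 : (c + y) ^ s ≤ ((c + 1) * y) ^ s :=
      Real.rpow_le_rpow (by linarith) (by nlinarith) (by linarith)
    rw [Real.mul_rpow (by linarith) hy] at h2
    have h3 : y ^ s ≤ y ^ r := Real.rpow_le_rpow_of_exponent_le h1 hsr
    have h4 : (c + 1) ^ s * y ^ s ≤ (c + 1) ^ r * y ^ r :=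
      mul_le_mul hmono h3 (Real.rpow_nonneg hy s) (by linarith)
    nlinarith

lemma rpow_add_le_two_rpow {x y r : ℝ} (hx : 0 ≤ x) (hy : 0 ≤ y) (hr : 0 ≤ r) :
    (x + y) ^ r ≤ 2 ^ r * (x ^ r + y ^ r) := by
  have hxr := Real.rpow_nonneg hx r
  have hyr := Real.rpow_nonneg hy r
  rcases le_total x y with h | h
  · calc (x + y) ^ r ≤ (2 * y) ^ r := Real.rpow_le_rpow (by linarith) (by linarith) hr
      _ = 2 ^ r * y ^ r := Real.mul_rpow (by norm_num) hy
      _ ≤ _ := by gcongr; linarith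
  · calc (x + y) ^ r ≤ (2 * x) ^ r := Real.rpow_le_rpow (by linarith) (by linarith) hr
      _ = 2 ^ r * x ^ r := Real.mul_rpow (by norm_num) hx
      _ ≤ _ := by gcongr; linarith

lemma prod_approx (l : List ℕ) (y z : ℕ → ℝ) {b ρ : ℝ}
    (hz : ∀ i ∈ l, |z i| ≤ b) (hd : ∀ i ∈ l, |y i - z i| ≤ ρ) {x x' A B : ℝ}
    (hA : |x'| ≤ A) (hB : |x - x'| ≤ B - A) :
    |x * (l.map y).prod - x' * (l.map z).prod| ≤ B * (b + ρ) ^ l.length - A * b ^ l.length ∧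
      |x' * (l.map z).prod| ≤ A * b ^ l.length := by
  induction l generalizing x x' A B with
  | nil => simpa using ⟨hB, hA⟩
  | cons i l ih =>
    have h1 : |x' * z i| ≤ A * b := by
      rw [abs_mul]
      exact mul_le_mul hA (hz i (by simp)) (abs_nonneg _) ((abs_nonneg _).trans hA)
    have h2 : |x * y i - x' * z i| ≤ B * (b + ρ) - A * b := by
      have e : x * y i - x' * z i = (x - x') * (y i - z i) + (x - x') * z i + x' * (y i - z i) := by
        ring
      have e1 := hz i (by simp)
      have e2 := hd i (by simp)
      have hBA := (abs_nonneg _).trans hB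
      have hA0 := (abs_nonneg _).trans hA
      calc |x * y i - x' * z i| ≤ |x - x'| * |y i - z i| + |x - x'| * |z i| + |x'| * |y i - z i| := by
            rw [e, ← abs_mul, ← abs_mul, ← abs_mul]
            exact abs_add_three _ _ _
        _ ≤ (B - A) * ρ + (B - A) * b + A * ρ := by gcongr
        _ = _ := by ring
    have := ih (fun j hj => hz j (by simp [hj])) (fun j hj => hd j (by simp [hj])) h1 h2
    simp only [List.map_cons, List.prod_cons, List.length_cons, pow_succ']
    rw [← mul_assoc, ← mul_assoc, ← mul_assoc, ← mul_assoc]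
    exact this

section Level

variable {Ω : Type*} [mΩ : MeasurableSpace Ω]

/-- Approximation of the process `Y` by bounded variables of size `c * L`, with a mixing bound `a`
for products of at most three of them lying at distance `g` in the future. -/
structure Lvl (P : Measure Ω) (𝓕 : Filtration ℕ mΩ) (Y : ℕ → Ω → ℝ) (c r : ℝ) (g : ℕ)
    (a L : ℝ) : Prop where
  a_nonneg : 0 ≤ a
  a_le_one : a ≤ 1
  one_le_c : 1 ≤ c
  one_le_L : 1 ≤ L
  approx : ∃ Z : ℕ → Ω → ℝ, (∀ j, Bdd (Z j)) ∧ (∀ j ω, |Z j ω| ≤ c * L) ∧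
    (∀ j, ∫ ω, |Y j ω - Z j ω| ∂P ≤ c * a * L) ∧
    (∀ j, ∫ ω, |Y j ω - Z j ω| ^ r ∂P ≤ c * a * L ^ r) ∧
    ∀ (T : ℕ) (ξ : Ω → ℝ), Measurable[𝓕 T] ξ → (∀ ω, |ξ ω| ≤ 1) → ∀ l : List ℕ, l.length ≤ 3 →
      (∀ i ∈ l, T + g ≤ i) →
      |cv P ξ (fun ω => (l.map fun i => Z i ω).prod)| ≤ (c * L) ^ l.length * a

/-- Nonnegative remainders with small first and `r`-th moments. -/
structure InR (P : Measure Ω) (κ r a L : ℝ) (R : Ω → ℝ) : Prop where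
  bdd : Bdd R
  nonneg : ∀ ω, 0 ≤ R ω
  e1 : ∫ ω, R ω ∂P ≤ κ * a * L
  er : ∫ ω, R ω ^ r ∂P ≤ κ * a * L ^ r

/-- Nonnegative variables of size `κ * L` up to a small remainder. -/
structure InW (P : Measure Ω) (κ r a L : ℝ) (V : Ω → ℝ) : Prop where
  bdd : Bdd V
  nonneg : ∀ ω, 0 ≤ V ω
  approx : ∃ R, InR P κ r a L R ∧ ∀ ω, V ω ≤ κ * L + R ω

variable {P : Measure Ω} [IsProbabilityMeasure P] {𝓕 : Filtration ℕ mΩ}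

omit [IsProbabilityMeasure P] in
lemma InR.mono {κ κ' r a L : ℝ} {R : Ω → ℝ} (h : InR P κ r a L R) (hκ : κ ≤ κ') (ha : 0 ≤ a)
    (hL : 0 ≤ L) : InR P κ' r a L R :=
  ⟨h.bdd, h.nonneg, h.e1.trans (by gcongr), h.er.trans (by gcongr)⟩

omit [IsProbabilityMeasure P] in
lemma InW.mono {κ κ' r a L : ℝ} {V : Ω → ℝ} (h : InW P κ r a L V) (hκ : κ ≤ κ') (ha : 0 ≤ a)
    (hL : 0 ≤ L) : InW P κ' r a L V := by
  obtain ⟨R, hR, hV⟩ := h.approx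
  exact ⟨h.bdd, h.nonneg, R, hR.mono hκ ha hL, fun ω => (hV ω).trans (by gcongr)⟩

lemma InR.add {κ κ' r a L : ℝ} {R R' : Ω → ℝ} (hr : 1 ≤ r) (ha : 0 ≤ a) (hL : 0 ≤ L)
    (hκ : 0 ≤ κ) (hκ' : 0 ≤ κ')
    (h : InR P κ r a L R) (h' : InR P κ' r a L R') :
    InR P (2 ^ r * (κ + κ')) r a L (fun ω => R ω + R' ω) := by
  have h2 : (1:ℝ) ≤ 2 ^ r := Real.one_le_rpow (by norm_num) (by linarith)
  have hb := h.bdd.rpow h.nonneg (by linarith : 0 ≤ r)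
  have hb' := h'.bdd.rpow h'.nonneg (by linarith : 0 ≤ r)
  have hLr : 0 ≤ L ^ r := Real.rpow_nonneg hL r
  refine ⟨h.bdd.add h'.bdd, fun ω => add_nonneg (h.nonneg ω) (h'.nonneg ω), ?_, ?_⟩
  · rw [E_add h.bdd h'.bdd]
    have := h.e1
    have := h'.e1
    have e : 0 ≤ (2 ^ r - 1) * ((κ + κ') * (a * L)) :=
      mul_nonneg (by linarith) (by positivity)
    nlinarith
  · have hp : ∀ ω, (R ω + R' ω) ^ r ≤ 2 ^ r * (R ω ^ r + R' ω ^ r) := fun ω =>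
      rpow_add_le_two_rpow (h.nonneg ω) (h'.nonneg ω) (by linarith)
    calc ∫ ω, (R ω + R' ω) ^ r ∂P ≤ ∫ ω, 2 ^ r * (R ω ^ r + R' ω ^ r) ∂P :=
          E_mono ((h.bdd.add h'.bdd).rpow
            (fun ω => add_nonneg (h.nonneg ω) (h'.nonneg ω)) (by linarith))
            ((Bdd.const _).mul (hb.add hb')) hp
      _ = 2 ^ r * (∫ ω, R ω ^ r ∂P + ∫ ω, R' ω ^ r ∂P) := by
          rw [integral_const_mul, E_add hb hb']
      _ ≤ 2 ^ r * (κ * a * L ^ r + κ' * a * L ^ r) := by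
          have := h.er
          have := h'.er
          gcongr
      _ = _ := by ring

lemma InW.add {κ κ' r a L : ℝ} {V V' : Ω → ℝ} (hr : 1 ≤ r) (ha : 0 ≤ a) (hL : 0 ≤ L)
    (hκ : 0 ≤ κ) (hκ' : 0 ≤ κ')
    (h : InW P κ r a L V) (h' : InW P κ' r a L V') :
    InW P (2 ^ r * (κ + κ')) r a L (fun ω => V ω + V' ω) := by
  obtain ⟨R, hR, hV⟩ := h.approx
  obtain ⟨R', hR', hV'⟩ := h'.approx
  have h2 : (1:ℝ) ≤ 2 ^ r := Real.one_le_rpow (by norm_num) (by linarith)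
  refine ⟨h.bdd.add h'.bdd, fun ω => add_nonneg (h.nonneg ω) (h'.nonneg ω), _,
    hR.add hr ha hL hκ hκ' hR', fun ω => ?_⟩
  have e : 0 ≤ (2 ^ r - 1) * ((κ + κ') * L) := mul_nonneg (by linarith) (by positivity)
  nlinarith [hV ω, hV' ω]

/-- Expectation of the error made by truncating a power at level `c * L`. -/
lemma InR.integral_rpow_sub_le {κ c r a L s : ℝ} {R : Ω → ℝ} (h : InR P κ r a L R) (hc : 1 ≤ c)
    (hL : 1 ≤ L) (hs : 1 ≤ s) (hsr : s ≤ r) :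
    ∫ ω, ((c * L + R ω) ^ s - (c * L) ^ s) ∂P ≤ (c + 1) ^ r * (2 * κ) * a * L ^ s := by
  have hL0 : 0 < L := by linarith
  have hcL : 0 ≤ c * L := by positivity
  have hLr : 0 < L ^ r := Real.rpow_pos_of_pos hL0 r
  have hp : ∀ ω, (c * L + R ω) ^ s - (c * L) ^ s
      ≤ L ^ s * (c + 1) ^ r * (1 / L * R ω + 1 / L ^ r * R ω ^ r) := by
    intro ω
    have h1 := rpow_add_sub_le hc (div_nonneg (h.nonneg ω) hL0.le) hs hsr
    have e1 : c * L + R ω = L * (c + R ω / L) := by field_simp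
    rw [e1, mul_comm c L, Real.mul_rpow hL0.le (by have := h.nonneg ω; positivity),
      Real.mul_rpow hL0.le (by linarith), ← mul_sub, mul_assoc]
    refine mul_le_mul_of_nonneg_left (h1.trans (le_of_eq ?_)) (Real.rpow_nonneg hL0.le _)
    rw [Real.div_rpow (h.nonneg ω) hL0.le]
    ring
  have hb := h.bdd.rpow h.nonneg (by linarith : 0 ≤ r)
  have hb1 := h.bdd
  have hb2 : Bdd fun ω => (c * L + R ω) ^ s :=
    ((Bdd.const _).add hb1).rpow (fun ω => by have := h.nonneg ω; positivity) (by linarith)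
  calc ∫ ω, ((c * L + R ω) ^ s - (c * L) ^ s) ∂P
      ≤ ∫ ω, L ^ s * (c + 1) ^ r * (1 / L * R ω + 1 / L ^ r * R ω ^ r) ∂P :=
        E_mono (by fun_prop) (by fun_prop) hp
    _ = L ^ s * (c + 1) ^ r * (1 / L * ∫ ω, R ω ∂P + 1 / L ^ r * ∫ ω, R ω ^ r ∂P) := by
        rw [integral_const_mul, E_add (by fun_prop) (by fun_prop), integral_const_mul,
          integral_const_mul]
    _ ≤ L ^ s * (c + 1) ^ r * (1 / L * (κ * a * L) + 1 / L ^ r * (κ * a * L ^ r)) := by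
        have := h.e1
        have := h.er
        gcongr
    _ = _ := by field_simp; ring

lemma InW.integral_rpow_le {κ r a L q : ℝ} {V : Ω → ℝ} (h : InW P κ r a L V) (hκ : 0 ≤ κ)
    (ha : a ≤ 1) (hL : 1 ≤ L) (hq : 0 ≤ q) (hqr : q ≤ r) (hr : 1 ≤ r) :
    ∫ ω, V ω ^ q ∂P ≤ (2 * (κ + 1)) ^ r * (1 + κ) * L ^ q := by
  obtain ⟨R, hR, hV⟩ := h.approx
  have hL0 : 0 < L := by linarith
  have hLr : 0 < L ^ r := Real.rpow_pos_of_pos hL0 r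
  have hb := hR.bdd.rpow hR.nonneg (by linarith : 0 ≤ r)
  have hp : ∀ ω, V ω ^ q ≤ L ^ q * (2 * (κ + 1)) ^ r * (1 + 1 / L ^ r * R ω ^ r) := by
    intro ω
    have hR0 := hR.nonneg ω
    set y := R ω / L with hy
    have hy0 : 0 ≤ y := by positivity
    have e1 : V ω ≤ L * ((κ + 1) * (1 + y)) := by
      have h1 := hV ω
      have h2 : R ω = L * y := by rw [hy]; field_simp
      have h3 : 0 ≤ L * (κ * y) := by positivity
      nlinarith
    have e2 : V ω ^ q ≤ L ^ q * ((κ + 1) * (1 + y)) ^ q := by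
      rw [← Real.mul_rpow hL0.le (by positivity)]
      exact Real.rpow_le_rpow (h.nonneg ω) e1 hq
    have e3 : ((κ + 1) * (1 + y)) ^ q ≤ ((κ + 1) * (1 + y)) ^ r :=
      Real.rpow_le_rpow_of_exponent_le (by nlinarith) hqr
    have e4 : (1 + y) ^ r ≤ 2 ^ r * (1 + y ^ r) := by
      have h1 := rpow_add_le_two_rpow zero_le_one hy0 (by linarith : 0 ≤ r)
      rwa [Real.one_rpow] at h1
    calc V ω ^ q ≤ L ^ q * ((κ + 1) ^ r * (2 ^ r * (1 + y ^ r))) := by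
          refine e2.trans (mul_le_mul_of_nonneg_left (e3.trans ?_) (Real.rpow_nonneg hL0.le _))
          rw [Real.mul_rpow (by positivity) (by positivity)]
          exact mul_le_mul_of_nonneg_left e4 (Real.rpow_nonneg (by positivity) _)
      _ = _ := by
          rw [hy, Real.div_rpow hR0 hL0.le, Real.mul_rpow (by norm_num) (by positivity)]
          ring
  have hVb : Bdd fun ω => V ω ^ q := h.bdd.rpow h.nonneg hq
  calc ∫ ω, V ω ^ q ∂P ≤ ∫ ω, L ^ q * (2 * (κ + 1)) ^ r * (1 + 1 / L ^ r * R ω ^ r) ∂P :=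
        E_mono hVb (by fun_prop) hp
    _ = L ^ q * (2 * (κ + 1)) ^ r * (1 + 1 / L ^ r * ∫ ω, R ω ^ r ∂P) := by
        rw [integral_const_mul, E_add (by fun_prop) (by fun_prop), integral_const_mul, E_const]
    _ ≤ L ^ q * (2 * (κ + 1)) ^ r * (1 + 1 / L ^ r * (κ * 1 * L ^ r)) := by
        have := hR.er
        have h3 : κ * a * L ^ r ≤ κ * 1 * L ^ r := by gcongr
        have h4 := this.trans h3
        gcongr
    _ = _ := by field_simp

/-- Constants in the remainder bound for a sum of `n + 1` remainders. -/
def remConst (c r : ℝ) : ℕ → ℝ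
  | 0 => c
  | n + 1 => 2 ^ r * (c + remConst c r n)

lemma remConst_nonneg {c r : ℝ} (hc : 0 ≤ c) (n : ℕ) : 0 ≤ remConst c r n := by
  induction n with
  | zero => exact hc
  | succ n ih => simp only [remConst]; positivity

lemma remConst_mono {c r : ℝ} (hc : 0 ≤ c) (hr : 0 ≤ r) : Monotone (remConst c r) := by
  refine monotone_nat_of_le_succ fun n => ?_
  have h2 : (1:ℝ) ≤ 2 ^ r := Real.one_le_rpow (by norm_num) hr
  have := remConst_nonneg (r := r) hc n
  simp only [remConst]
  nlinarith

lemma InR.add_list_sum {c r a L : ℝ} (hr : 1 ≤ r) (ha : 0 ≤ a) (hL : 0 ≤ L) (hc : 0 ≤ c)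
    {R : Ω → ℝ} (hR : InR P c r a L R) {D : ℕ → Ω → ℝ} (hD : ∀ j, InR P c r a L (D j))
    (l : List ℕ) :
    InR P (remConst c r l.length) r a L (fun ω => (l.map fun i => D i ω).sum + R ω) := by
  induction l with
  | nil => simpa [remConst] using hR
  | cons i l ih =>
    have := InR.add hr ha hL hc (remConst_nonneg (r := r) hc l.length) (hD i) ih
    simpa only [List.map_cons, List.sum_cons, List.length_cons, remConst, add_assoc] using this

omit [IsProbabilityMeasure P] in
lemma abs_cv_le_of_abs_le {ξ F : Ω → ℝ} {M B : ℝ} {T : ℕ}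
    (h : ∀ ξ : Ω → ℝ, Measurable[𝓕 T] ξ → (∀ ω, |ξ ω| ≤ 1) → |cv P ξ F| ≤ B)
    (hξ : Measurable[𝓕 T] ξ) (hM : ∀ ω, |ξ ω| ≤ M) (hM0 : 0 ≤ M) : |cv P ξ F| ≤ M * B := by
  rcases eq_or_lt_of_le hM0 with h0 | h0
  · have : ξ = fun _ => 0 := by
      ext ω
      have := hM ω
      rw [← h0] at this
      exact abs_eq_zero.mp (le_antisymm this (abs_nonneg _))
    rw [this, ← h0]
    simp [cv]
  · have h1 := h (fun ω => M⁻¹ * ξ ω) (hξ.const_mul _) (fun ω => by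
      rw [abs_mul, abs_of_pos (inv_pos.mpr h0), inv_mul_le_iff₀ h0]; simpa using hM ω)
    rw [cv_const_mul_left, abs_mul, abs_of_pos (inv_pos.mpr h0), inv_mul_le_iff₀ h0] at h1
    exact h1

variable (P 𝓕) in
/-- Covariance of a past variable, dominated by a power of `V`, with a product of at most three
future values of `Y`. -/
lemma exists_abs_cv_prod_le (κ c r : ℝ) (hr : 1 ≤ r) : ∃ K : ℝ, 0 ≤ K ∧
    ∀ (Y : ℕ → Ω → ℝ) (g : ℕ) (a L : ℝ), (∀ j, Bdd (Y j)) → Lvl P 𝓕 Y c r g a L →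
    ∀ V, InW P κ r a L V → ∀ (T : ℕ) (ξ : Ω → ℝ) (Λ q : ℝ), 0 ≤ Λ → 0 ≤ q →
    Measurable[𝓕 T] ξ → (∀ ω, |ξ ω| ≤ Λ * V ω ^ q) → ∀ l : List ℕ, l ≠ [] → l.length ≤ 3 →
    q + l.length ≤ r → (∀ i ∈ l, T + g ≤ i) →
    |cv P ξ (fun ω => (l.map fun i => Y i ω).prod)| ≤ K * Λ * a * L ^ (q + l.length) := by
  set c' := max (max κ c) 1 with hc'
  have hc1 : 1 ≤ c' := le_max_right _ _
  have hc0 : 0 ≤ c' := by linarith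
  set k := remConst c' r 3 with hk
  have hk0 : 0 ≤ k := remConst_nonneg hc0 3
  set K1 := (c' + 1) ^ r * (2 * k) with hK1
  have hK10 : 0 ≤ K1 := by positivity
  set K2 := (2 * (c' + 1)) ^ r * (1 + c') with hK2
  have hK20 : 0 ≤ K2 := by positivity
  refine ⟨K1 + K2 * K1 + K1 * c' ^ r + c' ^ r, by positivity, ?_⟩
  intro Y g a L hY hl V hV T ξ Λ q hΛ hq hξm hξ l hne hlen hqr hgap
  obtain ⟨Z, hZb, hZL, hZ1, hZr, hZcv⟩ := hl.approx
  have ha := hl.a_nonneg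
  have ha1 := hl.a_le_one
  have hL := hl.one_le_L
  have hL0 : 0 < L := by linarith
  have hκc : κ ≤ c' := (le_max_left _ _).trans (le_max_left _ _)
  have hcc : c ≤ c' := (le_max_right _ _).trans (le_max_left _ _)
  have hc00 : 0 ≤ c := by linarith [hl.one_le_c]
  have hV' := hV.mono hκc ha hL0.le
  obtain ⟨R, hR, hVR⟩ := hV'.approx
  set d := l.length with hd
  have hd1 : (1:ℝ) ≤ d := by
    have : 1 ≤ d := List.length_pos_of_ne_nil hne
    exact_mod_cast this
  have hD : ∀ j, InR P c' r a L (fun ω => |Y j ω - Z j ω|) := fun j =>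
    InR.mono ⟨((hY j).sub (hZb j)).abs, fun ω => abs_nonneg _, hZ1 j, hZr j⟩ hcc ha hL0.le
  set ρ : Ω → ℝ := fun ω => (l.map fun i => |Y i ω - Z i ω|).sum + R ω with hρ
  have hρR : InR P k r a L ρ :=
    (InR.add_list_sum hr ha hL0.le hc0 hR hD l).mono (remConst_mono hc0 (by linarith) hlen)
      ha hL0.le
  have hnn : ∀ ω, 0 ≤ (l.map fun i => |Y i ω - Z i ω|).sum := fun ω =>
    List.sum_nonneg (by simp)
  have hRρ : ∀ ω, R ω ≤ ρ ω := fun ω => le_add_of_nonneg_left (hnn ω)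
  have hDρ : ∀ ω, ∀ i ∈ l, |Y i ω - Z i ω| ≤ ρ ω := fun ω i hi =>
    le_add_of_le_of_nonneg (List.single_le_sum (l := l.map fun i => |Y i ω - Z i ω|) (by simp) _
      (List.mem_map.mpr ⟨i, hi, rfl⟩)) (hR.nonneg ω)
  set b := c' * L with hb
  have hb1 : 1 ≤ b := by rw [hb]; nlinarith
  have hb0 : 0 < b := by linarith
  have hbL : L ≤ b := by rw [hb]; nlinarith
  have hZb' : ∀ j ω, |Z j ω| ≤ b := fun j ω => (hZL j ω).trans (by rw [hb]; gcongr)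
  set M := Λ * b ^ q with hM
  have hM0 : 0 ≤ M := by positivity
  have hξM : ∀ ω, |ξ ω| ≤ Λ * (b + ρ ω) ^ q := fun ω => (hξ ω).trans (by
    refine mul_le_mul_of_nonneg_left (Real.rpow_le_rpow (hV.nonneg ω) ?_ hq) hΛ
    exact (hVR ω).trans (by linarith [hRρ ω]))
  set ξ' : Ω → ℝ := fun ω => max (-M) (min (ξ ω) M) with hξ'
  have hξ'm : Measurable[𝓕 T] ξ' :=
    (@measurable_const _ _ _ (𝓕 T) (-M)).max (hξm.min (@measurable_const _ _ _ (𝓕 T) M))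
  have hξ'M : ∀ ω, |ξ' ω| ≤ M := fun ω =>
    abs_le.mpr ⟨le_max_left _ _, max_le (by linarith) (min_le_right _ _)⟩
  have hbρ : ∀ ω, b ^ q ≤ (b + ρ ω) ^ q := fun ω =>
    Real.rpow_le_rpow hb0.le (by linarith [hρR.nonneg ω]) hq
  have hξξ' : ∀ ω, |ξ ω - ξ' ω| ≤ Λ * (b + ρ ω) ^ q - M := by
    intro ω
    have h1 := abs_le.mp (hξM ω)
    have h2 : M ≤ Λ * (b + ρ ω) ^ q := mul_le_mul_of_nonneg_left (hbρ ω) hΛ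
    simp only [hξ']
    rw [abs_le]
    rcases le_total (ξ ω) M with h | h
    · rw [min_eq_left h]
      rcases le_total (-M) (ξ ω) with h' | h'
      · rw [max_eq_right h']; constructor <;> linarith
      · rw [max_eq_left h']; constructor <;> linarith
    · rw [min_eq_right h, max_eq_right (by linarith)]; constructor <;> linarith
  have hVb := hV.bdd.rpow hV.nonneg hq
  have hξb : Bdd ξ := by
    obtain ⟨_, C, hC⟩ := hVb
    exact ⟨hξm.mono (𝓕.le T) le_rfl, Λ * C, fun ω => (hξ ω).trans
      (mul_le_mul_of_nonneg_left ((le_abs_self _).trans (hC ω)) hΛ)⟩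
  have hξ'b : Bdd ξ' := ⟨hξ'm.mono (𝓕.le T) le_rfl, M, hξ'M⟩
  have hFb := Bdd.list_prod hY l
  have hF'b := Bdd.list_prod hZb l
  set F : Ω → ℝ := fun ω => (l.map fun i => Y i ω).prod with hF
  set F' : Ω → ℝ := fun ω => (l.map fun i => Z i ω).prod with hF'
  have hbρ0 : ∀ ω, 0 < b + ρ ω := fun ω => by linarith [hρR.nonneg ω]
  have hpowb : ∀ s : ℝ, 0 ≤ s → Bdd fun ω => (b + ρ ω) ^ s := fun s hs =>
    ((Bdd.const b).add hρR.bdd).rpow (fun ω => (hbρ0 ω).le) hs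
  have hL' : ∀ s : ℝ, 0 < L ^ s := fun s => Real.rpow_pos_of_pos hL0 s
  -- the four error terms
  have t1 : |∫ ω, (ξ ω * F ω - ξ' ω * F' ω) ∂P| ≤ Λ * (K1 * a * L ^ (q + d)) := by
    have hp : ∀ ω, |ξ ω * F ω - ξ' ω * F' ω|
        ≤ Λ * ((b + ρ ω) ^ (q + d) - b ^ (q + d)) := by
      intro ω
      have := (prod_approx l (fun i => Y i ω) (fun i => Z i ω)
        (fun i _ => hZb' i ω) (hDρ ω) (hξ'M ω) (hξξ' ω)).1
      refine this.trans (le_of_eq ?_)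
      rw [Real.rpow_add (hbρ0 ω), Real.rpow_add hb0, Real.rpow_natCast, Real.rpow_natCast, hM]
      ring
    have hbd := hpowb (q + d) (by linarith)
    refine (abs_E_le_of_le (by fun_prop) hp).trans ?_
    rw [integral_const_mul]
    exact mul_le_mul_of_nonneg_left
      (hρR.integral_rpow_sub_le hc1 hL (by linarith) hqr) hΛ
  have t2 : |∫ ω, ξ ω ∂P| ≤ Λ * (K2 * L ^ q) := by
    refine (abs_E_le_of_le (by fun_prop) hξ).trans ?_
    rw [integral_const_mul]
    exact mul_le_mul_of_nonneg_left
      (hV'.integral_rpow_le hc0 ha1 hL hq (by linarith) hr) hΛ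
  have t3 : |∫ ω, F ω ∂P - ∫ ω, F' ω ∂P| ≤ K1 * a * L ^ (d:ℝ) := by
    rw [← E_sub hFb hF'b]
    have hp : ∀ ω, |F ω - F' ω| ≤ (b + ρ ω) ^ (d:ℝ) - b ^ (d:ℝ) := by
      intro ω
      have := (prod_approx l (fun i => Y i ω) (fun i => Z i ω)
        (fun i _ => hZb' i ω) (hDρ ω) (x := 1) (x' := 1) (A := 1) (B := 1) (by simp) (by simp)).1
      simpa only [one_mul, Real.rpow_natCast] using this
    have hbd := hpowb d (by linarith)
    exact (abs_E_le_of_le (by fun_prop) hp).trans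
      (hρR.integral_rpow_sub_le hc1 hL hd1 (by linarith))
  have t4 : |∫ ω, ξ ω ∂P - ∫ ω, ξ' ω ∂P| ≤ Λ * (K1 * a * L ^ q) := by
    rw [← E_sub hξb hξ'b]
    have hp : ∀ ω, |ξ ω - ξ' ω| ≤ Λ * (1 / L * ((b + ρ ω) ^ (q + 1) - b ^ (q + 1))) := by
      intro ω
      refine (hξξ' ω).trans ?_
      rw [hM, ← mul_sub]
      refine mul_le_mul_of_nonneg_left ?_ hΛ
      rw [one_div, le_inv_mul_iff₀ hL0, Real.rpow_add (hbρ0 ω), Real.rpow_add hb0, Real.rpow_one,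
        Real.rpow_one]
      have h1 : 0 ≤ ρ ω := hρR.nonneg ω
      have h2 : 0 ≤ (b + ρ ω) ^ q := Real.rpow_nonneg (hbρ0 ω).le _
      have h3 := hbρ ω
      nlinarith [mul_nonneg h2 h1, mul_nonneg (sub_nonneg.mpr hbL) (sub_nonneg.mpr h3)]
    have hbd := hpowb (q + 1) (by linarith)
    refine (abs_E_le_of_le (by fun_prop) hp).trans ?_
    rw [integral_const_mul, integral_const_mul]
    refine mul_le_mul_of_nonneg_left ?_ hΛ
    rw [one_div, inv_mul_le_iff₀ hL0]
    refine (hρR.integral_rpow_sub_le hc1 hL (by linarith) (by linarith)).trans (le_of_eq ?_)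
    rw [Real.rpow_add hL0, Real.rpow_one]; ring
  have hbs : ∀ s : ℝ, 0 ≤ s → s ≤ r → b ^ s ≤ c' ^ r * L ^ s := by
    intro s hs hsr
    rw [hb, Real.mul_rpow hc0 hL0.le]
    exact mul_le_mul_of_nonneg_right (Real.rpow_le_rpow_of_exponent_le hc1 hsr) (hL' s).le
  have t5 : |∫ ω, F' ω ∂P| ≤ c' ^ r * L ^ (d:ℝ) := by
    refine E_le_of_abs_le fun ω => ?_
    have := (prod_approx l (fun i => Y i ω) (fun i => Z i ω)
        (fun i _ => hZb' i ω) (hDρ ω) (x := 1) (x' := 1) (A := 1) (B := 1) (by simp) (by simp)).2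
    rw [one_mul, one_mul, ← Real.rpow_natCast] at this
    exact this.trans (hbs d (by linarith) (by linarith))
  have t6 : |cv P ξ' F'| ≤ Λ * (c' ^ r * a * L ^ (q + d)) := by
    have h1 := abs_cv_le_of_abs_le (B := (c * L) ^ d * a) (𝓕 := 𝓕) (T := T) (F := F')
      (fun ξ h1 h2 => hZcv T ξ h1 h2 l hlen hgap) hξ'm hξ'M hM0
    refine h1.trans ?_
    have h2 : (c * L) ^ d ≤ b ^ (d:ℝ) := by
      rw [Real.rpow_natCast, hb]; gcongr
    calc M * ((c * L) ^ d * a) ≤ M * (b ^ (d:ℝ) * a) := by gcongr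
      _ = Λ * (b ^ (q + d) * a) := by rw [hM, Real.rpow_add hb0]; ring
      _ ≤ Λ * (c' ^ r * L ^ (q + d) * a) := by
          gcongr
          exact hbs _ (by linarith) hqr
      _ = _ := by ring
  have hid : cv P ξ F = ∫ ω, (ξ ω * F ω - ξ' ω * F' ω) ∂P
      - (∫ ω, ξ ω ∂P) * (∫ ω, F ω ∂P - ∫ ω, F' ω ∂P)
      - (∫ ω, ξ ω ∂P - ∫ ω, ξ' ω ∂P) * ∫ ω, F' ω ∂P + cv P ξ' F' := by
    rw [E_sub (hξb.mul hFb) (hξ'b.mul hF'b)]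
    simp only [cv]; ring
  have m2 := mul_le_mul t2 t3 (abs_nonneg _) (mul_nonneg hΛ (mul_nonneg hK20 (hL' q).le))
  have m3 := mul_le_mul t4 t5 (abs_nonneg _)
    (mul_nonneg hΛ (mul_nonneg (mul_nonneg hK10 ha) (hL' q).le))
  rw [← abs_mul] at m2 m3
  have hLqd : L ^ (q + (d:ℝ)) = L ^ q * L ^ (d:ℝ) := Real.rpow_add hL0 _ _
  rw [hid]
  calc |∫ ω, (ξ ω * F ω - ξ' ω * F' ω) ∂P
      - (∫ ω, ξ ω ∂P) * (∫ ω, F ω ∂P - ∫ ω, F' ω ∂P)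
      - (∫ ω, ξ ω ∂P - ∫ ω, ξ' ω ∂P) * ∫ ω, F' ω ∂P + cv P ξ' F'|
      ≤ |∫ ω, (ξ ω * F ω - ξ' ω * F' ω) ∂P|
      + |(∫ ω, ξ ω ∂P) * (∫ ω, F ω ∂P - ∫ ω, F' ω ∂P)|
      + |(∫ ω, ξ ω ∂P - ∫ ω, ξ' ω ∂P) * ∫ ω, F' ω ∂P| + |cv P ξ' F'| :=
        (abs_add_le _ _).trans (add_le_add_left ((abs_sub _ _).trans
          (add_le_add_left (abs_sub _ _) _)) _)
    _ ≤ Λ * (K1 * a * L ^ (q + (d:ℝ))) + Λ * (K2 * L ^ q) * (K1 * a * L ^ (d:ℝ))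
      + Λ * (K1 * a * L ^ q) * (c' ^ r * L ^ (d:ℝ)) + Λ * (c' ^ r * a * L ^ (q + (d:ℝ))) := by
        linarith
    _ = _ := by rw [hLqd]; ring

end Level

/-! ### Covariances of past variables with local polynomials in the process -/

section Blocks

variable {Ω : Type*} [mΩ : MeasurableSpace Ω]

/-- The block sum `Y (m + 1) + ⋯ + Y n`. -/
def blk (Y : ℕ → Ω → ℝ) (m n : ℕ) (ω : Ω) : ℝ := ∑ i ∈ Finset.Ico m n, Y (i + 1) ω

omit mΩ in
lemma blk_add {Y : ℕ → Ω → ℝ} {l m n : ℕ} (h : l ≤ m) (h' : m ≤ n) (ω : Ω) :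
    blk Y l n ω = blk Y m n ω + blk Y l m ω := by
  rw [add_comm, blk, blk, blk, Finset.sum_Ico_consecutive _ h h']

omit mΩ in
lemma blk_self {Y : ℕ → Ω → ℝ} (m : ℕ) (ω : Ω) : blk Y m m ω = 0 := by simp [blk]

/-- Bounded adapted centered processes with stationary covariance `cc`. -/
structure CovSeq (P : Measure Ω) (𝓕 : Filtration ℕ mΩ) (Y : ℕ → Ω → ℝ) (cc : ℕ → ℝ) :
    Prop where
  bdd : ∀ j, Bdd (Y j)
  adapted : ∀ j, Measurable[𝓕 j] (Y j)
  centered : ∀ j, ∫ ω, Y j ω ∂P = 0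
  cov : ∀ j l, ∫ ω, Y j ω * Y (j + l) ω ∂P = cc l

variable {P : Measure Ω} [IsProbabilityMeasure P] {𝓕 : Filtration ℕ mΩ} {Y : ℕ → Ω → ℝ}
  {cc : ℕ → ℝ}

@[fun_prop]
lemma bdd_blk (hY : ∀ j, Bdd (Y j)) (m n : ℕ) : Bdd (blk Y m n) :=
  Bdd.sum _ fun i => hY (i + 1)

omit [IsProbabilityMeasure P] in
lemma CovSeq.measurable_blk (h : CovSeq P 𝓕 Y cc) {m n T : ℕ} (hT : n ≤ T) :
    Measurable[𝓕 T] (blk Y m n) := by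
  refine Finset.measurable_fun_sum _ fun i hi => ?_
  exact (h.adapted (i + 1)).mono (𝓕.mono (by rw [Finset.mem_Ico] at hi; omega)) le_rfl

lemma CovSeq.integral_blk (h : CovSeq P 𝓕 Y cc) (m n : ℕ) : ∫ ω, blk Y m n ω ∂P = 0 := by
  simp only [blk]
  rw [E_sum _ fun i => h.bdd (i + 1)]
  exact Finset.sum_eq_zero fun i _ => h.centered _

/-- Measurability with respect to `𝓕 T` and domination by `Λ * V ^ q` for some `V` of order `L`. -/
structure Dom (P : Measure Ω) (𝓕 : Filtration ℕ mΩ) (κ r a L : ℝ) (T : ℕ) (Λ q : ℝ)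
    (ξ : Ω → ℝ) : Prop where
  Λ_nonneg : 0 ≤ Λ
  q_nonneg : 0 ≤ q
  meas : Measurable[𝓕 T] ξ
  dom : ∃ V, InW P κ r a L V ∧ ∀ ω, |ξ ω| ≤ Λ * V ω ^ q

omit [IsProbabilityMeasure P] in
lemma Dom.bdd {κ r a L Λ q : ℝ} {T : ℕ} {ξ : Ω → ℝ} (h : Dom P 𝓕 κ r a L T Λ q ξ) : Bdd ξ := by
  obtain ⟨V, hV, hξ⟩ := h.dom
  obtain ⟨_, C, hC⟩ := hV.bdd.rpow hV.nonneg h.q_nonneg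
  exact ⟨h.meas.mono (𝓕.le T) le_rfl, Λ * C, fun ω => (hξ ω).trans
    (mul_le_mul_of_nonneg_left ((le_abs_self _).trans (hC ω)) h.Λ_nonneg)⟩

lemma inW_blk {c r a L : ℝ} {g : ℕ} (hY : ∀ j, Bdd (Y j)) (hr : 1 ≤ r)
    (h : Lvl P 𝓕 Y c r g a L) {m n : ℕ} {N : ℝ} (hN : 0 < N) (hmn : (n:ℝ) - m ≤ N) :
    InW P c r a L (fun ω => |blk Y m n ω| / N) := by
  obtain ⟨Z, hZb, hZL, hZ1, hZr, -⟩ := h.approx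
  set s := Finset.Ico m n with hs
  have hcard : (s.card : ℝ) ≤ N := by
    rw [hs, Nat.card_Ico]
    rcases le_total m n with h' | h'
    · rwa [Nat.cast_sub h']
    · rw [Nat.sub_eq_zero_of_le h']; simpa using hN.le
  have hc := h.one_le_c
  have hL := h.one_le_L
  have ha := h.a_nonneg
  have hL0 : 0 < L := by linarith
  have hLr : 0 < L ^ r := Real.rpow_pos_of_pos hL0 r
  set D : ℕ → Ω → ℝ := fun i ω => |Y (i + 1) ω - Z (i + 1) ω| with hD
  have hDb : ∀ i, Bdd (D i) := fun i => ((hY _).sub (hZb _)).abs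
  have hD0 : ∀ i ω, 0 ≤ D i ω := fun i ω => abs_nonneg _
  have hDrb : ∀ i, Bdd fun ω => D i ω ^ r := fun i => (hDb i).rpow (hD0 i) (by linarith)
  have hsum0 : ∀ ω, 0 ≤ ∑ i ∈ s, D i ω := fun ω => Finset.sum_nonneg fun i _ => hD0 i ω
  have hRb : Bdd fun ω => (∑ i ∈ s, D i ω) / N := by fun_prop
  have hR0 : ∀ ω, 0 ≤ (∑ i ∈ s, D i ω) / N := fun ω => div_nonneg (hsum0 ω) hN.le
  have hBb := bdd_blk hY m n
  refine ⟨by fun_prop, fun ω => by positivity, fun ω => (∑ i ∈ s, D i ω) / N,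
    ⟨hRb, hR0, ?_, ?_⟩, fun ω => ?_⟩
  · rw [integral_div, E_sum s hDb, div_le_iff₀ hN]
    calc ∑ i ∈ s, ∫ ω, D i ω ∂P ≤ ∑ _i ∈ s, c * a * L := Finset.sum_le_sum fun i _ => hZ1 _
      _ = s.card * (c * a * L) := by rw [Finset.sum_const, nsmul_eq_mul]
      _ ≤ N * (c * a * L) := by gcongr
      _ = _ := by ring
  · have hp : ∀ ω, ((∑ i ∈ s, D i ω) / N) ^ r ≤ 1 / N * ∑ i ∈ s, D i ω ^ r := by
      intro ω
      have h1 := Real.rpow_sum_le_const_mul_sum_rpow s (fun i => D i ω) hr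
      simp only [abs_of_nonneg (hD0 _ ω)] at h1
      rw [Real.div_rpow (hsum0 ω) hN.le, div_le_iff₀ (Real.rpow_pos_of_pos hN r)]
      have hsr : 0 ≤ ∑ i ∈ s, D i ω ^ r :=
        Finset.sum_nonneg fun i _ => Real.rpow_nonneg (hD0 i ω) r
      calc (∑ i ∈ s, D i ω) ^ r ≤ (s.card : ℝ) ^ (r - 1) * ∑ i ∈ s, D i ω ^ r := h1
        _ ≤ N ^ (r - 1) * ∑ i ∈ s, D i ω ^ r := by gcongr
        _ = 1 / N * (∑ i ∈ s, D i ω ^ r) * N ^ r := by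
            rw [Real.rpow_sub_one hN.ne']; ring
    refine (E_mono (hRb.rpow hR0 (by linarith)) (by fun_prop) hp).trans ?_
    rw [integral_const_mul, E_sum s hDrb, one_div, inv_mul_le_iff₀ hN]
    calc ∑ i ∈ s, ∫ ω, D i ω ^ r ∂P ≤ ∑ _i ∈ s, c * a * L ^ r :=
          Finset.sum_le_sum fun i _ => hZr _
      _ = s.card * (c * a * L ^ r) := by rw [Finset.sum_const, nsmul_eq_mul]
      _ ≤ N * (c * a * L ^ r) := by gcongr
  · rw [← sub_le_iff_le_add, div_sub_div_same, div_le_iff₀ hN]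
    have h1 : |blk Y m n ω| ≤ ∑ i ∈ s, (c * L + D i ω) := by
      refine (Finset.abs_sum_le_sum_abs _ _).trans (Finset.sum_le_sum fun i _ => ?_)
      have := abs_add_le (Z (i + 1) ω) (Y (i + 1) ω - Z (i + 1) ω)
      rw [add_sub_cancel] at this
      exact this.trans (add_le_add (hZL _ _) le_rfl)
    rw [Finset.sum_add_distrib, Finset.sum_const, nsmul_eq_mul] at h1
    have : (s.card : ℝ) * (c * L) ≤ N * (c * L) := by gcongr
    linarith

omit [IsProbabilityMeasure P] in
lemma inW_zero {κ r a L : ℝ} (hκ : 0 ≤ κ) (ha : 0 ≤ a) (hL : 0 ≤ L) (hr : 0 < r) :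
    InW P κ r a L (fun _ => 0) :=
  ⟨by fun_prop, fun _ => le_rfl, fun _ => 0, ⟨by fun_prop, fun _ => le_rfl,
    by simp only [integral_zero]; positivity,
    by simp only [Real.zero_rpow hr.ne', integral_zero]; positivity⟩, fun ω => by positivity⟩

omit [IsProbabilityMeasure P] in
lemma Dom.const {κ r a L : ℝ} (hκ : 0 ≤ κ) (ha : 0 ≤ a) (hL : 0 ≤ L) (hr : 0 < r) {T : ℕ}
    (b : ℝ) : Dom P 𝓕 κ r a L T |b| 0 (fun _ => b) :=
  ⟨abs_nonneg b, le_rfl, @measurable_const _ _ _ (𝓕 T) b, _, inW_zero hκ ha hL hr,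
    fun ω => by simp⟩

omit [IsProbabilityMeasure P] in
lemma Dom.mono_time {κ r a L Λ q : ℝ} {T T' : ℕ} {ξ : Ω → ℝ} (h : Dom P 𝓕 κ r a L T Λ q ξ)
    (hT : T ≤ T') : Dom P 𝓕 κ r a L T' Λ q ξ :=
  ⟨h.Λ_nonneg, h.q_nonneg, h.meas.mono (𝓕.mono hT) le_rfl, h.dom⟩

lemma Dom.mul_blk {κ c r a L Λ q N : ℝ} {g T m n : ℕ} {ξ : Ω → ℝ} (hr : 1 ≤ r) (hκ : 0 ≤ κ)
    (hY : CovSeq P 𝓕 Y cc) (hl : Lvl P 𝓕 Y c r g a L) (hN : 0 < N) (hmn : (n:ℝ) - m ≤ N)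
    (hnT : n ≤ T) (h : Dom P 𝓕 κ r a L T Λ q ξ) :
    Dom P 𝓕 (2 ^ r * (κ + c)) r a L T (Λ * N) (q + 1) (fun ω => ξ ω * blk Y m n ω) := by
  obtain ⟨V, hV, hd⟩ := h.dom
  have hc0 : 0 ≤ c := by linarith [hl.one_le_c]
  have hL0 : 0 ≤ L := by linarith [hl.one_le_L]
  have hΛ := h.Λ_nonneg
  have hq := h.q_nonneg
  refine ⟨by positivity, by positivity, h.meas.mul (hY.measurable_blk hnT), _,
    hV.add hr hl.a_nonneg hL0 hκ hc0 (inW_blk hY.bdd hr hl hN hmn), fun ω => ?_⟩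
  have h1 : 0 ≤ |blk Y m n ω| / N := by positivity
  have hV0 := hV.nonneg ω
  rw [abs_mul, Real.rpow_add_one' (by positivity) (by positivity)]
  calc |ξ ω| * |blk Y m n ω| ≤ (Λ * V ω ^ q) * |blk Y m n ω| := by gcongr; exact hd ω
    _ = Λ * N * (V ω ^ q * (|blk Y m n ω| / N)) := by field_simp
    _ ≤ Λ * N * ((V ω + |blk Y m n ω| / N) ^ q * (V ω + |blk Y m n ω| / N)) := by
        gcongr <;> linarith

/-- A function of a block bounded by a power of the block. -/
lemma dom_of_abs_le_blk {c r a L K q N : ℝ} {g T m n : ℕ} {ρ : Ω → ℝ} (hr : 1 ≤ r)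
    (hY : CovSeq P 𝓕 Y cc) (hl : Lvl P 𝓕 Y c r g a L) (hN : 0 < N) (hmn : (n:ℝ) - m ≤ N)
    (hK : 0 ≤ K) (hq : 0 ≤ q) (hρ : Measurable[𝓕 T] ρ)
    (h : ∀ ω, |ρ ω| ≤ K * |blk Y m n ω| ^ q) : Dom P 𝓕 c r a L T (K * N ^ q) q ρ := by
  refine ⟨by positivity, hq, hρ, _, inW_blk hY.bdd hr hl hN hmn, fun ω => (h ω).trans ?_⟩
  rw [Real.div_rpow (abs_nonneg _) hN.le, mul_assoc, mul_div_cancel₀ _ (by positivity)]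

lemma Dom.abs_integral_le {κ r a L Λ q : ℝ} {T : ℕ} {ξ : Ω → ℝ} (h : Dom P 𝓕 κ r a L T Λ q ξ)
    (hκ : 0 ≤ κ) (ha : a ≤ 1) (hL : 1 ≤ L) (hqr : q ≤ r) (hr : 1 ≤ r) :
    |∫ ω, ξ ω ∂P| ≤ Λ * ((2 * (κ + 1)) ^ r * (1 + κ) * L ^ q) := by
  obtain ⟨V, hV, hd⟩ := h.dom
  have hb := hV.bdd.rpow hV.nonneg h.q_nonneg
  refine (abs_E_le_of_le (by fun_prop) hd).trans ?_
  rw [integral_const_mul]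
  exact mul_le_mul_of_nonneg_left (hV.integral_rpow_le hκ ha hL h.q_nonneg hqr hr) h.Λ_nonneg

variable (P 𝓕) in
lemma exists_abs_cv_le_of_dom (κ c r : ℝ) (hr : 1 ≤ r) : ∃ K : ℝ, 0 ≤ K ∧
    ∀ (Y : ℕ → Ω → ℝ) (g : ℕ) (a L : ℝ), (∀ j, Bdd (Y j)) → Lvl P 𝓕 Y c r g a L →
    ∀ (T : ℕ) (ξ : Ω → ℝ) (Λ q : ℝ), Dom P 𝓕 κ r a L T Λ q ξ →
    (∀ i, q + 1 ≤ r → T + g ≤ i → |cv P ξ (Y i)| ≤ K * Λ * a * L ^ (q + 1)) ∧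
    (∀ i j, q + 2 ≤ r → T + g ≤ i → T + g ≤ j →
      |cv P ξ (fun ω => Y i ω * Y j ω)| ≤ K * Λ * a * L ^ (q + 2)) ∧
    ∀ i j l, q + 3 ≤ r → T + g ≤ i → T + g ≤ j → T + g ≤ l →
      |cv P ξ (fun ω => Y i ω * Y j ω * Y l ω)| ≤ K * Λ * a * L ^ (q + 3) := by
  obtain ⟨K, hK, h⟩ := exists_abs_cv_prod_le P 𝓕 κ c r hr
  refine ⟨K, hK, fun Y g a L hY hl T ξ Λ q hd => ?_⟩
  obtain ⟨V, hV, hξ⟩ := hd.dom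
  have key := h Y g a L hY hl V hV T ξ Λ q hd.Λ_nonneg hd.q_nonneg hd.meas hξ
  refine ⟨fun i hq hi => ?_, fun i j hq hi hj => ?_, fun i j l hq hi hj hl => ?_⟩
  · have := key [i] (by simp) (by simp) (by simpa using hq) (by simpa using hi)
    simpa using this
  · have := key [i, j] (by simp) (by simp) (by simpa using hq) (by simpa using ⟨hi, hj⟩)
    simpa using this
  · have := key [i, j, l] (by simp) (by simp) (by simpa using hq) (by simpa using ⟨hi, hj, hl⟩)
    simpa [mul_assoc] using this

/-- Moving a past factor from one side of a covariance to the other. -/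
lemma cv_mul_eq {ξ B F : Ω → ℝ} (hξ : Bdd ξ) (hB : Bdd B) (hF : Bdd F) :
    cv P ξ (fun ω => (F ω - ∫ ω, F ω ∂P) * B ω)
      = cv P (fun ω => ξ ω * B ω) F - (∫ ω, ξ ω ∂P) * cv P B F := by
  set m := ∫ ω, F ω ∂P with hm
  have h1 : ∫ ω, ξ ω * ((F ω - m) * B ω) ∂P
      = ∫ ω, ξ ω * B ω * F ω ∂P - m * ∫ ω, ξ ω * B ω ∂P := by
    rw [← integral_const_mul, ← E_sub (by fun_prop) (by fun_prop)]
    congr 1; ext ω; ring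
  have h2 : ∫ ω, (F ω - m) * B ω ∂P = ∫ ω, B ω * F ω ∂P - m * ∫ ω, B ω ∂P := by
    rw [← integral_const_mul, ← E_sub (by fun_prop) (by fun_prop)]
    congr 1; ext ω; ring
  simp only [cv, h1, h2, ← hm]
  ring

lemma cv_mul_eq_of_centered {ξ B F : Ω → ℝ} (hξ : Bdd ξ) (hB : Bdd B) (hF : Bdd F)
    (h0 : ∫ ω, F ω ∂P = 0) :
    cv P ξ (fun ω => F ω * B ω) = cv P (fun ω => ξ ω * B ω) F - (∫ ω, ξ ω ∂P) * cv P B F := by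
  simpa [h0] using cv_mul_eq (P := P) hξ hB hF

/-- Second order local polynomial at the step from `k` to `k + 1`. -/
def Hk (Y : ℕ → Ω → ℝ) (k T : ℕ) (ω : Ω) : ℝ :=
  Y (k + 1) ω ^ 2 / 2 + Y (k + 1) ω * blk Y T k ω

/-- Expectation of the second order local polynomial. -/
def CH (P : Measure Ω) (Y : ℕ → Ω → ℝ) (k T : ℕ) : ℝ := ∫ ω, Hk Y k T ω ∂P

/-- Third order local polynomial at the step from `k` to `k + 1`. -/
def Jk (P : Measure Ω) (Y : ℕ → Ω → ℝ) (k T : ℕ) (ω : Ω) : ℝ :=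
  Y (k + 1) ω * (blk Y T k ω ^ 2 / 2 + Y (k + 1) ω * blk Y T k ω / 2 + Y (k + 1) ω ^ 2 / 6)
    - CH P Y k T * blk Y T k ω

@[fun_prop]
lemma bdd_Hk (hY : ∀ j, Bdd (Y j)) (k T : ℕ) : Bdd (Hk Y k T) := by
  have h1 := hY (k + 1)
  have h2 := bdd_blk hY T k
  change Bdd fun ω => Y (k + 1) ω ^ 2 / 2 + Y (k + 1) ω * blk Y T k ω
  fun_prop

omit [IsProbabilityMeasure P] in
@[fun_prop]
lemma bdd_Jk (hY : ∀ j, Bdd (Y j)) (k T : ℕ) : Bdd (Jk P Y k T) := by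
  have h1 := hY (k + 1)
  have h2 := bdd_blk hY T k
  change Bdd fun ω => Y (k + 1) ω *
    (blk Y T k ω ^ 2 / 2 + Y (k + 1) ω * blk Y T k ω / 2 + Y (k + 1) ω ^ 2 / 6)
      - CH P Y k T * blk Y T k ω
  fun_prop

variable (P 𝓕) in
lemma exists_abs_cv_Hk_le (κ c r : ℝ) (hr : 1 ≤ r) (hκ : 0 ≤ κ) : ∃ K : ℝ, 0 ≤ K ∧
    ∀ (Y : ℕ → Ω → ℝ) (cc : ℕ → ℝ) (g : ℕ) (a L : ℝ), CovSeq P 𝓕 Y cc →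
    Lvl P 𝓕 Y c r g a L →
    ∀ (T T' k : ℕ) (N : ℝ) (ξ : Ω → ℝ) (Λ q : ℝ), Dom P 𝓕 κ r a L T Λ q ξ → q + 2 ≤ r →
    T ≤ T' → T' ≤ k → T + g ≤ T' + 1 → T' + g ≤ k + 1 → (k:ℝ) + 1 - T ≤ N →
    |cv P ξ (Hk Y k T)| ≤ K * Λ * N * a * L ^ (q + 2) := by
  obtain ⟨K1, hK1, h1⟩ := exists_abs_cv_le_of_dom P 𝓕 κ c r hr
  obtain ⟨K2, hK2, h2⟩ := exists_abs_cv_le_of_dom P 𝓕 (2 ^ r * (κ + c)) c r hr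
  set E := (2 * (κ + 1)) ^ r * (1 + κ) with hE
  have hE0 : 0 ≤ E := by positivity
  refine ⟨2 * K1 + K2 + E * K2, by positivity, ?_⟩
  intro Y cc g a L hY hl T T' k N ξ Λ q hd hq hTT' hT'k hg1 hg2 hN
  have hl1 := hl.one_le_L
  have hL0 : 0 < L := by linarith
  have ha := hl.a_nonneg
  have ha1 := hl.a_le_one
  have hc := hl.one_le_c
  have hΛ := hd.Λ_nonneg
  have hq0 := hd.q_nonneg
  have hTk : (T:ℝ) ≤ T' := by exact_mod_cast hTT'
  have hTk' : (T':ℝ) ≤ k := by exact_mod_cast hT'k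
  have hN1 : 1 ≤ N := by linarith
  have hYb := hY.bdd
  have hyb := hYb (k + 1)
  have hξb := hd.bdd
  have hBb := bdd_blk hYb T T'
  have hAb := bdd_blk hYb T' k
  obtain ⟨c1, c2, -⟩ := h1 Y g a L hYb hl T ξ Λ q hd
  have hX : 0 ≤ Λ * a * L ^ (q + 2) := by positivity
  have e1 : Hk Y k T = fun ω => (1 / 2 * (Y (k + 1) ω * Y (k + 1) ω) +
      Y (k + 1) ω * blk Y T' k ω) + Y (k + 1) ω * blk Y T T' ω := by
    ext ω
    rw [Hk, blk_add hTT' hT'k]; ring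
  have t1 : |cv P ξ (fun ω => 1 / 2 * (Y (k + 1) ω * Y (k + 1) ω))|
      ≤ K1 * (Λ * a * L ^ (q + 2)) := by
    rw [cv_const_mul_right, abs_mul]
    have := c2 (k + 1) (k + 1) hq (by omega) (by omega)
    have h0 := abs_nonneg (cv P ξ (fun ω => Y (k + 1) ω * Y (k + 1) ω))
    rw [abs_of_pos (by norm_num : (0:ℝ) < 1 / 2)]
    linarith
  have t2 : |cv P ξ (fun ω => Y (k + 1) ω * blk Y T' k ω)|
      ≤ N * (K1 * (Λ * a * L ^ (q + 2))) := by
    simp only [blk, Finset.mul_sum]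
    rw [cv_sum_right _ hξb fun i => hyb.mul (hYb (i + 1))]
    calc |∑ i ∈ Finset.Ico T' k, cv P ξ fun ω => Y (k + 1) ω * Y (i + 1) ω|
        ≤ ∑ i ∈ Finset.Ico T' k, K1 * (Λ * a * L ^ (q + 2)) := by
          refine (Finset.abs_sum_le_sum_abs _ _).trans (Finset.sum_le_sum fun i hi => ?_)
          rw [Finset.mem_Ico] at hi
          refine (c2 (k + 1) (i + 1) hq (by omega) (by omega)).trans (le_of_eq (by ring))
      _ = ((k - T' : ℕ) : ℝ) * (K1 * (Λ * a * L ^ (q + 2))) := by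
          rw [Finset.sum_const, nsmul_eq_mul, Nat.card_Ico]
      _ ≤ _ := by
          rw [Nat.cast_sub hT'k]
          gcongr
          linarith
  have hdB := (hd.mono_time hTT').mul_blk hr hκ hY hl (by linarith : 0 < N) (m := T) (n := T')
    (by linarith) le_rfl
  have hd1 := ((Dom.const (P := P) (𝓕 := 𝓕) (T := T') hκ ha hL0.le (by linarith) 1).mul_blk hr hκ
    hY hl (by linarith : 0 < N) (m := T) (n := T') (by linarith) le_rfl)
  simp only [one_mul, abs_one, zero_add] at hd1
  have t3 : |cv P ξ (fun ω => Y (k + 1) ω * blk Y T T' ω)|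
      ≤ (K2 + E * K2) * N * (Λ * a * L ^ (q + 2)) := by
    rw [cv_mul_eq_of_centered hξb hBb hyb (hY.centered _)]
    have s1 := (h2 Y g a L hYb hl T' _ _ _ hdB).1 (k + 1) (by linarith) (by omega)
    have s2 := (h2 Y g a L hYb hl T' _ _ _ hd1).1 (k + 1) (by linarith) (by omega)
    have s3 := hd.abs_integral_le hκ ha1 hl1 (by linarith) hr
    have s4 := mul_le_mul s3 s2 (abs_nonneg _) (by positivity)
    rw [← abs_mul] at s4
    refine (abs_sub _ _).trans ((add_le_add s1 s4).trans (le_of_eq ?_))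
    rw [show q + 1 + 1 = q + 2 by ring, show (1:ℝ) + 1 = 2 by norm_num, Real.rpow_add hL0 q 2]
    ring
  rw [e1, cv_add_right hξb (by fun_prop) (by fun_prop), cv_add_right hξb (by fun_prop)
    (by fun_prop)]
  refine (abs_add_three _ _ _).trans ((add_le_add (add_le_add t1 t2) t3).trans ?_)
  have : K1 * (Λ * a * L ^ (q + 2)) ≤ N * (K1 * (Λ * a * L ^ (q + 2))) :=
    le_mul_of_one_le_left (by positivity) hN1
  linarith

lemma CH_sub_CH (hY : ∀ j, Bdd (Y j)) (h0 : ∀ j, ∫ ω, Y j ω ∂P = 0) {k T T' : ℕ}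
    (hT : T ≤ T') (hT' : T' ≤ k) :
    CH P Y k T - CH P Y k T' = cv P (blk Y T T') (Y (k + 1)) := by
  have h1 := hY (k + 1)
  have h2 := bdd_blk hY T T'
  rw [CH, CH, ← E_sub (by fun_prop) (by fun_prop), cv, h0, mul_zero, sub_zero]
  congr 1; ext ω
  rw [Hk, Hk, blk_add hT hT']; ring

lemma Jk_eq (hY : ∀ j, Bdd (Y j)) (h0 : ∀ j, ∫ ω, Y j ω ∂P = 0) {k T T' : ℕ}
    (hT : T ≤ T') (hT' : T' ≤ k) (ω : Ω) :
    Jk P Y k T ω = Jk P Y k T' ω + 1 / 2 * (Y (k + 1) ω * blk Y T T' ω ^ 2)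
      + (Hk Y k T' ω - CH P Y k T') * blk Y T T' ω
      - cv P (blk Y T T') (Y (k + 1)) * blk Y T k ω := by
  rw [← CH_sub_CH hY h0 hT hT', Jk, Jk, Hk, blk_add hT hT']
  ring

omit mΩ in
lemma Hk_eq {k T T' : ℕ} (hT : T ≤ T') (hT' : T' ≤ k) (ω : Ω) :
    Hk Y k T ω = Hk Y k T' ω + Y (k + 1) ω * blk Y T T' ω := by
  rw [Hk, Hk, blk_add hT hT']; ring

end Blocks

section Third

variable {Ω : Type*} [mΩ : MeasurableSpace Ω] (P : Measure Ω) [IsProbabilityMeasure P]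
  (𝓕 : Filtration ℕ mΩ)

omit mΩ in
lemma blk_succ_self {Y : ℕ → Ω → ℝ} (k : ℕ) (ω : Ω) : blk Y k (k + 1) ω = Y (k + 1) ω := by
  simp [blk]

lemma exists_abs_CH_le (c r : ℝ) (hr : 2 ≤ r) (hc : 0 ≤ c) : ∃ K : ℝ, 0 ≤ K ∧
    ∀ (Y : ℕ → Ω → ℝ) (cc : ℕ → ℝ) (g : ℕ) (a L : ℝ), CovSeq P 𝓕 Y cc →
    Lvl P 𝓕 Y c r g a L → ∀ (T k : ℕ) (N : ℝ), T ≤ k → (k:ℝ) + 1 - T ≤ N →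
    |CH P Y k T| ≤ K * N * L ^ (2:ℝ) := by
  set κ2 := 2 ^ r * (2 ^ r * (c + c) + c) with hκ2
  have hκ0 : 0 ≤ κ2 := by positivity
  refine ⟨2 * ((2 * (κ2 + 1)) ^ r * (1 + κ2)), by positivity, ?_⟩
  intro Y cc g a L hY hl T k N hT hN
  have hl1 := hl.one_le_L
  have hL0 : 0 < L := by linarith
  have ha := hl.a_nonneg
  have hTk : (T:ℝ) ≤ k := by exact_mod_cast hT
  have hN1 : 1 ≤ N := by linarith
  have hyb := hY.bdd (k + 1)
  have hAb := bdd_blk hY.bdd T k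
  have hr1 : 1 ≤ r := by linarith
  have d1 := (Dom.const (P := P) (𝓕 := 𝓕) (T := k + 1) hc ha hL0.le (by linarith) 1).mul_blk hr1 hc
    hY hl one_pos (m := k) (n := k + 1) (by push_cast; linarith) le_rfl
  have d2 := d1.mul_blk hr1 (by positivity) hY hl one_pos (m := k) (n := k + 1)
    (by push_cast; linarith) le_rfl
  have d3 := d1.mul_blk hr1 (by positivity) hY hl (by linarith : 0 < N) (m := T) (n := k)
    (by linarith) (by omega)
  have b2 := d2.abs_integral_le hκ0 hl.a_le_one hl1 (by linarith) hr1
  have b3 := d3.abs_integral_le hκ0 hl.a_le_one hl1 (by linarith) hr1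
  simp only [abs_one, one_mul, zero_add, blk_succ_self, mul_one,
    show (1:ℝ) + 1 = 2 by norm_num] at b2 b3
  have e : CH P Y k T = 1 / 2 * ∫ ω, Y (k + 1) ω * Y (k + 1) ω ∂P
      + ∫ ω, Y (k + 1) ω * blk Y T k ω ∂P := by
    rw [CH, ← integral_const_mul, ← E_add (by fun_prop) (by fun_prop)]
    congr 1; ext ω; rw [Hk]; ring
  rw [e]
  set X := (2 * (κ2 + 1)) ^ r * (1 + κ2) * L ^ (2:ℝ) with hX
  have hX0 : 0 ≤ X := by positivity
  have : X ≤ N * X := le_mul_of_one_le_left hX0 hN1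
  rw [abs_le] at b2 b3 ⊢
  constructor <;> nlinarith

/-- Two intermediate times separate the past up to `T` from the step `k → k + 1`. -/
def Gap3 (g k T : ℕ) : Prop :=
  ∃ T' T'', T ≤ T' ∧ T' ≤ T'' ∧ T'' ≤ k ∧ T + g ≤ T' + 1 ∧ T' + g ≤ T'' + 1 ∧ T'' + g ≤ k + 1

lemma exists_abs_cv_Jk_le (κ c r : ℝ) (hr : 3 ≤ r) (hκ : 0 ≤ κ) (hc : 0 ≤ c) :
    ∃ K : ℝ, 0 ≤ K ∧
    ∀ (Y : ℕ → Ω → ℝ) (cc : ℕ → ℝ) (g : ℕ) (a L : ℝ), CovSeq P 𝓕 Y cc →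
    Lvl P 𝓕 Y c r g a L →
    ∀ (T k : ℕ) (N : ℝ) (ξ : Ω → ℝ) (Λ q : ℝ), Dom P 𝓕 κ r a L T Λ q ξ → q + 3 ≤ r →
    Gap3 g k T → (k:ℝ) + 1 - T ≤ N →
    |cv P ξ (Jk P Y k T)| ≤ K * Λ * N ^ 2 * a * L ^ (q + 3) := by
  have hr1 : 1 ≤ r := by linarith
  set κ1 := 2 ^ r * (κ + c) with hκ1
  have hκ10 : 0 ≤ κ1 := by positivity
  set κ2 := 2 ^ r * (κ1 + c) with hκ2
  have hκ20 : 0 ≤ κ2 := by positivity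
  obtain ⟨K0, hK0, h0⟩ := exists_abs_cv_le_of_dom P 𝓕 κ c r hr1
  obtain ⟨K1, hK1, h1⟩ := exists_abs_cv_le_of_dom P 𝓕 κ1 c r hr1
  obtain ⟨K2, hK2, h2⟩ := exists_abs_cv_le_of_dom P 𝓕 κ2 c r hr1
  obtain ⟨KH, hKH, hH⟩ := exists_abs_cv_Hk_le P 𝓕 κ1 c r hr1 hκ10
  obtain ⟨KC, hKC, hC⟩ := exists_abs_CH_le P 𝓕 c r (by linarith) hc
  set E := (2 * (κ + 1)) ^ r * (1 + κ) with hE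
  have hE0 : 0 ≤ E := by positivity
  set E1 := (2 * (κ1 + 1)) ^ r * (1 + κ1) with hE1
  have hE10 : 0 ≤ E1 := by positivity
  refine ⟨3 * K0 + KC * K0 + (K2 + E * K2) + (KH + E * KH) + K1 * (E1 + K0), by positivity, ?_⟩
  intro Y cc g a L hY hl T k N ξ Λ q hd hq hgap hN
  obtain ⟨T', T'', hT1, hT2, hT3, hg1, hg2, hg3⟩ := hgap
  have hl1 := hl.one_le_L
  have hL0 : 0 < L := by linarith
  have ha := hl.a_nonneg
  have ha1 := hl.a_le_one
  have hΛ := hd.Λ_nonneg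
  have hq0 := hd.q_nonneg
  have hTk : (T:ℝ) ≤ T' := by exact_mod_cast hT1
  have hT'k : T' ≤ k := hT2.trans hT3
  have hTk' : (T':ℝ) ≤ k := by exact_mod_cast hT'k
  have hN1 : 1 ≤ N := by linarith
  have hN0 : 0 < N := by linarith
  have hYb := hY.bdd
  have hyb := hYb (k + 1)
  have hξb := hd.bdd
  have hBb := bdd_blk hYb T T'
  have hAb := bdd_blk hYb T' k
  have hA0b := bdd_blk hYb T k
  have hHb := bdd_Hk hYb k T'
  have hJb := bdd_Jk (P := P) hYb k T'
  obtain ⟨c1, c2, c3⟩ := h0 Y g a L hYb hl T ξ Λ q hd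
  have hX : 0 ≤ Λ * a * L ^ (q + 3) := by positivity
  set X := Λ * a * L ^ (q + 3) with hXdef
  have hcard : ((k - T' : ℕ) : ℝ) ≤ N := by rw [Nat.cast_sub hT'k]; linarith
  -- products at large distance
  have hNN : N ≤ N ^ 2 := by nlinarith
  have s1 : |cv P ξ (fun ω => Y (k + 1) ω * blk Y T' k ω ^ 2)| ≤ N ^ 2 * (K0 * X) := by
    have e : (fun ω => Y (k + 1) ω * blk Y T' k ω ^ 2) = fun ω =>
        ∑ i ∈ Finset.Ico T' k, ∑ j ∈ Finset.Ico T' k, Y (k + 1) ω * Y (i + 1) ω * Y (j + 1) ω := by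
      ext ω
      rw [blk, sq, Finset.sum_mul_sum, Finset.mul_sum]
      refine Finset.sum_congr rfl fun i _ => ?_
      rw [Finset.mul_sum]
      exact Finset.sum_congr rfl fun j _ => by ring
    have hb : ∀ i, Bdd fun ω => ∑ j ∈ Finset.Ico T' k, Y (k + 1) ω * Y (i + 1) ω * Y (j + 1) ω :=
      fun i => Bdd.sum _ fun j => (hyb.mul (hYb _)).mul (hYb _)
    rw [e, cv_sum_right _ hξb hb]
    calc _ ≤ ∑ i ∈ Finset.Ico T' k, N * (K0 * X) := by
          refine (Finset.abs_sum_le_sum_abs _ _).trans (Finset.sum_le_sum fun i hi => ?_)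
          rw [cv_sum_right _ hξb fun j => (hyb.mul (hYb _)).mul (hYb _)]
          calc _ ≤ ∑ j ∈ Finset.Ico T' k, K0 * X := by
                refine (Finset.abs_sum_le_sum_abs _ _).trans (Finset.sum_le_sum fun j hj => ?_)
                rw [Finset.mem_Ico] at hi hj
                exact (c3 (k + 1) (i + 1) (j + 1) hq (by omega) (by omega) (by omega)).trans
                  (le_of_eq (by ring))
            _ = ((k - T' : ℕ) : ℝ) * (K0 * X) := by
                rw [Finset.sum_const, nsmul_eq_mul, Nat.card_Ico]
            _ ≤ _ := by gcongr
      _ = ((k - T' : ℕ) : ℝ) * (N * (K0 * X)) := by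
          rw [Finset.sum_const, nsmul_eq_mul, Nat.card_Ico]
      _ ≤ N * (N * (K0 * X)) := by gcongr
      _ = _ := by ring
  have s2 : |cv P ξ (fun ω => Y (k + 1) ω * Y (k + 1) ω * blk Y T' k ω)| ≤ N ^ 2 * (K0 * X) := by
    simp only [blk, Finset.mul_sum]
    rw [cv_sum_right _ hξb fun i => (hyb.mul hyb).mul (hYb (i + 1))]
    calc _ ≤ ∑ i ∈ Finset.Ico T' k, K0 * X := by
          refine (Finset.abs_sum_le_sum_abs _ _).trans (Finset.sum_le_sum fun i hi => ?_)
          rw [Finset.mem_Ico] at hi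
          exact (c3 (k + 1) (k + 1) (i + 1) hq (by omega) (by omega) (by omega)).trans
            (le_of_eq (by ring))
      _ = ((k - T' : ℕ) : ℝ) * (K0 * X) := by rw [Finset.sum_const, nsmul_eq_mul, Nat.card_Ico]
      _ ≤ N * (K0 * X) := by gcongr
      _ ≤ _ := by gcongr
  have s3 : |cv P ξ (fun ω => Y (k + 1) ω * Y (k + 1) ω * Y (k + 1) ω)| ≤ N ^ 2 * (K0 * X) := by
    refine (c3 (k + 1) (k + 1) (k + 1) hq (by omega) (by omega) (by omega)).trans ?_
    have : K0 * X ≤ N ^ 2 * (K0 * X) := le_mul_of_one_le_left (by positivity) (by nlinarith)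
    refine le_trans (le_of_eq ?_) this
    ring
  have s4' : |cv P ξ (blk Y T' k)| ≤ N * (K0 * (Λ * a * L ^ (q + 1))) := by
    have e : blk Y T' k = fun ω => ∑ i ∈ Finset.Ico T' k, Y (i + 1) ω := rfl
    rw [e, cv_sum_right _ hξb fun i => hYb (i + 1)]
    calc _ ≤ ∑ i ∈ Finset.Ico T' k, K0 * (Λ * a * L ^ (q + 1)) := by
          refine (Finset.abs_sum_le_sum_abs _ _).trans (Finset.sum_le_sum fun i hi => ?_)
          rw [Finset.mem_Ico] at hi
          exact (c1 (i + 1) (by linarith) (by omega)).trans (le_of_eq (by ring))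
      _ = ((k - T' : ℕ) : ℝ) * (K0 * (Λ * a * L ^ (q + 1))) := by
          rw [Finset.sum_const, nsmul_eq_mul, Nat.card_Ico]
      _ ≤ _ := by gcongr
  have hLL : L ^ (q + 3) = L ^ (2:ℝ) * L ^ (q + 1) := by
    rw [← Real.rpow_add hL0]; congr 1; ring
  have s4 : |cv P ξ (fun ω => CH P Y k T' * blk Y T' k ω)| ≤ KC * K0 * N ^ 2 * X := by
    rw [cv_const_mul_right, abs_mul]
    have := hC Y cc g a L hY hl T' k N hT'k (by linarith)
    refine (mul_le_mul this s4' (abs_nonneg _) (by positivity)).trans (le_of_eq ?_)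
    rw [hXdef, hLL]; ring
  -- the near block
  have hTT' := hd.mono_time hT1
  have hdB := hTT'.mul_blk hr1 hκ hY hl hN0 (m := T) (n := T') (by linarith) le_rfl
  have hdBB := hdB.mul_blk hr1 hκ10 hY hl hN0 (m := T) (n := T') (by linarith) le_rfl
  have hd1 := ((Dom.const (P := P) (𝓕 := 𝓕) (T := T') hκ ha hL0.le (by linarith) 1).mul_blk hr1 hκ
    hY hl hN0 (m := T) (n := T') (by linarith) le_rfl)
  have hd2 := hd1.mul_blk hr1 hκ10 hY hl hN0 (m := T) (n := T') (by linarith) le_rfl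
  simp only [one_mul, abs_one, zero_add] at hd1 hd2
  have s3E := hd.abs_integral_le hκ ha1 hl1 (by linarith) hr1
  have s5 : |cv P ξ (fun ω => Y (k + 1) ω * blk Y T T' ω ^ 2)| ≤ (K2 + E * K2) * N ^ 2 * X := by
    rw [cv_mul_eq_of_centered hξb (hBb.pow 2) hyb (hY.centered _)]
    have u1 := (h2 Y g a L hYb hl T' _ _ _ hdBB).1 (k + 1) (by linarith) (by omega)
    have u2 := (h2 Y g a L hYb hl T' _ _ _ hd2).1 (k + 1) (by linarith) (by omega)
    simp only [mul_assoc (ξ _), ← sq] at u1 u2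
    have u4 := mul_le_mul s3E u2 (abs_nonneg _) (by positivity)
    rw [← abs_mul] at u4
    refine (abs_sub _ _).trans ((add_le_add u1 u4).trans (le_of_eq ?_))
    rw [show q + 1 + 1 + 1 = q + 3 by ring, show (1:ℝ) + 1 + 1 = 3 by norm_num, hXdef,
      Real.rpow_add hL0 q 3]
    ring
  have s6 : |cv P ξ (fun ω => (Hk Y k T' ω - CH P Y k T') * blk Y T T' ω)|
      ≤ (KH + E * KH) * N ^ 2 * X := by
    rw [CH, cv_mul_eq hξb hBb hHb]
    have u1 := hH Y cc g a L hY hl T' T'' k N _ _ _ hdB (by linarith) hT2 hT3 hg2 hg3 (by linarith)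
    have u2 := hH Y cc g a L hY hl T' T'' k N _ _ _ hd1 (by linarith) hT2 hT3 hg2 hg3 (by linarith)
    have u4 := mul_le_mul s3E u2 (abs_nonneg _) (by positivity)
    rw [← abs_mul] at u4
    refine (abs_sub _ _).trans ((add_le_add u1 u4).trans (le_of_eq ?_))
    rw [show q + 1 + 2 = q + 3 by ring, show (1:ℝ) + 2 = 3 by norm_num, hXdef,
      Real.rpow_add hL0 q 3]
    ring
  have s7 : |cv P ξ (fun ω => cv P (blk Y T T') (Y (k + 1)) * blk Y T k ω)|
      ≤ K1 * (E1 + K0) * N ^ 2 * X := by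
    rw [cv_const_mul_right, abs_mul]
    have u1 := (h1 Y g a L hYb hl T' _ _ _ hd1).1 (k + 1) (by linarith) (by omega)
    have e : blk Y T k = fun ω => blk Y T' k ω + blk Y T T' ω := by
      ext ω; exact blk_add hT1 hT'k ω
    have u2 : |cv P ξ (blk Y T T')| ≤ Λ * N * (E1 * L ^ (q + 1)) := by
      rw [cv, hY.integral_blk, mul_zero, sub_zero]
      exact hdB.abs_integral_le hκ10 ha1 hl1 (by linarith) hr1
    have u3 : |cv P ξ (blk Y T k)| ≤ N * (E1 + K0) * (Λ * L ^ (q + 1)) := by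
      rw [e, cv_add_right hξb hAb hBb]
      have : N * (K0 * (Λ * a * L ^ (q + 1))) ≤ N * (K0 * (Λ * 1 * L ^ (q + 1))) := by gcongr
      refine (abs_add_le _ _).trans ((add_le_add (s4'.trans this) u2).trans (le_of_eq ?_))
      ring
    refine (mul_le_mul u1 u3 (abs_nonneg _) (by positivity)).trans (le_of_eq ?_)
    rw [hXdef, hLL, show (1:ℝ) + 1 = 2 by norm_num]; ring
  have eJ : Jk P Y k T = fun ω => ((((1 / 2 * (Y (k + 1) ω * blk Y T' k ω ^ 2)
      + 1 / 2 * (Y (k + 1) ω * Y (k + 1) ω * blk Y T' k ω))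
      + 1 / 6 * (Y (k + 1) ω * Y (k + 1) ω * Y (k + 1) ω)) - CH P Y k T' * blk Y T' k ω)
      + 1 / 2 * (Y (k + 1) ω * blk Y T T' ω ^ 2)
      + (Hk Y k T' ω - CH P Y k T') * blk Y T T' ω)
      - cv P (blk Y T T') (Y (k + 1)) * blk Y T k ω := by
    ext ω
    rw [Jk_eq hYb hY.centered hT1 hT'k, Jk]
    ring
  rw [eJ]
  simp (disch := fun_prop) only [cv_add_right, cv_sub_right]
  rw [cv_const_mul_right (1 / 2), cv_const_mul_right (1 / 2), cv_const_mul_right (1 / 6),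
    cv_const_mul_right (1 / 2)]
  have hX2 : 0 ≤ N ^ 2 * (K0 * X) := by positivity
  have hX3 : 0 ≤ (K2 + E * K2) * N ^ 2 * X := by positivity
  have e : (3 * K0 + KC * K0 + (K2 + E * K2) + (KH + E * KH) + K1 * (E1 + K0)) * Λ * N ^ 2 * a
      * L ^ (q + 3) = 3 * (N ^ 2 * (K0 * X)) + KC * K0 * N ^ 2 * X + (K2 + E * K2) * N ^ 2 * X
      + (KH + E * KH) * N ^ 2 * X + K1 * (E1 + K0) * N ^ 2 * X := by
    rw [hXdef]; ring
  rw [e]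
  rw [abs_le] at s1 s2 s3 s4 s5 s6 s7 ⊢
  constructor <;> linarith [s1.1, s1.2, s2.1, s2.2, s3.1, s3.2, s4.1, s4.2, s5.1, s5.2, s6.1, s6.2,
    s7.1, s7.2]

end Third

/-! ### One step of the Lindeberg expansion -/

/-- A function with three bounded derivatives, the third one being Hölder continuous. -/
structure HChain (δ Kh β1 β2 β3 : ℝ) (u0 u1 u2 u3 : ℝ → ℝ) : Prop where
  d0 : ∀ x, HasDerivAt u0 (u1 x) x
  d1 : ∀ x, HasDerivAt u1 (u2 x) x
  d2 : ∀ x, HasDerivAt u2 (u3 x) x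
  m1 : Measurable u1
  m2 : Measurable u2
  m3 : Measurable u3
  b1 : ∀ x, |u1 x| ≤ β1
  b2 : ∀ x, |u2 x| ≤ β2
  b3 : ∀ x, |u3 x| ≤ β3
  holder : ∀ x y, |u3 x - u3 y| ≤ Kh * |x - y| ^ δ
  Kh_nonneg : 0 ≤ Kh

section Step

variable {Ω : Type*} [mΩ : MeasurableSpace Ω] (P : Measure Ω) [IsProbabilityMeasure P]
  (𝓕 : Filtration ℕ mΩ)

/-- Expectation of the third order local polynomial. -/
def KJ (Y : ℕ → Ω → ℝ) (k T : ℕ) : ℝ := ∫ ω, Jk P Y k T ω ∂P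

/-- Correlation of the derivatives at the partial sum up to `T` with the step `k → k + 1`. -/
def Phi (Y : ℕ → Ω → ℝ) (u1 u2 u3 : ℝ → ℝ) (k T : ℕ) : ℝ :=
  cv P (fun ω => u1 (blk Y 0 T ω)) (Y (k + 1)) + cv P (fun ω => u2 (blk Y 0 T ω)) (Hk Y k T)
    + cv P (fun ω => u3 (blk Y 0 T ω)) (Jk P Y k T)

lemma cv_const_left (b : ℝ) (F : Ω → ℝ) : cv P (fun _ => b) F = 0 := by
  simp [cv, integral_const_mul]

lemma Phi_zero (Y : ℕ → Ω → ℝ) (u1 u2 u3 : ℝ → ℝ) (k : ℕ) : Phi P Y u1 u2 u3 k 0 = 0 := by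
  simp only [Phi, blk_self, cv_const_left, add_zero]

omit [IsProbabilityMeasure P] in
lemma dom_of_abs_le {c r a L b : ℝ} {T : ℕ} {ξ : Ω → ℝ} (hc : 0 ≤ c) (ha : 0 ≤ a) (hL : 0 ≤ L)
    (hr : 0 < r) (hb : 0 ≤ b) (hm : Measurable[𝓕 T] ξ) (h : ∀ ω, |ξ ω| ≤ b) :
    Dom P 𝓕 c r a L T b 0 ξ :=
  ⟨hb, le_rfl, hm, _, inW_zero hc ha hL hr, fun ω => by simpa using h ω⟩

lemma exists_abs_Phi_le (c r : ℝ) (hr : 3 ≤ r) (hc : 0 ≤ c) : ∃ K : ℝ, 0 ≤ K ∧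
    ∀ (Y : ℕ → Ω → ℝ) (cc : ℕ → ℝ) (g : ℕ) (a L : ℝ), CovSeq P 𝓕 Y cc →
    Lvl P 𝓕 Y c r g a L → ∀ (δ Kh β1 β2 β3 : ℝ) (u0 u1 u2 u3 : ℝ → ℝ),
    HChain δ Kh β1 β2 β3 u0 u1 u2 u3 → ∀ (T k : ℕ) (N : ℝ), Gap3 g k T → (k:ℝ) + 1 - T ≤ N →
    |Phi P Y u1 u2 u3 k T| ≤ K * a * (β1 * L + β2 * N * L ^ 2 + β3 * N ^ 2 * L ^ 3) := by
  have hr1 : 1 ≤ r := by linarith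
  obtain ⟨K1, hK1, h1⟩ := exists_abs_cv_le_of_dom P 𝓕 c c r hr1
  obtain ⟨K2, hK2, h2⟩ := exists_abs_cv_Hk_le P 𝓕 c c r hr1 hc
  obtain ⟨K3, hK3, h3⟩ := exists_abs_cv_Jk_le P 𝓕 c c r hr hc hc
  refine ⟨K1 + K2 + K3, by positivity, ?_⟩
  intro Y cc g a L hY hl δ Kh β1 β2 β3 u0 u1 u2 u3 hu T k N hg hN
  have hl1 := hl.one_le_L
  have hL0 : 0 < L := by linarith
  have ha := hl.a_nonneg
  have hS := hY.measurable_blk (m := 0) (le_refl T)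
  have B1 : 0 ≤ β1 := (abs_nonneg _).trans (hu.b1 0)
  have B2 : 0 ≤ β2 := (abs_nonneg _).trans (hu.b2 0)
  have B3 : 0 ≤ β3 := (abs_nonneg _).trans (hu.b3 0)
  obtain ⟨T', T'', hT1, hT2, hT3, hg1, hg2, hg3⟩ := id hg
  have hN0 : 0 ≤ N := by
    have : (T:ℝ) ≤ k := by exact_mod_cast hT1.trans (hT2.trans hT3)
    linarith
  have d1 := dom_of_abs_le P 𝓕 hc ha hL0.le (by linarith : 0 < r) B1 (hu.m1.comp hS)
    (fun ω => hu.b1 _)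
  have d2 := dom_of_abs_le P 𝓕 hc ha hL0.le (by linarith : 0 < r) B2 (hu.m2.comp hS)
    (fun ω => hu.b2 _)
  have d3 := dom_of_abs_le P 𝓕 hc ha hL0.le (by linarith : 0 < r) B3 (hu.m3.comp hS)
    (fun ω => hu.b3 _)
  have e1 := (h1 Y g a L hY.bdd hl T _ _ _ d1).1 (k + 1) (by linarith) (by omega)
  have e2 := h2 Y cc g a L hY hl T T' k N _ _ _ d2 (by linarith) hT1 (hT2.trans hT3) hg1
    (by omega) hN
  have e3 := h3 Y cc g a L hY hl T k N _ _ _ d3 (by linarith) hg hN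
  rw [zero_add, Real.rpow_one] at e1
  rw [zero_add, Real.rpow_ofNat] at e2 e3
  have p1 : 0 ≤ β1 * a * L := by positivity
  have p2 : 0 ≤ β2 * N * a * L ^ 2 := by positivity
  have p3 : 0 ≤ β3 * N ^ 2 * a * L ^ 3 := by positivity
  refine (abs_add_three _ _ _).trans ((add_le_add (add_le_add e1 e2) e3).trans ?_)
  have q1 := mul_nonneg (add_nonneg hK2 hK3) p1
  have q2 := mul_nonneg (add_nonneg hK1 hK3) p2
  have q3 := mul_nonneg (add_nonneg hK1 hK2) p3
  linarith

lemma KJ_sub_KJ {𝓕 : Filtration ℕ mΩ} {Y : ℕ → Ω → ℝ} {cc : ℕ → ℝ} (hY : CovSeq P 𝓕 Y cc)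
    {k T T' : ℕ}
    (hT : T ≤ T') (hT' : T' ≤ k) :
    KJ P Y k T - KJ P Y k T' = 1 / 2 * cv P (fun ω => blk Y T T' ω ^ 2) (Y (k + 1))
      + cv P (blk Y T T') (Hk Y k T') := by
  have hb := hY.bdd
  have h1 := hb (k + 1)
  have h2 := bdd_blk hb T T'
  have h3 := bdd_blk hb T k
  have h4 := bdd_Hk hb k T'
  have h5 := bdd_Jk (P := P) hb k T'
  rw [KJ, KJ]
  simp only [fun ω => Jk_eq (P := P) hb hY.centered hT hT' ω]
  simp (disch := fun_prop) only [E_add, E_sub, integral_const_mul]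
  simp only [cv, hY.integral_blk, hY.centered]
  have e1 : ∫ ω, Y (k + 1) ω * blk Y T T' ω ^ 2 ∂P = ∫ ω, blk Y T T' ω ^ 2 * Y (k + 1) ω ∂P := by
    congr 1; ext ω; ring
  have e2 : ∫ ω, (Hk Y k T' ω - CH P Y k T') * blk Y T T' ω ∂P
      = ∫ ω, blk Y T T' ω * Hk Y k T' ω ∂P := by
    have : ∀ ω, (Hk Y k T' ω - CH P Y k T') * blk Y T T' ω
        = blk Y T T' ω * Hk Y k T' ω - CH P Y k T' * blk Y T T' ω := fun ω => by ring
    simp only [this]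
    rw [E_sub (by fun_prop) (by fun_prop), integral_const_mul, hY.integral_blk]
    ring
  rw [e1, e2]; ring

lemma exists_abs_KJ_sub_le (c r : ℝ) (hr : 3 ≤ r) (hc : 0 ≤ c) : ∃ K : ℝ, 0 ≤ K ∧
    ∀ (Y : ℕ → Ω → ℝ) (cc : ℕ → ℝ) (g : ℕ) (a L : ℝ), CovSeq P 𝓕 Y cc →
    Lvl P 𝓕 Y c r g a L → ∀ (T1 T0 k : ℕ) (N : ℝ), T1 ≤ T0 → Gap3 g k T0 →
    (k:ℝ) + 1 - T1 ≤ N → |KJ P Y k T1 - KJ P Y k T0| ≤ K * N ^ 2 * a * L ^ 3 := by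
  have hr1 : 1 ≤ r := by linarith
  set κ1 := 2 ^ r * (c + c) with hκ1
  have hκ10 : 0 ≤ κ1 := by positivity
  obtain ⟨K1, hK1, h1⟩ := exists_abs_cv_le_of_dom P 𝓕 (2 ^ r * (κ1 + c)) c r hr1
  obtain ⟨K2, hK2, h2⟩ := exists_abs_cv_Hk_le P 𝓕 κ1 c r hr1 hκ10
  refine ⟨K1 + K2, by positivity, ?_⟩
  intro Y cc g a L hY hl T1 T0 k N hT hg hN
  obtain ⟨T', T'', hT1, hT2, hT3, hg1, hg2, hg3⟩ := id hg
  have hl1 := hl.one_le_L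
  have hL0 : 0 < L := by linarith
  have ha := hl.a_nonneg
  have hTk : (T0:ℝ) ≤ k := by exact_mod_cast hT1.trans (hT2.trans hT3)
  have hT10 : (T1:ℝ) ≤ T0 := by exact_mod_cast hT
  have hN0 : 0 < N := by linarith
  have d1 := ((Dom.const (P := P) (𝓕 := 𝓕) (T := T0) hc ha hL0.le (by linarith) 1).mul_blk hr1 hc
    hY hl hN0 (m := T1) (n := T0) (by linarith) le_rfl)
  have d2 := d1.mul_blk hr1 hκ10 hY hl hN0 (m := T1) (n := T0) (by linarith) le_rfl
  simp only [one_mul, abs_one, zero_add, ← sq] at d1 d2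
  have e1 := (h1 Y g a L hY.bdd hl T0 _ _ _ d2).1 (k + 1) (by linarith) (by omega)
  have e2 := h2 Y cc g a L hY hl T0 T' k N _ _ _ d1 (by linarith) hT1 (hT2.trans hT3) hg1
    (by omega) (by linarith)
  rw [show (1:ℝ) + 1 + 1 = 3 by norm_num, Real.rpow_ofNat] at e1
  rw [show (1:ℝ) + 2 = 3 by norm_num, Real.rpow_ofNat] at e2
  rw [KJ_sub_KJ P hY hT (hT1.trans (hT2.trans hT3))]
  refine (abs_add_le _ _).trans ?_
  rw [abs_mul, abs_of_pos (by norm_num : (0:ℝ) < 1 / 2)]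
  have := abs_nonneg (cv P (fun ω => blk Y T1 T0 ω ^ 2) (Y (k + 1)))
  linarith

lemma bdd_comp_blk {Y : ℕ → Ω → ℝ} (hY : ∀ j, Bdd (Y j)) {u : ℝ → ℝ} {β : ℝ} (hm : Measurable u)
    (hb : ∀ x, |u x| ≤ β) (n : ℕ) : Bdd fun ω => u (blk Y 0 n ω) := (bdd_blk hY 0 n).comp hm hb

/-- Exact expansion of `Phi` between two conditioning times. -/
lemma Phi_sub_Phi {𝓕 : Filtration ℕ mΩ} {Y : ℕ → Ω → ℝ} {cc : ℕ → ℝ} (hY : CovSeq P 𝓕 Y cc)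
    {δ Kh β1 β2 β3 : ℝ} {u0 u1 u2 u3 : ℝ → ℝ} (hu : HChain δ Kh β1 β2 β3 u0 u1 u2 u3) {k T1 T0 : ℕ}
    (hT : T1 ≤ T0) (hTk : T0 ≤ k) :
    Phi P Y u1 u2 u3 k T0 - Phi P Y u1 u2 u3 k T1
      - (CH P Y k T1 - CH P Y k T0) * ∫ ω, u2 (blk Y 0 k ω) ∂P
      - (KJ P Y k T1 - KJ P Y k T0) * ∫ ω, u3 (blk Y 0 T1 ω) ∂P
    = cv P (fun ω => u1 (blk Y 0 T1 ω + blk Y T1 T0 ω) - u1 (blk Y 0 T1 ω)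
          - blk Y T1 T0 ω * u2 (blk Y 0 T1 ω) - blk Y T1 T0 ω ^ 2 / 2 * u3 (blk Y 0 T1 ω)) (Y (k + 1))
      + cv P (fun ω => u2 (blk Y 0 T1 ω + blk Y T1 T0 ω) - u2 (blk Y 0 T1 ω)
          - blk Y T1 T0 ω * u3 (blk Y 0 T1 ω)) (Hk Y k T0)
      + cv P (fun ω => u3 (blk Y 0 T1 ω + blk Y T1 T0 ω) - u3 (blk Y 0 T1 ω)) (Jk P Y k T0)
      - (CH P Y k T1 - CH P Y k T0) * ∫ ω, (u2 (blk Y 0 T1 ω + blk Y T1 k ω) - u2 (blk Y 0 T1 ω)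
          - blk Y T1 k ω * u3 (blk Y 0 T1 ω)) ∂P := by
  have hb := hY.bdd
  have h1 := hb (k + 1)
  have hB := bdd_blk hb T1 T0
  have hA := bdd_blk hb T1 k
  have hx := bdd_blk hb 0 T1
  have hH0 := bdd_Hk hb k T0
  have hJ0 := bdd_Jk (P := P) hb k T0
  have hH1 := bdd_Hk hb k T1
  have hJ1 := bdd_Jk (P := P) hb k T1
  have hU1 := bdd_comp_blk hb hu.m1 hu.b1 T1
  have hU2 := bdd_comp_blk hb hu.m2 hu.b2 T1
  have hU3 := bdd_comp_blk hb hu.m3 hu.b3 T1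
  have hV1 : Bdd fun ω => u1 (blk Y 0 T1 ω + blk Y T1 T0 ω) := (hx.add hB).comp hu.m1 hu.b1
  have hV2 : Bdd fun ω => u2 (blk Y 0 T1 ω + blk Y T1 T0 ω) := (hx.add hB).comp hu.m2 hu.b2
  have hV3 : Bdd fun ω => u3 (blk Y 0 T1 ω + blk Y T1 T0 ω) := (hx.add hB).comp hu.m3 hu.b3
  have hW2 : Bdd fun ω => u2 (blk Y 0 T1 ω + blk Y T1 k ω) := (hx.add hA).comp hu.m2 hu.b2
  have e0 : ∀ ω, blk Y 0 T0 ω = blk Y 0 T1 ω + blk Y T1 T0 ω := fun ω => by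
    rw [blk_add (Nat.zero_le T1) hT, add_comm]
  have ek : ∀ ω, blk Y 0 k ω = blk Y 0 T1 ω + blk Y T1 k ω := fun ω => by
    rw [blk_add (Nat.zero_le T1) (hT.trans hTk), add_comm]
  set C0 := CH P Y k T0 with hC0
  set C1 := CH P Y k T1 with hC1
  set J0 := KJ P Y k T0 with hJ0'
  set J1 := KJ P Y k T1 with hJ1'
  have ec : cv P (blk Y T1 T0) (Y (k + 1)) = C1 - C0 := by
    rw [hC0, hC1, CH_sub_CH hb hY.centered hT hTk]
  obtain ⟨U1, u1e⟩ : ∃ U : Ω → ℝ, ∀ ω, u1 (blk Y 0 T1 ω) = U ω := ⟨_, fun _ => rfl⟩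
  simp only [u1e] at hU1
  obtain ⟨U2, u2e⟩ : ∃ U : Ω → ℝ, ∀ ω, u2 (blk Y 0 T1 ω) = U ω := ⟨_, fun _ => rfl⟩
  simp only [u2e] at hU2
  obtain ⟨U3, u3e⟩ : ∃ U : Ω → ℝ, ∀ ω, u3 (blk Y 0 T1 ω) = U ω := ⟨_, fun _ => rfl⟩
  simp only [u3e] at hU3
  obtain ⟨V1, v1e⟩ : ∃ U : Ω → ℝ, ∀ ω, u1 (blk Y 0 T1 ω + blk Y T1 T0 ω) = U ω := ⟨_, fun _ => rfl⟩
  simp only [v1e] at hV1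
  obtain ⟨V2, v2e⟩ : ∃ U : Ω → ℝ, ∀ ω, u2 (blk Y 0 T1 ω + blk Y T1 T0 ω) = U ω := ⟨_, fun _ => rfl⟩
  simp only [v2e] at hV2
  obtain ⟨V3, v3e⟩ : ∃ U : Ω → ℝ, ∀ ω, u3 (blk Y 0 T1 ω + blk Y T1 T0 ω) = U ω := ⟨_, fun _ => rfl⟩
  simp only [v3e] at hV3
  obtain ⟨W2, w2e⟩ : ∃ U : Ω → ℝ, ∀ ω, u2 (blk Y 0 T1 ω + blk Y T1 k ω) = U ω := ⟨_, fun _ => rfl⟩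
  simp only [w2e] at hW2
  -- integrals of products involving the later polynomials
  have i0 : ∫ ω, Hk Y k T0 ω ∂P = C0 := rfl
  have i1 : ∫ ω, Hk Y k T1 ω ∂P = C1 := rfl
  have i2 : ∫ ω, Jk P Y k T0 ω ∂P = J0 := rfl
  have i3 : ∫ ω, Jk P Y k T1 ω ∂P = J1 := rfl
  have iH : ∫ ω, U2 ω * Hk Y k T1 ω ∂P = ∫ ω, U2 ω * Hk Y k T0 ω ∂P
      + ∫ ω, blk Y T1 T0 ω * U2 ω * Y (k + 1) ω ∂P := by
    rw [← E_add (by fun_prop) (by fun_prop)]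
    congr 1; ext ω; rw [Hk_eq hT hTk]; ring
  have iJ : ∫ ω, U3 ω * Jk P Y k T1 ω ∂P = ∫ ω, U3 ω * Jk P Y k T0 ω ∂P
      + ∫ ω, blk Y T1 T0 ω ^ 2 / 2 * U3 ω * Y (k + 1) ω ∂P
      + (∫ ω, blk Y T1 T0 ω * U3 ω * Hk Y k T0 ω ∂P
        - C0 * ∫ ω, blk Y T1 T0 ω * U3 ω ∂P)
      - (C1 - C0) * ∫ ω, blk Y T1 k ω * U3 ω ∂P := by
    rw [← integral_const_mul, ← integral_const_mul, ← E_add (by fun_prop) (by fun_prop),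
      ← E_sub (by fun_prop) (by fun_prop), ← E_add (by fun_prop) (by fun_prop),
      ← E_sub (by fun_prop) (by fun_prop)]
    congr 1; ext ω
    rw [Jk_eq (P := P) hb hY.centered hT hTk, ec]
    ring
  simp only [Phi, e0, ek, cv, hY.centered, u1e, u2e, u3e, v1e, v2e, v3e, w2e, mul_zero, sub_zero,
    sub_mul]
  simp (disch := fun_prop) only [E_sub]
  rw [i0, i1, i2, i3, iH, iJ]
  ring

lemma exists_abs_Phi_sub_Phi_le (c δ : ℝ) (hδ : 0 ≤ δ) (hc : 0 ≤ c) : ∃ K : ℝ, 0 ≤ K ∧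
    ∀ (Y : ℕ → Ω → ℝ) (cc : ℕ → ℝ) (g : ℕ) (a L : ℝ), CovSeq P 𝓕 Y cc →
    Lvl P 𝓕 Y c (3 + δ) g a L → ∀ (Kh β1 β2 β3 : ℝ) (u0 u1 u2 u3 : ℝ → ℝ),
    HChain δ Kh β1 β2 β3 u0 u1 u2 u3 → ∀ (T1 T0 k : ℕ) (N : ℝ), T1 ≤ T0 → Gap3 g k T0 →
    (k:ℝ) + 1 - T1 ≤ N →
    |Phi P Y u1 u2 u3 k T0 - Phi P Y u1 u2 u3 k T1
      - (CH P Y k T1 - CH P Y k T0) * ∫ ω, u2 (blk Y 0 k ω) ∂P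
      - (KJ P Y k T1 - KJ P Y k T0) * ∫ ω, u3 (blk Y 0 T1 ω) ∂P|
    ≤ K * Kh * N ^ (2 + δ) * a * L ^ (3 + δ) := by
  set r := 3 + δ with hrδ
  have hr : 3 ≤ r := by linarith
  have hr1 : 1 ≤ r := by linarith
  obtain ⟨K1, hK1, h1⟩ := exists_abs_cv_le_of_dom P 𝓕 c c r hr1
  obtain ⟨K2, hK2, h2⟩ := exists_abs_cv_Hk_le P 𝓕 c c r hr1 hc
  obtain ⟨K3, hK3, h3⟩ := exists_abs_cv_Jk_le P 𝓕 c c r hr hc hc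
  set κ1 := 2 ^ r * (c + c) with hκ1
  have hκ10 : 0 ≤ κ1 := by positivity
  obtain ⟨K4, hK4, h4⟩ := exists_abs_cv_le_of_dom P 𝓕 κ1 c r hr1
  set E := (2 * (c + 1)) ^ r * (1 + c) with hE
  have hE0 : 0 ≤ E := by positivity
  refine ⟨K1 + K2 + K3 + K4 * E, by positivity, ?_⟩
  intro Y cc g a L hY hl Kh β1 β2 β3 u0 u1 u2 u3 hu T1 T0 k N hT hg hN
  obtain ⟨T', T'', hT1, hT2, hT3, hg1, hg2, hg3⟩ := id hg
  have hTk : T0 ≤ k := hT1.trans (hT2.trans hT3)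
  have hl1 := hl.one_le_L
  have hL0 : 0 < L := by linarith
  have ha := hl.a_nonneg
  have hTk' : (T0:ℝ) ≤ k := by exact_mod_cast hTk
  have hT10 : (T1:ℝ) ≤ T0 := by exact_mod_cast hT
  have hN1 : 1 ≤ N := by linarith
  have hN0 : 0 < N := by linarith
  have hKh := hu.Kh_nonneg
  have hb := hY.bdd
  have hx := hY.measurable_blk (m := 0) hT
  have hB := hY.measurable_blk (m := T1) (le_refl T0)
  have hxk := hY.measurable_blk (m := 0) (hT.trans hTk)
  have hAk := hY.measurable_blk (m := T1) (le_refl k)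
  rw [Phi_sub_Phi P hY hu hT hTk]
  have d1 := dom_of_abs_le_blk (m := T1) (n := T0) (T := T0) hr1 hY hl hN0 (by linarith) hKh
    (by linarith : 0 ≤ 2 + δ)
    (((hu.m1.comp (hx.add hB)).sub (hu.m1.comp hx)).sub (hB.mul (hu.m2.comp hx)) |>.sub
      (((hB.pow_const 2).div_const 2).mul (hu.m3.comp hx)))
    (fun ω => taylor_two hu.d1 hu.d2 hδ hu.holder (blk Y 0 T1 ω) (blk Y T1 T0 ω))
  have d2 := dom_of_abs_le_blk (m := T1) (n := T0) (T := T0) hr1 hY hl hN0 (by linarith) hKh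
    (by linarith : 0 ≤ 1 + δ)
    (((hu.m2.comp (hx.add hB)).sub (hu.m2.comp hx)).sub (hB.mul (hu.m3.comp hx)))
    (fun ω => taylor_one hu.d2 hδ hu.holder (blk Y 0 T1 ω) (blk Y T1 T0 ω))
  have d3 := dom_of_abs_le_blk (m := T1) (n := T0) (T := T0) hr1 hY hl hN0 (by linarith) hKh hδ
    ((hu.m3.comp (hx.add hB)).sub (hu.m3.comp hx))
    (fun ω => (hu.holder (blk Y 0 T1 ω + blk Y T1 T0 ω) (blk Y 0 T1 ω)).trans
      (by rw [add_sub_cancel_left]))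
  have d4 := dom_of_abs_le_blk (m := T1) (n := k) (T := k) hr1 hY hl hN0 (by linarith) hKh
    (by linarith : 0 ≤ 1 + δ)
    (((hu.m2.comp (hxk.add hAk)).sub (hu.m2.comp hxk)).sub (hAk.mul (hu.m3.comp hxk)))
    (fun ω => taylor_one hu.d2 hδ hu.holder (blk Y 0 T1 ω) (blk Y T1 k ω))
  have d5 := ((Dom.const (P := P) (𝓕 := 𝓕) (T := T0) hc ha hL0.le (by linarith) 1).mul_blk hr1 hc
    hY hl hN0 (m := T1) (n := T0) (by linarith) le_rfl)
  simp only [one_mul, abs_one, zero_add] at d5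
  have e1 := (h1 Y g a L hb hl T0 _ _ _ d1).1 (k + 1) (by linarith) (by omega)
  have e2 := h2 Y cc g a L hY hl T0 T' k N _ _ _ d2 (by linarith) hT1 (hT2.trans hT3) hg1
    (by omega) (by linarith)
  have e3 := h3 Y cc g a L hY hl T0 k N _ _ _ d3 (by linarith) hg (by linarith)
  have e4 := d4.abs_integral_le hc hl.a_le_one hl1 (by linarith) hr1
  have e5 := (h4 Y g a L hb hl T0 _ _ _ d5).1 (k + 1) (by linarith) (by omega)
  rw [← CH_sub_CH hb hY.centered hT hTk] at e5
  have e6 := mul_le_mul e5 e4 (abs_nonneg _) (by positivity)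
  rw [← abs_mul] at e6
  rw [show 2 + δ + 1 = r by rw [hrδ]; ring] at e1
  rw [show 1 + δ + 2 = r by rw [hrδ]; ring] at e2
  rw [show δ + 3 = r by rw [hrδ]; ring] at e3
  have n1 : N ^ (1 + δ) * N = N ^ (2 + δ) := by
    rw [← Real.rpow_add_one hN0.ne']; congr 1; ring
  have n2 : N ^ δ * N ^ 2 = N ^ (2 + δ) := by
    rw [← Real.rpow_add_natCast hN0.ne']; congr 1; push_cast; ring
  have n3 : L ^ (1 + 1 : ℝ) * L ^ (1 + δ) = L ^ r := by
    rw [← Real.rpow_add hL0]; congr 1; rw [hrδ]; ring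
  refine (abs_sub _ _).trans ((add_le_add ((abs_add_three _ _ _).trans
    (add_le_add (add_le_add e1 e2) e3)) e6).trans (le_of_eq ?_))
  rw [← n3]
  calc _ = (K1 * Kh * N ^ (2 + δ) * a + K2 * Kh * (N ^ (1 + δ) * N) * a
        + K3 * Kh * (N ^ δ * N ^ 2) * a
        + K4 * E * Kh * (N ^ (1 + δ) * N) * a) * (L ^ (1 + 1 : ℝ) * L ^ (1 + δ)) := by
        ring
    _ = _ := by rw [n1, n2]; ring

/-- Taylor expansion at the last partial sum. -/
lemma exists_abs_sub_Phi_le (c δ : ℝ) (hδ : 0 ≤ δ) (hc : 0 ≤ c) : ∃ K : ℝ, 0 ≤ K ∧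
    ∀ (Y : ℕ → Ω → ℝ) (cc : ℕ → ℝ) (g : ℕ) (a : ℝ), CovSeq P 𝓕 Y cc →
    Lvl P 𝓕 Y c (3 + δ) g a 1 → ∀ (Kh β1 β2 β3 : ℝ) (u0 u1 u2 u3 : ℝ → ℝ),
    HChain δ Kh β1 β2 β3 u0 u1 u2 u3 → ∀ k : ℕ,
    |∫ ω, u0 (blk Y 0 (k + 1) ω) ∂P - ∫ ω, u0 (blk Y 0 k ω) ∂P - (Phi P Y u1 u2 u3 k k
      + CH P Y k k * ∫ ω, u2 (blk Y 0 k ω) ∂P + KJ P Y k k * ∫ ω, u3 (blk Y 0 k ω) ∂P)|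
    ≤ K * Kh := by
  set r := 3 + δ with hrδ
  refine ⟨(2 * (c + 1)) ^ r * (1 + c), by positivity, ?_⟩
  intro Y cc g a hY hl Kh β1 β2 β3 u0 u1 u2 u3 hu k
  have hb := hY.bdd
  have hy := hb (k + 1)
  have hx := bdd_blk hb 0 k
  have hxk := bdd_blk hb 0 (k + 1)
  have m0 : Measurable u0 := (continuous_iff_continuousAt.mpr fun x =>
    (hu.d0 x).continuousAt).measurable
  have lip : ∀ x, |u0 x| ≤ |u0 0| + β1 * |x| := by
    intro x
    have h1 := Convex.norm_image_sub_le_of_norm_hasDerivWithin_le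
      (f := u0) (f' := u1) (s := univ) (x := 0) (y := x)
      (fun y _ => (hu.d0 y).hasDerivWithinAt) (fun y _ => hu.b1 y) convex_univ trivial trivial
    simp only [Real.norm_eq_abs, sub_zero] at h1
    have h2 := abs_sub_abs_le_abs_sub (u0 x) (u0 0)
    linarith
  have hβ1 : 0 ≤ β1 := (abs_nonneg _).trans (hu.b1 0)
  have bd0 : ∀ {F : Ω → ℝ}, Bdd F → Bdd fun ω => u0 (F ω) := by
    intro F hF
    obtain ⟨hm, C, hC⟩ := hF
    exact ⟨m0.comp hm, |u0 0| + β1 * C, fun ω => (lip _).trans (by gcongr; exact hC ω)⟩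
  have hU0 := bd0 hx
  have hV0 := bd0 hxk
  have hU1 := bdd_comp_blk hb hu.m1 hu.b1 k
  have hU2 := bdd_comp_blk hb hu.m2 hu.b2 k
  have hU3 := bdd_comp_blk hb hu.m3 hu.b3 k
  have eH : Hk Y k k = fun ω => Y (k + 1) ω ^ 2 / 2 := by ext ω; simp [Hk, blk_self]
  have eJ : Jk P Y k k = fun ω => Y (k + 1) ω ^ 3 / 6 := by
    ext ω; simp only [Jk, blk_self]; ring
  have e : ∫ ω, u0 (blk Y 0 (k + 1) ω) ∂P - ∫ ω, u0 (blk Y 0 k ω) ∂P - (Phi P Y u1 u2 u3 k k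
      + CH P Y k k * ∫ ω, u2 (blk Y 0 k ω) ∂P + KJ P Y k k * ∫ ω, u3 (blk Y 0 k ω) ∂P)
      = ∫ ω, (u0 (blk Y 0 (k + 1) ω) - u0 (blk Y 0 k ω) - Y (k + 1) ω * u1 (blk Y 0 k ω)
        - Y (k + 1) ω ^ 2 / 2 * u2 (blk Y 0 k ω) - Y (k + 1) ω ^ 3 / 6 * u3 (blk Y 0 k ω)) ∂P := by
    obtain ⟨U0, u0e⟩ : ∃ U : Ω → ℝ, ∀ ω, u0 (blk Y 0 k ω) = U ω := ⟨_, fun _ => rfl⟩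
    simp only [u0e] at hU0
    obtain ⟨V0, v0e⟩ : ∃ U : Ω → ℝ, ∀ ω, u0 (blk Y 0 (k + 1) ω) = U ω := ⟨_, fun _ => rfl⟩
    simp only [v0e] at hV0
    obtain ⟨U1, u1e⟩ : ∃ U : Ω → ℝ, ∀ ω, u1 (blk Y 0 k ω) = U ω := ⟨_, fun _ => rfl⟩
    simp only [u1e] at hU1
    obtain ⟨U2, u2e⟩ : ∃ U : Ω → ℝ, ∀ ω, u2 (blk Y 0 k ω) = U ω := ⟨_, fun _ => rfl⟩
    simp only [u2e] at hU2
    obtain ⟨U3, u3e⟩ : ∃ U : Ω → ℝ, ∀ ω, u3 (blk Y 0 k ω) = U ω := ⟨_, fun _ => rfl⟩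
    simp only [u3e] at hU3
    simp only [Phi, cv, u0e, v0e, u1e, u2e, u3e]
    simp (disch := fun_prop) only [E_sub]
    simp only [hY.centered, mul_zero, sub_zero, CH, KJ, eH, eJ]
    simp only [mul_comm (U1 _), mul_comm (U2 _), mul_comm (U3 _)]
    ring
  rw [e]
  have hW := inW_blk (m := k) (n := k + 1) hb (by linarith) hl one_pos (by push_cast; linarith)
  simp only [blk_succ_self, div_one] at hW
  have hWb := hW.bdd.rpow hW.nonneg (by linarith : 0 ≤ r)
  have hp : ∀ ω, |u0 (blk Y 0 (k + 1) ω) - u0 (blk Y 0 k ω) - Y (k + 1) ω * u1 (blk Y 0 k ω)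
        - Y (k + 1) ω ^ 2 / 2 * u2 (blk Y 0 k ω) - Y (k + 1) ω ^ 3 / 6 * u3 (blk Y 0 k ω)|
      ≤ Kh * |Y (k + 1) ω| ^ r := by
    intro ω
    have := taylor_three hu.d0 hu.d1 hu.d2 hδ hu.holder (blk Y 0 k ω) (Y (k + 1) ω)
    rwa [show blk Y 0 k ω + Y (k + 1) ω = blk Y 0 (k + 1) ω by
      rw [blk_add (Nat.zero_le k) (Nat.le_succ k), blk_succ_self, add_comm]] at this
  refine (abs_E_le_of_le (by fun_prop) hp).trans ?_
  have := hW.integral_rpow_le hc hl.a_le_one le_rfl (by linarith) le_rfl (by linarith)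
  rw [Real.one_rpow, mul_one] at this
  rw [integral_const_mul, mul_comm]
  exact mul_le_mul_of_nonneg_right this hu.Kh_nonneg

end Step

/-! ### Telescoping over dyadic conditioning times -/

section Telescope

variable {Ω : Type*} [mΩ : MeasurableSpace Ω] (P : Measure Ω) [IsProbabilityMeasure P]
  (𝓕 : Filtration ℕ mΩ)

lemma gap3_dyadic {g k e : ℕ} (hg : g ≤ max 1 (2 ^ e / 4)) (hT : k + 1 - 2 ^ e ≠ 0) :
    Gap3 g k (k + 1 - 2 ^ e) := by
  match e with
  | 0 => exact ⟨k, k, by simp, le_rfl, le_rfl, by simp at hg ⊢; omega, by simp at hg ⊢; omega,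
      by simp at hg ⊢; omega⟩
  | 1 => exact ⟨k, k, by simp, le_rfl, le_rfl, by simp at hg ⊢; omega, by simp at hg ⊢; omega,
      by simp at hg ⊢; omega⟩
  | e + 2 =>
    have h1 : 2 ^ (e + 2) = 4 * 2 ^ e := by ring
    have h2 : 0 < 2 ^ e := by positivity
    have h3 : 2 ^ (e + 2) / 4 = 2 ^ e := by omega
    rw [h3] at hg
    have h4 : max 1 (2 ^ e) = 2 ^ e := max_eq_right h2
    exact ⟨k + 1 - 2 * 2 ^ e, k + 1 - 2 ^ e, by omega, by omega, by omega, by omega, by omega,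
      by omega⟩

lemma exists_abs_KJ_self_le (c r : ℝ) (hr : 3 ≤ r) (hc : 0 ≤ c) : ∃ K : ℝ, 0 ≤ K ∧
    ∀ (Y : ℕ → Ω → ℝ) (g : ℕ) (a : ℝ), (∀ j, Bdd (Y j)) → Lvl P 𝓕 Y c r g a 1 → ∀ k : ℕ,
    |KJ P Y k k| ≤ K := by
  refine ⟨(2 * (c + 1)) ^ r * (1 + c), by positivity, ?_⟩
  intro Y g a hb hl k
  have hy := hb (k + 1)
  have hW := inW_blk (m := k) (n := k + 1) hb (by linarith) hl one_pos (by push_cast; linarith)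
  simp only [blk_succ_self, div_one] at hW
  have h3 := hW.integral_rpow_le hc hl.a_le_one le_rfl (by norm_num) hr (by linarith)
  rw [Real.one_rpow, mul_one] at h3
  refine le_trans ?_ h3
  have e : KJ P Y k k = ∫ ω, Y (k + 1) ω ^ 3 / 6 ∂P := by
    rw [KJ]; congr 1; ext ω; simp only [Jk, blk_self]; ring
  rw [e]
  simp only [Real.rpow_ofNat]
  refine abs_E_le_of_le (by fun_prop) fun ω => ?_
  rw [abs_div, abs_pow, abs_of_pos (by norm_num : (0:ℝ) < 6)]
  exact div_le_self (by positivity) (by norm_num)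

/-- The expansion of one step with conditioning up to distance `2 ^ E`. -/
lemma exists_abs_step_le (c δ : ℝ) (hδ : 0 ≤ δ) (hc : 0 ≤ c) : ∃ K : ℝ, 0 ≤ K ∧
    ∀ (Y : ℕ → Ω → ℝ) (cc : ℕ → ℝ) (g : ℕ → ℕ) (a L : ℕ → ℝ), CovSeq P 𝓕 Y cc →
    (∀ e, Lvl P 𝓕 Y c (3 + δ) (g e) (a e) (L e)) → (∀ e, g e ≤ max 1 (2 ^ e / 4)) → L 0 = 1 →
    ∀ (Kh β1 β2 β3 : ℝ) (u0 u1 u2 u3 : ℝ → ℝ), HChain δ Kh β1 β2 β3 u0 u1 u2 u3 →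
    ∀ (k E : ℕ) (D : ℝ),
    (∀ T ≤ k, k + 1 ≤ T + 2 ^ E → |∫ ω, u3 (blk Y 0 T ω) ∂P| ≤ D) →
    |∫ ω, u0 (blk Y 0 (k + 1) ω) ∂P - ∫ ω, u0 (blk Y 0 k ω) ∂P
      - CH P Y k (k + 1 - 2 ^ E) * ∫ ω, u2 (blk Y 0 k ω) ∂P|
    ≤ K * (Kh * (1 + ∑ e ∈ Finset.range E, ((2:ℝ) ^ e) ^ (2 + δ) * a e * L e ^ (3 + δ))
      + a E * (β1 * L E + β2 * 2 ^ E * L E ^ 2 + β3 * 4 ^ E * L E ^ 3)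
      + (1 + ∑ e ∈ Finset.range E, 4 ^ e * a e * L e ^ 3) * D) := by
  obtain ⟨K1, hK1, h1⟩ := exists_abs_Phi_sub_Phi_le P 𝓕 c δ hδ hc
  obtain ⟨K2, hK2, h2⟩ := exists_abs_Phi_le P 𝓕 c (3 + δ) (by linarith) hc
  obtain ⟨K3, hK3, h3⟩ := exists_abs_KJ_sub_le P 𝓕 c (3 + δ) (by linarith) hc
  obtain ⟨K4, hK4, h4⟩ := exists_abs_sub_Phi_le P 𝓕 c δ hδ hc
  obtain ⟨K5, hK5, h5⟩ := exists_abs_KJ_self_le P 𝓕 c (3 + δ) (by linarith) hc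
  set q : ℝ := 2 ^ (2 + δ) with hq
  have hq0 : 0 ≤ q := by positivity
  refine ⟨K1 * q + K2 + 4 * K3 + K4 + K5, by positivity, ?_⟩
  intro Y cc g a L hY hl hg hL0 Kh β1 β2 β3 u0 u1 u2 u3 hu k E D hD
  have hKh := hu.Kh_nonneg
  have ha := fun e => (hl e).a_nonneg
  have hL := fun e => (zero_le_one.trans (hl e).one_le_L)
  have B1 : 0 ≤ β1 := (abs_nonneg _).trans (hu.b1 0)
  have B2 : 0 ≤ β2 := (abs_nonneg _).trans (hu.b2 0)
  have B3 : 0 ≤ β3 := (abs_nonneg _).trans (hu.b3 0)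
  have hD0 : 0 ≤ D := (abs_nonneg _).trans (hD k le_rfl
    (by have := Nat.one_le_two_pow (n := E); omega))
  set T : ℕ → ℕ := fun e => k + 1 - 2 ^ e with hT
  have hT0 : T 0 = k := by simp [hT]
  have hTk : ∀ e, T e ≤ k := fun e => by
    have := Nat.one_le_two_pow (n := e); simp only [hT]; omega
  have hTN : ∀ e, (k:ℝ) + 1 - T e ≤ 2 ^ e := fun e => by
    have : k + 1 ≤ T e + 2 ^ e := by simp only [hT]; omega
    have : ((k + 1 : ℕ):ℝ) ≤ ((T e + 2 ^ e : ℕ):ℝ) := by exact_mod_cast this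
    push_cast at this; linarith
  have hTs : ∀ e, T (e + 1) ≤ T e := fun e => by
    have := Nat.pow_le_pow_right (n := 2) (by norm_num) (Nat.le_succ e)
    simp only [hT, Nat.succ_eq_add_one] at *; omega
  set U2 := ∫ ω, u2 (blk Y 0 k ω) ∂P with hU2
  -- one dyadic step
  have s1 : ∀ e ∈ Finset.range E,
      |(Phi P Y u1 u2 u3 k (T e) + CH P Y k (T e) * U2)
        - (Phi P Y u1 u2 u3 k (T (e + 1)) + CH P Y k (T (e + 1)) * U2)|
      ≤ K1 * q * Kh * (((2:ℝ) ^ e) ^ (2 + δ) * a e * L e ^ (3 + δ))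
        + 4 * K3 * (4 ^ e * a e * L e ^ 3) * D := by
    intro e he
    have he' := Finset.mem_range.1 he
    have hLp : 0 ≤ L e ^ (3 + δ) := Real.rpow_nonneg (hL e) _
    by_cases hz : T e = 0
    · have hz' : T (e + 1) = 0 := Nat.le_zero.1 (hz ▸ hTs e)
      rw [hz, hz', sub_self, abs_zero]
      have := ha e
      have := hL e
      positivity
    have hgap : Gap3 (g e) k (T e) := gap3_dyadic (hg e) hz
    have hN := hTN (e + 1)
    have t1 := h1 Y cc (g e) (a e) (L e) hY (hl e) Kh β1 β2 β3 u0 u1 u2 u3 hu (T (e + 1)) (T e) k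
      (2 ^ (e + 1)) (hTs e) hgap hN
    have t2 := h3 Y cc (g e) (a e) (L e) hY (hl e) (T (e + 1)) (T e) k (2 ^ (e + 1)) (hTs e)
      hgap hN
    have t3 := hD (T (e + 1)) (hTk _) (by
      have := Nat.pow_le_pow_right (n := 2) (by norm_num) (show e + 1 ≤ E by omega)
      simp only [hT]; omega)
    have t4 := mul_le_mul t2 t3 (abs_nonneg _) ((abs_nonneg _).trans t2)
    rw [← abs_mul] at t4
    have n1 : ((2:ℝ) ^ (e + 1)) ^ (2 + δ) = q * ((2:ℝ) ^ e) ^ (2 + δ) := by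
      rw [pow_succ', Real.mul_rpow (by norm_num) (by positivity)]
    have n2 : ((2:ℝ) ^ (e + 1)) ^ 2 = 4 * 4 ^ e := by
      rw [← pow_mul, mul_comm, pow_mul]; norm_num [pow_succ']
    rw [n1] at t1
    rw [n2] at t4
    have t5 := add_le_add t1 t4
    refine le_trans ?_ (t5.trans (le_of_eq (by ring)))
    refine le_trans (le_of_eq ?_) (abs_add_le _ _)
    congr 1; ring
  have s2 := (Finset.abs_sum_le_sum_abs _ _).trans (Finset.sum_le_sum s1)
  rw [Finset.sum_range_sub' (fun e => Phi P Y u1 u2 u3 k (T e) + CH P Y k (T e) * U2),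
    Finset.sum_add_distrib, ← Finset.mul_sum, ← Finset.sum_mul, ← Finset.mul_sum, hT0] at s2
  -- terminal step
  have s3 : |Phi P Y u1 u2 u3 k (T E)|
      ≤ K2 * (a E * (β1 * L E + β2 * 2 ^ E * L E ^ 2 + β3 * 4 ^ E * L E ^ 3)) := by
    by_cases hz : T E = 0
    · rw [hz, Phi_zero, abs_zero]
      have := ha E
      have := hL E
      positivity
    have := h2 Y cc (g E) (a E) (L E) hY (hl E) δ Kh β1 β2 β3 u0 u1 u2 u3 hu (T E) k (2 ^ E)
      (gap3_dyadic (hg E) hz) (hTN E)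
    rwa [← pow_mul, mul_comm E, pow_mul, mul_assoc, show (2:ℝ) ^ 2 = 4 by norm_num] at this
  have hl0 := hl 0
  rw [hL0] at hl0
  have s4 := h4 Y cc (g 0) (a 0) hY hl0 Kh β1 β2 β3 u0 u1 u2 u3 hu k
  have s5 := mul_le_mul (h5 Y (g 0) (a 0) hY.bdd hl0 k) (hD k le_rfl
    (by have := Nat.one_le_two_pow (n := E); omega)) (abs_nonneg _) hK5
  rw [← abs_mul] at s5
  set S1 := ∑ e ∈ Finset.range E, ((2:ℝ) ^ e) ^ (2 + δ) * a e * L e ^ (3 + δ) with hS1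
  set S2 := ∑ e ∈ Finset.range E, 4 ^ e * a e * L e ^ 3 with hS2
  set A3 := a E * (β1 * L E + β2 * 2 ^ E * L E ^ 2 + β3 * 4 ^ E * L E ^ 3) with hA3
  have p1 : 0 ≤ S1 := Finset.sum_nonneg fun e _ => by
    have := ha e
    have := hL e
    positivity
  have p2 : 0 ≤ S2 := Finset.sum_nonneg fun e _ => by
    have := ha e
    have := hL e
    positivity
  have p3 : 0 ≤ A3 := by
    have := ha E
    have := hL E
    positivity
  set x0 := ∫ ω, u0 (blk Y 0 (k + 1) ω) ∂P - ∫ ω, u0 (blk Y 0 k ω) ∂P with hx0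
  set x1 := Phi P Y u1 u2 u3 k k with hx1
  set x2 := CH P Y k k * U2 with hx2
  set x3 := KJ P Y k k * ∫ ω, u3 (blk Y 0 k ω) ∂P with hx3
  have hid : x0 - CH P Y k (k + 1 - 2 ^ E) * U2 = (x0 - (x1 + x2 + x3))
      + (x1 + x2 - (Phi P Y u1 u2 u3 k (T E) + CH P Y k (T E) * U2)) + (Phi P Y u1 u2 u3 k (T E))
      + x3 := by
    simp only [hT]; ring
  rw [hid]
  refine (abs_add_le _ _).trans ((add_le_add ((abs_add_three _ _ _).trans
    (add_le_add (add_le_add s4 s2) s3)) s5).trans ?_)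
  have q1 := mul_nonneg hKh p1
  have q2 := mul_nonneg p2 hD0
  have r1 : 0 ≤ (K1 * q + K2 + 4 * K3 + K5) * Kh := by positivity
  have r2 : 0 ≤ (K2 + 4 * K3 + K4 + K5) * (Kh * S1) := by positivity
  have r3 : 0 ≤ (K1 * q + 4 * K3 + K4 + K5) * A3 := by positivity
  have r4 : 0 ≤ (K1 * q + K2 + 4 * K3 + K4) * D := by positivity
  have r5 : 0 ≤ (K1 * q + K2 + K4 + K5) * (S2 * D) := by positivity
  linarith

lemma CH_eq {𝓕 : Filtration ℕ mΩ} {Y : ℕ → Ω → ℝ} {cc : ℕ → ℝ} (hY : CovSeq P 𝓕 Y cc) {k T : ℕ}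
    (hT : T ≤ k) : CH P Y k T = cc 0 / 2 + ∑ l ∈ Finset.range (k - T), cc (l + 1) := by
  have hb := hY.bdd
  have h1 := hb (k + 1)
  have h2 := bdd_blk hb T k
  have e1 : ∫ ω, Y (k + 1) ω ^ 2 / 2 ∂P = cc 0 / 2 := by
    rw [integral_div, ← hY.cov (k + 1) 0]; simp only [add_zero, sq]
  have e2 : ∫ ω, Y (k + 1) ω * blk Y T k ω ∂P = ∑ i ∈ Finset.Ico T k, cc (k - i) := by
    simp only [blk, Finset.mul_sum]
    rw [E_sum _ fun i => (h1.mul (hb (i + 1)))]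
    refine Finset.sum_congr rfl fun i hi => ?_
    have hi' := Finset.mem_Ico.1 hi
    rw [← hY.cov (i + 1) (k - i), show i + 1 + (k - i) = k + 1 by omega]
    congr 1; ext ω; ring
  have e3 : ∑ i ∈ Finset.Ico T k, cc (k - i) = ∑ l ∈ Finset.range (k - T), cc (l + 1) := by
    rw [Finset.sum_Ico_eq_sum_range, ← Finset.sum_range_reflect]
    refine Finset.sum_congr rfl fun i hi => ?_
    have hi' := Finset.mem_range.1 hi
    congr 1; omega
  simp only [CH, Hk]
  rw [E_add (by fun_prop) (by fun_prop), e1, e2, e3]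

end Telescope

/-! ### Sums over time -/

lemma rpow_neg_le_sub {s t : ℝ} (hs : 0 < s) (hs1 : s ≤ 1) (ht : 1 ≤ t) :
    t ^ (-(1 + s)) ≤ 2 / s * (t ^ (-s) - (t + 1) ^ (-s)) := by
  have ht0 : 0 < t := by linarith
  have h1 : (1 + -(1 / (t + 1))) ^ s ≤ 1 + s * -(1 / (t + 1)) := by
    refine rpow_one_add_le_one_add_mul_self ?_ hs.le hs1
    have : 1 / (t + 1) ≤ 1 := (div_le_one (by linarith)).2 (by linarith)
    linarith
  have h2 : 1 + -(1 / (t + 1)) = t / (t + 1) := by field_simp; ring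
  rw [h2, Real.div_rpow ht0.le (by linarith)] at h1
  have hp : 0 < t ^ s := Real.rpow_pos_of_pos ht0 s
  have hq : 0 < (t + 1) ^ s := Real.rpow_pos_of_pos (by linarith) s
  rw [Real.rpow_neg ht0.le, Real.rpow_neg ht0.le, Real.rpow_neg (by linarith),
    Real.rpow_add ht0, Real.rpow_one]
  have h3 : (t + 1) ^ s = t ^ s / (t ^ s / (t + 1) ^ s) := by field_simp
  have h4 : (t ^ s)⁻¹ - ((t + 1) ^ s)⁻¹ = (t ^ s)⁻¹ * (1 - t ^ s / (t + 1) ^ s) := by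
    field_simp
  rw [h4, mul_inv]
  have h5 : t⁻¹ ≤ 2 / s * (1 - t ^ s / (t + 1) ^ s) := by
    calc t⁻¹ ≤ 2 / (t + 1) := by
          rw [inv_eq_one_div, div_le_div_iff₀ ht0 (by linarith)]; linarith
      _ = 2 / s * (s * (1 / (t + 1))) := by field_simp
      _ ≤ _ := by gcongr; linarith
  calc t⁻¹ * (t ^ s)⁻¹ = (t ^ s)⁻¹ * t⁻¹ := mul_comm _ _
    _ ≤ (t ^ s)⁻¹ * (2 / s * (1 - t ^ s / (t + 1) ^ s)) := by gcongr
    _ = _ := by ring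

lemma sum_Ico_rpow_neg_le {s : ℝ} (hs : 0 < s) (hs1 : s ≤ 1) {m N : ℕ} (hm : 1 ≤ m) :
    ∑ t ∈ Finset.Ico m N, (t:ℝ) ^ (-(1 + s)) ≤ 2 / s * (m:ℝ) ^ (-s) := by
  rcases le_total m N with h | h
  · have : ∑ t ∈ Finset.Ico m N, (t:ℝ) ^ (-(1 + s))
        ≤ 2 / s * ((m:ℝ) ^ (-s) - (N:ℝ) ^ (-s)) := by
      induction N, h using Nat.le_induction with
      | base => simp
      | succ n hn ih =>
        rw [Finset.sum_Ico_succ_top hn]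
        have := rpow_neg_le_sub hs hs1 (t := n) (by exact_mod_cast hm.trans hn)
        push_cast
        linarith
    refine this.trans ?_
    have : (0:ℝ) ≤ (N:ℝ) ^ (-s) := by positivity
    gcongr
    linarith
  · rw [Finset.Ico_eq_empty_of_le h, Finset.sum_empty]; positivity

lemma sum_Ico_filter_rpow_neg_le {s : ℝ} (hs : 0 < s) (hs1 : s ≤ 1) {x : ℝ} (hx : 1 ≤ x) (N : ℕ) :
    ∑ t ∈ Finset.Ico 1 N, (if x ≤ t then (t:ℝ) ^ (-(1 + s)) else 0) ≤ 2 / s * x ^ (-s) := by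
  rw [← Finset.sum_filter]
  have h0 : 0 < x := by linarith
  have hc : 1 ≤ ⌈x⌉₊ := Nat.one_le_ceil_iff.2 h0
  calc _ ≤ ∑ t ∈ Finset.Ico ⌈x⌉₊ N, (t:ℝ) ^ (-(1 + s)) := by
        refine Finset.sum_le_sum_of_subset_of_nonneg (fun t ht => ?_) fun _ _ _ => by positivity
        obtain ⟨h1, h2⟩ := Finset.mem_filter.1 ht
        exact Finset.mem_Ico.2 ⟨Nat.ceil_le.2 h2, (Finset.mem_Ico.1 h1).2⟩
    _ ≤ 2 / s * (⌈x⌉₊:ℝ) ^ (-s) := sum_Ico_rpow_neg_le hs hs1 hc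
    _ ≤ _ := by
        gcongr ?_ * ?_
        exact Real.rpow_le_rpow_of_nonpos h0 (Nat.le_ceil x) (by linarith)

lemma sum_Ico_filter_inv_sqrt_le (y : ℝ) (hy : 0 ≤ y) (N : ℕ) :
    ∑ t ∈ Finset.Ico 1 N, (if √(t:ℝ) < y then 1 / √(t:ℝ) else 0) ≤ 2 * y := by
  have : ∑ t ∈ Finset.Ico 1 N, (if √(t:ℝ) < y then 1 / √(t:ℝ) else 0)
      ≤ 2 * min y √((N - 1 : ℕ) : ℝ) := by
    induction N with
    | zero => simp [hy]
    | succ n ih =>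
      rcases Nat.eq_zero_or_pos n with rfl | hn
      · simp [hy]
      rw [Finset.sum_Ico_succ_top hn]
      have hn' : (1:ℝ) ≤ n := by exact_mod_cast hn
      have hs : 0 < √(n:ℝ) := by positivity
      have hc : ((n - 1 : ℕ):ℝ) = n - 1 := by push_cast [hn]; ring
      have hle : √(((n - 1 : ℕ)) : ℝ) ≤ √(n:ℝ) := Real.sqrt_le_sqrt (by rw [hc]; linarith)
      simp only [add_tsub_cancel_right]
      split_ifs with h
      · rw [min_eq_right h.le]
        rw [min_eq_right (hle.trans h.le)] at ih
        have h1 : 1 / √(n:ℝ) ≤ 2 * (√(n:ℝ) - √(((n - 1 : ℕ)) : ℝ)) := by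
          rw [div_le_iff₀ hs]
          have e1 := Real.sq_sqrt (by linarith : (0:ℝ) ≤ n)
          have e2 := Real.sq_sqrt (by rw [hc]; linarith : (0:ℝ) ≤ ((n - 1 : ℕ):ℝ))
          nlinarith [sq_nonneg (√(n:ℝ) - √(((n - 1 : ℕ)) : ℝ))]
        linarith
      · rw [add_zero]
        refine ih.trans ?_
        gcongr
  exact this.trans (by gcongr; exact min_le_left _ _)

lemma card_filter_sqrt_lt_le (y : ℝ) (N : ℕ) :
    ∑ t ∈ Finset.Ico 1 N, (if √(t:ℝ) < y then (1:ℝ) else 0) ≤ y ^ 2 := by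
  rw [← Finset.sum_filter, Finset.sum_const, nsmul_eq_mul, mul_one]
  have : ((Finset.Ico 1 N).filter fun t : ℕ => √(t:ℝ) < y) ⊆ Finset.Ioc 0 ⌊y ^ 2⌋₊ := by
    intro t ht
    obtain ⟨h1, h2⟩ := Finset.mem_filter.1 ht
    refine Finset.mem_Ioc.2 ⟨(Finset.mem_Ico.1 h1).1, Nat.le_floor ?_⟩
    exact ((Real.sqrt_lt' (lt_of_le_of_lt (Real.sqrt_nonneg _) h2)).1 h2).le
  have h2 := Finset.card_le_card this
  rw [Nat.card_Ioc, tsub_zero] at h2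
  calc ((((Finset.Ico 1 N).filter fun t : ℕ => √(t:ℝ) < y).card : ℕ) : ℝ)
      ≤ (⌊y ^ 2⌋₊ : ℝ) := by exact_mod_cast h2
    _ ≤ y ^ 2 := Nat.floor_le (by positivity)

/-- Sequences of approximation errors `a e` and truncation levels `L e` at lag `2 ^ e`. -/
structure Scale (a L : ℕ → ℝ) (Cd : ℝ) : Prop where
  a_nonneg : ∀ e, 0 ≤ a e
  L_zero : L 0 = 1
  L_mono : Monotone L
  L_succ : ∀ e, L (e + 1) ≤ Cd * L e
  summable : Summable fun e => 4 ^ e * a e * L e ^ 3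

namespace Scale

variable {a L : ℕ → ℝ} {Cd : ℝ} (h : Scale a L Cd)

include h

lemma one_le_L (e : ℕ) : 1 ≤ L e := h.L_zero ▸ h.L_mono (Nat.zero_le e)

lemma L_pos (e : ℕ) : 0 < L e := zero_lt_one.trans_le (h.one_le_L e)

lemma term_nonneg (e : ℕ) : 0 ≤ 4 ^ e * a e * L e ^ 3 := by
  have := h.a_nonneg e
  have := h.L_pos e
  positivity

lemma two_pow_le (e : ℕ) : 2 ^ e ≤ 2 ^ e * L e :=
  le_mul_of_one_le_right (by positivity) (h.one_le_L e)

lemma mono_mul : Monotone fun e => 2 ^ e * L e := fun i j hij =>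
  mul_le_mul (pow_le_pow_right₀ (by norm_num) hij) (h.L_mono hij) (h.L_pos i).le (by positivity)

lemma exists_lt (t : ℕ) : ∃ e ≤ t, √(t:ℝ) < 2 ^ e * L e := by
  refine ⟨t, le_rfl, lt_of_lt_of_le ?_ (h.two_pow_le t)⟩
  rw [Real.sqrt_lt' (by positivity)]
  have h1 : (t:ℝ) < 2 ^ t := by exact_mod_cast Nat.lt_two_pow_self
  have h2 : (1:ℝ) ≤ 2 ^ t := one_le_pow₀ (by norm_num)
  nlinarith

/-- For each time there is a scale at which `2 ^ e * L e` is comparable to its square root. -/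
lemma exists_index : ∃ E : ℕ → ℕ, (∀ t, E t ≤ t) ∧ (∀ t : ℕ, √(t:ℝ) < 2 ^ E t * L (E t)) ∧
    (∀ t e : ℕ, e < E t → 2 ^ e * L e ≤ √(t:ℝ)) ∧
    (∀ t : ℕ, 1 ≤ t → 2 ^ E t * L (E t) ≤ 2 * Cd * √(t:ℝ)) ∧
    ∀ t : ℕ, 1 ≤ t → (2:ℝ) ^ E t ≤ 2 * √(t:ℝ) := by
  classical
  have hex : ∀ t : ℕ, ∃ e, √(t:ℝ) < 2 ^ e * L e := fun t => by
    obtain ⟨e, -, he⟩ := h.exists_lt t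
    exact ⟨e, he⟩
  have hlt : ∀ t e : ℕ, e < Nat.find (hex t) → 2 ^ e * L e ≤ √(t:ℝ) := fun t e he =>
    not_lt.1 (Nat.find_min (hex t) he)
  have hpos : ∀ t : ℕ, 1 ≤ t → ∃ j, Nat.find (hex t) = j + 1 := by
    intro t ht
    refine Nat.exists_eq_succ_of_ne_zero fun h0 => ?_
    have := Nat.find_spec (hex t)
    rw [h0, pow_zero, one_mul, h.L_zero] at this
    have h2 : 1 ≤ √(t:ℝ) := Real.one_le_sqrt.2 (by exact_mod_cast ht)
    linarith
  have hCd : 0 ≤ Cd := by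
    have h1 := h.L_succ 0
    have h2 := h.one_le_L (0 + 1)
    rw [h.L_zero] at h1
    linarith
  refine ⟨fun t => Nat.find (hex t), fun t => ?_, fun t => Nat.find_spec (hex t), hlt, ?_, ?_⟩
  · obtain ⟨e, het, he⟩ := h.exists_lt t
    exact (Nat.find_min' (hex t) he).trans het
  · intro t ht
    obtain ⟨j, hj⟩ := hpos t ht
    have h1 := hlt t j (by omega)
    simp only [hj]
    calc 2 ^ (j + 1) * L (j + 1) ≤ 2 ^ (j + 1) * (Cd * L j) := by gcongr; exact h.L_succ j
      _ = 2 * Cd * (2 ^ j * L j) := by ring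
      _ ≤ _ := by gcongr
  · intro t ht
    obtain ⟨j, hj⟩ := hpos t ht
    have h1 := (h.two_pow_le j).trans (hlt t j (by omega))
    simp only [hj, pow_succ]
    linarith

lemma sum_le_tsum_of_term {x : ℕ → ℝ} {C : ℝ} (hC : 0 ≤ C)
    (hx : ∀ e, x e ≤ C * (4 ^ e * a e * L e ^ 3)) (s : Finset ℕ) :
    ∑ e ∈ s, x e ≤ C * ∑' e, 4 ^ e * a e * L e ^ 3 := by
  refine (Finset.sum_le_sum fun e _ => hx e).trans ?_
  rw [← Finset.mul_sum]
  gcongr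
  exact h.summable.sum_le_tsum s fun e _ => h.term_nonneg e

/-- Summation of the local Taylor remainders. -/
lemma sum_remainder_le {δ : ℝ} (hδ : 0 < δ) (hδ1 : δ ≤ 1) {E : ℕ → ℕ} (hE : ∀ t, E t ≤ t)
    (hlt : ∀ t e : ℕ, e < E t → 2 ^ e * L e ≤ √(t:ℝ)) (N : ℕ) :
    ∑ t ∈ Finset.Ico 1 N, (t:ℝ) ^ (-(1 + δ / 2)) *
        ∑ e ∈ Finset.range (E t), ((2:ℝ) ^ e) ^ (2 + δ) * a e * L e ^ (3 + δ)
      ≤ 4 / δ * ∑' e, 4 ^ e * a e * L e ^ 3 := by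
  have hw : ∀ e, 0 ≤ ((2:ℝ) ^ e) ^ (2 + δ) * a e * L e ^ (3 + δ) := fun e => by
    have := h.a_nonneg e
    have := h.L_pos e
    positivity
  have h1 : ∀ t ∈ Finset.Ico 1 N, (t:ℝ) ^ (-(1 + δ / 2)) *
        ∑ e ∈ Finset.range (E t), ((2:ℝ) ^ e) ^ (2 + δ) * a e * L e ^ (3 + δ)
      ≤ ∑ e ∈ Finset.range N, ((2:ℝ) ^ e) ^ (2 + δ) * a e * L e ^ (3 + δ) *
        (if (2 ^ e * L e) ^ 2 ≤ (t:ℝ) then (t:ℝ) ^ (-(1 + δ / 2)) else 0) := by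
    intro t ht
    have htN := (Finset.mem_Ico.1 ht).2
    rw [Finset.mul_sum]
    calc _ ≤ ∑ e ∈ Finset.range (E t), ((2:ℝ) ^ e) ^ (2 + δ) * a e * L e ^ (3 + δ) *
        (if (2 ^ e * L e) ^ 2 ≤ (t:ℝ) then (t:ℝ) ^ (-(1 + δ / 2)) else 0) := by
          refine Finset.sum_le_sum fun e he => ?_
          have := hlt t e (Finset.mem_range.1 he)
          have h2 : (2 ^ e * L e) ^ 2 ≤ (t:ℝ) :=
            (Real.le_sqrt (by have := h.L_pos e; positivity) (by positivity)).1 this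
          rw [if_pos h2, mul_comm]
      _ ≤ _ := by
          refine Finset.sum_le_sum_of_subset_of_nonneg
            (Finset.range_subset_range.2 ((hE t).trans htN.le)) fun e _ _ => ?_
          have := hw e
          split_ifs <;> positivity
  refine (Finset.sum_le_sum h1).trans ?_
  rw [Finset.sum_comm]
  refine h.sum_le_tsum_of_term (by positivity) (fun e => ?_) _
  rw [← Finset.mul_sum]
  have hLe := h.L_pos e
  have hx1 : 1 ≤ (2 ^ e * L e) ^ 2 :=
    one_le_pow₀ ((one_le_pow₀ (by norm_num)).trans (h.two_pow_le e))
  have h2 := sum_Ico_filter_rpow_neg_le (s := δ / 2) (by positivity) (by linarith) hx1 N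
  refine (mul_le_mul_of_nonneg_left h2 (hw e)).trans (le_of_eq ?_)
  have h3 : ((2 ^ e * L e) ^ 2) ^ (-(δ / 2)) = ((2:ℝ) ^ e) ^ (-δ) * L e ^ (-δ) := by
    rw [← Real.rpow_natCast, ← Real.rpow_mul (by positivity),
      Real.mul_rpow (by positivity) hLe.le]
    congr 2 <;> push_cast <;> ring
  have h4 : ((2:ℝ) ^ e) ^ (2 + δ) * ((2:ℝ) ^ e) ^ (-δ) = 4 ^ e := by
    rw [← Real.rpow_add (by positivity), show 2 + δ + -δ = 2 by ring, Real.rpow_ofNat, ← pow_mul,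
      mul_comm, pow_mul]
    norm_num
  have h5 : L e ^ (3 + δ) * L e ^ (-δ) = L e ^ 3 := by
    rw [← Real.rpow_add hLe, show 3 + δ + -δ = 3 by ring, Real.rpow_ofNat]
  rw [h3]
  calc _ = 2 / (δ / 2) * ((((2:ℝ) ^ e) ^ (2 + δ) * ((2:ℝ) ^ e) ^ (-δ)) * a e
        * (L e ^ (3 + δ) * L e ^ (-δ))) := by ring
    _ = _ := by rw [h4, h5]; field_simp; ring

/-- Summation of the terminal correlations. -/
lemma sum_terminal_le {E : ℕ → ℕ} (hE : ∀ t, E t ≤ t)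
    (hgt : ∀ t : ℕ, √(t:ℝ) < 2 ^ E t * L (E t)) (N : ℕ) :
    ∑ t ∈ Finset.Ico 1 N, a (E t) * L (E t) ≤ ∑' e, 4 ^ e * a e * L e ^ 3 := by
  have h1 : ∀ t ∈ Finset.Ico 1 N, a (E t) * L (E t) ≤ ∑ e ∈ Finset.range N,
      a e * L e * (if √(t:ℝ) < 2 ^ e * L e then 1 else 0) := by
    intro t ht
    have htN := (Finset.mem_Ico.1 ht).2
    have hm : E t ∈ Finset.range N := Finset.mem_range.2 ((hE t).trans_lt htN)
    refine le_trans (le_of_eq ?_) (Finset.single_le_sum (fun e _ => ?_) hm)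
    · rw [if_pos (hgt t), mul_one]
    · have := h.a_nonneg e
      have := h.L_pos e
      split_ifs <;> positivity
  refine (Finset.sum_le_sum h1).trans ?_
  rw [Finset.sum_comm]
  rw [← one_mul (∑' e, 4 ^ e * a e * L e ^ 3)]
  refine h.sum_le_tsum_of_term zero_le_one (fun e => ?_) _
  rw [← Finset.mul_sum]
  have ha := h.a_nonneg e
  have hLe := h.L_pos e
  refine (mul_le_mul_of_nonneg_left (card_filter_sqrt_lt_le (2 ^ e * L e) N)
    (by positivity)).trans (le_of_eq ?_)
  rw [mul_pow, ← pow_mul, mul_comm e, pow_mul]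
  norm_num
  ring

lemma summable_two_pow : Summable fun e => 2 ^ e * a e * L e ^ 2 := by
  refine Summable.of_nonneg_of_le (fun e => ?_) (fun e => ?_) h.summable
  · have := h.a_nonneg e
    positivity
  · have := h.a_nonneg e
    have := h.one_le_L e
    gcongr <;> norm_num

/-- Summation of the covariance tails. -/
lemma sum_tail_le {E : ℕ → ℕ} (hgt : ∀ t : ℕ, √(t:ℝ) < 2 ^ E t * L (E t)) (N : ℕ) :
    ∑ t ∈ Finset.Ico 1 N, 1 / √(t:ℝ) * (∑' e, if E t ≤ e then 2 ^ e * a e * L e ^ 2 else 0)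
      ≤ 2 * ∑' e, 4 ^ e * a e * L e ^ 3 := by
  have hw : ∀ e, 0 ≤ 2 ^ e * a e * L e ^ 2 := fun e => by
    have := h.a_nonneg e
    positivity
  have hs : ∀ t, Summable fun e => if E t ≤ e then 2 ^ e * a e * L e ^ 2 else 0 := fun t =>
    Summable.of_nonneg_of_le (fun e => by split_ifs <;> simp [hw e])
      (fun e => by split_ifs <;> simp [hw e]) h.summable_two_pow
  simp only [← tsum_mul_left]
  rw [← Summable.tsum_finsetSum fun t _ => (hs t).mul_left _]
  have hterm : ∀ e, ∑ t ∈ Finset.Ico 1 N, 1 / √(t:ℝ) *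
      (if E t ≤ e then 2 ^ e * a e * L e ^ 2 else 0) ≤ 2 * (4 ^ e * a e * L e ^ 3) := by
    intro e
    have h1 : ∀ t ∈ Finset.Ico 1 N, 1 / √(t:ℝ) * (if E t ≤ e then 2 ^ e * a e * L e ^ 2 else 0)
        ≤ 2 ^ e * a e * L e ^ 2 * (if √(t:ℝ) < 2 ^ e * L e then 1 / √(t:ℝ) else 0) := by
      intro t _
      by_cases hc : E t ≤ e
      · rw [if_pos hc, if_pos ((hgt t).trans_le (h.mono_mul hc)), mul_comm]
      · rw [if_neg hc, mul_zero]
        have := hw e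
        split_ifs <;> positivity
    refine (Finset.sum_le_sum h1).trans ?_
    rw [← Finset.mul_sum]
    have hLe := h.L_pos e
    refine (mul_le_mul_of_nonneg_left (sum_Ico_filter_inv_sqrt_le (2 ^ e * L e) (by positivity) N)
      (hw e)).trans (le_of_eq ?_)
    rw [show (4:ℝ) ^ e = 2 ^ e * 2 ^ e by rw [← mul_pow]; norm_num]
    ring
  have hsum := summable_sum fun t (_ : t ∈ Finset.Ico 1 N) => (hs t).mul_left (1 / √(t:ℝ))
  exact hsum.tsum_le_tsum hterm (h.summable.mul_left 2)

end Scale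

/-! ### Tails of the covariances -/

namespace Scale

variable {a L : ℕ → ℝ} {Cd : ℝ} (h : Scale a L Cd) {x : ℕ → ℝ} {Q : ℝ} (hx0 : ∀ l, 0 ≤ x l)
  (hQ : 0 ≤ Q)
  (hx : ∀ e l : ℕ, 2 ^ e ≤ l + 1 → l + 1 < 2 ^ (e + 1) → x l ≤ Q * (a e * L e ^ 2))

include hx in
lemma sum_block_le (e : ℕ) :
    ∑ l ∈ Finset.Ico (2 ^ e - 1) (2 ^ (e + 1) - 1), x l ≤ Q * (2 ^ e * a e * L e ^ 2) := by
  have hp : 1 ≤ 2 ^ e := Nat.one_le_two_pow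
  have h1 := Finset.sum_le_card_nsmul (Finset.Ico (2 ^ e - 1) (2 ^ (e + 1) - 1)) x
    (Q * (a e * L e ^ 2)) fun l hl => by
      obtain ⟨h1, h2⟩ := Finset.mem_Ico.1 hl
      exact hx e l (by omega) (by omega)
  rw [Nat.card_Ico, show 2 ^ (e + 1) - 1 - (2 ^ e - 1) = 2 ^ e by rw [pow_succ]; omega,
    nsmul_eq_mul] at h1
  push_cast at h1
  exact h1.trans (le_of_eq (by ring))

include h hx hQ in
lemma sum_block_mul_le (e : ℕ) :
    ∑ l ∈ Finset.Ico (2 ^ e - 1 : ℕ) (2 ^ (e + 1) - 1), ((l:ℝ) + 1) * x l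
      ≤ 2 * Q * (4 ^ e * a e * L e ^ 3) := by
  have hp : 1 ≤ 2 ^ e := Nat.one_le_two_pow
  have ha := h.a_nonneg e
  have hL1 := h.one_le_L e
  have h1 := Finset.sum_le_card_nsmul (Finset.Ico (2 ^ e - 1) (2 ^ (e + 1) - 1))
    (fun l : ℕ => ((l:ℝ) + 1) * x l) (2 ^ (e + 1) * (Q * (a e * L e ^ 2))) fun l hl => by
      obtain ⟨h1, h2⟩ := Finset.mem_Ico.1 hl
      have h3 : ((l + 1 : ℕ):ℝ) ≤ ((2 ^ (e + 1) : ℕ):ℝ) := by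
        exact_mod_cast (by omega : l + 1 ≤ 2 ^ (e + 1))
      push_cast at h3
      exact (mul_le_mul_of_nonneg_left (hx e l (by omega) (by omega)) (by positivity)).trans
        (mul_le_mul_of_nonneg_right h3 (by positivity))
  rw [Nat.card_Ico, show 2 ^ (e + 1) - 1 - (2 ^ e - 1) = 2 ^ e by rw [pow_succ]; omega,
    nsmul_eq_mul] at h1
  push_cast at h1
  calc _ ≤ _ := h1
    _ = 2 * Q * (2 ^ e * 2 ^ e * a e * L e ^ 2) := by ring
    _ = 2 * Q * (4 ^ e * a e * L e ^ 2) := by rw [← mul_pow]; norm_num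
    _ ≤ _ := by gcongr; norm_num

include h hx0 hx hQ in
lemma sum_range_mul_le (n : ℕ) : ∑ l ∈ Finset.range n, ((l:ℝ) + 1) * x l
    ≤ 2 * Q * ∑' e, 4 ^ e * a e * L e ^ 3 := by
  have h1 : ∀ J : ℕ, ∑ l ∈ Finset.range (2 ^ J - 1), ((l:ℝ) + 1) * x l
      ≤ ∑ e ∈ Finset.range J, 2 * Q * (4 ^ e * a e * L e ^ 3) := by
    intro J
    induction J with
    | zero => simp
    | succ J ih =>
      have hle : 2 ^ J - 1 ≤ 2 ^ (J + 1) - 1 :=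
        Nat.sub_le_sub_right (Nat.pow_le_pow_right (by norm_num) (Nat.le_succ J)) 1
      rw [← Finset.sum_range_add_sum_Ico _ hle, Finset.sum_range_succ]
      exact add_le_add ih (h.sum_block_mul_le hQ hx J)
  have h2 : n ≤ 2 ^ n - 1 := by have := Nat.lt_two_pow_self (n := n); omega
  refine le_trans ?_ ((h1 n).trans (h.sum_le_tsum_of_term (by positivity) (fun e => le_rfl) _))
  exact Finset.sum_le_sum_of_subset_of_nonneg (Finset.range_subset_range.2 h2) fun l _ _ => by
    have := hx0 l
    positivity

include h hx0 hx hQ in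
lemma summable_mul : Summable fun l : ℕ => ((l:ℝ) + 1) * x l :=
  summable_of_sum_range_le (fun l => mul_nonneg (by positivity) (hx0 l))
    (h.sum_range_mul_le hx0 hQ hx)

include h hx0 hx hQ in
lemma summable_of_block : Summable x :=
  Summable.of_nonneg_of_le hx0 (fun l => le_mul_of_one_le_left (hx0 l) (by simp))
    (h.summable_mul hx0 hQ hx)

include h hx0 hx hQ in
lemma sum_shifted_tsum_le (N : ℕ) : ∑ k ∈ Finset.range N, ∑' l, x (l + k)
    ≤ 2 * Q * ∑' e, 4 ^ e * a e * L e ^ 3 := by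
  have hs := h.summable_of_block hx0 hQ hx
  have hsm := h.summable_mul hx0 hQ hx
  have hsk : ∀ k, Summable fun l => x (l + k) := fun k => (summable_nat_add_iff k).2 hs
  have h1 : ∑ k ∈ Finset.range N, ∑' l, x (l + k)
      = ∑ l ∈ Finset.range N, ((l:ℝ) + 1) * x l + N * ∑' l, x (l + N) := by
    induction N with
    | zero => simp
    | succ N ih =>
      have e : ∑' l, x (l + N) = x N + ∑' l, x (l + (N + 1)) := by
        rw [(hsk N).tsum_eq_zero_add, zero_add]
        simp only [add_assoc, add_comm 1 N]
      rw [Finset.sum_range_succ, ih, Finset.sum_range_succ, e]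
      push_cast
      ring
  have h2 : N * ∑' l, x (l + N) ≤ ∑' l : ℕ, (((l + N : ℕ):ℝ) + 1) * x (l + N) := by
    rw [← tsum_mul_left]
    refine ((hsk N).mul_left _).tsum_le_tsum (fun l => ?_) ((summable_nat_add_iff N).2 hsm)
    have := hx0 (l + N)
    gcongr
    push_cast
    have : (0:ℝ) ≤ l := by positivity
    linarith
  rw [h1]
  refine (add_le_add_right h2 _).trans ?_
  rw [hsm.sum_add_tsum_nat_add N]
  exact hsm.tsum_le_of_sum_range_le (h.sum_range_mul_le hx0 hQ hx)

include h hx0 hx hQ in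
lemma tail_le (j : ℕ) : ∑' l, x (l + (2 ^ j - 1))
    ≤ Q * ∑' e, if j ≤ e then 2 ^ e * a e * L e ^ 2 else 0 := by
  have hs := h.summable_of_block hx0 hQ hx
  have hw : ∀ e, 0 ≤ 2 ^ e * a e * L e ^ 2 := fun e => by
    have := h.a_nonneg e
    positivity
  have hsj : Summable fun e => if j ≤ e then 2 ^ e * a e * L e ^ 2 else 0 :=
    Summable.of_nonneg_of_le (fun e => by split_ifs <;> simp [hw e])
      (fun e => by split_ifs <;> simp [hw e]) h.summable_two_pow
  have h1 : ∀ J : ℕ, ∑ l ∈ Finset.Ico (2 ^ j - 1) (2 ^ (j + J) - 1), x l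
      ≤ Q * ∑ e ∈ Finset.range (j + J), if j ≤ e then 2 ^ e * a e * L e ^ 2 else 0 := by
    intro J
    induction J with
    | zero =>
      simp only [add_zero, Finset.Ico_self, Finset.sum_empty]
      refine mul_nonneg hQ (Finset.sum_nonneg fun e _ => ?_)
      split_ifs <;> simp [hw e]
    | succ J ih =>
      have hle : 2 ^ j - 1 ≤ 2 ^ (j + J) - 1 :=
        Nat.sub_le_sub_right (Nat.pow_le_pow_right (by norm_num) (by omega)) 1
      have hle' : 2 ^ (j + J) - 1 ≤ 2 ^ (j + J + 1) - 1 :=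
        Nat.sub_le_sub_right (Nat.pow_le_pow_right (by norm_num) (by omega)) 1
      rw [← add_assoc, ← Finset.sum_Ico_consecutive _ hle hle', Finset.sum_range_succ, mul_add,
        if_pos (by omega)]
      exact add_le_add ih (sum_block_le hx (j + J))
  have hsk : Summable fun l => x (l + (2 ^ j - 1)) := (summable_nat_add_iff _).2 hs
  refine hsk.tsum_le_of_sum_range_le fun n => ?_
  calc ∑ l ∈ Finset.range n, x (l + (2 ^ j - 1))
      = ∑ l ∈ Finset.Ico (2 ^ j - 1) (2 ^ j - 1 + n), x l := by
        rw [Finset.sum_Ico_eq_sum_range, add_tsub_cancel_left]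
        simp only [add_comm]
    _ ≤ ∑ l ∈ Finset.Ico (2 ^ j - 1) (2 ^ (j + n) - 1), x l := by
        refine Finset.sum_le_sum_of_subset_of_nonneg (Finset.Ico_subset_Ico le_rfl ?_)
          fun l _ _ => hx0 l
        have h2 : 1 ≤ 2 ^ j := Nat.one_le_two_pow
        have h3 : n + 1 ≤ 2 ^ n := Nat.lt_two_pow_self
        have h4 : 2 ^ j * (n + 1) ≤ 2 ^ j * 2 ^ n := Nat.mul_le_mul_left _ h3
        have h5 : 2 ^ (j + n) = 2 ^ j * 2 ^ n := pow_add 2 j n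
        have h6 : n ≤ 2 ^ j * n := Nat.le_mul_of_pos_left n h2
        rw [mul_add, mul_one] at h4
        omega
    _ ≤ _ := (h1 n).trans (mul_le_mul_of_nonneg_left
        (hsj.sum_le_tsum _ fun e _ => by split_ifs <;> simp [hw e]) hQ)

end Scale

section Cov

variable {Ω : Type*} [mΩ : MeasurableSpace Ω] (P : Measure Ω) [IsProbabilityMeasure P]
  (𝓕 : Filtration ℕ mΩ)

lemma exists_abs_cov_le (c r : ℝ) (hr : 2 ≤ r) (hc : 0 ≤ c) : ∃ K : ℝ, 0 ≤ K ∧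
    ∀ (Y : ℕ → Ω → ℝ) (cc : ℕ → ℝ) (g : ℕ) (a L : ℝ), CovSeq P 𝓕 Y cc →
    Lvl P 𝓕 Y c r g a L → ∀ l : ℕ, g ≤ l → |cc l| ≤ K * (a * L ^ 2) := by
  have hr1 : 1 ≤ r := by linarith
  obtain ⟨K, hK, h1⟩ := exists_abs_cv_le_of_dom P 𝓕 (2 ^ r * (c + c)) c r hr1
  refine ⟨K, hK, ?_⟩
  intro Y cc g a L hY hl l hgl
  have hl1 := hl.one_le_L
  have d := (Dom.const (P := P) (𝓕 := 𝓕) (T := 0 + 1) hc hl.a_nonneg (by linarith) (by linarith)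
    1).mul_blk hr1 hc hY hl one_pos (m := 0) (n := 0 + 1) (by push_cast; linarith) le_rfl
  simp only [blk_succ_self, one_mul, abs_one, mul_one, zero_add] at d
  have e := (h1 Y g a L hY.bdd hl 1 _ _ _ d).1 (1 + l) (by linarith) (by omega)
  have ec : cv P (fun ω => Y 1 ω) (Y (1 + l)) = cc l := by
    rw [cv, hY.centered, zero_mul, hY.cov, sub_zero]
  rw [ec, show (1:ℝ) + 1 = 2 by norm_num, Real.rpow_ofNat] at e
  linarith

lemma exists_abs_cov_block_le (c r : ℝ) (hr : 2 ≤ r) (hc : 0 ≤ c) : ∃ K : ℝ, 0 ≤ K ∧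
    ∀ (Y : ℕ → Ω → ℝ) (cc : ℕ → ℝ) (g : ℕ → ℕ) (a L : ℕ → ℝ), CovSeq P 𝓕 Y cc →
    (∀ e, Lvl P 𝓕 Y c r (g e) (a e) (L e)) → (∀ e, g e ≤ max 1 (2 ^ e / 4)) → ∀ e l : ℕ,
    2 ^ e ≤ l + 1 → l + 1 < 2 ^ (e + 1) → |cc (l + 1)| ≤ K * (a e * L e ^ 2) := by
  obtain ⟨K, hK, h1⟩ := exists_abs_cov_le P 𝓕 c r hr hc
  refine ⟨K, hK, ?_⟩
  intro Y cc g a L hY hl hg e l h2 _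
  refine h1 Y cc (g e) (a e) (L e) hY (hl e) (l + 1) ((hg e).trans (max_le (by omega) ?_))
  exact (Nat.div_le_self _ _).trans h2

end Cov

/-! ### Comparison with the Gaussian law -/

section Lindeberg

variable {Ω : Type*} [mΩ : MeasurableSpace Ω] (P : Measure Ω) [IsProbabilityMeasure P]
  (𝓕 : Filtration ℕ mΩ)

/-- Uniform bound `W` for the distance between the law of `blk Y 0 T` and the Gaussian law of
variance `T`, tested on Lipschitz functions. -/
def GaussClose (Y : ℕ → Ω → ℝ) (W : ℝ) (T : ℕ) : Prop :=
  ∀ h : ℝ → ℝ, (∀ x y, |h x - h y| ≤ |x - y|) →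
    |∫ ω, h (blk Y 0 T ω) ∂P - gsm (T : ℝ≥0) h 0| ≤ W

variable {P} in
omit [IsProbabilityMeasure P] in
lemma abs_integral_third_le {Y : ℕ → Ω → ℝ} {W : ℝ} {T t : ℕ} (ht : 1 ≤ t)
    (hW : GaussClose P Y W T) {h : ℝ → ℝ} (hl : ∀ x y, |h x - h y| ≤ |x - y|)
    {u1 u2 u3 : ℝ → ℝ} (hu : SmoothChain (t : ℝ≥0) (gsm (t : ℝ≥0) h) u1 u2 u3) :
    |∫ ω, u3 (blk Y 0 T ω) ∂P| ≤ 8 / (t * √t) * W + 4 / ((t:ℝ) + T) := by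
  have ht0 : (0:ℝ) < t := by exact_mod_cast ht
  set b : ℝ := 8 / (t * √t) with hb
  have hb0 : 0 < b := by positivity
  have h1 := hW (fun x => u3 x / b) fun x y => by
    rw [← sub_div, abs_div, abs_of_pos hb0, div_le_iff₀ hb0, mul_comm]
    simpa using hu.l3 x y
  have h2 := abs_gsm_third_le (w := (T : ℝ≥0)) (by exact_mod_cast (by omega : t ≠ 0)) hl hu 0
  have h3 : gsm (T : ℝ≥0) (fun x => u3 x / b) 0 = gsm (T : ℝ≥0) u3 0 / b := by
    simp only [gsm, integral_div]
  rw [integral_div, h3, ← sub_div, abs_div, abs_of_pos hb0, div_le_iff₀ hb0] at h1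
  simp only [NNReal.coe_natCast] at h2
  have h4 := abs_sub_abs_le_abs_sub (∫ ω, u3 (blk Y 0 T ω) ∂P) (gsm (T : ℝ≥0) u3 0)
  linarith

lemma exists_abs_lindeberg_step_le (c δ : ℝ) (hδ : 0 ≤ δ) (hδ1 : δ ≤ 1) (hc : 0 ≤ c) :
    ∃ K : ℝ, 0 ≤ K ∧ ∀ (Y : ℕ → Ω → ℝ) (cc : ℕ → ℝ) (g : ℕ → ℕ) (a L : ℕ → ℝ), CovSeq P 𝓕 Y cc →
    (∀ e, Lvl P 𝓕 Y c (3 + δ) (g e) (a e) (L e)) → (∀ e, g e ≤ max 1 (2 ^ e / 4)) → L 0 = 1 →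
    ∀ h : ℝ → ℝ, (∀ x y, |h x - h y| ≤ |x - y|) → ∀ (t k E : ℕ) (W m : ℝ), 1 ≤ t → 0 < m →
    (∀ T ≤ k, k + 1 ≤ T + 2 ^ E → m ≤ (t:ℝ) + T) → (∀ T ≤ k, GaussClose P Y W T) →
    |∫ ω, gsm (t : ℝ≥0) h (blk Y 0 (k + 1) ω) ∂P
        - ∫ ω, gsm ((t + 1 : ℕ) : ℝ≥0) h (blk Y 0 k ω) ∂P|
    ≤ K * (8 * (t:ℝ) ^ (-(1 + δ / 2))
          * (1 + ∑ e ∈ Finset.range E, ((2:ℝ) ^ e) ^ (2 + δ) * a e * L e ^ (3 + δ))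
        + a E * (1 * L E + 2 / √t * 2 ^ E * L E ^ 2 + 4 / t * 4 ^ E * L E ^ 3)
        + (1 + ∑ e ∈ Finset.range E, 4 ^ e * a e * L e ^ 3) * (8 / (t * √t) * W + 4 / m))
      + |CH P Y k (k + 1 - 2 ^ E) - 1 / 2| * (2 / √t) + 8 * gaussM4 / (t * √t) := by
  obtain ⟨K, hK, h1⟩ := exists_abs_step_le P 𝓕 c δ hδ hc
  refine ⟨K, hK, ?_⟩
  intro Y cc g a L hY hl hg hL0 h hh t k E W m ht hm hmT hW
  have ht0 : (0:ℝ) < t := by exact_mod_cast ht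
  obtain ⟨u1, u2, u3, hu⟩ := exists_smoothChain (v := (t : ℝ≥0))
    (by exact_mod_cast (by omega : t ≠ 0)) hh
  obtain ⟨m1, m2, m3⟩ := hu.measurable3
  have hg' := gsm_lipschitz (v := (t : ℝ≥0)) hh
  have hb := bdd_blk hY.bdd 0 k
  have b0 := hb.comp_lipschitz (measurable_of_lipschitz hg') hg'
  have b2 := hb.comp m2 hu.b2
  have hgg := gsm_lipschitz (v := ((t + 1 : ℕ) : ℝ≥0)) hh
  have b1 := hb.comp_lipschitz (measurable_of_lipschitz hgg) hgg
  have hch : HChain δ (8 * (t:ℝ) ^ (-(1 + δ / 2))) 1 (2 / √t) (4 / t) (gsm (t : ℝ≥0) h) u1 u2 u3 :=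
    ⟨hu.d0, hu.d1, hu.d2, m1, m2, m3, hu.b1, by simpa using hu.b2, by simpa using hu.b3,
      by simpa using hu.holder (by simpa using ht0) hδ hδ1, by positivity⟩
  have e1 := h1 Y cc g a L hY hl hg hL0 _ _ _ _ _ _ _ _ hch k E (8 / (t * √t) * W + 4 / m)
    fun T hT hT' => (abs_integral_third_le ht (hW T hT) hh hu).trans (by
      have := hmT T hT hT'
      gcongr)
  have e2 : |∫ ω, gsm ((t + 1 : ℕ) : ℝ≥0) h (blk Y 0 k ω) ∂P
      - ∫ ω, gsm (t : ℝ≥0) h (blk Y 0 k ω) ∂P - 1 / 2 * ∫ ω, u2 (blk Y 0 k ω) ∂P|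
      ≤ 8 * gaussM4 / (t * √t) := by
    rw [← E_sub b1 b0, ← integral_const_mul, ← E_sub (b1.sub b0) ((Bdd.const _).mul b2)]
    refine E_le_of_abs_le fun ω => ?_
    have e3 := hu.heat (by simpa using ht0) (w := 1) (blk Y 0 k ω)
    rw [gsm_gsm hh, show (1 : ℝ≥0) + t = ((t + 1 : ℕ) : ℝ≥0) by push_cast; ring] at e3
    simpa using e3
  have e4 : |∫ ω, u2 (blk Y 0 k ω) ∂P| ≤ 2 / √t := E_le_of_abs_le fun ω => by
    simpa using hu.b2 (blk Y 0 k ω)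
  have e5 : |(CH P Y k (k + 1 - 2 ^ E) - 1 / 2) * ∫ ω, u2 (blk Y 0 k ω) ∂P|
      ≤ |CH P Y k (k + 1 - 2 ^ E) - 1 / 2| * (2 / √t) := by
    rw [abs_mul]
    gcongr
  rw [abs_le] at *
  constructor <;> linarith [e1.1, e1.2, e2.1, e2.2, e5.1, e5.2]

variable {P 𝓕} in
/-- The truncated series of covariances is close to its limit. -/
lemma abs_CH_sub_half_le {Y : ℕ → Ω → ℝ} {cc : ℕ → ℝ} (hY : CovSeq P 𝓕 Y cc)
    (hs : Summable fun l => |cc (l + 1)|) (h1 : cc 0 + 2 * ∑' l, cc (l + 1) = 1) (k E : ℕ) :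
    |CH P Y k (k + 1 - 2 ^ E) - 1 / 2|
      ≤ ∑' l, |cc (l + (2 ^ E - 1) + 1)| + ∑' l, |cc (l + k + 1)| := by
  have hp : 1 ≤ 2 ^ E := Nat.one_le_two_pow
  have hsc : Summable fun l => cc (l + 1) := hs.of_abs
  have key : ∀ m, |cc 0 / 2 + ∑ l ∈ Finset.range m, cc (l + 1) - 1 / 2|
      ≤ ∑' l, |cc (l + m + 1)| := by
    intro m
    have e1 := hsc.sum_add_tsum_nat_add m
    have e2 : cc 0 / 2 + ∑ l ∈ Finset.range m, cc (l + 1) - 1 / 2 = -∑' l, cc (l + m + 1) := by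
      linarith
    rw [e2, abs_neg]
    have := norm_tsum_le_tsum_norm (f := fun l => cc (l + m + 1))
      ((summable_nat_add_iff m).2 hs)
    simpa using this
  have n1 : 0 ≤ ∑' l, |cc (l + (2 ^ E - 1) + 1)| := tsum_nonneg fun _ => abs_nonneg _
  have n2 : 0 ≤ ∑' l, |cc (l + k + 1)| := tsum_nonneg fun _ => abs_nonneg _
  rw [CH_eq P hY (by omega)]
  rcases le_total (2 ^ E - 1) k with h | h
  · rw [show k - (k + 1 - 2 ^ E) = 2 ^ E - 1 by omega]
    exact (key _).trans (by linarith)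
  · rw [show k - (k + 1 - 2 ^ E) = k by omega]
    exact (key _).trans (by linarith)

end Lindeberg

section Core

variable {Ω : Type*} [mΩ : MeasurableSpace Ω] (P : Measure Ω) [IsProbabilityMeasure P]
  (𝓕 : Filtration ℕ mΩ)

lemma one_div_mul_sqrt_eq_rpow {t : ℝ} (ht : 0 < t) : 1 / (t * √t) = t ^ (-(1 + (1 / 2 : ℝ))) := by
  rw [Real.rpow_neg ht.le, Real.rpow_add ht, Real.rpow_one, Real.sqrt_eq_rpow, one_div]

lemma exists_abs_lindeberg_sum_le (c δ : ℝ) (hδ : 0 < δ) (hδ1 : δ ≤ 1) (hc : 0 ≤ c) {Cd : ℝ}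
    {a L : ℕ → ℝ} (hs : Scale a L Cd) (g : ℕ → ℕ) (hg : ∀ e, g e ≤ max 1 (2 ^ e / 4)) :
    ∃ C1 C2 : ℝ, 0 ≤ C1 ∧ 0 ≤ C2 ∧ ∀ (Y : ℕ → Ω → ℝ) (cc : ℕ → ℝ), CovSeq P 𝓕 Y cc →
    (∀ e, Lvl P 𝓕 Y c (3 + δ) (g e) (a e) (L e)) → cc 0 + 2 * ∑' l, cc (l + 1) = 1 →
    ∀ (t₀ n : ℕ) (W : ℝ), 16 ≤ t₀ → 1 ≤ n → (∀ T < n, GaussClose P Y W T) →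
    GaussClose P Y (2 * √t₀ + C1 + C2 * (t₀ : ℝ) ^ (-(1 / 2 : ℝ)) * W) n := by
  obtain ⟨K, hK, h1⟩ := exists_abs_lindeberg_step_le P 𝓕 c δ hδ.le hδ1 hc
  obtain ⟨Q, hQ, h2⟩ := exists_abs_cov_block_le P 𝓕 c (3 + δ) (by linarith) hc
  obtain ⟨E, hE, hgt, hlt, hE2, hE3⟩ := hs.exists_index
  set A : ℝ := ∑' e, 4 ^ e * a e * L e ^ 3 with hA
  have hA0 : 0 ≤ A := tsum_nonneg hs.term_nonneg
  have hCd : 0 ≤ 2 * Cd := by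
    have := hE2 1 le_rfl
    have h3 := hgt 1
    simp only [Nat.cast_one, Real.sqrt_one, mul_one] at this h3
    linarith
  have hM := gaussM4_nonneg
  set R : ℕ → ℝ := fun t => ∑ e ∈ Finset.range (E t), ((2:ℝ) ^ e) ^ (2 + δ) * a e * L e ^ (3 + δ)
    with hR
  set U : ℕ → ℝ := fun t => ∑' e, if E t ≤ e then 2 ^ e * a e * L e ^ 2 else 0 with hU
  set κ : ℝ := 1 + 2 * (2 * Cd) + 4 * (2 * Cd) ^ 2 with hκ
  refine ⟨K * 8 * (4 / δ) + K * 8 * (4 / δ * A) + K * κ * A + K * (1 + A) * 8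
    + 2 * Q * (2 * A) + 2 * (2 * Q * A) + 8 * gaussM4 * 4, K * (1 + A) * 8 * 4, by positivity,
    by positivity, ?_⟩
  intro Y cc hY hl hcc t₀ n W ht₀ hn hW h hh
  have hn0 : (0:ℝ) < n := by exact_mod_cast hn
  have hW0 : 0 ≤ W := (abs_nonneg _).trans (hW 0 (by omega) (fun _ => 0) (by simp))
  have hx : ∀ e l : ℕ, 2 ^ e ≤ l + 1 → l + 1 < 2 ^ (e + 1) → |cc (l + 1)| ≤ Q * (a e * L e ^ 2) :=
    h2 Y cc g a L hY hl hg
  have hx0 : ∀ l : ℕ, 0 ≤ |cc (l + 1)| := fun _ => abs_nonneg _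
  have hsum := hs.summable_of_block hx0 hQ hx
  set τ : ℕ → ℝ := fun k => ∑' l, |cc (l + k + 1)| with hτ
  have hτ0 : ∀ k, 0 ≤ τ k := fun k => tsum_nonneg fun _ => abs_nonneg _
  set G : ℕ → ℝ := fun t => K * 8 * (t:ℝ) ^ (-(1 + δ / 2))
    + K * 8 * ((t:ℝ) ^ (-(1 + δ / 2)) * R t) + K * κ * (a (E t) * L (E t))
    + 2 * Q * (1 / √t * U t) + 8 * gaussM4 * (t:ℝ) ^ (-(1 + (1 / 2 : ℝ)))
    + K * (1 + A) * 8 * W * (t:ℝ) ^ (-(1 + (1 / 2 : ℝ))) with hG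
  set F : ℕ → ℝ := fun k => ∫ ω, gsm ((t₀ + n - k : ℕ) : ℝ≥0) h (blk Y 0 k ω) ∂P with hF
  have step : ∀ k < n, |F (k + 1) - F k|
      ≤ G (t₀ + (n - 1 - k)) + K * (1 + A) * (8 / n) + 2 * τ k := by
    intro k hk
    set t := t₀ + (n - 1 - k) with ht
    have ht16 : 16 ≤ t := by omega
    have ht0 : (0:ℝ) < t := by exact_mod_cast (by omega : 0 < t)
    have hst : 1 ≤ √(t:ℝ) := Real.one_le_sqrt.2 (by exact_mod_cast (by omega : 1 ≤ t))
    have hsq : √(t:ℝ) * √t = t := Real.mul_self_sqrt ht0.le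
    have hst4 : 4 * √(t:ℝ) ≤ t := by
      have : 4 ≤ √(t:ℝ) := Real.le_sqrt_of_sq_le (by norm_num; exact_mod_cast ht16)
      nlinarith
    have e1 := h1 Y cc g a L hY hl hg hs.L_zero h hh t k (E t) W (n / 2) (by omega) (by positivity)
      (fun T hT hT' => by
        have h3 := hE3 t (by omega)
        have h4 : ((k + 1 : ℕ) : ℝ) ≤ ((T + 2 ^ E t : ℕ) : ℝ) := by exact_mod_cast hT'
        have h5 : (t:ℝ) + k + 1 = t₀ + n := by exact_mod_cast (by omega : t + k + 1 = t₀ + n)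
        push_cast at h4
        have h6 : (t:ℝ) ≤ t₀ + n := by
          have : (0:ℝ) ≤ k := by positivity
          linarith
        have h7 : (0:ℝ) ≤ t₀ := by positivity
        linarith)
      (fun T hT => hW T (by omega))
    rw [show t = t₀ + n - (k + 1) by omega, show t₀ + n - (k + 1) + 1 = t₀ + n - k by omega,
      ← show t = t₀ + n - (k + 1) by omega] at e1
    have eF : F (k + 1) - F k = ∫ ω, gsm (t : ℝ≥0) h (blk Y 0 (k + 1) ω) ∂P
        - ∫ ω, gsm ((t₀ + n - k : ℕ) : ℝ≥0) h (blk Y 0 k ω) ∂P := by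
      simp only [hF, show t = t₀ + n - (k + 1) by omega]
    rw [eF]
    refine e1.trans ?_
    have ha := hs.a_nonneg (E t)
    have hL := hs.L_pos (E t)
    have b1 : a (E t) * (1 * L (E t) + 2 / √t * 2 ^ E t * L (E t) ^ 2
        + 4 / t * 4 ^ E t * L (E t) ^ 3) ≤ κ * (a (E t) * L (E t)) := by
      have h3 : 2 ^ E t * L (E t) / √t ≤ 2 * Cd := by
        rw [div_le_iff₀ (by positivity)]
        exact hE2 t (by omega)
      have h4 : (4:ℝ) ^ E t = 2 ^ E t * 2 ^ E t := by rw [← mul_pow]; norm_num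
      calc _ = a (E t) * L (E t) * (1 + 2 * (2 ^ E t * L (E t) / √t)
            + 4 * (2 ^ E t * L (E t) / √t) ^ 2) := by
            have h5 : 4 / (t:ℝ) = 4 / √t / √t := by rw [div_div, hsq]
            rw [h4, h5]
            field_simp
        _ ≤ a (E t) * L (E t) * κ := by
            rw [hκ]
            gcongr
        _ = _ := by ring
    have b2 : 1 + ∑ e ∈ Finset.range (E t), 4 ^ e * a e * L e ^ 3 ≤ 1 + A := by
      gcongr
      exact hs.summable.sum_le_tsum _ fun e _ => hs.term_nonneg e
    have b3 : |CH P Y k (k + 1 - 2 ^ E t) - 1 / 2| * (2 / √t)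
        ≤ 2 * Q * (1 / √t * U t) + 2 * τ k := by
      have h3 := abs_CH_sub_half_le hY hsum hcc k (E t)
      have h4 := hs.tail_le hx0 hQ hx (E t)
      have h5 : 2 / √(t:ℝ) ≤ 2 := by
        rw [div_le_iff₀ (by positivity)]
        linarith
      have h6 := hτ0 k
      calc _ ≤ (Q * U t + τ k) * (2 / √t) := by
            gcongr
            exact h3.trans (add_le_add h4 le_rfl)
        _ = 2 * Q * (1 / √t * U t) + τ k * (2 / √t) := by ring
        _ ≤ _ := by nlinarith
    have b4 : 0 ≤ 8 / (t * √(t:ℝ)) * W + 4 / ((n:ℝ) / 2) := by positivity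
    have b5 := mul_le_mul_of_nonneg_right b2 b4
    have b6 : 8 / (t * √(t:ℝ)) = 8 * (t:ℝ) ^ (-(1 + (1 / 2 : ℝ))) := by
      rw [← one_div_mul_sqrt_eq_rpow ht0]; ring
    have b7 : 8 * gaussM4 / (t * √(t:ℝ)) = 8 * gaussM4 * (t:ℝ) ^ (-(1 + (1 / 2 : ℝ))) := by
      rw [← one_div_mul_sqrt_eq_rpow ht0]; ring
    have b8 := mul_le_mul_of_nonneg_left (add_le_add (add_le_add (le_refl
      (8 * (t:ℝ) ^ (-(1 + δ / 2)) * (1 + R t))) b1) b5) hK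
    rw [b7]
    refine (add_le_add (add_le_add b8 b3) le_rfl).trans (le_of_eq ?_)
    rw [b6, hG]
    field_simp
    ring
  have hGs : ∑ k ∈ Finset.range n, G (t₀ + (n - 1 - k)) = ∑ t ∈ Finset.Ico t₀ (t₀ + n), G t := by
    rw [Finset.sum_range_reflect (fun k => G (t₀ + k)), Finset.sum_Ico_eq_sum_range,
      add_tsub_cancel_left]
  have hsub : ∀ f : ℕ → ℝ, (∀ t, 0 ≤ f t) → ∑ t ∈ Finset.Ico t₀ (t₀ + n), f t
      ≤ ∑ t ∈ Finset.Ico 1 (t₀ + n), f t := fun f hf =>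
    Finset.sum_le_sum_of_subset_of_nonneg (Finset.Ico_subset_Ico (by omega) le_rfl)
      fun t _ _ => hf t
  have hRn : ∀ t, 0 ≤ R t := fun t => Finset.sum_nonneg fun e _ => by
    have := hs.a_nonneg e
    have := hs.L_pos e
    positivity
  have hUn : ∀ t, 0 ≤ U t := fun t => tsum_nonneg fun e => by
    have := hs.a_nonneg e
    split_ifs <;> positivity
  have s1 : ∑ t ∈ Finset.Ico t₀ (t₀ + n), (t:ℝ) ^ (-(1 + δ / 2)) ≤ 4 / δ := by
    refine (hsub _ fun t => by positivity).trans ((sum_Ico_rpow_neg_le (by positivity)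
      (by linarith) le_rfl).trans (le_of_eq ?_))
    rw [Nat.cast_one, Real.one_rpow]
    field_simp
    norm_num
  have s2 : ∑ t ∈ Finset.Ico t₀ (t₀ + n), (t:ℝ) ^ (-(1 + δ / 2)) * R t ≤ 4 / δ * A :=
    (hsub _ fun t => mul_nonneg (by positivity) (hRn t)).trans
      (hs.sum_remainder_le hδ hδ1 hE hlt _)
  have s3 : ∑ t ∈ Finset.Ico t₀ (t₀ + n), a (E t) * L (E t) ≤ A :=
    (hsub _ fun t => mul_nonneg (hs.a_nonneg _) (hs.L_pos _).le).trans
      (hs.sum_terminal_le hE hgt _)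
  have s4 : ∑ t ∈ Finset.Ico t₀ (t₀ + n), 1 / √(t:ℝ) * U t ≤ 2 * A :=
    (hsub _ fun t => mul_nonneg (by positivity) (hUn t)).trans (hs.sum_tail_le hgt _)
  have s5 : ∑ t ∈ Finset.Ico t₀ (t₀ + n), (t:ℝ) ^ (-(1 + (1 / 2 : ℝ)))
      ≤ 4 * (t₀ : ℝ) ^ (-(1 / 2 : ℝ)) :=
    (sum_Ico_rpow_neg_le (by norm_num) (by norm_num) (by omega)).trans (le_of_eq (by norm_num))
  have s6 : (t₀ : ℝ) ^ (-(1 / 2 : ℝ)) ≤ 1 :=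
    Real.rpow_le_one_of_one_le_of_nonpos (by exact_mod_cast (by omega : 1 ≤ t₀)) (by norm_num)
  have s7 : ∑ k ∈ Finset.range n, τ k ≤ 2 * Q * A := hs.sum_shifted_tsum_le hx0 hQ hx n
  have sG : ∑ t ∈ Finset.Ico t₀ (t₀ + n), G t ≤ K * 8 * (4 / δ) + K * 8 * (4 / δ * A) + K * κ * A
      + 2 * Q * (2 * A) + 8 * gaussM4 * 4
      + K * (1 + A) * 8 * W * (4 * (t₀ : ℝ) ^ (-(1 / 2 : ℝ))) := by
    simp only [hG, Finset.sum_add_distrib, ← Finset.mul_sum]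
    gcongr
    linarith
  have tel : |F n - F 0| ≤ ∑ t ∈ Finset.Ico t₀ (t₀ + n), G t + K * (1 + A) * 8
      + 2 * (2 * Q * A) := by
    rw [← Finset.sum_range_sub]
    refine (Finset.abs_sum_le_sum_abs _ _).trans ((Finset.sum_le_sum fun k hk =>
      step k (Finset.mem_range.1 hk)).trans ?_)
    rw [Finset.sum_add_distrib, Finset.sum_add_distrib, hGs, ← Finset.mul_sum, Finset.sum_const,
      Finset.card_range, nsmul_eq_mul]
    have e1 : (n:ℝ) * (8 / n) = 8 := by field_simp
    rw [← Finset.mul_sum, e1]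
    gcongr
  have f0 : F 0 = gsm ((t₀ + n : ℕ) : ℝ≥0) h 0 := by
    simp [hF, blk_self]
  have fn : F n = ∫ ω, gsm (t₀ : ℝ≥0) h (blk Y 0 n ω) ∂P := by
    simp [hF]
  have d0 : |gsm ((t₀ + n : ℕ) : ℝ≥0) h 0 - gsm (n : ℝ≥0) h 0| ≤ √t₀ := by
    have := abs_gsm_sub_self_le (w := (t₀ : ℝ≥0)) (gsm_lipschitz (v := (n : ℝ≥0)) hh) 0
    rw [gsm_gsm hh] at this
    simpa using this
  have dn : |∫ ω, gsm (t₀ : ℝ≥0) h (blk Y 0 n ω) ∂P - ∫ ω, h (blk Y 0 n ω) ∂P| ≤ √t₀ := by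
    have hb := bdd_blk hY.bdd 0 n
    have hg' := gsm_lipschitz (v := (t₀ : ℝ≥0)) hh
    rw [← E_sub (hb.comp_lipschitz (measurable_of_lipschitz hg') hg')
      (hb.comp_lipschitz (measurable_of_lipschitz hh) hh)]
    exact E_le_of_abs_le fun ω => by simpa using abs_gsm_sub_self_le (w := (t₀ : ℝ≥0)) hh _
  rw [f0, fn] at tel
  have fin := tel.trans (add_le_add (add_le_add sG le_rfl) le_rfl)
  rw [abs_le] at *
  constructor <;> linarith [fin.1, fin.2, d0.1, d0.2, dn.1, dn.2]

/-- The Gaussian approximation of normalized centered stationary sequences. -/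
theorem exists_gaussClose (c δ : ℝ) (hδ : 0 < δ) (hδ1 : δ ≤ 1) (hc : 0 ≤ c) {Cd : ℝ}
    {a L : ℕ → ℝ} (hs : Scale a L Cd) (g : ℕ → ℕ) (hg : ∀ e, g e ≤ max 1 (2 ^ e / 4)) :
    ∃ W : ℝ, ∀ (Y : ℕ → Ω → ℝ) (cc : ℕ → ℝ), CovSeq P 𝓕 Y cc →
    (∀ e, Lvl P 𝓕 Y c (3 + δ) (g e) (a e) (L e)) → cc 0 + 2 * ∑' l, cc (l + 1) = 1 →
    ∀ n, GaussClose P Y W n := by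
  obtain ⟨C1, C2, hC1, hC2, h1⟩ := exists_abs_lindeberg_sum_le P 𝓕 c δ hδ hδ1 hc hs g hg
  obtain ⟨t₀, ht₀⟩ := exists_nat_ge (max 16 ((2 * C2) ^ 2))
  have h16 : 16 ≤ t₀ := by exact_mod_cast (le_max_left _ _).trans ht₀
  have hC : (2 * C2) ^ 2 ≤ t₀ := (le_max_right _ _).trans ht₀
  have ht0 : (0:ℝ) < t₀ := by exact_mod_cast (by omega : 0 < t₀)
  have h2 : C2 * (t₀ : ℝ) ^ (-(1 / 2 : ℝ)) ≤ 1 / 2 := by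
    rw [Real.rpow_neg ht0.le, ← Real.sqrt_eq_rpow, ← div_eq_mul_inv, div_le_iff₀ (by positivity)]
    have := Real.le_sqrt_of_sq_le hC
    linarith
  set W : ℝ := 2 * (2 * √t₀ + C1) with hW
  have hW0 : 0 ≤ W := by positivity
  refine ⟨W, fun Y cc hY hl hcc n => ?_⟩
  induction n using Nat.strong_induction_on with
  | _ n ih =>
    rcases Nat.eq_zero_or_pos n with rfl | hn
    · intro h hh
      simpa [blk_self, gsm] using hW0
    · intro h hh
      refine (h1 Y cc hY hl hcc t₀ n W h16 hn ih h hh).trans ?_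
      have := mul_le_mul_of_nonneg_right h2 hW0
      linarith

end Core

/-! ### General variances -/

section Variance

variable {Ω : Type*} [mΩ : MeasurableSpace Ω] {P : Measure Ω} [IsProbabilityMeasure P]
  {𝓕 : Filtration ℕ mΩ} {Y : ℕ → Ω → ℝ} {cc : ℕ → ℝ}

omit mΩ in
lemma blk_const_mul (s : ℝ) (m n : ℕ) (ω : Ω) :
    blk (fun j ω => s * Y j ω) m n ω = s * blk Y m n ω := by
  simp only [blk, Finset.mul_sum]

omit [IsProbabilityMeasure P] in
lemma CovSeq.const_mul (h : CovSeq P 𝓕 Y cc) (s : ℝ) :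
    CovSeq P 𝓕 (fun j ω => s * Y j ω) (fun l => s ^ 2 * cc l) where
  bdd j := (Bdd.const s).mul (h.bdd j)
  adapted j := (h.adapted j).const_mul s
  centered j := by rw [integral_const_mul, h.centered, mul_zero]
  cov j l := by
    rw [← h.cov j l, ← integral_const_mul]
    congr 1
    ext ω
    ring

omit [IsProbabilityMeasure P] in
lemma Lvl.const_mul {c r a L s Λ : ℝ} {g : ℕ} (h : Lvl P 𝓕 Y c r g a L) (hr : 1 ≤ r)
    (hΛ : 1 ≤ Λ) (hs : |s| ≤ Λ) : Lvl P 𝓕 (fun j ω => s * Y j ω) (c * Λ ^ r) r g a L := by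
  obtain ⟨Z, hZ, hZc, hZ1, hZr, hcv⟩ := h.approx
  have ha := h.a_nonneg
  have hL := h.one_le_L
  have hc := h.one_le_c
  have hΛr : Λ ≤ Λ ^ r := Real.self_le_rpow_of_one_le hΛ hr
  have hΛ1 : 1 ≤ Λ ^ r := hΛ.trans hΛr
  refine ⟨ha, h.a_le_one, one_le_mul_of_one_le_of_one_le hc hΛ1, hL,
    fun j ω => s * Z j ω, fun j => (Bdd.const s).mul (hZ j), ?_, ?_, ?_, ?_⟩
  · intro j ω
    rw [abs_mul]
    calc |s| * |Z j ω| ≤ Λ ^ r * (c * L) :=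
          mul_le_mul (hs.trans hΛr) (hZc j ω) (abs_nonneg _) (by positivity)
      _ = _ := by ring
  · intro j
    simp only [← mul_sub, abs_mul, integral_const_mul]
    calc _ ≤ Λ ^ r * (c * a * L) :=
          mul_le_mul (hs.trans hΛr) (hZ1 j) (integral_nonneg fun _ => abs_nonneg _) (by positivity)
      _ = _ := by ring
  · intro j
    simp only [← mul_sub, abs_mul, Real.mul_rpow (abs_nonneg _) (abs_nonneg _),
      integral_const_mul]
    calc _ ≤ Λ ^ r * (c * a * L ^ r) :=
          mul_le_mul (Real.rpow_le_rpow (abs_nonneg _) hs (by linarith)) (hZr j)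
            (integral_nonneg fun _ => by positivity) (by positivity)
      _ = _ := by ring
  · intro T ξ hξ hξ1 l hl hlT
    have e : (fun ω => (l.map fun i => s * Z i ω).prod)
        = fun ω => s ^ l.length * (l.map fun i => Z i ω).prod := by
      ext ω
      rw [List.prod_map_mul]
      simp
    rw [e, cv_const_mul_right, abs_mul, abs_pow]
    calc _ ≤ (Λ ^ r) ^ l.length * ((c * L) ^ l.length * a) :=
          mul_le_mul (pow_le_pow_left₀ (abs_nonneg _) (hs.trans hΛr) _) (hcv T ξ hξ hξ1 l hl hlT)
            (abs_nonneg _) (by positivity)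
      _ = _ := by rw [← mul_assoc, ← mul_pow]; ring_nf

lemma gsm_scale {s v : ℝ≥0} {h : ℝ → ℝ} :
    gsm (v * s ^ 2) h 0 = gsm v (fun x => h (s * x)) 0 := by
  rcases eq_or_ne s 0 with rfl | hs
  · simp [gsm]
  have h1 := gaussianReal_map_const_mul (μ := 0) (v := v) (s : ℝ)
  rw [mul_zero, show NNReal.mk ((s:ℝ) ^ 2) (sq_nonneg _) * v = v * s ^ 2 by
    rw [mul_comm]; rfl] at h1
  simp only [gsm, zero_add]
  rw [← h1]
  exact (Homeomorph.mulLeft₀ (s : ℝ) (by exact_mod_cast hs)).measurableEmbedding.integral_map h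

variable (P 𝓕) in
/-- Gaussian approximation when the asymptotic variance is bounded below. -/
theorem exists_abs_sub_gsm_le (c δ : ℝ) (hδ : 0 < δ) (hδ1 : δ ≤ 1) (hc : 0 ≤ c) {Cd : ℝ}
    {a L : ℕ → ℝ} (hs : Scale a L Cd) (g : ℕ → ℕ) (hg : ∀ e, g e ≤ max 1 (2 ^ e / 4))
    {s₀ : ℝ} (hs₀ : 0 < s₀) :
    ∃ W : ℝ, ∀ (Y : ℕ → Ω → ℝ) (cc : ℕ → ℝ) (s : ℝ≥0), CovSeq P 𝓕 Y cc →
    (∀ e, Lvl P 𝓕 Y c (3 + δ) (g e) (a e) (L e)) → s₀ ≤ s →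
    cc 0 + 2 * ∑' l, cc (l + 1) = (s:ℝ) ^ 2 →
    ∀ (n : ℕ) (h : ℝ → ℝ), (∀ x y, |h x - h y| ≤ |x - y|) →
      |∫ ω, h (blk Y 0 n ω) ∂P - gsm (n * s ^ 2) h 0| ≤ s * W := by
  set Λ : ℝ := max 1 s₀⁻¹ with hΛ
  have hΛ1 : 1 ≤ Λ := le_max_left _ _
  obtain ⟨W, h1⟩ := exists_gaussClose P 𝓕 (c * Λ ^ (3 + δ)) δ hδ hδ1 (by positivity) hs g hg
  refine ⟨W, ?_⟩
  intro Y cc s hY hl hss hcc n h hh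
  have hs0 : (0:ℝ) < s := hs₀.trans_le hss
  have h2 := h1 _ _ (hY.const_mul (s:ℝ)⁻¹) (fun e => (hl e).const_mul (by linarith) hΛ1 (by
      rw [abs_of_pos (by positivity)]
      exact (inv_anti₀ hs₀ hss).trans (le_max_right _ _))) (by
      rw [tsum_mul_left, mul_left_comm, ← mul_add, hcc, inv_pow, inv_mul_cancel₀ (by positivity)])
    n (fun x => h (s * x) / s) (fun x y => by
      rw [← sub_div, abs_div, abs_of_pos hs0, div_le_iff₀ hs0]
      refine (hh _ _).trans (le_of_eq ?_)
      rw [← mul_sub, abs_mul, abs_of_pos hs0, mul_comm])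
  have e1 : gsm (n : ℝ≥0) (fun x => h (s * x) / s) 0 = gsm (n * s ^ 2) h 0 / s := by
    rw [gsm_scale]
    simp only [gsm, integral_div]
  simp only [blk_const_mul, mul_inv_cancel_left₀ hs0.ne'] at h2
  rw [e1, integral_div, ← sub_div, abs_div, abs_of_pos hs0, div_le_iff₀ hs0] at h2
  linarith

variable (P 𝓕) in
/-- Second moments of the partial sums. -/
theorem exists_abs_sub_zero_le (c δ : ℝ) (hδ : 0 ≤ δ) (hc : 0 ≤ c) {Cd : ℝ}
    {a L : ℕ → ℝ} (hs : Scale a L Cd) (g : ℕ → ℕ) (hg : ∀ e, g e ≤ max 1 (2 ^ e / 4)) :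
    ∃ W : ℝ, 0 ≤ W ∧ ∀ (Y : ℕ → Ω → ℝ) (cc : ℕ → ℝ), CovSeq P 𝓕 Y cc →
    (∀ e, Lvl P 𝓕 Y c (3 + δ) (g e) (a e) (L e)) →
    ∀ (n : ℕ) (h : ℝ → ℝ), (∀ x y, |h x - h y| ≤ |x - y|) →
      |∫ ω, h (blk Y 0 n ω) ∂P - h 0| ≤ √(n * (cc 0 + 2 * ∑' l, cc (l + 1)) + W) := by
  obtain ⟨Q, hQ, h2⟩ := exists_abs_cov_block_le P 𝓕 c (3 + δ) (by linarith) hc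
  have hA0 : 0 ≤ ∑' e, 4 ^ e * a e * L e ^ 3 := tsum_nonneg hs.term_nonneg
  refine ⟨2 * (2 * Q * ∑' e, 4 ^ e * a e * L e ^ 3), by positivity, ?_⟩
  intro Y cc hY hl n h hh
  have hx : ∀ e l : ℕ, 2 ^ e ≤ l + 1 → l + 1 < 2 ^ (e + 1) → |cc (l + 1)| ≤ Q * (a e * L e ^ 2) :=
    h2 Y cc g a L hY hl hg
  have hx0 : ∀ l : ℕ, 0 ≤ |cc (l + 1)| := fun _ => abs_nonneg _
  have hsum := hs.summable_of_block hx0 hQ hx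
  have hb := fun k => bdd_blk hY.bdd 0 k
  have step : ∀ k, ∫ ω, blk Y 0 (k + 1) ω ^ 2 ∂P - ∫ ω, blk Y 0 k ω ^ 2 ∂P
      ≤ cc 0 + 2 * ∑' l, cc (l + 1) + 2 * ∑' l, |cc (l + k + 1)| := by
    intro k
    have e1 : ∫ ω, blk Y 0 (k + 1) ω ^ 2 ∂P - ∫ ω, blk Y 0 k ω ^ 2 ∂P = 2 * CH P Y k 0 := by
      rw [← E_sub ((hb _).pow 2) ((hb _).pow 2), CH, ← integral_const_mul]
      congr 1
      ext ω
      rw [blk_add (Nat.zero_le k) (Nat.le_succ k), blk_succ_self, Hk]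
      ring
    have e2 := hsum.of_abs.sum_add_tsum_nat_add k
    have e3 : |∑' l, cc (l + k + 1)| ≤ ∑' l, |cc (l + k + 1)| := by
      simpa using norm_tsum_le_tsum_norm (f := fun l => cc (l + k + 1))
        ((summable_nat_add_iff k).2 hsum)
    rw [e1, CH_eq P hY (Nat.zero_le k), tsub_zero]
    rw [abs_le] at e3
    linarith [e3.1]
  have h3 : ∫ ω, blk Y 0 n ω ^ 2 ∂P ≤ n * (cc 0 + 2 * ∑' l, cc (l + 1))
      + 2 * (2 * Q * ∑' e, 4 ^ e * a e * L e ^ 3) := by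
    have e1 := Finset.sum_range_sub (fun k => ∫ ω, blk Y 0 k ω ^ 2 ∂P) n
    simp only [blk_self, ne_eq, OfNat.ofNat_ne_zero, not_false_eq_true, zero_pow, integral_zero,
      sub_zero] at e1
    rw [← e1]
    refine (Finset.sum_le_sum fun k _ => step k).trans ?_
    rw [Finset.sum_add_distrib, Finset.sum_const, Finset.card_range, nsmul_eq_mul,
      ← Finset.mul_sum]
    gcongr
    exact hs.sum_shifted_tsum_le hx0 hQ hx n
  refine Real.le_sqrt_of_sq_le (le_trans ?_ h3)
  have h4 : |∫ ω, h (blk Y 0 n ω) ∂P - h 0| ≤ ∫ ω, |blk Y 0 n ω| ∂P := by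
    rw [← E_const (P := P) (h 0), ← E_sub ((hb n).comp_lipschitz (measurable_of_lipschitz hh) hh)
      (Bdd.const _)]
    exact abs_E_le_of_le (hb n).abs fun ω => by simpa using hh (blk Y 0 n ω) 0
  have h5 : (∫ ω, |blk Y 0 n ω| ∂P) ^ 2 ≤ ∫ ω, blk Y 0 n ω ^ 2 ∂P := by
    set m := ∫ ω, |blk Y 0 n ω| ∂P with hm
    have : 0 ≤ ∫ ω, (|blk Y 0 n ω| - m) ^ 2 ∂P := integral_nonneg fun _ => sq_nonneg _
    have e : ∀ ω, (|blk Y 0 n ω| - m) ^ 2 = blk Y 0 n ω ^ 2 - (2 * m * |blk Y 0 n ω| - m ^ 2) :=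
      fun ω => by rw [← sq_abs (blk Y 0 n ω)]; ring
    have b1 := hb n
    simp only [e] at this
    rw [E_sub (by fun_prop) (by fun_prop), E_sub (by fun_prop) (by fun_prop), integral_const_mul,
      E_const, ← hm] at this
    nlinarith
  exact (pow_le_pow_left₀ (abs_nonneg _) h4 2).trans h5

end Variance

/-! ### The operator of a Markov kernel -/

section KernelOperator

variable {K : Kernel ℝ ℝ} {μ : Measure ℝ}

lemma abs_kop_le (g : ℝ → ℝ) (x : ℝ) : |Kop K g x| ≤ Kop K (fun y => |g y|) x :=
  abs_integral_le_integral_abs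

lemma integrable_kop [SFinite μ] [IsMarkovKernel K] (hinv : μ.bind K = μ) {g : ℝ → ℝ}
    (hg : Integrable g μ) :
    Integrable (Kop K g) μ := by
  rw [← hinv, Measure.comp_eq_comp_const_apply] at hg
  have h := hg.integral_comp
  rwa [Kernel.const_apply] at h

lemma integral_kop [SFinite μ] [IsMarkovKernel K] (hinv : μ.bind K = μ) {g : ℝ → ℝ}
    (hg : Integrable g μ) : ∫ x, Kop K g x ∂μ = ∫ x, g x ∂μ := by
  rw [← hinv] at hg
  conv_rhs => rw [← hinv]
  rw [Measure.comp_eq_comp_const_apply] at hg ⊢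
  rw [Kernel.integral_comp hg, Kernel.const_apply]
  rfl

lemma integral_abs_kop_le [SFinite μ] [IsMarkovKernel K] (hinv : μ.bind K = μ) {g : ℝ → ℝ}
    (hg : Integrable g μ) : ∫ x, |Kop K g x| ∂μ ≤ ∫ x, |g x| ∂μ := by
  rw [← integral_kop hinv hg.abs]
  exact integral_mono (integrable_kop hinv hg).abs (integrable_kop hinv hg.abs) (abs_kop_le g)

lemma kop_congr_ae (hinv : μ.bind K = μ) {g g' : ℝ → ℝ} (h : g =ᵐ[μ] g') :
    Kop K g =ᵐ[μ] Kop K g' := by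
  rw [← hinv] at h
  filter_upwards [Measure.ae_ae_of_ae_comp h] with x hx using integral_congr_ae hx

lemma kop_sub_ae [SFinite μ] [IsMarkovKernel K] (hinv : μ.bind K = μ) {g g' : ℝ → ℝ}
    (hg : Integrable g μ) (hg' : Integrable g' μ) :
    Kop K (fun x => g x - g' x) =ᵐ[μ] fun x => Kop K g x - Kop K g' x := by
  rw [← hinv] at hg hg'
  filter_upwards [Measure.ae_integrable_of_integrable_comp hg,
    Measure.ae_integrable_of_integrable_comp hg'] with x h1 h2 using integral_sub h1 h2

lemma kop_const [IsMarkovKernel K] (c : ℝ) : Kop K (fun _ => c) = fun _ => c := by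
  funext x
  simp [Kop]

variable [IsMarkovKernel K]

lemma Bdd.kop {g : ℝ → ℝ} (hg : Bdd g) : Bdd (Kop K g) := by
  obtain ⟨hm, C, hC⟩ := hg
  exact ⟨hm.stronglyMeasurable.integral_kernel.measurable, C, fun x => E_le_of_abs_le hC⟩

lemma Bdd.kop_iterate {g : ℝ → ℝ} (hg : Bdd g) (n : ℕ) : Bdd ((Kop K)^[n] g) := by
  induction n generalizing g with
  | zero => exact hg
  | succ n ih => exact ih hg.kop

lemma kop_iterate_mem {g : ℝ → ℝ} (h : ∀ x, g x ∈ Icc (0:ℝ) 1) (hg : Bdd g) (n : ℕ) (x : ℝ) :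
    (Kop K)^[n] g x ∈ Icc (0:ℝ) 1 := by
  induction n generalizing g with
  | zero => exact h x
  | succ n ih =>
    refine ih (fun y => ⟨integral_nonneg fun z => (h z).1, ?_⟩) hg.kop
    calc Kop K g y ≤ ∫ _, (1:ℝ) ∂(K y) := E_mono hg (Bdd.const 1) fun z => (h z).2
      _ = 1 := E_const 1

lemma integral_kop_iterate [IsProbabilityMeasure μ] (hinv : μ.bind K = μ) {g : ℝ → ℝ}
    (hg : Integrable g μ) (n : ℕ) : Integrable ((Kop K)^[n] g) μ ∧
      ∫ x, (Kop K)^[n] g x ∂μ = ∫ x, g x ∂μ := by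
  induction n generalizing g with
  | zero => exact ⟨hg, rfl⟩
  | succ n ih =>
    simp only [Function.iterate_succ_apply]
    obtain ⟨h1, h2⟩ := ih (integrable_kop hinv hg)
    exact ⟨h1, h2.trans (integral_kop hinv hg)⟩

lemma measurable_indic (t : ℝ) : Measurable (indic t) :=
  measurable_const.indicator measurableSet_Iic

lemma indic_mem (t x : ℝ) : indic t x ∈ Icc (0:ℝ) 1 := by
  unfold indic
  by_cases h : x ∈ Iic t <;> simp [h]

lemma bdd_indic (t : ℝ) : Bdd (indic t) :=
  ⟨measurable_indic t, 1, fun x => by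
    rw [abs_of_nonneg (indic_mem t x).1]; exact (indic_mem t x).2⟩

lemma indic_mul_indic (s t x : ℝ) : indic s x * indic t x = indic (min s t) x := by
  unfold indic
  by_cases h : x ≤ s <;> by_cases h' : x ≤ t <;> simp [Set.indicator, h, h']

lemma Bdd.nestedK {l : List (ℕ × (ℝ → ℝ))} (hl : ∀ q ∈ l, Bdd q.2) :
    Bdd (nestedK (Kop K) l) := by
  induction l with
  | nil => exact Bdd.const 1
  | cons q r ih =>
    have h1 := hl q (by simp)
    have h2 := ih fun q hq => hl q (by simp [hq])
    exact (h1.mul h2).kop_iterate q.1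

lemma nestedK_mem {l : List (ℕ × (ℝ → ℝ))} (hl : ∀ q ∈ l, ∃ t, q.2 = indic t) (x : ℝ) :
    nestedK (Kop K) l x ∈ Icc (0:ℝ) 1 := by
  induction l generalizing x with
  | nil => exact ⟨zero_le_one, le_rfl⟩
  | cons q r ih =>
    obtain ⟨t, ht⟩ := hl q (by simp)
    have hb : Bdd (_root_.nestedK (Kop K) r) := Bdd.nestedK fun q hq => by
      obtain ⟨t, ht⟩ := hl q (by simp [hq])
      rw [ht]; exact bdd_indic t
    refine kop_iterate_mem (fun y => ?_) ((by rw [ht]; exact bdd_indic t : Bdd q.2).mul hb) q.1 x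
    have h1 := ih (fun q hq => hl q (by simp [hq])) y
    rw [ht]
    have h2 := indic_mem t y
    exact ⟨mul_nonneg h2.1 h1.1, mul_le_one₀ h2.2 h1.1 h1.2⟩

/-! ### The dependence coefficients -/

lemma exists_eq_indic_of_mem_tList {n l : ℕ} {ns : Fin l → ℕ} {ts : Fin (l + 1) → ℝ}
    {q : ℕ × (ℝ → ℝ)} (hq : q ∈ tList n ns ts) : ∃ t, q.2 = indic t := by
  simp only [tList, List.mem_cons, List.mem_ofFn] at hq
  rcases hq with rfl | ⟨i, rfl⟩
  exacts [⟨_, rfl⟩, ⟨_, rfl⟩]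

lemma integral_abs_sub_integral_le_one [IsProbabilityMeasure μ] {F : ℝ → ℝ}
    (hF : ∀ x, F x ∈ Icc (0:ℝ) 1) (hb : Bdd F) (m : ℝ) (hm : m ∈ Icc (0:ℝ) 1) :
    ∫ x, |F x - m| ∂μ ≤ 1 := by
  calc ∫ x, |F x - m| ∂μ ≤ ∫ _, (1:ℝ) ∂μ := by
        refine E_mono (by fun_prop) (Bdd.const 1) fun x => ?_
        have := hF x
        rw [abs_le]; constructor <;> linarith [this.1, this.2, hm.1, hm.2]
    _ = 1 := E_const 1

lemma integral_mem_Icc [IsProbabilityMeasure μ] {F : ℝ → ℝ}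
    (hF : ∀ x, F x ∈ Icc (0:ℝ) 1) (hb : Bdd F) : ∫ x, F x ∂μ ∈ Icc (0:ℝ) 1 := by
  refine ⟨integral_nonneg fun x => (hF x).1, ?_⟩
  calc ∫ x, F x ∂μ ≤ ∫ _, (1:ℝ) ∂μ := E_mono hb (Bdd.const 1) fun x => (hF x).2
    _ = 1 := E_const 1

variable [IsProbabilityMeasure μ]

lemma alpha1_term_le_one (n : ℕ) (t : ℝ) :
    ∫ x, |(Kop K)^[n] (indic t) x - ∫ y, indic t y ∂μ| ∂μ ≤ 1 :=
  integral_abs_sub_integral_le_one (kop_iterate_mem (indic_mem t) (bdd_indic t) n)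
    ((bdd_indic t).kop_iterate n) _ (integral_mem_Icc (indic_mem t) (bdd_indic t))

lemma nested_term_le_one {n l : ℕ} (ns : Fin l → ℕ) (ts : Fin (l + 1) → ℝ) :
    ∫ x, |nestedK (Kop K) (tList n ns ts) x - ∫ y, nestedK (Kop K) (tList n ns ts) y ∂μ| ∂μ
      ≤ 1 := by
  have h1 : ∀ q ∈ tList n ns ts, ∃ t, q.2 = indic t := fun q => exists_eq_indic_of_mem_tList
  have h2 : Bdd (nestedK (Kop K) (tList n ns ts)) := Bdd.nestedK fun q hq => by
    obtain ⟨t, ht⟩ := h1 q hq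
    rw [ht]; exact bdd_indic t
  exact integral_abs_sub_integral_le_one (nestedK_mem h1) h2 _
    (integral_mem_Icc (nestedK_mem h1) h2)

lemma alpha1_term_le_alphaCoef (k n : ℕ) (t : ℝ) :
    ∫ x, |(Kop K)^[n] (indic t) x - ∫ y, indic t y ∂μ| ∂μ ≤ alphaCoef (Kop K) μ k n :=
  (le_ciSup (f := fun t => ∫ x, |(Kop K)^[n] (indic t) x - ∫ y, indic t y ∂μ| ∂μ)
    ⟨1, by rintro _ ⟨t, rfl⟩; exact alpha1_term_le_one n t⟩ t).trans (le_max_left _ _)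

lemma nested_term_le_alphaCoef {k : ℕ} (n : ℕ) (j : Fin (k - 1)) (ns : Fin (j.1 + 1) → ℕ)
    (hns : ∀ i, 1 ≤ ns i) (ts : Fin (j.1 + 2) → ℝ) :
    ∫ x, |nestedK (Kop K) (tList n ns ts) x - ∫ y, nestedK (Kop K) (tList n ns ts) y ∂μ| ∂μ
      ≤ alphaCoef (Kop K) μ k n := by
  refine le_trans ?_ (le_max_right _ _)
  refine le_trans ?_ (le_ciSup (Finite.bddAbove_range _) j)
  refine le_trans ?_ (le_ciSup ⟨1, ?_⟩ (⟨ns, hns⟩ : {m : Fin (j.1 + 1) → ℕ // ∀ i, 1 ≤ m i}))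
  · exact le_ciSup (f := fun ts : Fin (j.1 + 2) → ℝ =>
      ∫ x, |nestedK (Kop K) (tList n ns ts) x - ∫ y, nestedK (Kop K) (tList n ns ts) y ∂μ| ∂μ)
      ⟨1, by rintro _ ⟨ts, rfl⟩; exact nested_term_le_one ns ts⟩ ts
  · rintro _ ⟨ns, rfl⟩
    exact ciSup_le fun ts => nested_term_le_one ns.1 ts

omit [IsMarkovKernel K] [IsProbabilityMeasure μ] in
lemma alphaCoef_le {k n : ℕ} {B : ℝ} (hB : 0 ≤ B)
    (h1 : ∀ t, ∫ x, |(Kop K)^[n] (indic t) x - ∫ y, indic t y ∂μ| ∂μ ≤ B)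
    (h2 : ∀ (j : Fin (k - 1)) (ns : Fin (j.1 + 1) → ℕ), (∀ i, 1 ≤ ns i) →
      ∀ ts : Fin (j.1 + 2) → ℝ,
      ∫ x, |nestedK (Kop K) (tList n ns ts) x - ∫ y, nestedK (Kop K) (tList n ns ts) y ∂μ| ∂μ
        ≤ B) : alphaCoef (Kop K) μ k n ≤ B :=
  max_le (Real.iSup_le h1 hB) (Real.iSup_le (fun j => Real.iSup_le (fun ns =>
    Real.iSup_le (fun ts => h2 j ns.1 ns.2 ts) hB) hB) hB)

lemma alphaCoef_nonneg (k n : ℕ) : 0 ≤ alphaCoef (Kop K) μ k n :=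
  le_trans (integral_nonneg fun _ => abs_nonneg _) (alpha1_term_le_alphaCoef k n 0)

lemma alphaCoef_le_one (k n : ℕ) : alphaCoef (Kop K) μ k n ≤ 1 :=
  alphaCoef_le zero_le_one (alpha1_term_le_one n) fun _ ns _ ts => nested_term_le_one ns ts

lemma integral_abs_kop_sub_le (hinv : μ.bind K = μ) {F : ℝ → ℝ} (hF : Bdd F) (m : ℝ) :
    ∫ x, |Kop K F x - m| ∂μ ≤ ∫ x, |F x - m| ∂μ := by
  refine le_trans (integral_congr_ae ?_).le
    (integral_abs_kop_le hinv (hF.sub (Bdd.const m)).integrable)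
  filter_upwards [kop_sub_ae hinv hF.integrable (Bdd.const m).integrable] with x hx
  rw [hx, kop_const]

lemma alphaCoef_antitone (hinv : μ.bind K = μ) (k : ℕ) : Antitone (alphaCoef (Kop K) μ k) := by
  refine antitone_nat_of_succ_le fun n => alphaCoef_le (alphaCoef_nonneg k n) (fun t => ?_) ?_
  · refine le_trans ?_ (alpha1_term_le_alphaCoef k n t)
    simp only [Function.iterate_succ_apply']
    exact integral_abs_kop_sub_le hinv ((bdd_indic t).kop_iterate n) _
  · intro j ns hns ts
    refine le_trans ?_ (nested_term_le_alphaCoef n j ns hns ts)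
    have h2 : Bdd (nestedK (Kop K) (tList n ns ts)) := Bdd.nestedK fun q hq => by
      obtain ⟨t, ht⟩ := exists_eq_indic_of_mem_tList hq
      rw [ht]; exact bdd_indic t
    have h3 : nestedK (Kop K) (tList (n + 1) ns ts) =
        Kop K (nestedK (Kop K) (tList n ns ts)) := by
      simp only [tList, nestedK, Function.iterate_succ_apply']
    rw [h3, integral_kop hinv h2.integrable]
    exact integral_abs_kop_sub_le hinv h2 _

end KernelOperator

/-! ### Stationary Markov chains -/

section MarkovChain

variable {Ω : Type*} [mΩ : MeasurableSpace Ω] {P : Measure Ω} {X : ℕ → Ω → ℝ} {μ : Measure ℝ}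
  {K : Kernel ℝ ℝ}

/-- The natural filtration of a real process. -/
def past (X : ℕ → Ω → ℝ) (hX : ∀ i, Measurable (X i)) : Filtration ℕ mΩ where
  seq n := MeasurableSpace.comap (fun ω => fun i : Fin (n + 1) => X i.1 ω) inferInstance
  mono' m n hmn := by
    rintro _ ⟨s, hs, rfl⟩
    refine ⟨(fun (u : Fin (n + 1) → ℝ) (i : Fin (m + 1)) => u ⟨i.1, by omega⟩) ⁻¹' s, ?_, rfl⟩
    exact (measurable_pi_lambda _ fun i => measurable_pi_apply _) hs
  le' n := (measurable_pi_lambda _ fun i : Fin (n + 1) => hX i.1).comap_le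

lemma measurable_past (hX : ∀ i, Measurable (X i)) {i n : ℕ} (hi : i ≤ n) :
    Measurable[past X hX n] (X i) := by
  have h : X i = (fun u : Fin (n + 1) → ℝ => u ⟨i, by omega⟩) ∘
      (fun ω => fun i : Fin (n + 1) => X i.1 ω) := rfl
  rw [h]
  refine (measurable_pi_apply _).comp ?_
  change Measurable[MeasurableSpace.comap _ _] _
  exact comap_measurable _

/-- `X` is a stationary Markov chain with kernel `K` and invariant law `μ`. -/
structure StatChain (P : Measure Ω) (X : ℕ → Ω → ℝ) (μ : Measure ℝ) (K : Kernel ℝ ℝ) : Prop where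
  meas : ∀ i, Measurable (X i)
  bind : μ.bind K = μ
  law : ∀ n, Measure.map (X n) P = μ
  markov : ∀ n : ℕ, ∀ g : ℝ → ℝ, Measurable g → (∃ C, ∀ x, |g x| ≤ C) →
    P[fun ω => g (X (n + 1) ω)
      | MeasurableSpace.comap (fun ω => fun i : Fin (n + 1) => X i.1 ω) inferInstance]
      =ᵐ[P] fun ω => Kop K g (X n ω)

lemma Bdd.comp_measurable {Z : Ω → ℝ} (hZ : Measurable Z) {g : ℝ → ℝ} (hg : Bdd g) :
    Bdd (fun ω => g (Z ω)) := by
  obtain ⟨hm, C, hC⟩ := hg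
  exact ⟨hm.comp hZ, C, fun ω => hC _⟩

lemma StatChain.integral_eq (hX : StatChain P X μ K) {g : ℝ → ℝ} (hg : Measurable g) (n : ℕ) :
    ∫ ω, g (X n ω) ∂P = ∫ x, g x ∂μ := by
  rw [← hX.law n, integral_map (hX.meas n).aemeasurable hg.aestronglyMeasurable]

variable [IsProbabilityMeasure P]

lemma StatChain.integral_step (hX : StatChain P X μ K) {T : ℕ} {ξ : Ω → ℝ}
    (hξ : Measurable[past X hX.meas T] ξ) (hb : Bdd ξ) {g : ℝ → ℝ} (hg : Bdd g) :
    ∫ ω, ξ ω * g (X (T + 1) ω) ∂P = ∫ ω, ξ ω * Kop K g (X T ω) ∂P := by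
  have hgX : Bdd fun ω => g (X (T + 1) ω) := hg.comp_measurable (hX.meas _)
  rw [← integral_condExp ((past X hX.meas).le T)]
  refine integral_congr_ae ?_
  have h1 := condExp_mul_of_stronglyMeasurable_left (m := past X hX.meas T) (μ := P)
    hξ.stronglyMeasurable (hb.mul hgX).integrable hgX.integrable
  have h2 : P[fun ω => g (X (T + 1) ω) | past X hX.meas T] =ᵐ[P] fun ω => Kop K g (X T ω) :=
    hX.markov T g hg.1 hg.2
  filter_upwards [h1, h2] with ω e1 e2
  refine Eq.trans e1 ?_
  rw [Pi.mul_apply]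
  exact congrArg (ξ ω * ·) e2

variable [IsMarkovKernel K]

lemma StatChain.integral_iterate (hX : StatChain P X μ K) {T : ℕ} {ξ : Ω → ℝ}
    (hξ : Measurable[past X hX.meas T] ξ) (hb : Bdd ξ) (n : ℕ) {g : ℝ → ℝ} (hg : Bdd g) :
    ∫ ω, ξ ω * g (X (T + n) ω) ∂P = ∫ ω, ξ ω * (Kop K)^[n] g (X T ω) ∂P := by
  induction n generalizing g with
  | zero => rfl
  | succ n ih =>
    rw [Function.iterate_succ_apply, ← ih hg.kop]
    exact hX.integral_step (hξ.mono ((past X hX.meas).mono (Nat.le_add_right T n)) le_rfl) hb hg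

/-- The product of the observables along a path, for a list of gaps and observables. -/
def pathProd (X : ℕ → Ω → ℝ) : ℕ → List (ℕ × (ℝ → ℝ)) → Ω → ℝ
  | _, [] => fun _ => 1
  | T, (n, f) :: r => fun ω => f (X (T + n) ω) * pathProd X (T + n) r ω

lemma StatChain.integral_pathProd (hX : StatChain P X μ K) {l : List (ℕ × (ℝ → ℝ))}
    (hl : ∀ q ∈ l, Bdd q.2) {T : ℕ} {ξ : Ω → ℝ}
    (hξ : Measurable[past X hX.meas T] ξ) (hb : Bdd ξ) :
    ∫ ω, ξ ω * pathProd X T l ω ∂P = ∫ ω, ξ ω * nestedK (Kop K) l (X T ω) ∂P := by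
  induction l generalizing T ξ with
  | nil => rfl
  | cons q r ih =>
    obtain ⟨n, f⟩ := q
    have hf : Bdd f := hl (n, f) (by simp)
    have hr : ∀ q ∈ r, Bdd q.2 := fun q hq => hl q (by simp [hq])
    have h1 : Measurable[past X hX.meas (T + n)] fun ω => ξ ω * f (X (T + n) ω) :=
      (hξ.mono ((past X hX.meas).mono (by omega)) le_rfl).mul
        (hf.1.comp (measurable_past hX.meas le_rfl))
    have h2 := ih hr h1 (hb.mul (hf.comp_measurable (hX.meas _)))
    have h3 := hX.integral_iterate hξ hb n (hf.mul (Bdd.nestedK (K := K) hr))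
    simp only [pathProd, nestedK]
    rw [← h3]
    simpa only [mul_assoc] using h2

/-- The product of indicators `f_{t_i}` evaluated along times `n_i`. -/
def indProd (x : ℕ → ℝ) (l : List (ℕ × ℝ)) : ℝ := (l.map fun q => indic q.2 (x q.1)).prod

lemma exists_sorted_insert (q : ℕ × ℝ) (l : List (ℕ × ℝ)) (hl : l.Pairwise fun a b => a.1 < b.1) :
    ∃ l' : List (ℕ × ℝ), (l'.Pairwise fun a b => a.1 < b.1) ∧ l'.length ≤ l.length + 1 ∧
      (∀ b ∈ l', b.1 = q.1 ∨ ∃ a ∈ l, a.1 = b.1) ∧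
      ∀ x, indProd x l' = indic q.2 (x q.1) * indProd x l := by
  induction l with
  | nil => exact ⟨[q], by simp, by simp, by simp, fun x => rfl⟩
  | cons a r ih =>
    rw [List.pairwise_cons] at hl
    rcases lt_trichotomy q.1 a.1 with h | h | h
    · refine ⟨q :: a :: r, ?_, by simp, ?_, fun x => rfl⟩
      · simp only [List.pairwise_cons, List.mem_cons, forall_eq_or_imp]
        exact ⟨⟨h, fun b hb => h.trans (hl.1 b hb)⟩, hl⟩
      · intro b hb
        simp only [List.mem_cons] at hb ⊢
        rcases hb with rfl | hb
        exacts [Or.inl rfl, Or.inr ⟨b, hb, rfl⟩]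
    · refine ⟨(a.1, min q.2 a.2) :: r, ?_, by simp, ?_, fun x => ?_⟩
      · simpa only [List.pairwise_cons] using hl
      · intro b hb
        simp only [List.mem_cons] at hb ⊢
        rcases hb with rfl | hb
        exacts [Or.inl h.symm, Or.inr ⟨b, Or.inr hb, rfl⟩]
      · simp only [indProd, List.map_cons, List.prod_cons]
        rw [← indic_mul_indic, h, mul_assoc]
    · obtain ⟨l', h1, h2, h3, h4⟩ := ih hl.2
      refine ⟨a :: l', ?_, by simpa using h2, ?_, fun x => ?_⟩
      · rw [List.pairwise_cons]
        refine ⟨fun b hb => ?_, h1⟩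
        rcases h3 b hb with h5 | ⟨c, hc, h5⟩
        · rwa [h5]
        · rw [← h5]; exact hl.1 c hc
      · intro b hb
        simp only [List.mem_cons] at hb ⊢
        rcases hb with rfl | hb
        · exact Or.inr ⟨b, Or.inl rfl, rfl⟩
        · rcases h3 b hb with h5 | ⟨c, hc, h5⟩
          exacts [Or.inl h5, Or.inr ⟨c, Or.inr hc, h5⟩]
      · have := h4 x
        simp only [indProd, List.map_cons, List.prod_cons] at this ⊢
        rw [this]; ring

lemma exists_sorted (l : List (ℕ × ℝ)) :
    ∃ l' : List (ℕ × ℝ), (l'.Pairwise fun a b => a.1 < b.1) ∧ l'.length ≤ l.length ∧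
      (∀ b ∈ l', ∃ a ∈ l, a.1 = b.1) ∧ ∀ x, indProd x l' = indProd x l := by
  induction l with
  | nil => exact ⟨[], by simp, by simp, by simp, fun x => rfl⟩
  | cons a r ih =>
    obtain ⟨l₁, h1, h2, h3, h4⟩ := ih
    obtain ⟨l₂, g1, g2, g3, g4⟩ := exists_sorted_insert a l₁ h1
    refine ⟨l₂, g1, by simp only [List.length_cons]; omega, fun b hb => ?_, fun x => ?_⟩
    · rcases g3 b hb with h | ⟨c, hc, h⟩
      · exact ⟨a, by simp, h.symm⟩
      · obtain ⟨d, hd, h'⟩ := h3 c hc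
        exact ⟨d, by simp [hd], h'.trans h⟩
    · rw [g4, h4]; rfl

/-- The gaps of an increasing list of times, starting from `T`. -/
def gaps : ℕ → List (ℕ × ℝ) → List (ℕ × (ℝ → ℝ))
  | _, [] => []
  | T, (n, t) :: r => (n - T, indic t) :: gaps n r

omit mΩ in
lemma pathProd_gaps {l : List (ℕ × ℝ)} (hl : l.Pairwise fun a b => a.1 < b.1) {T : ℕ}
    (hT : ∀ q ∈ l, T ≤ q.1) (ω : Ω) : pathProd X T (gaps T l) ω = indProd (fun n => X n ω) l := by
  induction l generalizing T with
  | nil => rfl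
  | cons q r ih =>
    obtain ⟨n, t⟩ := q
    rw [List.pairwise_cons] at hl
    have hn : T ≤ n := hT (n, t) (by simp)
    have := ih hl.2 (T := n) fun q hq => (hl.1 q hq).le
    simp only [gaps, pathProd, Nat.add_sub_cancel' hn, this]
    rfl

lemma exists_eq_indic_of_mem_gaps {l : List (ℕ × ℝ)} {T : ℕ} {q : ℕ × (ℝ → ℝ)}
    (hq : q ∈ gaps T l) : ∃ t, q.2 = indic t := by
  induction l generalizing T with
  | nil => simp [gaps] at hq
  | cons b r ih =>
    simp only [gaps, List.mem_cons] at hq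
    rcases hq with rfl | hq
    exacts [⟨_, rfl⟩, ih hq]

variable [IsProbabilityMeasure μ]

lemma integral_abs_nestedK_gaps_le (hinv : μ.bind K = μ) {l : List (ℕ × ℝ)} {T g : ℕ}
    (hl : l.Pairwise fun a b => a.1 < b.1) (hT : ∀ q ∈ l, T < q.1) (h2 : l.length ≤ 2) (t : ℝ) :
    ∫ x, |nestedK (Kop K) ((g, indic t) :: gaps T l) x
      - ∫ y, nestedK (Kop K) ((g, indic t) :: gaps T l) y ∂μ| ∂μ ≤ alphaCoef (Kop K) μ 3 g := by
  match l with
  | [] =>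
    simp only [gaps, nestedK, mul_one]
    have h := integral_kop_iterate (K := K) hinv (bdd_indic t).integrable g
    change ∫ x, |(Kop K)^[g] (indic t) x - ∫ y, (Kop K)^[g] (indic t) y ∂μ| ∂μ ≤ _
    rw [h.2]
    exact alpha1_term_le_alphaCoef 3 g t
  | [a] =>
    have ha : T < a.1 := hT a (by simp)
    have := nested_term_le_alphaCoef (K := K) (μ := μ) (k := 3) g (0 : Fin 2)
      (fun _ => a.1 - T) (fun _ => by omega) ![t, a.2]
    simpa [tList, gaps, List.ofFn_succ] using this
  | [a, b] =>
    have ha : T < a.1 := hT a (by simp)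
    have hb : a.1 < b.1 := by
      rw [List.pairwise_cons] at hl
      exact hl.1 b (by simp)
    have := nested_term_le_alphaCoef (K := K) (μ := μ) (k := 3) g (1 : Fin 2)
      ![a.1 - T, b.1 - a.1] (by
        intro i
        fin_cases i
        · show 1 ≤ a.1 - T
          omega
        · show 1 ≤ b.1 - a.1
          omega) ![t, a.2, b.2]
    simpa [tList, gaps, List.ofFn_succ] using this
  | _ :: _ :: _ :: _ => simp at h2

/-- Covariances between the past and products of at most three indicators of the future. -/
lemma StatChain.abs_cv_indProd_le (hX : StatChain P X μ K) {T g : ℕ} {ξ : Ω → ℝ}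
    (hξ : Measurable[past X hX.meas T] ξ) (hb : ∀ ω, |ξ ω| ≤ 1) (l : List (ℕ × ℝ))
    (hl : l.length ≤ 3) (hT : ∀ q ∈ l, T + g ≤ q.1) :
    |cv P ξ (fun ω => indProd (fun n => X n ω) l)| ≤ alphaCoef (Kop K) μ 3 g := by
  have hξb : Bdd ξ := ⟨hξ.mono ((past X hX.meas).le T) le_rfl, 1, hb⟩
  obtain ⟨l', h1, h2, h3, h4⟩ := exists_sorted l
  simp only [← h4]
  match l' with
  | [] =>
    simp only [indProd, List.map_nil, List.prod_nil, cv, mul_one, integral_const, probReal_univ,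
      smul_eq_mul, sub_self, abs_zero]
    exact alphaCoef_nonneg 3 g
  | (n, t) :: r =>
    have hn : T + g ≤ n := by
      obtain ⟨a, ha, e⟩ := h3 (n, t) (by simp)
      have := hT a ha
      simp only at e
      omega
    have h1' := List.pairwise_cons.mp h1
    set T' := n - g with hT'
    have hTT : T ≤ T' := by omega
    have hng : n - T' = g := by omega
    have hge : ∀ q ∈ (n, t) :: r, T' ≤ q.1 := by
      intro q hq
      rcases List.mem_cons.mp hq with rfl | hq
      · simp only; omega
      · have := h1'.1 q hq
        simp only at this
        omega
    set w := (g, indic t) :: gaps n r with hw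
    have hgw : gaps T' ((n, t) :: r) = w := by simp only [gaps, hng, hw]
    have hbw : ∀ q ∈ w, Bdd q.2 := fun q hq => by
      rw [← hgw] at hq
      obtain ⟨t, ht⟩ := exists_eq_indic_of_mem_gaps hq
      rw [ht]; exact bdd_indic t
    have e1 : (fun ω => indProd (fun n => X n ω) ((n, t) :: r)) = pathProd X T' w := by
      funext ω
      rw [← hgw, pathProd_gaps h1 hge]
    have hξ' : Measurable[past X hX.meas T'] ξ := hξ.mono ((past X hX.meas).mono hTT) le_rfl
    have hF : Bdd (nestedK (Kop K) w) := Bdd.nestedK hbw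
    have hFX : Bdd fun ω => nestedK (Kop K) w (X T' ω) := hF.comp_measurable (hX.meas _)
    set m := ∫ y, nestedK (Kop K) w y ∂μ with hm
    have e2 : ∫ ω, pathProd X T' w ω ∂P = m := by
      have := hX.integral_pathProd hbw (T := T') (ξ := fun _ => 1) measurable_const (Bdd.const 1)
      simp only [one_mul] at this
      rw [this, hX.integral_eq hF.1]
    rw [e1]
    have e3 : cv P ξ (pathProd X T' w) = ∫ ω, ξ ω * (nestedK (Kop K) w (X T' ω) - m) ∂P := by
      unfold cv
      rw [e2, hX.integral_pathProd hbw hξ' hξb]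
      simp only [mul_sub]
      rw [E_sub (hξb.mul hFX) (hξb.mul (Bdd.const m)), integral_mul_const]
    rw [e3]
    refine (abs_E_le_of_le (g := fun ω => |nestedK (Kop K) w (X T' ω) - m|) (by fun_prop)
      fun ω => ?_).trans ?_
    · rw [abs_mul]
      exact mul_le_of_le_one_left (abs_nonneg _) (hb ω)
    · rw [hX.integral_eq (g := fun x => |nestedK (Kop K) w x - m|) (by
        have : Bdd fun x => |nestedK (Kop K) w x - m| := by fun_prop
        exact this.1)]
      exact integral_abs_nestedK_gaps_le hX.bind h1'.2 (fun q hq => h1'.1 q hq) (by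
        simp only [List.length_cons] at h2
        omega) t

end MarkovChain

/-! ### Monotonic observables -/

section Monotonic

lemma ordConnected_inter_lt {g : ℝ → ℝ} {I : Set ℝ} (hI : I.OrdConnected)
    (hg : MonotoneOn g I ∨ AntitoneOn g I) (b : ℝ) : (I ∩ {x | b < g x}).OrdConnected := by
  refine ⟨fun x hx y hy z hz => ?_⟩
  have hzI : z ∈ I := hI.out hx.1 hy.1 hz
  refine ⟨hzI, ?_⟩
  rcases hg with hg | hg
  · exact lt_of_lt_of_le hx.2 (hg hx.1 hzI hz.1)
  · exact lt_of_lt_of_le hy.2 (hg hzI hy.1 hz.2)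

lemma measurable_of_monotoneOn_ordConnected {g : ℝ → ℝ} {I : Set ℝ} (hI : I.OrdConnected)
    (hg : MonotoneOn g I ∨ AntitoneOn g I) (h0 : ∀ x ∉ I, g x = 0) : Measurable g := by
  refine measurable_of_Ioi fun b => ?_
  have h1 : g ⁻¹' Ioi b = (I ∩ {x | b < g x}) ∪ (Iᶜ ∩ {_x : ℝ | b < 0}) := by
    ext x
    by_cases hx : x ∈ I
    · simp [hx]
    · simp [hx, h0 x hx]
  rw [h1]
  exact (ordConnected_inter_lt hI hg b).measurableSet.union
    (hI.measurableSet.compl.inter (MeasurableSet.const _))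

/-- Truncation to `[-b, b]`. -/
def clip (b x : ℝ) : ℝ := max (-b) (min x b)

lemma abs_clip_le {b : ℝ} (hb : 0 ≤ b) (x : ℝ) : |clip b x| ≤ b := by
  unfold clip
  rw [abs_le]
  exact ⟨le_max_left _ _, max_le (by linarith) (min_le_right _ _)⟩

lemma clip_eq_self {b x : ℝ} (hx : |x| ≤ b) : clip b x = x := by
  rw [abs_le] at hx
  rw [clip, min_eq_left hx.2, max_eq_right hx.1]

lemma abs_clip_le_abs {b : ℝ} (hb : 0 ≤ b) (x : ℝ) : |clip b x| ≤ |x| := by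
  rcases le_or_gt |x| b with h | h
  · rw [clip_eq_self h]
  · exact (abs_clip_le hb x).trans h.le

lemma clip_zero_right {b : ℝ} (hb : 0 ≤ b) : clip b 0 = 0 := clip_eq_self (by simpa using hb)

lemma clip_mono (b : ℝ) : Monotone (clip b) := fun _ _ h =>
  max_le_max le_rfl (min_le_min h le_rfl)

lemma measurable_clip (b : ℝ) : Measurable (clip b) := (clip_mono b).measurable

lemma abs_sub_clip_le {b : ℝ} (hb : 0 ≤ b) (x : ℝ) : |x - clip b x| ≤ |x| := by
  rcases le_or_gt |x| b with h | h
  · simp [clip_eq_self h]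
  · rcases le_total 0 x with hx | hx
    · rw [abs_of_nonneg hx] at h
      rw [clip, min_eq_right h.le, max_eq_right (by linarith), abs_of_nonneg hx, abs_of_nonneg] <;>
        linarith
    · rw [abs_of_nonpos hx] at h
      rw [clip, min_eq_left (by linarith), max_eq_left (by linarith), abs_of_nonpos hx,
        abs_of_nonpos] <;> linarith

variable {M : ℝ} {p : ℝ≥0∞} {μ : Measure ℝ} {g : ℝ → ℝ}

lemma Mon.measurable (hg : Mon M p μ g) : Measurable g := by
  obtain ⟨⟨I, -, h2, h3, h4⟩, -⟩ := hg
  exact measurable_of_monotoneOn_ordConnected h2 h3 h4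

lemma Mon.clip (hg : Mon M p μ g) {b : ℝ} (hb : 0 ≤ b) : Mon M p μ (fun x => clip b (g x)) := by
  obtain ⟨⟨I, h1, h2, h3, h4⟩, h5⟩ := hg
  refine ⟨⟨I, h1, h2, ?_, fun x hx => by
    simp only [h4 x hx, clip_zero_right hb]⟩, ?_⟩
  · exact h3.imp (fun h x hx y hy hxy => clip_mono b (h hx hy hxy))
      fun h x hx y hy hxy => clip_mono b (h hx hy hxy)
  · split_ifs at h5 ⊢ with hp
    · exact measure_mono_null (fun x hx => lt_of_lt_of_le hx (abs_clip_le_abs hb _)) h5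
    · exact fun t ht => (measure_mono fun x hx =>
        lt_of_lt_of_le hx (abs_clip_le_abs hb _)).trans (h5 t ht)

lemma ofReal_rpow_le_tsum {A q : ℝ} (hA : 0 < A) (hq : 0 < q) (x : ℝ) :
    ENNReal.ofReal (|x - _root_.clip A x| ^ q) ≤ ∑' k : ℕ, ENNReal.ofReal ((2 ^ (k + 1) * A) ^ q) *
      ({y : ℝ | 2 ^ k * A / 2 < |y|}.indicator 1 x) := by
  rcases le_or_gt |x| A with h | h
  · rw [clip_eq_self h, sub_self, abs_zero, Real.zero_rpow hq.ne', ENNReal.ofReal_zero]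
    exact zero_le
  · obtain ⟨k, h1, h2⟩ := exists_nat_pow_near ((one_le_div hA).mpr h.le) (one_lt_two (α := ℝ))
    rw [le_div_iff₀ hA] at h1
    rw [div_lt_iff₀ hA] at h2
    refine le_trans ?_ (ENNReal.le_tsum k)
    have hp : 0 < 2 ^ k * A := by positivity
    have hx : x ∈ {y : ℝ | 2 ^ k * A / 2 < |y|} := by
      simp only [mem_ofPred_eq]
      linarith
    rw [indicator_of_mem hx, Pi.one_apply, mul_one]
    exact ENNReal.ofReal_le_ofReal (Real.rpow_le_rpow (abs_nonneg _)
      ((abs_sub_clip_le hA.le x).trans h2.le) hq.le)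

lemma exists_lintegral_tail_le (hM : 0 < M) {q : ℝ} (hq : 0 < q)
    (hqp : p ≠ ∞ → q < p.toReal) : ∃ C : ℝ, 0 ≤ C ∧ ∀ (g : ℝ → ℝ) (L a : ℝ), Mon M p μ g →
      1 ≤ L → 0 ≤ a → (p ≠ ∞ → L ^ (-p.toReal) ≤ a) →
      ∫⁻ x, ENNReal.ofReal (|g x - _root_.clip (M * L) (g x)| ^ q) ∂μ
        ≤ ENNReal.ofReal (C * (a * L ^ q)) := by
  by_cases hpt : p = ∞
  · refine ⟨0, le_rfl, fun g L a hg hL ha _ => ?_⟩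
    have h5 := hg.2
    rw [if_pos hpt] at h5
    rw [zero_mul, ENNReal.ofReal_zero, nonpos_iff_eq_zero]
    rw [lintegral_eq_zero_iff' (by
      have := hg.measurable
      have := (measurable_clip (M * L)).comp this
      simp only [Function.comp_def] at this
      fun_prop)]
    have h6 : ∀ᵐ x ∂μ, ¬ M < |g x| := measure_eq_zero_iff_ae_notMem.mp h5
    filter_upwards [h6] with x hx
    rw [clip_eq_self (by nlinarith [not_lt.mp hx]), sub_self, abs_zero, Real.zero_rpow hq.ne']
    simp
  · have hqp' := hqp hpt
    set p' := p.toReal with hp'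
    set ρ : ℝ := 2 ^ (q - p') with hρ
    have hρ0 : 0 ≤ ρ := by positivity
    have hρ1 : ρ < 1 := Real.rpow_lt_one_of_one_lt_of_neg one_lt_two (by linarith)
    set D : ℝ := 2 ^ q * 2 ^ p' * M ^ q with hD
    have hD0 : 0 ≤ D := by positivity
    refine ⟨D * (1 - ρ)⁻¹, mul_nonneg hD0 (inv_nonneg.mpr (by linarith)),
      fun g L a hg hL ha hLa => ?_⟩
    have hLa := hLa hpt
    have hL0 : 0 < L := by linarith
    have h5 := hg.2
    rw [if_neg hpt] at h5
    have hgm := hg.measurable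
    calc ∫⁻ x, ENNReal.ofReal (|g x - _root_.clip (M * L) (g x)| ^ q) ∂μ
        ≤ ∫⁻ x, ∑' k : ℕ, ENNReal.ofReal ((2 ^ (k + 1) * (M * L)) ^ q) *
          ({y : ℝ | 2 ^ k * (M * L) / 2 < |y|}.indicator 1 (g x)) ∂μ :=
          lintegral_mono fun x => ofReal_rpow_le_tsum (by positivity) hq (g x)
      _ = ∑' k : ℕ, ENNReal.ofReal ((2 ^ (k + 1) * (M * L)) ^ q) *
          μ {x | 2 ^ k * (M * L) / 2 < |g x|} := by
        have hms : ∀ k : ℕ, MeasurableSet {x | 2 ^ k * (M * L) / 2 < |g x|} := fun k =>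
          measurableSet_lt measurable_const (by
            simpa [Real.norm_eq_abs] using hgm.norm)
        have he : ∀ (k : ℕ) (x : ℝ), ({y : ℝ | 2 ^ k * (M * L) / 2 < |y|}.indicator
            (1 : ℝ → ℝ≥0∞) (g x)) = {x | 2 ^ k * (M * L) / 2 < |g x|}.indicator 1 x := fun k x => by
          simp [Set.indicator]
        simp only [he]
        rw [lintegral_tsum fun k => ((measurable_one.indicator (hms k)).const_mul _).aemeasurable]
        refine tsum_congr fun k => ?_
        rw [lintegral_const_mul _ (measurable_one.indicator (hms k)),
          lintegral_indicator_one (hms k)]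
      _ ≤ ∑' k : ℕ, ENNReal.ofReal (D * (a * L ^ q) * ρ ^ k) := by
        refine ENNReal.tsum_le_tsum fun k => ?_
        refine (mul_le_mul_right (h5 _ (by positivity)) _).trans ?_
        rw [← ENNReal.ofReal_mul (by positivity)]
        refine ENNReal.ofReal_le_ofReal ?_
        have e1 : ((2:ℝ) ^ (k + 1) * (M * L)) ^ q = 2 ^ q * (2 ^ k) ^ q * M ^ q * L ^ q := by
          rw [Real.mul_rpow (by positivity) (by positivity), Real.mul_rpow hM.le hL0.le, pow_succ',
            Real.mul_rpow (by positivity) (by positivity)]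
          ring
        have e2 : M ^ p' * (2 ^ k * (M * L) / 2) ^ (-p') = 2 ^ p' * (2 ^ k) ^ (-p') * L ^ (-p') := by
          have e3 : (2:ℝ) ^ k * (M * L) / 2 = 2⁻¹ * (2 ^ k * (M * L)) := by ring
          rw [e3, Real.mul_rpow (by positivity) (by positivity),
            Real.mul_rpow (by positivity) (by positivity), Real.mul_rpow hM.le hL0.le,
            Real.inv_rpow (by positivity), Real.rpow_neg (x := 2) (by positivity), inv_inv,
            Real.rpow_neg hM.le]
          have : M ^ p' ≠ 0 := (Real.rpow_pos_of_pos hM _).ne'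
          field_simp
        have e4 : ((2:ℝ) ^ k) ^ q * (2 ^ k) ^ (-p') = ρ ^ k := by
          rw [← Real.rpow_add (by positivity), ← sub_eq_add_neg, hρ, ← Real.rpow_natCast,
            ← Real.rpow_natCast, ← Real.rpow_mul (by norm_num), ← Real.rpow_mul (by norm_num),
            mul_comm]
        rw [e1, e2]
        calc 2 ^ q * (2 ^ k) ^ q * M ^ q * L ^ q * (2 ^ p' * (2 ^ k) ^ (-p') * L ^ (-p'))
            = D * (L ^ (-p') * L ^ q) * ((2 ^ k) ^ q * (2 ^ k) ^ (-p')) := by rw [hD]; ring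
          _ = D * (L ^ (-p') * L ^ q) * ρ ^ k := by rw [e4]
          _ ≤ D * (a * L ^ q) * ρ ^ k := by gcongr
      _ = ENNReal.ofReal (D * (1 - ρ)⁻¹ * (a * L ^ q)) := by
        rw [← ENNReal.ofReal_tsum_of_nonneg (fun k => by positivity)
          ((summable_geometric_of_lt_one hρ0 hρ1).mul_left _), tsum_mul_left,
          tsum_geometric_of_lt_one hρ0 hρ1]
        congr 1
        ring

end Monotonic

/-! ### Approximation by combinations of half-line indicators -/

section Approximation

/-- `Z` is a combination of half-line indicators with total weight at most `V`. -/
def IsComb (V : ℝ) (Z : ℝ → ℝ) : Prop :=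
  ∃ (n : ℕ) (c t : Fin n → ℝ), ∑ i, |c i| ≤ V ∧ ∀ x, Z x = ∑ i, c i * indic (t i) x

lemma IsComb.bdd {V : ℝ} {Z : ℝ → ℝ} (h : IsComb V Z) : Bdd Z := by
  obtain ⟨n, c, t, -, hZ⟩ := h
  rw [show Z = fun x => ∑ i, c i * indic (t i) x from funext hZ]
  exact Bdd.sum _ fun i => (Bdd.const _).mul (bdd_indic _)

lemma IsComb.abs_le {V : ℝ} {Z : ℝ → ℝ} (h : IsComb V Z) (x : ℝ) : |Z x| ≤ V := by
  obtain ⟨n, c, t, hV, hZ⟩ := h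
  rw [hZ]
  refine (Finset.abs_sum_le_sum_abs _ _).trans (le_trans (Finset.sum_le_sum fun i _ => ?_) hV)
  rw [abs_mul, abs_of_nonneg (indic_mem (t i) x).1]
  exact mul_le_of_le_one_right (abs_nonneg _) (indic_mem (t i) x).2

lemma IsComb.add {V W : ℝ} {Z Z' : ℝ → ℝ} (h : IsComb V Z) (h' : IsComb W Z') :
    IsComb (V + W) (fun x => Z x + Z' x) := by
  obtain ⟨n, c, t, hV, hZ⟩ := h
  obtain ⟨m, d, s, hW, hZ'⟩ := h'
  refine ⟨n + m, Fin.append c d, Fin.append t s, ?_, fun x => ?_⟩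
  · simpa [Fin.sum_univ_add] using add_le_add hV hW
  · simp [Fin.sum_univ_add, hZ, hZ']

lemma IsComb.const_mul {V : ℝ} {Z : ℝ → ℝ} (h : IsComb V Z) (b : ℝ) :
    IsComb (|b| * V) (fun x => b * Z x) := by
  obtain ⟨n, c, t, hV, hZ⟩ := h
  refine ⟨n, fun i => b * c i, t, ?_, fun x => ?_⟩
  · simp only [abs_mul, ← Finset.mul_sum]
    exact mul_le_mul_of_nonneg_left hV (abs_nonneg b)
  · simp only [hZ, Finset.mul_sum, mul_assoc]

lemma isComb_zero : IsComb 0 (fun _ => 0) := ⟨0, Fin.elim0, Fin.elim0, by simp, by simp⟩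

variable {μ : Measure ℝ} [IsProbabilityMeasure μ]

/-- Bounded functions in the `L¹`-closure of the combinations of total weight at most `V`. -/
def Appr (μ : Measure ℝ) (V : ℝ) (F : ℝ → ℝ) : Prop :=
  Bdd F ∧ ∀ η : ℝ, 0 < η → ∃ Z, IsComb V Z ∧ ∫ x, |F x - Z x| ∂μ ≤ η

lemma Appr.add {V W : ℝ} {F G : ℝ → ℝ} (hF : Appr μ V F) (hG : Appr μ W G) :
    Appr μ (V + W) (fun x => F x + G x) := by
  refine ⟨hF.1.add hG.1, fun η hη => ?_⟩
  obtain ⟨Z, hZ, h1⟩ := hF.2 (η / 2) (by positivity)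
  obtain ⟨Z', hZ', h2⟩ := hG.2 (η / 2) (by positivity)
  refine ⟨_, hZ.add hZ', ?_⟩
  have b1 := hF.1
  have b2 := hG.1
  have b3 := hZ.bdd
  have b4 := hZ'.bdd
  calc ∫ x, |F x + G x - (Z x + Z' x)| ∂μ ≤ ∫ x, (|F x - Z x| + |G x - Z' x|) ∂μ := by
        refine E_mono (by fun_prop) (by fun_prop) fun x => ?_
        rw [show F x + G x - (Z x + Z' x) = (F x - Z x) + (G x - Z' x) by ring]
        exact abs_add_le _ _
    _ ≤ η := by
        rw [E_add (by fun_prop) (by fun_prop)]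
        linarith

omit [IsProbabilityMeasure μ] in
lemma Appr.const_mul {V : ℝ} {F : ℝ → ℝ} (hF : Appr μ V F) (b : ℝ) :
    Appr μ (|b| * V) (fun x => b * F x) := by
  refine ⟨(Bdd.const b).mul hF.1, fun η hη => ?_⟩
  obtain ⟨Z, hZ, h1⟩ := hF.2 (η / (|b| + 1)) (by positivity)
  refine ⟨_, hZ.const_mul b, ?_⟩
  simp only [← mul_sub, abs_mul, integral_const_mul]
  calc |b| * ∫ x, |F x - Z x| ∂μ ≤ |b| * (η / (|b| + 1)) := by gcongr
    _ ≤ η := by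
      rw [mul_div_assoc', div_le_iff₀ (by positivity)]
      nlinarith [abs_nonneg b]

omit [IsProbabilityMeasure μ] in
lemma appr_zero : Appr μ 0 (fun _ => 0) :=
  ⟨Bdd.const 0, fun η hη => ⟨_, isComb_zero, by simpa using hη.le⟩⟩

omit [IsProbabilityMeasure μ] in
lemma Appr.weaken {V W : ℝ} {F : ℝ → ℝ} (hF : Appr μ V F) (h : V ≤ W) : Appr μ W F := by
  refine ⟨hF.1, fun η hη => ?_⟩
  obtain ⟨Z, ⟨n, c, t, hV, hZ⟩, h1⟩ := hF.2 η hη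
  exact ⟨Z, ⟨n, c, t, hV.trans h, hZ⟩, h1⟩

lemma Appr.sum {ι : Type*} (s : Finset ι) {V : ι → ℝ} {F : ι → ℝ → ℝ}
    (hF : ∀ i, Appr μ (V i) (F i)) : Appr μ (∑ i ∈ s, V i) (fun x => ∑ i ∈ s, F i x) := by
  classical
  induction s using Finset.induction_on with
  | empty => simpa using appr_zero
  | insert i s hi ih =>
    simp only [Finset.sum_insert hi]
    exact (hF i).add ih

lemma Appr.of_forall {V : ℝ} {F : ℝ → ℝ} (hb : Bdd F)
    (h : ∀ η : ℝ, 0 < η → ∃ G, Appr μ V G ∧ ∀ x, |F x - G x| ≤ η) : Appr μ V F := by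
  refine ⟨hb, fun η hη => ?_⟩
  obtain ⟨G, hG, h1⟩ := h (η / 2) (by positivity)
  obtain ⟨Z, hZ, h2⟩ := hG.2 (η / 2) (by positivity)
  refine ⟨Z, hZ, ?_⟩
  have b1 := hG.1
  have b2 := hZ.bdd
  calc ∫ x, |F x - Z x| ∂μ ≤ ∫ x, (η / 2 + |G x - Z x|) ∂μ := by
        refine E_mono (by fun_prop) (by fun_prop) fun x => ?_
        have := abs_sub_le (F x) (G x) (Z x)
        linarith [h1 x]
    _ ≤ η := by
        rw [E_add (by fun_prop) (by fun_prop), E_const]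
        linarith

lemma Appr.of_tendsto {D : Set ℝ} (hD : MeasurableSet D) (t : ℕ → ℝ)
    (h : ∀ x, ∀ᶠ n in atTop, (x ≤ t n ↔ x ∈ D)) : Appr μ 1 (D.indicator fun _ => 1) := by
  have hb : Bdd (D.indicator fun _ => (1:ℝ)) :=
    ⟨measurable_const.indicator hD, 1, fun x => by
      by_cases hx : x ∈ D <;> simp [hx]⟩
  refine ⟨hb, fun η hη => ?_⟩
  have hlim : Tendsto (fun n => ∫ x, |D.indicator (fun _ => (1:ℝ)) x - indic (t n) x| ∂μ) atTop
      (𝓝 (∫ _, (0:ℝ) ∂μ)) := by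
    refine tendsto_integral_of_dominated_convergence (fun _ => 2) (fun n => ?_)
      (integrable_const _) (fun n => ?_) ?_
    · exact (hb.sub (bdd_indic _)).abs.1.aestronglyMeasurable
    · refine ae_of_all _ fun x => ?_
      have h1 := indic_mem (t n) x
      rw [Real.norm_eq_abs, abs_abs]
      by_cases hx : x ∈ D <;> simp only [hx, indicator_of_mem, indicator_of_notMem,
        not_false_eq_true] <;> rw [abs_le] <;> constructor <;> linarith [h1.1, h1.2]
    · refine ae_of_all _ fun x => tendsto_const_nhds.congr' ?_
      filter_upwards [h x] with n hn
      unfold indic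
      by_cases hx : x ∈ D
      · simp [hx, hn.mpr hx]
      · simp [hx, mt hn.mp hx]
  rw [integral_zero] at hlim
  obtain ⟨n, hn⟩ := (hlim.eventually (gt_mem_nhds hη)).exists
  exact ⟨indic (t n), ⟨1, fun _ => 1, fun _ => t n, by simp, by simp⟩, hn.le⟩

lemma IsLowerSet.appr {D : Set ℝ} (hD : IsLowerSet D) : Appr μ 1 (D.indicator fun _ => 1) := by
  have hm : MeasurableSet D := hD.ordConnected.measurableSet
  by_cases hne : D.Nonempty
  swap
  · rw [not_nonempty_iff_eq_empty] at hne
    subst hne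
    refine Appr.of_tendsto hm (fun n => -(n:ℝ)) fun x => ?_
    obtain ⟨n, hn⟩ := exists_nat_gt (-x)
    filter_upwards [eventually_ge_atTop n] with k hk
    have : (n:ℝ) ≤ k := by exact_mod_cast hk
    simp only [mem_empty_iff_false, iff_false, not_le]
    linarith
  by_cases hbd : BddAbove D
  swap
  · have hu : D = univ := by
      refine eq_univ_of_forall fun x => ?_
      obtain ⟨y, hy, hxy⟩ := not_bddAbove_iff.mp hbd x
      exact hD hxy.le hy
    subst hu
    refine Appr.of_tendsto hm (fun n => (n:ℝ)) fun x => ?_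
    obtain ⟨n, hn⟩ := exists_nat_gt x
    filter_upwards [eventually_ge_atTop n] with k hk
    have : (n:ℝ) ≤ k := by exact_mod_cast hk
    simp only [mem_univ, iff_true]
    linarith
  set s := sSup D with hs
  have h1 : ∀ x, x < s → x ∈ D := fun x hx => by
    obtain ⟨y, hy, hxy⟩ := exists_lt_of_lt_csSup hne hx
    exact hD hxy.le hy
  have h2 : ∀ x ∈ D, x ≤ s := fun x hx => le_csSup hbd hx
  by_cases hsD : s ∈ D
  · exact Appr.of_tendsto hm (fun _ => s) fun x => .of_forall fun _ => ⟨fun hx => hD hx hsD, h2 x⟩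
  · refine Appr.of_tendsto hm (fun n => s - 1 / ((n:ℝ) + 1)) fun x => ?_
    by_cases hx : x < s
    · have h3 : Tendsto (fun n : ℕ => s - 1 / ((n:ℝ) + 1)) atTop (𝓝 (s - 0)) :=
        tendsto_const_nhds.sub tendsto_one_div_add_atTop_nhds_zero_nat
      rw [sub_zero] at h3
      filter_upwards [h3.eventually (lt_mem_nhds hx)] with n hn
      exact ⟨fun _ => h1 x hx, fun _ => hn.le⟩
    · refine .of_forall fun n => ⟨fun h => ?_, fun h => ?_⟩
      · have : 0 < 1 / ((n:ℝ) + 1) := by positivity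
        linarith
      · exact absurd (lt_of_le_of_ne (h2 x h) fun e => hsD (e ▸ h)) hx

lemma Set.OrdConnected.appr {J : Set ℝ} (hJ : J.OrdConnected) :
    Appr μ 2 (J.indicator fun _ => 1) := by
  by_cases hne : J.Nonempty
  swap
  · rw [not_nonempty_iff_eq_empty] at hne
    subst hne
    simpa using (appr_zero (μ := μ)).weaken (W := 2) (by norm_num)
  have h1 : IsLowerSet {x : ℝ | ∃ y ∈ J, x ≤ y} := fun a b hab ⟨y, hy, h⟩ => ⟨y, hy, hab.trans h⟩
  have h2 : IsLowerSet {x : ℝ | ∀ y ∈ J, x < y} := fun a b hab h y hy => lt_of_le_of_lt hab (h y hy)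
  have h3 := (IsLowerSet.appr (μ := μ) h1).add ((IsLowerSet.appr (μ := μ) h2).const_mul (-1))
  have h4 : (fun x => ({x : ℝ | ∃ y ∈ J, x ≤ y}.indicator (fun _ => (1:ℝ)) x +
      -1 * {x : ℝ | ∀ y ∈ J, x < y}.indicator (fun _ => (1:ℝ)) x)) = J.indicator fun _ => 1 := by
    funext x
    by_cases hx : x ∈ J
    · have e1 : x ∈ {x : ℝ | ∃ y ∈ J, x ≤ y} := ⟨x, hx, le_rfl⟩
      have e2 : x ∉ {x : ℝ | ∀ y ∈ J, x < y} := fun h => lt_irrefl _ (h x hx)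
      rw [indicator_of_mem e1, indicator_of_notMem e2, indicator_of_mem hx]
      norm_num
    · by_cases e1 : x ∈ {x : ℝ | ∃ y ∈ J, x ≤ y}
      · have e2 : x ∈ {x : ℝ | ∀ y ∈ J, x < y} := fun z hz => by
          obtain ⟨y, hy, hxy⟩ := e1
          by_contra h
          exact hx (hJ.out hz hy ⟨not_lt.mp h, hxy⟩)
        rw [indicator_of_mem e1, indicator_of_mem e2, indicator_of_notMem hx]
        norm_num
      · have e2 : x ∉ {x : ℝ | ∀ y ∈ J, x < y} := fun h => by
          obtain ⟨y, hy⟩ := hne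
          exact e1 ⟨y, hy, (h y hy).le⟩
        rw [indicator_of_notMem e1, indicator_of_notMem e2, indicator_of_notMem hx]
        norm_num
  rw [h4] at h3
  exact h3.weaken (by norm_num)

end Approximation

section Decomposition

variable {μ : Measure ℝ} [IsProbabilityMeasure μ]

lemma sum_range_lt_eq {y : ℝ} {k : ℕ} (hy : y ≤ k) :
    ∑ m ∈ Finset.range k, (if (m:ℝ) < y then (1:ℝ) else 0) = (⌈y⌉₊ : ℝ) := by
  have h1 : ⌈y⌉₊ ≤ k := Nat.ceil_le.mpr hy
  simp only [← Nat.lt_ceil, Finset.sum_boole]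
  congr 1
  have : Finset.filter (fun m => m < ⌈y⌉₊) (Finset.range k) = Finset.range ⌈y⌉₊ := by
    ext m
    simp only [Finset.mem_filter, Finset.mem_range]
    omega
  rw [this, Finset.card_range]

lemma appr_of_monotoneOn {g : ℝ → ℝ} {I : Set ℝ} (hI : I.OrdConnected)
    (hg : MonotoneOn g I ∨ AntitoneOn g I) (h0 : ∀ x ∉ I, g x = 0) {B : ℝ} (hB : 0 < B)
    (hgB : ∀ x, |g x| ≤ B) : Appr μ (6 * B) g := by
  have hm := measurable_of_monotoneOn_ordConnected hI hg h0
  refine Appr.of_forall ⟨hm, B, hgB⟩ fun η hη => ?_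
  obtain ⟨k, hk⟩ := exists_nat_gt (2 * B / η)
  have hk0 : (0:ℝ) < k := lt_of_le_of_lt (by positivity) hk
  refine ⟨_, (((Set.OrdConnected.appr (μ := μ) hI).const_mul (-B)).add
    (Appr.sum (Finset.range k) fun m : ℕ => ((Set.OrdConnected.appr (μ := μ)
      (ordConnected_inter_lt hI hg (2 * B * m / k - B))).const_mul (2 * B / k)))).weaken ?_,
    fun x => ?_⟩
  · rw [abs_neg, abs_of_pos hB, abs_of_pos (by positivity), Finset.sum_const, Finset.card_range,
      nsmul_eq_mul]
    have : (k:ℝ) * (2 * B / k * 2) = 4 * B := by field_simp; norm_num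
    linarith
  · by_cases hx : x ∈ I
    · have hb := abs_le.mp (hgB x)
      set y := k * (g x + B) / (2 * B) with hy
      have hy0 : 0 ≤ y := div_nonneg (mul_nonneg hk0.le (by linarith)) (by positivity)
      have hyk : y ≤ k := by
        rw [hy, div_le_iff₀ (by positivity)]
        exact mul_le_mul_of_nonneg_left (by linarith) hk0.le
      have h1 : ∀ m : ℕ, (I ∩ {x | 2 * B * m / k - B < g x}).indicator (fun _ => (1:ℝ)) x =
          if (m:ℝ) < y then 1 else 0 := fun m => by
        have : 2 * B * m / k - B < g x ↔ (m:ℝ) < y := by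
          rw [hy, lt_div_iff₀ (by positivity), sub_lt_iff_lt_add, div_lt_iff₀ hk0]
          constructor <;> intro h <;> linarith
        by_cases hmy : (m:ℝ) < y
        · rw [if_pos hmy, indicator_of_mem (show x ∈ I ∩ {x | 2 * B * m / k - B < g x} from
            ⟨hx, this.mpr hmy⟩)]
        · rw [if_neg hmy, indicator_of_notMem fun h => hmy (this.mp h.2)]
      simp only [h1, ← Finset.mul_sum, sum_range_lt_eq hyk, indicator_of_mem hx]
      have e1 : g x - (-B * 1 + 2 * B / k * (⌈y⌉₊:ℝ)) = 2 * B / k * (y - ⌈y⌉₊) := by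
        rw [hy]; field_simp; ring
      have e2 := Nat.le_ceil y
      have e3 := Nat.ceil_lt_add_one hy0
      rw [e1, abs_mul, abs_of_pos (by positivity : 0 < 2 * B / k)]
      have e4 : |y - ⌈y⌉₊| ≤ 1 := by rw [abs_le]; constructor <;> linarith
      have e5 : 2 * B / k ≤ η := by
        rw [div_lt_iff₀ hη] at hk
        rw [div_le_iff₀ hk0]
        linarith
      calc 2 * B / k * |y - ⌈y⌉₊| ≤ 2 * B / k * 1 := by gcongr
        _ ≤ η := by linarith
    · have h1 : ∀ m : ℕ, (I ∩ {x | 2 * B * m / k - B < g x}).indicator (fun _ => (1:ℝ)) x = 0 :=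
        fun m => indicator_of_notMem (fun h => hx h.1) _
      simp only [h1, h0 x hx, indicator_of_notMem hx, mul_zero, Finset.sum_const_zero, add_zero,
        sub_zero, abs_zero]
      exact hη.le

/-- The approximation of an observable at truncation level `L`, with error scale `a`. -/
def LevelAppr (μ : Measure ℝ) (C r a L : ℝ) (F : ℝ → ℝ) : Prop :=
  ∃ Z, IsComb (C * L) Z ∧ ∫ x, |F x - Z x| ∂μ ≤ C * a * L ∧
    ∫ x, |F x - Z x| ^ r ∂μ ≤ C * a * L ^ r

lemma rpow_sum_mul_le {n : ℕ} {w h : Fin n → ℝ} (hw : ∀ i, 0 ≤ w i) (hw1 : ∑ i, w i ≤ 1)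
    (hh : ∀ i, 0 ≤ h i) {q : ℝ} (hq : 1 ≤ q) : (∑ i, w i * h i) ^ q ≤ ∑ i, w i * h i ^ q := by
  have := Real.rpow_arith_mean_le_arith_mean_rpow Finset.univ
    (Fin.cons (1 - ∑ i, w i) w : Fin (n + 1) → ℝ) (Fin.cons 0 h : Fin (n + 1) → ℝ)
    (fun i _ => by
      refine Fin.cases ?_ (fun j => ?_) i
      · simpa using hw1
      · simpa using hw j)
    (by simp [Fin.sum_univ_succ])
    (fun i _ => by
      refine Fin.cases ?_ (fun j => ?_) i
      · simp
      · simpa using hh j) hq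
  simpa [Fin.sum_univ_succ, Real.zero_rpow (by linarith : q ≠ 0)] using this

variable {M : ℝ} {p : ℝ≥0∞}

omit [IsProbabilityMeasure μ] in
lemma exists_integral_tail_le (hM : 0 < M) {q : ℝ} (hq : 0 < q) (hqp : p ≠ ∞ → q < p.toReal) :
    ∃ C : ℝ, 0 ≤ C ∧ ∀ (g : ℝ → ℝ) (L a : ℝ), Mon M p μ g → 1 ≤ L → 0 ≤ a →
      (p ≠ ∞ → L ^ (-p.toReal) ≤ a) →
      Integrable (fun x => |g x - clip (M * L) (g x)| ^ q) μ ∧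
      ∫ x, |g x - clip (M * L) (g x)| ^ q ∂μ ≤ C * (a * L ^ q) := by
  obtain ⟨C, hC, h⟩ := exists_lintegral_tail_le (μ := μ) hM hq hqp
  refine ⟨C, hC, fun g L a hg hL ha hLa => ?_⟩
  have hm : Measurable fun x => |g x - clip (M * L) (g x)| ^ q := by
    have h1 := hg.measurable
    have h2 := (measurable_clip (M * L)).comp h1
    simp only [Function.comp_def] at h2
    fun_prop
  have h0 : ∀ x, 0 ≤ |g x - clip (M * L) (g x)| ^ q := fun x => by positivity
  have h1 := h g L a hg hL ha hLa
  refine ⟨⟨hm.aestronglyMeasurable, ?_⟩, ?_⟩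
  · rw [hasFiniteIntegral_iff_ofReal (ae_of_all _ h0)]
    exact h1.trans_lt ENNReal.ofReal_lt_top
  · rw [integral_eq_lintegral_of_nonneg_ae (ae_of_all _ h0) hm.aestronglyMeasurable]
    exact ENNReal.toReal_le_of_le_ofReal (by positivity) h1

lemma Mon.exists_integrable_le (hM : 0 < M) (hp : p ≠ ∞ → 1 < p.toReal) :
    ∃ C : ℝ, 0 ≤ C ∧ ∀ g, Mon M p μ g → Integrable g μ ∧ ∫ x, |g x| ∂μ ≤ C := by
  obtain ⟨C, hC, h⟩ := exists_integral_tail_le (μ := μ) (p := p) hM zero_lt_one hp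
  refine ⟨C + M, by positivity, fun g hg => ?_⟩
  obtain ⟨h1, h2⟩ := h g 1 1 hg le_rfl zero_le_one fun _ => by simp
  simp only [mul_one, Real.rpow_one] at h1 h2
  have hb : Bdd fun x => _root_.clip M (g x) :=
    ⟨(measurable_clip M).comp hg.measurable, M, fun x => abs_clip_le hM.le _⟩
  have hle : ∀ x, |g x| ≤ |g x - _root_.clip M (g x)| + M := fun x => by
    have e1 := abs_sub_abs_le_abs_sub (g x) (_root_.clip M (g x))
    have e2 := abs_clip_le hM.le (g x)
    linarith
  have hi : Integrable (fun x => |g x - _root_.clip M (g x)| + M) μ := h1.add (integrable_const M)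
  have hgi : Integrable g μ := hi.mono' hg.measurable.aestronglyMeasurable (ae_of_all _ hle)
  refine ⟨hgi, (integral_mono hgi.abs hi hle).trans ?_⟩
  rw [integral_add h1 (integrable_const M), E_const]
  linarith

/-- Bounded elements of the convex class, centered, satisfy the approximation property at every
level. -/
lemma exists_levelAppr (hM : 0 < M) {r : ℝ} (hr : 1 < r) (hrp : p ≠ ∞ → r < p.toReal) :
    ∃ C : ℝ, 1 ≤ C ∧ ∀ (n : ℕ) (w : Fin n → ℝ) (g : Fin n → ℝ → ℝ), ∑ i, |w i| ≤ 1 →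
      (∀ i, Mon M p μ (g i)) → (∀ i, Bdd (g i)) → ∀ L a : ℝ, 1 ≤ L → 0 < a → a ≤ 1 →
      (p ≠ ∞ → L ^ (-p.toReal) ≤ a) →
      LevelAppr μ C r a L
        (fun x => ∑ i, w i * g i x - ∫ y, ∑ i, w i * g i y ∂μ) := by
  obtain ⟨C1, hC1, h1⟩ := exists_integral_tail_le (μ := μ) (p := p) hM zero_lt_one
    (fun h => hr.trans (hrp h))
  obtain ⟨C2, hC2, h2⟩ := exists_integral_tail_le (μ := μ) (p := p) hM (zero_lt_one.trans hr) hrp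
  obtain ⟨C3, hC3, h3⟩ := Mon.exists_integrable_le (μ := μ) (p := p) hM (fun h => hr.trans (hrp h))
  refine ⟨max (max 1 (C1 + 1)) (max (2 ^ r * (C2 + 1)) (6 * M + C3)),
    (le_max_left _ _).trans (le_max_left _ _), fun n w g hw hg hgb L a hL ha ha1 hLa => ?_⟩
  set C := max (max 1 (C1 + 1)) (max (2 ^ r * (C2 + 1)) (6 * M + C3)) with hC
  have hCa : C1 + 1 ≤ C := (le_max_right _ _).trans (le_max_left _ _)
  have hCb : 2 ^ r * (C2 + 1) ≤ C := (le_max_left _ _).trans (le_max_right _ _)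
  have hCc : 6 * M + C3 ≤ C := (le_max_right _ _).trans (le_max_right _ _)
  have hL0 : 0 < L := by linarith
  have hr0 : 0 < r := by linarith
  set m := ∫ y, ∑ i, w i * g i y ∂μ with hm
  have hmC : |m| ≤ C3 := by
    rw [hm, E_sum (f := fun i y => w i * g i y) Finset.univ fun i => (Bdd.const _).mul (hgb i)]
    refine (Finset.abs_sum_le_sum_abs _ _).trans ?_
    calc ∑ i, |∫ y, w i * g i y ∂μ| ≤ ∑ i, |w i| * C3 := by
          refine Finset.sum_le_sum fun i _ => ?_
          rw [integral_const_mul, abs_mul]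
          exact mul_le_mul_of_nonneg_left (abs_E_le.trans (h3 _ (hg i)).2) (abs_nonneg _)
      _ = (∑ i, |w i|) * C3 := by rw [Finset.sum_mul]
      _ ≤ C3 := mul_le_of_le_one_left hC3 hw
  set t : Fin n → ℝ → ℝ := fun i x => clip (M * L) (g i x) with ht
  have htb : ∀ i, Bdd (t i) := fun i =>
    ⟨(measurable_clip _).comp (hgb i).1, M * L, fun x => abs_clip_le (by positivity) _⟩
  have hta : ∀ i, Appr μ (6 * (M * L)) (t i) := fun i => by
    obtain ⟨⟨I, -, e2, e3, e4⟩, -⟩ := (hg i).clip (b := M * L) (by positivity)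
    exact appr_of_monotoneOn e2 e3 e4 (by positivity) fun x => abs_clip_le (by positivity) _
  set G : ℝ → ℝ := fun x => ∑ i, w i * t i x - m with hG
  set F : ℝ → ℝ := fun x => ∑ i, w i * g i x - m with hF
  have huniv : Appr μ 1 (fun _ => (1:ℝ)) := by
    simpa only [indicator_univ] using IsLowerSet.appr (μ := μ) isLowerSet_univ
  have hGA : Appr μ (C * L) G := by
    have e := (Appr.sum Finset.univ fun i => (hta i).const_mul (w i)).add (huniv.const_mul (-m))
    have e' : (fun x => ∑ i, w i * t i x + -m * 1) = G := by
      funext x; rw [hG]; ring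
    rw [e'] at e
    refine e.weaken ?_
    rw [← Finset.sum_mul, abs_neg]
    calc (∑ i, |w i|) * (6 * (M * L)) + |m| * 1 ≤ 1 * (6 * (M * L)) + C3 * L := by
          gcongr
      _ = (6 * M + C3) * L := by ring
      _ ≤ C * L := by gcongr
  have hFb : Bdd F := (Bdd.sum Finset.univ fun i => (Bdd.const (w i)).mul (hgb i)).sub (Bdd.const m)
  obtain ⟨D, hD0, hD⟩ : ∃ D : ℝ, 0 ≤ D ∧ ∀ x, |G x| ≤ D := by
    obtain ⟨-, D, hD⟩ := hGA.1
    exact ⟨D, (abs_nonneg _).trans (hD 0), hD⟩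
  have hE : 0 < D + C * L + 1 := by
    have : 0 ≤ C * L := mul_nonneg (by linarith) hL0.le
    linarith
  set η : ℝ := min (a * L) (a * L ^ r / (D + C * L + 1) ^ (r - 1)) with hη
  have hη0 : 0 < η := lt_min (by positivity) (by positivity)
  obtain ⟨Z, hZ, hGZ⟩ := hGA.2 η hη0
  have hZb := hZ.bdd
  have hGb := hGA.1
  have hdiff : ∀ x, |F x - G x| ≤ ∑ i, |w i| * |g i x - t i x| := fun x => by
    have : F x - G x = ∑ i, w i * (g i x - t i x) := by
      simp only [hF, hG, mul_sub, Finset.sum_sub_distrib]; ring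
    rw [this]
    refine (Finset.abs_sum_le_sum_abs _ _).trans (le_of_eq ?_)
    simp only [abs_mul]
  have hgt : ∀ i, Bdd fun x => g i x - t i x := fun i => (hgb i).sub (htb i)
  have hFG1 : ∫ x, |F x - G x| ∂μ ≤ C1 * (a * L) := by
    calc ∫ x, |F x - G x| ∂μ ≤ ∫ x, ∑ i, |w i| * |g i x - t i x| ∂μ :=
          E_mono (by fun_prop)
            (Bdd.sum Finset.univ fun i => (Bdd.const _).mul (hgt i).abs) hdiff
      _ = ∑ i, |w i| * ∫ x, |g i x - t i x| ∂μ := by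
          rw [E_sum Finset.univ fun i => (Bdd.const _).mul (hgt i).abs]
          simp only [integral_const_mul]
      _ ≤ ∑ i, |w i| * (C1 * (a * L)) := by
          refine Finset.sum_le_sum fun i _ => mul_le_mul_of_nonneg_left ?_ (abs_nonneg _)
          have := (h1 _ L a (hg i) hL ha.le hLa).2
          simpa only [Real.rpow_one] using this
      _ = (∑ i, |w i|) * (C1 * (a * L)) := by rw [Finset.sum_mul]
      _ ≤ C1 * (a * L) := mul_le_of_le_one_left (by positivity) hw
  have hFGr : ∫ x, |F x - G x| ^ r ∂μ ≤ C2 * (a * L ^ r) := by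
    have hbr : ∀ i, Bdd fun x => |g i x - t i x| ^ r := fun i =>
      (hgt i).abs.rpow (fun x => abs_nonneg _) hr0.le
    calc ∫ x, |F x - G x| ^ r ∂μ ≤ ∫ x, ∑ i, |w i| * |g i x - t i x| ^ r ∂μ := by
          refine E_mono ((hFb.sub hGb).abs.rpow (fun x => abs_nonneg _) hr0.le)
            (Bdd.sum Finset.univ fun i => (Bdd.const _).mul (hbr i)) fun x => ?_
          exact (Real.rpow_le_rpow (abs_nonneg _) (hdiff x) hr0.le).trans
            (rpow_sum_mul_le (fun i => abs_nonneg _) hw (fun i => abs_nonneg _) hr.le)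
      _ = ∑ i, |w i| * ∫ x, |g i x - t i x| ^ r ∂μ := by
          rw [E_sum Finset.univ fun i => (Bdd.const _).mul (hbr i)]
          simp only [integral_const_mul]
      _ ≤ ∑ i, |w i| * (C2 * (a * L ^ r)) :=
          Finset.sum_le_sum fun i _ => mul_le_mul_of_nonneg_left
            (h2 _ L a (hg i) hL ha.le hLa).2 (abs_nonneg _)
      _ = (∑ i, |w i|) * (C2 * (a * L ^ r)) := by rw [Finset.sum_mul]
      _ ≤ C2 * (a * L ^ r) := mul_le_of_le_one_left (by positivity) hw
  refine ⟨Z, hZ, ?_, ?_⟩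
  · calc ∫ x, |F x - Z x| ∂μ ≤ ∫ x, (|F x - G x| + |G x - Z x|) ∂μ :=
          E_mono (by fun_prop) (by fun_prop) fun x => abs_sub_le _ _ _
      _ ≤ C1 * (a * L) + a * L := by
          rw [E_add (by fun_prop) (by fun_prop)]
          exact add_le_add hFG1 (hGZ.trans (min_le_left _ _))
      _ = (C1 + 1) * a * L := by ring
      _ ≤ C * a * L := by gcongr
  · have b1 : Bdd fun x => |F x - G x| ^ r := (hFb.sub hGb).abs.rpow (fun x => abs_nonneg _) hr0.le
    have b2 : Bdd fun x => |G x - Z x| ^ r := (hGb.sub hZb).abs.rpow (fun x => abs_nonneg _) hr0.le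
    have b3 : Bdd fun x => |F x - Z x| ^ r := (hFb.sub hZb).abs.rpow (fun x => abs_nonneg _) hr0.le
    have hGZr : ∫ x, |G x - Z x| ^ r ∂μ ≤ a * L ^ r := by
      calc ∫ x, |G x - Z x| ^ r ∂μ
          ≤ ∫ x, (D + C * L + 1) ^ (r - 1) * |G x - Z x| ∂μ := by
            refine E_mono b2 (by fun_prop) fun x => ?_
            have e1 : |G x - Z x| ≤ D + C * L + 1 := by
              have := abs_sub (G x) (Z x)
              linarith [hD x, hZ.abs_le x]
            rcases (abs_nonneg (G x - Z x)).eq_or_lt with e0 | e0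
            · rw [← e0, Real.zero_rpow hr0.ne', mul_zero]
            · calc |G x - Z x| ^ r = |G x - Z x| ^ (r - 1) * |G x - Z x| := by
                    rw [← Real.rpow_add_one e0.ne']; ring_nf
                _ ≤ _ := by
                    gcongr
        _ ≤ (D + C * L + 1) ^ (r - 1) * (a * L ^ r / (D + C * L + 1) ^ (r - 1)) := by
            rw [integral_const_mul]
            gcongr
            exact hGZ.trans (min_le_right _ _)
        _ = a * L ^ r := by
            have : (D + C * L + 1) ^ (r - 1) ≠ 0 := (Real.rpow_pos_of_pos hE _).ne'
            field_simp
    calc ∫ x, |F x - Z x| ^ r ∂μ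
        ≤ ∫ x, 2 ^ r * (|F x - G x| ^ r + |G x - Z x| ^ r) ∂μ := by
          refine E_mono b3 (by fun_prop) fun x => ?_
          exact (Real.rpow_le_rpow (abs_nonneg _) (abs_sub_le _ (G x) _) hr0.le).trans
            (rpow_add_le_two_rpow (abs_nonneg _) (abs_nonneg _) hr0.le)
      _ ≤ 2 ^ r * (C2 * (a * L ^ r) + a * L ^ r) := by
          rw [integral_const_mul, E_add b1 b2]
          gcongr
      _ = 2 ^ r * (C2 + 1) * a * L ^ r := by ring
      _ ≤ C * a * L ^ r := by gcongr

end Decomposition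

section Levels

variable {Ω : Type*} [mΩ : MeasurableSpace Ω] {P : Measure Ω} [IsProbabilityMeasure P]
  {X : ℕ → Ω → ℝ} {μ : Measure ℝ} [IsProbabilityMeasure μ] {K : Kernel ℝ ℝ} [IsMarkovKernel K]

lemma StatChain.abs_cv_comb_prod_le (hX : StatChain P X μ K) {T g : ℕ} {ξ : Ω → ℝ}
    (hξ : Measurable[past X hX.meas T] ξ) (hb : ∀ ω, |ξ ω| ≤ 1) {V : ℝ} {Z : ℝ → ℝ}
    (hZ : IsComb V Z) (l : List ℕ) (l₀ : List (ℕ × ℝ)) (hl : l₀.length + l.length ≤ 3)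
    (hT : ∀ i ∈ l, T + g ≤ i) (hT₀ : ∀ q ∈ l₀, T + g ≤ q.1) :
    |cv P ξ (fun ω => indProd (fun n => X n ω) l₀ * (l.map fun i => Z (X i ω)).prod)| ≤
      V ^ l.length * alphaCoef (Kop K) μ 3 g := by
  induction l generalizing l₀ with
  | nil =>
    simpa using hX.abs_cv_indProd_le hξ hb l₀ (by simpa using hl) hT₀
  | cons i r ih =>
    have hξb : Bdd ξ := ⟨hξ.mono ((past X hX.meas).le T) le_rfl, 1, hb⟩
    obtain ⟨n, c, t, hV, hZs⟩ := id hZ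
    have hV0 : 0 ≤ V := (Finset.sum_nonneg fun _ _ => abs_nonneg _).trans hV
    have hbi : ∀ l : List (ℕ × ℝ), Bdd fun ω => indProd (fun n => X n ω) l := fun l => by
      simp only [indProd]
      exact Bdd.list_prod (fun q : ℕ × ℝ => (bdd_indic q.2).comp_measurable (hX.meas q.1)) l
    have hbr : Bdd fun ω => (r.map fun i => Z (X i ω)).prod :=
      Bdd.list_prod (fun i => hZ.bdd.comp_measurable (hX.meas i)) r
    have e1 : (fun ω => indProd (fun n => X n ω) l₀ * ((i :: r).map fun i => Z (X i ω)).prod) =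
        fun ω => ∑ k, c k * (indProd (fun n => X n ω) ((i, t k) :: l₀) *
          (r.map fun i => Z (X i ω)).prod) := by
      funext ω
      simp only [List.map_cons, List.prod_cons, hZs (X i ω), indProd, Finset.sum_mul,
        Finset.mul_sum]
      exact Finset.sum_congr rfl fun k _ => by ring
    rw [e1, cv_sum_right _ hξb fun k => (Bdd.const _).mul ((hbi _).mul hbr)]
    simp only [cv_const_mul_right]
    refine (Finset.abs_sum_le_sum_abs _ _).trans ?_
    calc ∑ k, |c k * cv P ξ (fun ω => indProd (fun n => X n ω) ((i, t k) :: l₀) *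
          (r.map fun i => Z (X i ω)).prod)|
        ≤ ∑ k, |c k| * (V ^ r.length * alphaCoef (Kop K) μ 3 g) := by
          refine Finset.sum_le_sum fun k _ => ?_
          rw [abs_mul]
          refine mul_le_mul_of_nonneg_left (ih _ ?_ (fun j hj => hT j (by simp [hj])) ?_)
            (abs_nonneg _)
          · simp only [List.length_cons] at hl ⊢
            omega
          · intro q hq
            rcases List.mem_cons.mp hq with rfl | hq
            · exact hT i (by simp)
            · exact hT₀ q hq
      _ = (∑ k, |c k|) * (V ^ r.length * alphaCoef (Kop K) μ 3 g) := by rw [Finset.sum_mul]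
      _ ≤ V * (V ^ r.length * alphaCoef (Kop K) μ 3 g) :=
          mul_le_mul_of_nonneg_right hV (mul_nonneg (pow_nonneg hV0 _) (alphaCoef_nonneg _ _))
      _ = V ^ (i :: r).length * alphaCoef (Kop K) μ 3 g := by
          rw [List.length_cons, pow_succ]; ring

lemma StatChain.lvl (hX : StatChain P X μ K) {C r a L : ℝ} {g : ℕ} {F : ℝ → ℝ}
    (hF : Measurable F) (h : LevelAppr μ C r a L F) (ha : 0 ≤ a) (ha1 : a ≤ 1) (hC : 1 ≤ C)
    (hL : 1 ≤ L) (hg : alphaCoef (Kop K) μ 3 g ≤ a) :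
    Lvl P (past X hX.meas) (fun j ω => F (X j ω)) C r g a L := by
  obtain ⟨Z, hZ, h1, h2⟩ := h
  have hm : Measurable fun x => |F x - Z x| := (hF.sub hZ.bdd.1).abs
  refine ⟨ha, ha1, hC, hL, fun j ω => Z (X j ω), fun j => hZ.bdd.comp_measurable (hX.meas j),
    fun j ω => hZ.abs_le _, fun j => ?_, fun j => ?_, fun T ξ hξ hb l hl hT => ?_⟩
  · rwa [hX.integral_eq hm j]
  · rwa [hX.integral_eq (hm.pow_const r) j]
  · have := hX.abs_cv_comb_prod_le hξ hb hZ l [] (by simpa using hl) hT (by simp)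
    simp only [indProd, List.map_nil, List.prod_nil, one_mul] at this
    refine this.trans (mul_le_mul_of_nonneg_left hg ?_)
    have : 0 ≤ C * L := by positivity
    positivity

omit [IsProbabilityMeasure μ] in
lemma StatChain.covSeq (hX : StatChain P X μ K) {F : ℝ → ℝ} (hF : Bdd F)
    (h0 : ∫ x, F x ∂μ = 0) :
    CovSeq P (past X hX.meas) (fun j ω => F (X j ω))
      (fun l => ∫ x, F x * (Kop K)^[l] F x ∂μ) where
  bdd j := hF.comp_measurable (hX.meas j)
  adapted j := hF.1.comp (measurable_past hX.meas le_rfl)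
  centered j := by rw [hX.integral_eq hF.1 j, h0]
  cov j l := by
    refine (hX.integral_iterate (hF.1.comp (measurable_past hX.meas le_rfl))
      (hF.comp_measurable (hX.meas j)) l hF).trans ?_
    exact hX.integral_eq (hF.1.mul (hF.kop_iterate l).1) j

end Levels

section LevelSequences

/-- The gap used between blocks of length `2 ^ e`. -/
def gap (e : ℕ) : ℕ := 2 ^ (e - 3)

lemma gap_le (e : ℕ) : gap e ≤ max 1 (2 ^ e / 4) := by
  rcases le_or_gt e 3 with h | h
  · simp [gap, Nat.sub_eq_zero_of_le h]
  · obtain ⟨k, rfl⟩ := Nat.exists_eq_add_of_lt h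
    refine le_max_of_le_right ?_
    rw [gap, show 3 + k + 1 - 3 = k + 1 by omega, Nat.le_div_iff_mul_le (by norm_num),
      show 3 + k + 1 = (k + 1) + 3 by ring, pow_add _ (k + 1) 3]
    omega

lemma gap_mono : Monotone gap := fun _ _ h =>
  Nat.pow_le_pow_right (by norm_num) (Nat.sub_le_sub_right h 3)

lemma summable_dyadic {y : ℕ → ℝ} (hy : Antitone y) (hy0 : ∀ k, 0 ≤ y k)
    (hs : Summable fun k : ℕ => ((k:ℝ) + 1) * y (k + 1)) :
    Summable fun e => (4:ℝ) ^ e * y (gap e) := by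
  rw [← summable_nat_add_iff 4]
  have h1 : ∀ e : ℕ, (4:ℝ) ^ e * y (2 ^ (e + 1)) ≤
      ∑ k ∈ Finset.Ico ((2:ℕ) ^ e) (2 ^ (e + 1)), (k:ℝ) * y k := fun e => by
    calc (4:ℝ) ^ e * y (2 ^ (e + 1))
        = ∑ _k ∈ Finset.Ico ((2:ℕ) ^ e) (2 ^ (e + 1)), (2:ℝ) ^ e * y (2 ^ (e + 1)) := by
          rw [Finset.sum_const, Nat.card_Ico, nsmul_eq_mul, pow_succ 2 e, mul_two,
            Nat.add_sub_cancel, ← mul_assoc]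
          push_cast
          rw [← mul_pow]; norm_num
      _ ≤ _ := by
          refine Finset.sum_le_sum fun k hk => ?_
          rw [Finset.mem_Ico] at hk
          refine mul_le_mul (by exact_mod_cast hk.1) (hy hk.2.le) (hy0 _) (by positivity)
  have h2 : ∀ n : ℕ, ∑ e ∈ Finset.range n, (4:ℝ) ^ e * y (2 ^ (e + 1)) ≤
      ∑ k ∈ Finset.Ico (1:ℕ) (2 ^ n), (k:ℝ) * y k := fun n => by
    induction n with
    | zero => simp
    | succ n ih =>
      rw [Finset.sum_range_succ, ← Finset.sum_Ico_consecutive _ (Nat.one_le_two_pow (n := n))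
        (Nat.pow_le_pow_right (by norm_num) (Nat.le_succ n))]
      exact add_le_add ih (h1 n)
  have h3 : Summable fun e : ℕ => (4:ℝ) ^ e * y (2 ^ (e + 1)) := by
    refine summable_of_sum_range_le (c := ∑' k : ℕ, ((k:ℝ) + 1) * y (k + 1))
      (fun e => mul_nonneg (by positivity) (hy0 _)) fun n => (h2 n).trans ?_
    rw [Finset.sum_Ico_eq_sum_range]
    refine le_trans (le_of_eq ?_) (hs.sum_le_tsum (Finset.range (2 ^ n - 1))
      fun k _ => mul_nonneg (by positivity) (hy0 _))
    refine Finset.sum_congr rfl fun k _ => ?_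
    rw [add_comm 1 k]; push_cast; ring
  refine (h3.mul_left ((4:ℝ) ^ 4)).congr fun e => ?_
  rw [gap, show e + 4 - 3 = e + 1 by omega, pow_add]
  ring

/-- The regularized majorant of `y`, which decays at most geometrically. -/
def slow (y : ℕ → ℝ) : ℕ → ℝ
  | 0 => 1
  | e + 1 => max (slow y e / 8) (y (e + 1))

lemma slow_pos (y : ℕ → ℝ) (e : ℕ) : 0 < slow y e := by
  induction e with
  | zero => exact one_pos
  | succ e ih => exact lt_max_of_lt_left (by positivity)

lemma le_slow {y : ℕ → ℝ} (hy1 : ∀ e, y e ≤ 1) (e : ℕ) : y e ≤ slow y e := by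
  cases e with
  | zero => exact hy1 0
  | succ e => exact le_max_right _ _

lemma slow_antitone {y : ℕ → ℝ} (hy : Antitone y) (hy1 : ∀ e, y e ≤ 1) : Antitone (slow y) :=
  antitone_nat_of_succ_le fun e => max_le (by linarith [slow_pos y e])
    ((hy (Nat.le_succ e)).trans (le_slow hy1 e))

lemma summable_slow {y : ℕ → ℝ} (hy0 : ∀ e, 0 ≤ y e)
    (hs : Summable fun e => (4:ℝ) ^ e * y e) : Summable fun e => (4:ℝ) ^ e * slow y e := by
  have h0 : ∀ e, 0 ≤ (4:ℝ) ^ e * slow y e := fun e => mul_nonneg (by positivity) (slow_pos y e).le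
  have h1 : ∀ e, (4:ℝ) ^ (e + 1) * slow y (e + 1) ≤
      4 ^ e * slow y e / 2 + 4 ^ (e + 1) * y (e + 1) := fun e => by
    have : slow y (e + 1) ≤ slow y e / 8 + y (e + 1) :=
      max_le (le_add_of_nonneg_right (hy0 _)) (le_add_of_nonneg_left (by linarith [slow_pos y e]))
    calc (4:ℝ) ^ (e + 1) * slow y (e + 1) ≤ 4 ^ (e + 1) * (slow y e / 8 + y (e + 1)) := by gcongr
      _ = _ := by ring
  set Y := ∑' e, (4:ℝ) ^ e * y e with hY
  have h2 : ∀ n, ∑ e ∈ Finset.range n, (4:ℝ) ^ e * slow y e ≤ 2 * (1 + Y) := fun n => by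
    have h3 : ∑ e ∈ Finset.range n, (4:ℝ) ^ (e + 1) * y (e + 1) ≤ Y := by
      have := hs.sum_le_tsum (Finset.range (n + 1))
        fun e _ => mul_nonneg (by positivity) (hy0 e)
      rw [Finset.sum_range_succ'] at this
      linarith [mul_nonneg (by positivity : 0 ≤ (4:ℝ) ^ 0) (hy0 0)]
    have h4 : ∑ e ∈ Finset.range (n + 1), (4:ℝ) ^ e * slow y e ≤
        (∑ e ∈ Finset.range n, (4:ℝ) ^ e * slow y e) / 2 + Y + 1 := by
      rw [Finset.sum_range_succ', Finset.sum_div]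
      have := Finset.sum_le_sum fun e (_ : e ∈ Finset.range n) => h1 e
      rw [Finset.sum_add_distrib] at this
      have e0 : (4:ℝ) ^ 0 * slow y 0 = 1 := by simp [slow]
      linarith
    rw [Finset.sum_range_succ] at h4
    linarith [h0 n]
  exact summable_of_sum_range_le h0 h2

lemma exists_scale {α : ℕ → ℝ} (hα : Antitone α) (hα0 : ∀ k, 0 ≤ α k) (hα1 : ∀ k, α k ≤ 1)
    {s θ : ℝ} (hs : 0 ≤ s) (hθ : 0 < θ) (hsθ : θ = 1 - 3 * s)
    (hsum : Summable fun k : ℕ => ((k:ℝ) + 1) * α (k + 1) ^ θ) :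
    ∃ (a L : ℕ → ℝ) (Cd : ℝ), Scale a L Cd ∧ ∀ e, 0 < a e ∧ a e ≤ 1 ∧ 1 ≤ L e ∧
      α (gap e) ≤ a e ∧ L e = a e ^ (-s) := by
  set y : ℕ → ℝ := fun e => α (gap e) ^ θ with hy
  have hyk : Antitone fun k => α k ^ θ := fun i j h =>
    Real.rpow_le_rpow (hα0 _) (hα h) hθ.le
  have hya : Antitone y := fun i j h => hyk (gap_mono h)
  have hy0 : ∀ e, 0 ≤ y e := fun e => Real.rpow_nonneg (hα0 _) _
  have hy1 : ∀ e, y e ≤ 1 := fun e => Real.rpow_le_one (hα0 _) (hα1 _) hθ.le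
  have hm := summable_slow hy0
    (summable_dyadic hyk (fun k => Real.rpow_nonneg (hα0 _) _) hsum)
  set m := slow y with hmd
  have hm0 : ∀ e, 0 < m e := slow_pos y
  have hma : Antitone m := slow_antitone hya hy1
  have hm1 : ∀ e, m e ≤ 1 := fun e => hma (Nat.zero_le e)
  have ha0 : ∀ e, 0 < m e ^ (1 / θ) := fun e => Real.rpow_pos_of_pos (hm0 e) _
  have ha1 : ∀ e, m e ^ (1 / θ) ≤ 1 := fun e =>
    Real.rpow_le_one (hm0 e).le (hm1 e) (by positivity)
  have haa : Antitone fun e => m e ^ (1 / θ) := fun i j h =>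
    Real.rpow_le_rpow (hm0 _).le (hma h) (by positivity)
  refine ⟨fun e => m e ^ (1 / θ), fun e => (m e ^ (1 / θ)) ^ (-s), (8 ^ (-(1 / θ))) ^ (-s),
    ⟨fun e => (ha0 e).le, ?_, ?_, fun e => ?_, ?_⟩, fun e => ⟨ha0 e, ha1 e, ?_, ?_, rfl⟩⟩
  · simp [hmd, slow]
  · exact fun i j h => Real.rpow_le_rpow_of_nonpos (ha0 _) (haa h) (by linarith)
  · rw [← Real.mul_rpow (by positivity) (ha0 e).le]
    refine Real.rpow_le_rpow_of_nonpos (by have := ha0 e; positivity) ?_ (by linarith)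
    rw [Real.rpow_neg (by norm_num), ← Real.inv_rpow (by norm_num),
      ← Real.mul_rpow (by norm_num) (hm0 e).le]
    refine Real.rpow_le_rpow (by have := hm0 e; positivity) ?_ (by positivity)
    refine le_trans (le_of_eq ?_) (le_max_left _ _)
    rw [div_eq_inv_mul]
  · refine hm.congr fun e => ?_
    have h1 : m e ^ (1 / θ) * ((m e ^ (1 / θ)) ^ (-s)) ^ 3 = m e := by
      rw [← Real.rpow_natCast, ← Real.rpow_mul (ha0 e).le]
      nth_rewrite 1 [← Real.rpow_one (m e ^ (1 / θ))]
      rw [← Real.rpow_add (ha0 e), ← Real.rpow_mul (hm0 e).le]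
      rw [show 1 / θ * (1 + -s * ((3:ℕ):ℝ)) = 1 by
        rw [show (1 + -s * ((3:ℕ):ℝ)) = θ by rw [hsθ]; push_cast; ring]
        field_simp, Real.rpow_one]
    rw [mul_assoc, h1]
  · exact Real.one_le_rpow_of_pos_of_le_one_of_nonpos (ha0 e) (ha1 e) (by linarith)
  · calc α (gap e) = (α (gap e) ^ θ) ^ (1 / θ) := by
          rw [← Real.rpow_mul (hα0 _), mul_one_div_cancel hθ.ne', Real.rpow_one]
      _ ≤ m e ^ (1 / θ) := Real.rpow_le_rpow (hy0 e) (le_slow hy1 e) (by positivity)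

end LevelSequences

/-! ### Continuity of autocovariances in mean square -/

section MeanSquare

variable {μ : Measure ℝ} [IsProbabilityMeasure μ]

omit [IsProbabilityMeasure μ] in
lemma abs_integral_mul_le_sqrt {f g : ℝ → ℝ} (hf : MemLp f 2 μ) (hg : MemLp g 2 μ) :
    |∫ x, f x * g x ∂μ| ≤ √(∫ x, f x ^ 2 ∂μ) * √(∫ x, g x ^ 2 ∂μ) := by
  have h := integral_mul_norm_le_Lp_mul_Lq (μ := μ) (f := f) (g := g) (p := 2) (q := 2)
    Real.HolderConjugate.two_two (by simpa using hf) (by simpa using hg)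
  simp only [Real.norm_eq_abs, ← abs_mul, Real.rpow_ofNat, sq_abs, ← Real.sqrt_eq_rpow] at h
  exact abs_integral_le_integral_abs.trans h

variable {K : Kernel ℝ ℝ} [IsMarkovKernel K]

lemma memLp_two_kop (hinv : μ.bind K = μ) {g : ℝ → ℝ} (hg : MemLp g 2 μ) :
    MemLp (Kop K g) 2 μ ∧ ∫ x, Kop K g x ^ 2 ∂μ ≤ ∫ x, g x ^ 2 ∂μ := by
  have h1 := hg.integrable one_le_two
  have h2 := hg.integrable_sq
  have h3 : ∀ᵐ x ∂μ, Kop K g x ^ 2 ≤ Kop K (fun y => g y ^ 2) x := by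
    have h1' := h1
    have h2' := h2
    rw [← hinv] at h1' h2'
    filter_upwards [Measure.ae_integrable_of_integrable_comp h1',
      Measure.ae_integrable_of_integrable_comp h2'] with x i1 i2
    have h0 : 0 ≤ ∫ y, (g y - Kop K g x) ^ 2 ∂(K x) := integral_nonneg fun y => sq_nonneg _
    have i3 : Integrable (fun y => g y ^ 2 - 2 * Kop K g x * g y) (K x) := i2.sub (i1.const_mul _)
    have e : ∫ y, (g y - Kop K g x) ^ 2 ∂(K x) =
        Kop K (fun y => g y ^ 2) x - Kop K g x ^ 2 := by
      calc ∫ y, (g y - Kop K g x) ^ 2 ∂(K x)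
          = ∫ y, (g y ^ 2 - 2 * Kop K g x * g y + Kop K g x ^ 2) ∂(K x) := by
            congr 1; funext y; ring
        _ = ∫ y, g y ^ 2 ∂(K x) - 2 * Kop K g x * ∫ y, g y ∂(K x) + Kop K g x ^ 2 := by
            rw [integral_add i3 (integrable_const _), integral_sub i2 (i1.const_mul _), integral_const_mul, E_const]
        _ = _ := by simp only [Kop]; ring
    linarith
  have h4 := integrable_kop hinv h2
  have hm := (integrable_kop hinv h1).aestronglyMeasurable
  have h5 : Integrable (fun x => Kop K g x ^ 2) μ := h4.mono' (hm.pow 2) (by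
    filter_upwards [h3] with x hx
    rwa [Real.norm_eq_abs, abs_of_nonneg (sq_nonneg _)])
  refine ⟨(memLp_two_iff_integrable_sq hm).mpr h5, ?_⟩
  rw [← integral_kop hinv h2]
  exact integral_mono_ae h5 h4 h3

lemma memLp_two_kop_iterate (hinv : μ.bind K = μ) {g : ℝ → ℝ} (hg : MemLp g 2 μ) (n : ℕ) :
    MemLp ((Kop K)^[n] g) 2 μ ∧ ∫ x, (Kop K)^[n] g x ^ 2 ∂μ ≤ ∫ x, g x ^ 2 ∂μ := by
  induction n generalizing g with
  | zero => exact ⟨hg, le_rfl⟩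
  | succ n ih =>
    obtain ⟨h1, h2⟩ := memLp_two_kop hinv hg
    obtain ⟨h3, h4⟩ := ih h1
    exact ⟨h3, h4.trans h2⟩

omit [IsProbabilityMeasure μ] [IsMarkovKernel K] in
lemma kop_iterate_congr_ae (hinv : μ.bind K = μ) {g g' : ℝ → ℝ} (h : g =ᵐ[μ] g') (n : ℕ) :
    (Kop K)^[n] g =ᵐ[μ] (Kop K)^[n] g' := by
  induction n generalizing g g' with
  | zero => exact h
  | succ n ih => exact ih (kop_congr_ae hinv h)

lemma kop_iterate_sub_ae (hinv : μ.bind K = μ) {g g' : ℝ → ℝ} (hg : Integrable g μ)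
    (hg' : Integrable g' μ) (n : ℕ) : (Kop K)^[n] (fun x => g x - g' x) =ᵐ[μ]
      fun x => (Kop K)^[n] g x - (Kop K)^[n] g' x := by
  induction n generalizing g g' with
  | zero => rfl
  | succ n ih =>
    exact (kop_iterate_congr_ae hinv (kop_sub_ae hinv hg hg') n).trans
      (ih (integrable_kop hinv hg) (integrable_kop hinv hg'))

omit [IsProbabilityMeasure μ] in
lemma kop_iterate_const (c : ℝ) (n : ℕ) : (Kop K)^[n] (fun _ => c) = fun _ => c :=
  Function.iterate_fixed (kop_const c) n

lemma tendsto_integral_mul_kop_iterate (hinv : μ.bind K = μ) {F : ℕ → ℝ → ℝ} {φ : ℝ → ℝ}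
    (hF : ∀ N, MemLp (F N) 2 μ) (hφ : MemLp φ 2 μ)
    (h : Tendsto (fun N => ∫ x, (F N x - φ x) ^ 2 ∂μ) atTop (𝓝 0)) (l : ℕ) :
    Tendsto (fun N => ∫ x, F N x * (Kop K)^[l] (F N) x ∂μ) atTop
      (𝓝 (∫ x, φ x * (Kop K)^[l] φ x ∂μ)) := by
  set v : ℕ → ℝ := fun N => √(∫ x, (F N x - φ x) ^ 2 ∂μ) with hv
  have hv0 : Tendsto v atTop (𝓝 0) := by
    simpa [Function.comp_def] using (Real.continuous_sqrt.tendsto 0).comp h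
  set b := √(∫ x, φ x ^ 2 ∂μ) with hb
  have hlim : Tendsto (fun N => v N * v N + v N * b + b * v N) atTop (𝓝 0) := by
    simpa using ((hv0.mul hv0).add (hv0.mul_const b)).add (hv0.const_mul b)
  rw [tendsto_iff_norm_sub_tendsto_zero]
  refine squeeze_zero (fun N => norm_nonneg _) (fun N => ?_) hlim
  have hu : MemLp (fun x => F N x - φ x) 2 μ := (hF N).sub hφ
  obtain ⟨k1, k2⟩ := memLp_two_kop_iterate hinv hu l
  obtain ⟨k3, k4⟩ := memLp_two_kop_iterate hinv hφ l
  have i1 : Integrable (fun x => (F N x - φ x) * (Kop K)^[l] (fun x => F N x - φ x) x) μ :=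
    hu.integrable_mul k1
  have i2 : Integrable (fun x => (F N x - φ x) * (Kop K)^[l] φ x) μ := hu.integrable_mul k3
  have i3 : Integrable (fun x => φ x * (Kop K)^[l] (fun x => F N x - φ x) x) μ :=
    hφ.integrable_mul k1
  have i4 : Integrable (fun x => φ x * (Kop K)^[l] φ x) μ := hφ.integrable_mul k3
  have e : ∫ x, F N x * (Kop K)^[l] (F N) x ∂μ =
      ∫ x, (F N x - φ x) * (Kop K)^[l] (fun x => F N x - φ x) x ∂μ +
      ∫ x, (F N x - φ x) * (Kop K)^[l] φ x ∂μ +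
      ∫ x, φ x * (Kop K)^[l] (fun x => F N x - φ x) x ∂μ + ∫ x, φ x * (Kop K)^[l] φ x ∂μ := by
    rw [← integral_add i1 i2, ← integral_add (i1.fun_add i2) i3,
      ← integral_add ((i1.fun_add i2).fun_add i3) i4]
    refine integral_congr_ae ?_
    filter_upwards [kop_iterate_sub_ae hinv ((hF N).integrable one_le_two)
      (hφ.integrable one_le_two) l] with x hx
    rw [hx]
    ring
  have hmono : ∀ {s t : ℝ}, s ≤ t → √s ≤ √t := fun h => Real.sqrt_le_sqrt h
  have b1 := (abs_integral_mul_le_sqrt hu k1).trans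
    (mul_le_mul_of_nonneg_left (hmono k2) (Real.sqrt_nonneg _))
  have b2 := (abs_integral_mul_le_sqrt hu k3).trans
    (mul_le_mul_of_nonneg_left (hmono k4) (Real.sqrt_nonneg _))
  have b3 := (abs_integral_mul_le_sqrt hφ k1).trans
    (mul_le_mul_of_nonneg_left (hmono k2) (Real.sqrt_nonneg _))
  rw [e, add_sub_cancel_right, Real.norm_eq_abs]
  exact (abs_add_three _ _ _).trans (add_le_add (add_le_add b1 b2) b3)

lemma integral_cube_le_of_tendsto {F : ℕ → ℝ → ℝ} {φ : ℝ → ℝ} {D : ℝ} (hF : ∀ N, Bdd (F N))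
    (hφ : Integrable φ μ) (h : Tendsto (fun N => ∫ x, |F N x - φ x| ∂μ) atTop (𝓝 0))
    (hD : ∀ N, ∫ x, |F N x| ^ 3 ∂μ ≤ D) :
    Integrable (fun x => |φ x| ^ 3) μ ∧ ∫ x, |φ x| ^ 3 ∂μ ≤ D := by
  have hD0 : 0 ≤ D := (integral_nonneg fun x => by positivity).trans (hD 0)
  have hm : TendstoInMeasure μ F atTop φ := by
    refine tendstoInMeasure_of_tendsto_eLpNorm one_ne_zero
      (fun N => (hF N).1.aestronglyMeasurable) hφ.aestronglyMeasurable ?_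
    have e : ∀ N, eLpNorm (F N - φ) 1 μ = ENNReal.ofReal (∫ x, |F N x - φ x| ∂μ) := fun N => by
      rw [eLpNorm_one_eq_lintegral_enorm,
        ← ofReal_integral_norm_eq_lintegral_enorm ((hF N).integrable.sub hφ)]
      rfl
    simp only [e]
    simpa using ENNReal.tendsto_ofReal h
  obtain ⟨ns, -, hns⟩ := hm.exists_seq_tendsto_ae
  have key : ∫⁻ x, ENNReal.ofReal (|φ x| ^ 3) ∂μ ≤ ENNReal.ofReal D := by
    calc ∫⁻ x, ENNReal.ofReal (|φ x| ^ 3) ∂μ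
        = ∫⁻ x, liminf (fun i => ENNReal.ofReal (|F (ns i) x| ^ 3)) atTop ∂μ := by
          refine lintegral_congr_ae ?_
          filter_upwards [hns] with x hx
          exact (ENNReal.tendsto_ofReal ((hx.abs).pow 3)).liminf_eq.symm
      _ ≤ liminf (fun i => ∫⁻ x, ENNReal.ofReal (|F (ns i) x| ^ 3) ∂μ) atTop :=
          lintegral_liminf_le fun i => (((hF (ns i)).1.abs).pow_const 3).ennreal_ofReal
      _ ≤ liminf (fun _ : ℕ => ENNReal.ofReal D) atTop := by
          refine liminf_le_liminf (Eventually.of_forall fun i => ?_)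
          rw [← ofReal_integral_eq_lintegral_ofReal ((hF (ns i)).abs.pow 3).integrable
            (ae_of_all _ fun x => by positivity)]
          exact ENNReal.ofReal_le_ofReal (hD _)
      _ = ENNReal.ofReal D := by simp
  have hms : AEStronglyMeasurable (fun x => |φ x| ^ 3) μ := hφ.abs.aestronglyMeasurable.pow 3
  refine ⟨⟨hms, ?_⟩, ?_⟩
  · rw [hasFiniteIntegral_iff_ofReal (ae_of_all _ fun x => by positivity)]
    exact key.trans_lt ENNReal.ofReal_lt_top
  · rw [integral_eq_lintegral_of_nonneg_ae (ae_of_all _ fun x => by positivity) hms]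
    exact ENNReal.toReal_le_of_le_ofReal hD0 key

lemma sq_le_mul_add_div {T x : ℝ} (hT : 0 < T) : x ^ 2 ≤ T * |x| + |x| ^ 3 / T := by
  rw [← sq_abs, ← sub_nonneg]
  have : T * |x| + |x| ^ 3 / T - |x| ^ 2 = |x| * ((T - |x| / 2) ^ 2 + 3 / 4 * |x| ^ 2) / T := by
    field_simp; ring
  rw [this]
  positivity

omit [IsProbabilityMeasure μ] in
lemma memLp_two_of_cube {φ : ℝ → ℝ} (hφ : Integrable φ μ) (h3 : Integrable (fun x => |φ x| ^ 3) μ) :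
    MemLp φ 2 μ := by
  rw [memLp_two_iff_integrable_sq hφ.aestronglyMeasurable]
  refine (hφ.abs.add h3).mono' (hφ.aestronglyMeasurable.pow 2) (ae_of_all _ fun x => ?_)
  rw [Real.norm_eq_abs, abs_of_nonneg (sq_nonneg _)]
  simpa using sq_le_mul_add_div (x := φ x) one_pos

omit [IsProbabilityMeasure μ] in
lemma tendsto_integral_sq_of_cube {u : ℕ → ℝ → ℝ} {D : ℝ} (hu : ∀ N, Integrable (u N) μ)
    (hu3 : ∀ N, Integrable (fun x => |u N x| ^ 3) μ) (hD : ∀ N, ∫ x, |u N x| ^ 3 ∂μ ≤ D)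
    (h : Tendsto (fun N => ∫ x, |u N x| ∂μ) atTop (𝓝 0)) :
    Tendsto (fun N => ∫ x, u N x ^ 2 ∂μ) atTop (𝓝 0) := by
  have hD0 : 0 ≤ D := (integral_nonneg fun x => by positivity).trans (hD 0)
  rw [Metric.tendsto_atTop] at h ⊢
  intro ε hε
  set T := 2 * (D + 1) / ε with hT
  have hT0 : 0 < T := by positivity
  obtain ⟨N₀, hN₀⟩ := h (ε / (2 * T)) (by positivity)
  refine ⟨N₀, fun N hN => ?_⟩
  have h1 := hN₀ N hN
  rw [Real.dist_eq, sub_zero, abs_of_nonneg (integral_nonneg fun x => abs_nonneg _)] at h1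
  rw [Real.dist_eq, sub_zero, abs_of_nonneg (integral_nonneg fun x => sq_nonneg _)]
  have h2 : ∫ x, u N x ^ 2 ∂μ ≤ T * ∫ x, |u N x| ∂μ + (∫ x, |u N x| ^ 3 ∂μ) / T := by
    rw [← integral_const_mul, ← integral_div,
      ← integral_add ((hu N).abs.const_mul T) ((hu3 N).div_const T)]
    exact integral_mono (memLp_two_of_cube (hu N) (hu3 N)).integrable_sq
      (((hu N).abs.const_mul T).add ((hu3 N).div_const T)) fun x => sq_le_mul_add_div hT0
  have h3 : T * ∫ x, |u N x| ∂μ < ε / 2 := by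
    calc T * ∫ x, |u N x| ∂μ < T * (ε / (2 * T)) := mul_lt_mul_of_pos_left h1 hT0
      _ = ε / 2 := by field_simp
  have h4 : (∫ x, |u N x| ^ 3 ∂μ) / T ≤ ε / 2 := by
    rw [div_le_iff₀ hT0, hT]
    have : ε / 2 * (2 * (D + 1) / ε) = D + 1 := by field_simp
    linarith [hD N]
  linarith

end MeanSquare

section Approximation

variable {μ : Measure ℝ} [IsProbabilityMeasure μ] {M : ℝ} {p : ℝ≥0∞}

omit [IsProbabilityMeasure μ] in
lemma tendsto_integral_abs_sub_clip {g : ℝ → ℝ} (hg : Integrable g μ) :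
    Tendsto (fun b : ℕ => ∫ x, |g x - clip b (g x)| ∂μ) atTop (𝓝 0) := by
  have := tendsto_integral_of_dominated_convergence (μ := μ) (f := fun _ => (0:ℝ))
    (F := fun (b : ℕ) x => |g x - clip b (g x)|) (fun x => |g x|)
    (fun b => ((hg.aestronglyMeasurable.aemeasurable.sub
      ((measurable_clip b).comp_aemeasurable hg.aestronglyMeasurable.aemeasurable)).abs
        ).aestronglyMeasurable) hg.abs
    (fun b => ae_of_all _ fun x => by
      rw [Real.norm_eq_abs, abs_abs]
      exact abs_sub_clip_le (Nat.cast_nonneg b) _)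
    (ae_of_all _ fun x => by
      refine tendsto_const_nhds.congr' ?_
      filter_upwards [eventually_ge_atTop ⌈|g x|⌉₊] with b hb
      rw [clip_eq_self ((Nat.le_ceil _).trans (Nat.cast_le.mpr hb)), sub_self, abs_zero])
  simpa using this

lemma ClassC.exists_bdd (hM : 0 < M) (hp : p ≠ ∞ → 1 < p.toReal) {f : ℝ → ℝ}
    (hf : ClassC M p μ f) {ε : ℝ} (hε : 0 < ε) :
    ∃ (n : ℕ) (w : Fin n → ℝ) (g : Fin n → ℝ → ℝ), ∑ i, |w i| ≤ 1 ∧ (∀ i, Mon M p μ (g i)) ∧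
      (∀ i, Bdd (g i)) ∧ ∫ x, |f x - ∑ i, w i * g i x| ∂μ < ε := by
  obtain ⟨hfi, hfa⟩ := hf
  obtain ⟨n, w, g, hw, hg, h1⟩ := hfa (ε / 2) (by positivity)
  obtain ⟨C, -, hC⟩ := Mon.exists_integrable_le (μ := μ) hM hp
  have hgi : ∀ i, Integrable (g i) μ := fun i => (hC _ (hg i)).1
  have hlim : Tendsto (fun b : ℕ => ∑ i, |w i| * ∫ x, |g i x - clip b (g i x)| ∂μ) atTop
      (𝓝 (∑ i, |w i| * 0)) :=
    tendsto_finsetSum _ fun i _ => (tendsto_integral_abs_sub_clip (hgi i)).const_mul _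
  simp only [mul_zero, Finset.sum_const_zero] at hlim
  obtain ⟨b, hb⟩ := (hlim.eventually (gt_mem_nhds (by positivity : 0 < ε / 2))).exists
  have hbd : ∀ i, Bdd fun x => clip b (g i x) := fun i =>
    ⟨(measurable_clip _).comp (hg i).measurable, b, fun x => abs_clip_le (Nat.cast_nonneg b) _⟩
  refine ⟨n, w, fun i x => clip b (g i x), hw, fun i => (hg i).clip (Nat.cast_nonneg b), hbd, ?_⟩
  have i1 : Integrable (fun x => |f x - ∑ i, w i * g i x|) μ :=
    (hfi.sub (integrable_finsetSum _ fun i _ => (hgi i).const_mul (w i))).abs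
  have i2 : ∀ i, Integrable (fun x => |w i| * |g i x - clip b (g i x)|) μ := fun i =>
    ((hgi i).sub (hbd i).integrable).abs.const_mul _
  have i3 : Integrable (fun x => ∑ i, |w i| * |g i x - clip b (g i x)|) μ :=
    integrable_finsetSum _ fun i _ => i2 i
  calc ∫ x, |f x - ∑ i, w i * clip b (g i x)| ∂μ
      ≤ ∫ x, (|f x - ∑ i, w i * g i x| + ∑ i, |w i| * |g i x - clip b (g i x)|) ∂μ := by
        refine integral_mono (hfi.sub (integrable_finsetSum _ fun i _ =>
          ((hbd i).integrable (P := μ)).const_mul (w i))).abs (i1.add i3) fun x => ?_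
        refine (abs_sub_le _ (∑ i, w i * g i x) _).trans (add_le_add_right ?_ _)
        rw [← Finset.sum_sub_distrib]
        refine (Finset.abs_sum_le_sum_abs _ _).trans (le_of_eq ?_)
        simp only [← mul_sub, abs_mul]
    _ = ∫ x, |f x - ∑ i, w i * g i x| ∂μ + ∑ i, |w i| * ∫ x, |g i x - clip b (g i x)| ∂μ := by
        rw [integral_add i1 i3, integral_finsetSum _ fun i _ => i2 i]
        simp only [integral_const_mul]
    _ < ε := by linarith

lemma LevelAppr.integral_cube_le {C r : ℝ} (hr : 3 ≤ r) {F : ℝ → ℝ} (hF : Bdd F)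
    (h : LevelAppr μ C r 1 1 F) : ∫ x, |F x| ^ 3 ∂μ ≤ 1 + 2 ^ r * (C + C ^ r) := by
  obtain ⟨Z, hZ, -, h2⟩ := h
  simp only [mul_one, Real.one_rpow] at hZ h2
  have hr0 : 0 ≤ r := by linarith
  have b1 : Bdd fun x => |F x - Z x| ^ r := (hF.sub hZ.bdd).abs.rpow (fun x => abs_nonneg _) hr0
  have hle : ∀ x, |F x| ^ 3 ≤ 1 + 2 ^ r * (|F x - Z x| ^ r + C ^ r) := fun x => by
    have e1 : |F x| ≤ |F x - Z x| + C := by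
      have := abs_sub_abs_le_abs_sub (F x) (Z x)
      linarith [hZ.abs_le x]
    have hC : 0 ≤ C := (abs_nonneg _).trans (hZ.abs_le x)
    have e2 : |F x| ^ r ≤ 2 ^ r * (|F x - Z x| ^ r + C ^ r) :=
      (Real.rpow_le_rpow (abs_nonneg _) e1 hr0).trans
        (rpow_add_le_two_rpow (abs_nonneg _) hC hr0)
    rcases le_total |F x| 1 with h | h
    · have := pow_le_one₀ (abs_nonneg _) h (n := 3)
      have : 0 ≤ |F x| ^ r := Real.rpow_nonneg (abs_nonneg _) _
      linarith
    · have : |F x| ^ 3 ≤ |F x| ^ r := by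
        rw [← Real.rpow_ofNat]
        exact Real.rpow_le_rpow_of_exponent_le h hr
      linarith
  refine (E_mono (by fun_prop) ((Bdd.const 1).add ((Bdd.const _).mul (b1.add (Bdd.const _))))
    hle).trans ?_
  rw [E_add (Bdd.const _) ((Bdd.const _).mul (b1.add (Bdd.const _))), integral_const_mul,
    E_add b1 (Bdd.const _), E_const, E_const]
  gcongr

variable {Ω : Type*} [mΩ : MeasurableSpace Ω] {P : Measure Ω} [IsProbabilityMeasure P]
  {X : ℕ → Ω → ℝ} {K : Kernel ℝ ℝ} [IsMarkovKernel K]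

/-- Bounded centered observables converging to `f - μ f`, approximable uniformly at all levels of
a common scale. -/
lemma StatChain.exists_approx (hX : StatChain P X μ K) (hM : 0 < M) (hp : 3 < p) {f : ℝ → ℝ}
    (hf : ClassC M p μ f) (hsum : Summable fun k : ℕ => ((k : ℝ) + 1) *
      (alphaCoef (Kop K) μ 3 (k + 1)) ^ (((1:ℝ≥0∞) - 3 / p).toReal)) :
    ∃ (F : ℕ → ℝ → ℝ) (a L : ℕ → ℝ) (Cd C δ D : ℝ), Scale a L Cd ∧ 0 < δ ∧ δ ≤ 1 ∧ 0 ≤ C ∧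
      (∀ N, Bdd (F N)) ∧ (∀ N, ∫ x, F N x ∂μ = 0) ∧
      (∀ N e, Lvl P (past X hX.meas) (fun j ω => F N (X j ω)) C (3 + δ) (gap e) (a e) (L e)) ∧
      (∀ N, ∫ x, |F N x| ^ 3 ∂μ ≤ D) ∧
      Tendsto (fun N => ∫ x, |F N x - (f x - ∫ y, f y ∂μ)| ∂μ) atTop (𝓝 0) := by
  set s : ℝ := 1 / p.toReal with hs
  set θ : ℝ := ((1:ℝ≥0∞) - 3 / p).toReal with hθ
  have hp0 : p ≠ 0 := by rintro rfl; simp at hp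
  have hp3 : p ≠ ∞ → 3 < p.toReal := fun h => by
    have := (ENNReal.toReal_lt_toReal (by norm_num) h).mpr hp
    simpa using this
  have hθs : θ = 1 - 3 * s := by
    rw [hθ, hs, ENNReal.toReal_sub_of_le (ENNReal.div_le_of_le_mul (by simpa using hp.le))
      ENNReal.one_ne_top, ENNReal.toReal_div]
    simp [div_eq_mul_inv]
  have hs0 : 0 ≤ s := by positivity
  have hθ0 : 0 < θ := by
    rw [hθs, hs]
    by_cases h : p = ∞
    · simp [h]
    · have := hp3 h
      rw [sub_pos, mul_one_div, div_lt_one (by linarith)]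
      exact this
  have hr : p ≠ ∞ → 3 + θ < p.toReal := fun h => by
    have h3 := hp3 h
    rw [hθs, hs]
    have : p.toReal - (3 + (1 - 3 * (1 / p.toReal))) =
        (p.toReal - 1) * (p.toReal - 3) / p.toReal := by
      have : p.toReal ≠ 0 := by linarith
      field_simp; ring
    rw [← sub_pos, this]
    exact div_pos (mul_pos (by linarith) (by linarith)) (by linarith)
  obtain ⟨a, L, Cd, hsc, haL⟩ := exists_scale (alphaCoef_antitone (K := K) hX.bind 3)
    (fun n => alphaCoef_nonneg 3 n) (fun n => alphaCoef_le_one 3 n) hs0 hθ0 hθs hsum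
  obtain ⟨C, hC1, hC⟩ := exists_levelAppr (μ := μ) hM (by linarith : 1 < 3 + θ) hr
  choose n w g hw hg hgb hfg using fun N : ℕ =>
    hf.exists_bdd hM (fun h => by linarith [hp3 h]) (Nat.one_div_pos_of_nat (α := ℝ) (n := N))
  have hS : ∀ N, Bdd fun x => ∑ i, w N i * g N i x := fun N =>
    Bdd.sum _ fun i => (Bdd.const _).mul (hgb N i)
  set F : ℕ → ℝ → ℝ := fun N x => ∑ i, w N i * g N i x - ∫ y, ∑ i, w N i * g N i y ∂μ with hF
  have hFb : ∀ N, Bdd (F N) := fun N => (hS N).sub (Bdd.const _)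
  have hlim : Tendsto (fun N : ℕ => 2 * (1 / ((N:ℝ) + 1))) atTop (𝓝 0) := by
    simpa using tendsto_one_div_add_atTop_nhds_zero_nat.const_mul (2:ℝ)
  refine ⟨F, a, L, Cd, C, θ, 1 + 2 ^ (3 + θ) * (C + C ^ (3 + θ)), hsc, hθ0, by linarith,
    by linarith, hFb, fun N => ?_, fun N e => ?_, fun N => ?_, ?_⟩
  · rw [hF, E_sub (hS N) (Bdd.const _), E_const, sub_self]
  · obtain ⟨h1, h2, h3, h4, h5⟩ := haL e
    refine hX.lvl (hFb N).1 (hC _ _ _ (hw N) (hg N) (hgb N) (L e) (a e) h3 h1 h2 fun h => ?_)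
      h1.le h2 hC1 h3 h4
    have : p.toReal ≠ 0 := by linarith [hp3 h]
    rw [h5, ← Real.rpow_mul h1.le, hs, show -(1 / p.toReal) * -p.toReal = 1 by field_simp,
      Real.rpow_one]
  · exact (hC _ _ _ (hw N) (hg N) (hgb N) 1 1 le_rfl one_pos le_rfl
      fun _ => by simp).integral_cube_le (by linarith) (hFb N)
  · refine squeeze_zero (fun N => integral_nonneg fun x => abs_nonneg _) (fun N => ?_) hlim
    have hi : Integrable (fun x => |f x - ∑ i, w N i * g N i x|) μ :=
      (hf.1.sub (hS N).integrable).abs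
    have e0 : |∫ y, f y ∂μ - ∫ y, ∑ i, w N i * g N i y ∂μ| ≤
        ∫ x, |f x - ∑ i, w N i * g N i x| ∂μ := by
      rw [← integral_sub hf.1 (hS N).integrable]
      exact abs_integral_le_integral_abs
    calc ∫ x, |F N x - (f x - ∫ y, f y ∂μ)| ∂μ
        ≤ ∫ x, (|f x - ∑ i, w N i * g N i x| +
          |∫ y, f y ∂μ - ∫ y, ∑ i, w N i * g N i y ∂μ|) ∂μ := by
          refine integral_mono ((hFb N).integrable.sub (hf.1.sub (integrable_const _))).abs
            (hi.add (integrable_const _)) fun x => ?_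
          rw [← abs_neg (f x - _)]
          refine le_trans (le_of_eq ?_) (abs_add_le _ _)
          congr 1
          simp only [hF]
          ring
      _ ≤ 2 * (1 / ((N:ℝ) + 1)) := by
          rw [integral_add hi (integrable_const _), E_const]
          linarith [hfg N]

end Approximation

section Kantorovich

lemma abs_gsm_mul_sq_sub_le {h : ℝ → ℝ} (hl : ∀ x y, |h x - h y| ≤ |x - y|) (v s t : ℝ≥0) :
    |gsm (v * s ^ 2) h 0 - gsm (v * t ^ 2) h 0| ≤ |(s:ℝ) - t| * √v := by
  have hi : ∀ u : ℝ≥0, Integrable (fun y => h (u * y)) (gaussianReal 0 v) := fun u => by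
    have hm : Measurable h := measurable_of_lipschitz hl
    refine (((integrable_abs_gaussianReal v).const_mul (u:ℝ)).add
      (integrable_const |h 0|)).mono'
      (hm.comp (measurable_const_mul (u:ℝ))).aestronglyMeasurable (ae_of_all _ fun y => ?_)
    have h1 := hl (u * y) 0
    have h2 := abs_sub_abs_le_abs_sub (h (u * y)) (h 0)
    rw [sub_zero, abs_mul, abs_of_nonneg u.coe_nonneg] at h1
    simp only [Real.norm_eq_abs, Pi.add_apply]
    linarith
  rw [gsm_scale, gsm_scale]
  simp only [gsm, zero_add]
  rw [← integral_sub (hi s) (hi t)]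
  calc |∫ y, (h (s * y) - h (t * y)) ∂gaussianReal 0 v|
      ≤ ∫ y, |(s:ℝ) - t| * |y| ∂gaussianReal 0 v := by
        rw [← Real.norm_eq_abs]
        refine norm_integral_le_of_norm_le ((integrable_abs_gaussianReal v).const_mul _)
          (ae_of_all _ fun y => ?_)
        rw [← abs_mul, sub_mul]
        exact hl _ _
    _ ≤ |(s:ℝ) - t| * √v := by
        rw [integral_const_mul]
        exact mul_le_mul_of_nonneg_left (integral_abs_gaussianReal_le v) (abs_nonneg _)

lemma gsm_zero_left (h : ℝ → ℝ) (x : ℝ) : gsm 0 h x = h x := by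
  simp [gsm, gaussianReal_zero_var]

variable {μ : Measure ℝ} [IsProbabilityMeasure μ] {M : ℝ} {p : ℝ≥0∞}
  {Ω : Type*} [mΩ : MeasurableSpace Ω] {P : Measure Ω} [IsProbabilityMeasure P]
  {X : ℕ → Ω → ℝ} {K : Kernel ℝ ℝ} [IsMarkovKernel K]

omit [IsProbabilityMeasure μ] [IsProbabilityMeasure P] [IsMarkovKernel K] in
lemma StatChain.integrable_comp (hX : StatChain P X μ K) {g : ℝ → ℝ} (hg : Integrable g μ) (n : ℕ) :
    Integrable (fun ω => g (X n ω)) P ∧ ∫ ω, g (X n ω) ∂P = ∫ x, g x ∂μ := by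
  rw [← hX.law n] at hg
  refine ⟨hg.comp_measurable (hX.meas n), ?_⟩
  conv_rhs => rw [← hX.law n]
  rw [integral_map (hX.meas n).aemeasurable hg.aestronglyMeasurable]

omit [IsProbabilityMeasure μ] [IsMarkovKernel K] in
lemma StatChain.tendsto_integral_blk (hX : StatChain P X μ K) {F : ℕ → ℝ → ℝ} {φ : ℝ → ℝ}
    (hF : ∀ N, Integrable (F N) μ) (hφ : Integrable φ μ)
    (h : Tendsto (fun N => ∫ x, |F N x - φ x| ∂μ) atTop (𝓝 0)) {u : ℝ → ℝ}
    (hu : ∀ x y, |u x - u y| ≤ |x - y|) (n : ℕ) :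
    Tendsto (fun N => ∫ ω, u (blk (fun j ω => F N (X j ω)) 0 n ω) ∂P) atTop
      (𝓝 (∫ ω, u (blk (fun j ω => φ (X j ω)) 0 n ω) ∂P)) := by
  have hb : ∀ {g : ℝ → ℝ}, Integrable g μ → Integrable (blk (fun j ω => g (X j ω)) 0 n) P :=
    fun hg => integrable_finsetSum _ fun i _ => (hX.integrable_comp hg (i + 1)).1
  have hub : ∀ {g : ℝ → ℝ}, Integrable g μ →
      Integrable (fun ω => u (blk (fun j ω => g (X j ω)) 0 n ω)) P := by
    intro g hg
    refine ((hb hg).abs.add (integrable_const |u 0|)).mono'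
      ((measurable_of_lipschitz hu).comp_aemeasurable
        (hb hg).aestronglyMeasurable.aemeasurable).aestronglyMeasurable (ae_of_all _ fun ω => ?_)
    have h1 := hu (blk (fun j ω => g (X j ω)) 0 n ω) 0
    have h2 := abs_sub_abs_le_abs_sub (u (blk (fun j ω => g (X j ω)) 0 n ω)) (u 0)
    rw [sub_zero] at h1
    simp only [Real.norm_eq_abs, Pi.add_apply]
    linarith
  rw [tendsto_iff_norm_sub_tendsto_zero]
  have hlim : Tendsto (fun N => (n:ℝ) * ∫ x, |F N x - φ x| ∂μ) atTop (𝓝 0) := by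
    simpa using h.const_mul (n:ℝ)
  refine squeeze_zero (fun N => norm_nonneg _) (fun N => ?_) hlim
  have hd : ∀ i, Integrable (fun ω => |F N (X i ω) - φ (X i ω)|) P ∧
      ∫ ω, |F N (X i ω) - φ (X i ω)| ∂P = ∫ x, |F N x - φ x| ∂μ :=
    hX.integrable_comp ((hF N).sub hφ).abs
  rw [← integral_sub (hub (hF N)) (hub hφ)]
  calc ‖∫ ω, (u (blk (fun j ω => F N (X j ω)) 0 n ω) - u (blk (fun j ω => φ (X j ω)) 0 n ω)) ∂P‖
      ≤ ∫ ω, ∑ i ∈ Finset.Ico 0 n, |F N (X (i + 1) ω) - φ (X (i + 1) ω)| ∂P := by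
        refine norm_integral_le_of_norm_le (integrable_finsetSum _ fun i _ => (hd (i + 1)).1)
          (ae_of_all _ fun ω => (hu _ _).trans ?_)
        simp only [blk]
        rw [← Finset.sum_sub_distrib]
        exact Finset.abs_sum_le_sum_abs _ _
    _ = n * ∫ x, |F N x - φ x| ∂μ := by
        rw [integral_finsetSum _ fun i _ => (hd (i + 1)).1]
        simp [(hd _).2]

/-- Uniform Gaussian approximation of Lipschitz statistics of the partial sums. -/
theorem StatChain.exists_abs_sub_gsm_le (hX : StatChain P X μ K) (hM : 0 < M) (hp : 3 < p)
    {f : ℝ → ℝ} (hf : ClassC M p μ f) (hsum : Summable fun k : ℕ => ((k : ℝ) + 1) *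
      (alphaCoef (Kop K) μ 3 (k + 1)) ^ (((1:ℝ≥0∞) - 3 / p).toReal)) :
    ∃ A : ℝ, ∀ (n : ℕ) (h : ℝ → ℝ), (∀ x y, |h x - h y| ≤ |x - y|) →
      |∫ ω, h (blk (fun j ω => f (X j ω) - ∫ y, f y ∂μ) 0 n ω) ∂P -
        gsm (n * Real.toNNReal ((∫ x, (f x - ∫ y, f y ∂μ) ^ 2 ∂μ) +
          2 * ∑' k : ℕ, ∫ x, (f x - ∫ y, f y ∂μ) * (Kop K)^[k + 1] f x ∂μ)) h 0| ≤ A := by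
  obtain ⟨F, a, L, Cd, C, δ, D, hsc, hδ, hδ1, hC, hFb, hF0, hFl, hFD, hlim⟩ :=
    hX.exists_approx hM hp hf hsum
  set φ : ℝ → ℝ := fun x => f x - ∫ y, f y ∂μ with hφd
  have hφ : Integrable φ μ := hf.1.sub (integrable_const _)
  obtain ⟨hφ3, hφD⟩ := integral_cube_le_of_tendsto hFb hφ hlim hFD
  have hφ2 := memLp_two_of_cube hφ hφ3
  have hF2 : ∀ N, MemLp (F N) 2 μ := fun N =>
    memLp_two_of_cube (hFb N).integrable ((hFb N).abs.pow 3).integrable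
  have hcube : ∀ x y : ℝ, |x - y| ^ 3 ≤ 4 * |x| ^ 3 + 4 * |y| ^ 3 := fun x y => by
    have h1 : |x - y| ^ 3 ≤ (|x| + |y|) ^ 3 := by
      gcongr
      exact abs_sub _ _
    have h2 : 4 * |x| ^ 3 + 4 * |y| ^ 3 - (|x| + |y|) ^ 3 =
        3 * (|x| + |y|) * (|x| - |y|) ^ 2 := by ring
    have h3 : 0 ≤ 3 * (|x| + |y|) * (|x| - |y|) ^ 2 := by positivity
    linarith
  have hu3 : ∀ N, Integrable (fun x => 4 * |F N x| ^ 3 + 4 * |φ x| ^ 3) μ := fun N =>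
    (((hFb N).abs.pow 3).integrable.const_mul 4).add (hφ3.const_mul 4)
  have hu3' : ∀ N, Integrable (fun x => |F N x - φ x| ^ 3) μ := fun N =>
    (hu3 N).mono' (((hFb N).integrable.sub hφ).abs.aestronglyMeasurable.pow 3)
      (ae_of_all _ fun x => by
        rw [Real.norm_eq_abs, abs_of_nonneg (by positivity)]
        exact hcube _ _)
  have hsq : Tendsto (fun N => ∫ x, (F N x - φ x) ^ 2 ∂μ) atTop (𝓝 0) := by
    refine tendsto_integral_sq_of_cube (D := 4 * D + 4 * D)
      (fun N => (hFb N).integrable.sub hφ) hu3' (fun N => ?_) hlim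
    refine (integral_mono (hu3' N) (hu3 N) fun x => hcube _ _).trans ?_
    rw [integral_add (((hFb N).abs.pow 3).integrable.const_mul 4) (hφ3.const_mul 4),
      integral_const_mul, integral_const_mul]
    linarith [hFD N]
  have hcov : ∀ l, Tendsto (fun N => ∫ x, F N x * (Kop K)^[l] (F N) x ∂μ) atTop
      (𝓝 (∫ x, φ x * (Kop K)^[l] φ x ∂μ)) :=
    tendsto_integral_mul_kop_iterate hX.bind hF2 hφ2 hsq
  have hcs : ∀ N, CovSeq P (past X hX.meas) (fun j ω => F N (X j ω))
      (fun l => ∫ x, F N x * (Kop K)^[l] (F N) x ∂μ) := fun N => hX.covSeq (hFb N) (hF0 N)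
  obtain ⟨Q, hQ, hcb⟩ := exists_abs_cov_block_le P (past X hX.meas) C (3 + δ) (by linarith) hC
  set B : ℕ → ℝ := fun l => Q * (a (Nat.log 2 (l + 1)) * L (Nat.log 2 (l + 1)) ^ 2) with hB
  have hL0 : ∀ e, 0 ≤ a e * L e ^ 2 := fun e => mul_nonneg (hsc.a_nonneg e) (sq_nonneg _)
  have hBs : Summable B := hsc.summable_of_block (fun l => mul_nonneg hQ (hL0 _)) hQ
    fun e l h1 h2 => by
      simp only [hB, Nat.log_eq_of_pow_le_of_lt_pow h1 h2]
      exact le_rfl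
  set σ2 : ℕ → ℝ := fun N => ∫ x, F N x * (Kop K)^[0] (F N) x ∂μ +
    2 * ∑' l, ∫ x, F N x * (Kop K)^[l + 1] (F N) x ∂μ with hσ2
  set σ := (∫ x, φ x ^ 2 ∂μ) + 2 * ∑' k : ℕ, ∫ x, φ x * (Kop K)^[k + 1] f x ∂μ with hσ
  have hφ0 : ∫ x, φ x ∂μ = 0 := by
    rw [hφd, integral_sub hf.1 (integrable_const _), E_const, sub_self]
  have hterm : ∀ k, ∫ x, φ x * (Kop K)^[k + 1] φ x ∂μ = ∫ x, φ x * (Kop K)^[k + 1] f x ∂μ := by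
    intro k
    have hK := (memLp_two_kop_iterate hX.bind hφ2 (k + 1)).1
    have e : (Kop K)^[k + 1] φ =ᵐ[μ] fun x => (Kop K)^[k + 1] f x - ∫ y, f y ∂μ := by
      have := kop_iterate_sub_ae hX.bind hf.1 (integrable_const (∫ y, f y ∂μ)) (k + 1)
      rwa [kop_iterate_const] at this
    have i1 : Integrable (fun x => φ x * (Kop K)^[k + 1] φ x) μ := hφ2.integrable_mul hK
    have e2 : ∫ x, φ x * (Kop K)^[k + 1] f x ∂μ =
        ∫ x, (φ x * (Kop K)^[k + 1] φ x + (∫ y, f y ∂μ) * φ x) ∂μ := by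
      refine integral_congr_ae ?_
      filter_upwards [e] with x hx
      rw [hx]
      ring
    rw [e2, integral_add i1 (hφ.const_mul _), integral_const_mul, hφ0, mul_zero, add_zero]
  have hσlim : Tendsto σ2 atTop (𝓝 σ) := by
    have h0 : ∫ x, φ x * (Kop K)^[0] φ x ∂μ = ∫ x, φ x ^ 2 ∂μ := by
      congr 1; funext x
      exact (sq (φ x)).symm
    rw [hσ, ← h0]
    simp only [← hterm]
    refine (hcov 0).add (Tendsto.const_mul 2 ?_)
    refine tendsto_tsum_of_dominated_convergence hBs (fun l => hcov (l + 1))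
      (Eventually.of_forall fun N l => ?_)
    exact hcb _ _ gap a L (hcs N) (hFl N) gap_le _ l
      (Nat.pow_log_le_self 2 (Nat.succ_ne_zero l)) (Nat.lt_pow_succ_log_self one_lt_two _)
  have hblk := fun n {h : ℝ → ℝ} (hh : ∀ x y, |h x - h y| ≤ |x - y|) =>
    hX.tendsto_integral_blk (fun N => (hFb N).integrable) hφ hlim hh n
  rcases le_or_gt σ 0 with hσ0 | hσ0
  · obtain ⟨W, hW, hW'⟩ := exists_abs_sub_zero_le P (past X hX.meas) C δ hδ.le hC hsc gap gap_le
    refine ⟨√W, fun n h hh => ?_⟩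
    rw [Real.toNNReal_of_nonpos hσ0, mul_zero, gsm_zero_left]
    have h1 := ((hblk n hh).sub_const (h 0)).abs
    have h2 : Tendsto (fun N => √(n * σ2 N + W)) atTop (𝓝 √(n * σ + W)) :=
      ((hσlim.const_mul (n:ℝ)).add_const W).sqrt
    refine (le_of_tendsto_of_tendsto' h1 h2 fun N => hW' _ _ (hcs N) (hFl N) n h hh).trans
      (Real.sqrt_le_sqrt ?_)
    have := mul_nonpos_of_nonneg_of_nonpos (Nat.cast_nonneg (α := ℝ) n) hσ0
    linarith
  · obtain ⟨W, hW⟩ := _root_.exists_abs_sub_gsm_le P (past X hX.meas) C δ hδ hδ1 hC hsc gap gap_le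
      (Real.sqrt_pos.mpr (half_pos hσ0))
    refine ⟨√σ * W, fun n h hh => ?_⟩
    set t : ℕ → ℝ≥0 := fun N => ⟨√(σ2 N), Real.sqrt_nonneg _⟩ with ht
    set t₀ : ℝ≥0 := ⟨√σ, Real.sqrt_nonneg _⟩ with ht₀
    have htl : Tendsto (fun N => (t N : ℝ)) atTop (𝓝 t₀) := hσlim.sqrt
    have e0 : Real.toNNReal σ = t₀ ^ 2 := by
      apply NNReal.eq
      rw [Real.coe_toNNReal _ hσ0.le, NNReal.coe_pow]
      exact (Real.sq_sqrt hσ0.le).symm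
    have hg : Tendsto (fun N => gsm (n * t N ^ 2) h 0) atTop (𝓝 (gsm (n * t₀ ^ 2) h 0)) := by
      rw [tendsto_iff_norm_sub_tendsto_zero]
      have hl0 : Tendsto (fun N => |(t N : ℝ) - t₀| * √((n:ℝ≥0):ℝ)) atTop (𝓝 0) := by
        simpa using (htl.sub_const (t₀:ℝ)).abs.mul_const (√((n:ℝ≥0):ℝ))
      exact squeeze_zero (fun N => norm_nonneg _)
        (fun N => abs_gsm_mul_sq_sub_le hh n (t N) t₀) hl0
    rw [e0]
    refine le_of_tendsto_of_tendsto ((hblk n hh).sub hg).abs (htl.mul_const W) ?_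
    filter_upwards [hσlim.eventually (lt_mem_nhds (half_lt_self hσ0))] with N hN
    refine hW _ _ (t N) (hcs N) (hFl N) (Real.sqrt_le_sqrt hN.le) ?_ n h hh
    exact (Real.sq_sqrt ((half_pos hσ0).trans hN).le).symm

end Kantorovich

section Wrapper

lemma concave_le_of_le {c : ℝ → ℝ} (hc : ConcaveOn ℝ (Ici 0) c) (h0 : ∀ x, 0 ≤ x → 0 ≤ c x)
    {u v : ℝ} (hu : 0 ≤ u) (huv : u ≤ v) : c u ≤ c v := by
  by_contra! hlt
  have hv := h0 v (hu.trans huv)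
  have hcu : 0 < c u := hv.trans_lt hlt
  set s := (c u - c v) / (2 * c u) with hs
  have hs0 : 0 < s := div_pos (sub_pos.2 hlt) (by linarith)
  have hs1 : s ≤ 1 := by
    rw [hs, div_le_one (by linarith)]
    linarith
  have hw : 0 ≤ (v - u) / s := div_nonneg (sub_nonneg.2 huv) hs0.le
  have h := hc.2 (x := u) (y := u + (v - u) / s) hu (mem_Ici.2 (by linarith))
    (sub_nonneg.2 hs1) hs0.le (by ring)
  have e : (1 - s) • u + s • (u + (v - u) / s) = v := by
    simp only [smul_eq_mul]
    field_simp
    ring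
  rw [e] at h
  simp only [smul_eq_mul] at h
  have h1 : s * c u = (c u - c v) / 2 := by
    rw [hs]
    field_simp
  nlinarith [mul_nonneg hs0.le (h0 (u + (v - u) / s) (by linarith))]

lemma concave_le_add_mul {c : ℝ → ℝ} (hc : ConcaveOn ℝ (Ici 0) c) (h0 : ∀ x, 0 ≤ x → 0 ≤ c x)
    {ε u : ℝ} (hε : 0 < ε) (hu : 0 ≤ u) : c u ≤ c ε + c ε / ε * u := by
  have hcε := h0 ε hε.le
  rcases le_total u ε with h | h
  · have := concave_le_of_le hc h0 hu h
    have : 0 ≤ c ε / ε * u := by positivity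
    linarith
  · have hu0 : 0 < u := hε.trans_le h
    have h1 := hc.2 (x := 0) (y := u) self_mem_Ici hu
      (sub_nonneg.2 ((div_le_one hu0).2 h)) (div_nonneg hε.le hu) (by ring)
    have e : (1 - ε / u) • (0:ℝ) + (ε / u) • u = ε := by
      simp only [smul_eq_mul]
      field_simp
      ring
    rw [e] at h1
    simp only [smul_eq_mul] at h1
    have h2 : 0 ≤ (1 - ε / u) * c 0 :=
      mul_nonneg (sub_nonneg.2 ((div_le_one hu0).2 h)) (h0 0 le_rfl)
    have h3 : ε / u * c u ≤ c ε := by linarith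
    have h4 : c u ≤ c ε / ε * u := by
      calc c u = (ε / u * c u) / ε * u := by field_simp
        _ ≤ c ε / ε * u := by gcongr
    linarith

/-- A function with modulus of continuity `b + L u` is within `b` of an `L`-Lipschitz function. -/
lemma exists_lipschitz_near {g : ℝ → ℝ} {b L : ℝ} (hL : 0 ≤ L)
    (hg : ∀ x y, |g x - g y| ≤ b + L * |x - y|) :
    ∃ k : ℝ → ℝ, (∀ x y, |k x - k y| ≤ L * |x - y|) ∧ ∀ x, |g x - k x| ≤ b := by
  have hlow : ∀ x y, g x - b ≤ g y + L * |x - y| := fun x y => by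
    have := (abs_le.1 (hg x y)).2
    linarith
  have hbd : ∀ x, BddBelow (range fun y => g y + L * |x - y|) := fun x =>
    ⟨g x - b, by rintro _ ⟨y, rfl⟩; exact hlow x y⟩
  have hk : ∀ x y, (⨅ z, (g z + L * |x - z|)) ≤ (⨅ z, (g z + L * |y - z|)) + L * |x - y| := by
    intro x y
    rw [← sub_le_iff_le_add]
    refine le_ciInf fun z => ?_
    rw [sub_le_iff_le_add]
    refine (ciInf_le (hbd x) z).trans ?_
    have := mul_le_mul_of_nonneg_left (abs_sub_le x y z) hL
    linarith
  refine ⟨fun x => ⨅ y, (g y + L * |x - y|), fun x y => abs_le.2 ⟨?_, ?_⟩, fun x => ?_⟩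
  · have := hk y x
    rw [abs_sub_comm] at this
    linarith
  · have := hk x y
    linarith
  · have h1 : (⨅ y, (g y + L * |x - y|)) ≤ g x := by simpa using ciInf_le (hbd x) x
    have h2 : g x - b ≤ ⨅ y, (g y + L * |x - y|) := le_ciInf (hlow x)
    rw [abs_le]
    constructor <;> linarith [(abs_nonneg _).trans (hg x x)]

lemma integrable_of_linear_growth {Q : Measure ℝ} [IsFiniteMeasure Q]
    (hQ : Integrable (fun x : ℝ => x) Q) {g : ℝ → ℝ} (hm : AEStronglyMeasurable g Q) {b L : ℝ}
    (hg : ∀ x y, |g x - g y| ≤ b + L * |x - y|) : Integrable g Q := by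
  refine (((hQ.abs.const_mul L).add (integrable_const (b + |g 0|)))).mono' hm
    (ae_of_all _ fun x => ?_)
  have h1 := hg x 0
  have h2 := abs_sub_abs_le_abs_sub (g x) (g 0)
  rw [sub_zero] at h1
  simp only [Real.norm_eq_abs, Pi.add_apply]
  linarith

lemma abs_integral_sub_le_of_near {P Q : Measure ℝ} [IsProbabilityMeasure P]
    [IsProbabilityMeasure Q] (hP : Integrable (fun x : ℝ => x) P)
    (hQ : Integrable (fun x : ℝ => x) Q) {D : ℝ}
    (hD : ∀ h : ℝ → ℝ, (∀ x y, |h x - h y| ≤ |x - y|) → |(∫ x, h x ∂P) - ∫ x, h x ∂Q| ≤ D)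
    {g : ℝ → ℝ} (hgP : Integrable g P) (hgQ : Integrable g Q) {b L : ℝ} (hL : 0 ≤ L)
    (hg : ∀ x y, |g x - g y| ≤ b + L * |x - y|) :
    |(∫ x, g x ∂P) - ∫ x, g x ∂Q| ≤ 2 * b + L * D := by
  obtain ⟨k, hk, hkb⟩ := exists_lipschitz_near hL hg
  have hkm : Measurable k := by
    have : LipschitzWith (Real.toNNReal L) k := LipschitzWith.of_dist_le_mul fun x y => by
      rw [Real.coe_toNNReal _ hL]
      exact hk x y
    exact this.continuous.measurable
  have hk' : ∀ x y, |k x - k y| ≤ 0 + L * |x - y| := fun x y => by simpa using hk x y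
  have hkD : |(∫ x, k x ∂P) - ∫ x, k x ∂Q| ≤ L * D := by
    rcases hL.eq_or_lt with rfl | hL0
    · have : k = fun _ => k 0 := by
        funext x
        have := hk x 0
        rw [zero_mul] at this
        exact sub_eq_zero.1 (abs_nonpos_iff.1 this)
      rw [this]
      simp
    · have h1 := hD (fun x => k x / L) fun x y => by
        rw [← sub_div, abs_div, abs_of_pos hL0, div_le_iff₀ hL0, mul_comm]
        exact hk x y
      rwa [integral_div, integral_div, ← sub_div, abs_div, abs_of_pos hL0, div_le_iff₀ hL0,
        mul_comm] at h1
  have hnear : ∀ (S : Measure ℝ) [IsProbabilityMeasure S], Integrable (fun x : ℝ => x) S →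
      Integrable g S → |(∫ x, g x ∂S) - ∫ x, k x ∂S| ≤ b := fun S _ hS hgS => by
    rw [← integral_sub hgS (integrable_of_linear_growth hS hkm.aestronglyMeasurable hk'),
      ← Real.norm_eq_abs]
    simpa using norm_integral_le_of_norm_le_const (f := fun x => g x - k x)
      (ae_of_all S hkb)
  have h1 := abs_le.1 (hnear P hP hgP)
  have h2 := abs_le.1 (hnear Q hQ hgQ)
  have h3 := abs_le.1 hkD
  rw [abs_le]
  constructor <;> linarith [h1.1, h1.2, h2.1, h2.2, h3.1, h3.2]

lemma lipC_add_const {c g : ℝ → ℝ} (hg : g ∈ LipC c) (t : ℝ) : (fun x => g x + t) ∈ LipC c :=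
  fun x y => by simpa using hg x y

lemma not_bddAbove_of_aestronglyMeasurable_ne {c : ℝ → ℝ} {P Q : Measure ℝ}
    [IsProbabilityMeasure P] {g : ℝ → ℝ} (hg : g ∈ LipC c) (hP : Integrable g P)
    (hQ : ¬ AEStronglyMeasurable g Q) (C : ℝ) :
    ∃ g' ∈ LipC c, C < |(∫ x, g' x ∂P) - ∫ x, g' x ∂Q| := by
  refine ⟨_, lipC_add_const hg (C + 1 - ∫ x, g x ∂P), ?_⟩
  rw [integral_add hP (integrable_const _), integral_non_aestronglyMeasurable (μ := Q)]
  · simp only [integral_const, probReal_univ, one_smul, sub_zero]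
    exact (lt_add_one C).trans_le ((le_of_eq (by ring)).trans (le_abs_self _))
  · intro h
    exact hQ ((h.sub (aestronglyMeasurable_const (b := C + 1 - ∫ x, g x ∂P))).congr
      (ae_of_all _ fun x => by simp))

/-- A Kantorovich bound controls `dC` for a concave modulus. -/
lemma dC_le_of_forall_lipschitz {c : ℝ → ℝ} (hc : ConcaveOn ℝ (Ici 0) c)
    (h0 : ∀ x, 0 ≤ x → 0 ≤ c x) {P Q : Measure ℝ} [IsProbabilityMeasure P]
    [IsProbabilityMeasure Q] (hP : Integrable (fun x : ℝ => x) P)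
    (hQ : Integrable (fun x : ℝ => x) Q) {A ε : ℝ} (hA : 0 ≤ A) (hε : 0 < ε)
    (hD : ∀ h : ℝ → ℝ, (∀ x y, |h x - h y| ≤ |x - y|) →
      |(∫ x, h x ∂P) - ∫ x, h x ∂Q| ≤ A * ε) :
    dC c P Q ≤ (2 + A) * c ε := by
  have hcε := h0 ε hε.le
  have hpos : 0 ≤ (2 + A) * c ε := by positivity
  have hg : ∀ g ∈ LipC c, ∀ x y, |g x - g y| ≤ c ε + c ε / ε * |x - y| := fun g hg x y =>
    (hg x y).trans (concave_le_add_mul hc h0 hε (abs_nonneg _))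
  by_cases hb : BddAbove (range fun g : LipC c =>
      |(∫ x, (g : ℝ → ℝ) x ∂P) - ∫ x, (g : ℝ → ℝ) x ∂Q|)
  swap
  · rw [dC, Real.iSup_of_not_bddAbove hb]
    exact hpos
  refine Real.iSup_le (fun ⟨g, hgc⟩ => ?_) hpos
  obtain ⟨C, hC⟩ := hb
  by_cases h1 : AEStronglyMeasurable g P <;> by_cases h2 : AEStronglyMeasurable g Q
  · refine (abs_integral_sub_le_of_near hP hQ hD (integrable_of_linear_growth hP h1 (hg g hgc))
      (integrable_of_linear_growth hQ h2 (hg g hgc)) (div_nonneg hcε hε.le) (hg g hgc)).trans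
      (le_of_eq ?_)
    field_simp
  · obtain ⟨g', hg', hlt⟩ := not_bddAbove_of_aestronglyMeasurable_ne hgc
      (integrable_of_linear_growth hP h1 (hg g hgc)) h2 C
    exact absurd (hC ⟨⟨g', hg'⟩, rfl⟩) hlt.not_ge
  · obtain ⟨g', hg', hlt⟩ := not_bddAbove_of_aestronglyMeasurable_ne hgc
      (integrable_of_linear_growth hQ h2 (hg g hgc)) h1 C
    rw [abs_sub_comm] at hlt
    exact absurd (hC ⟨⟨g', hg'⟩, rfl⟩) hlt.not_ge
  · simpa [integral_non_aestronglyMeasurable h1, integral_non_aestronglyMeasurable h2] using hpos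

lemma gsm_zero_eq (v : ℝ≥0) (h : ℝ → ℝ) : gsm v h 0 = ∫ y, h y ∂gaussianReal 0 v := by
  simp [gsm]

end Wrapper

/-- Theorem 4(2): for a stationary Markov chain, if
`f ∈ C(M,p,μ)` with `p ∈ (3,∞]` and `Σ_{k>0} k α_3(k)^{(p−3)/p} < ∞`, then for
every concave `c` with `c(0)=0`, `d_c(P_n(f), G_{σ²(f)}) = O(c(n^{-1/2}))`.
For `p = ∞`, `(p−3)/p` is read as `1`, which is how `(1 − 3/p).toReal` behaves. -/
theorem statement13 {Ω : Type*} [MeasurableSpace Ω] (P : Measure Ω)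
    [IsProbabilityMeasure P] (X : ℕ → Ω → ℝ) (hXm : ∀ i, Measurable (X i))
    (μ : Measure ℝ) [IsProbabilityMeasure μ]
    (K : Kernel ℝ ℝ) [IsMarkovKernel K] (hinv : μ.bind (fun x => K x) = μ)
    (hX0 : Measure.map (X 0) P = μ)
    (hMarkov : ∀ n : ℕ, ∀ g : ℝ → ℝ, Measurable g → (∃ C, ∀ x, |g x| ≤ C) →
      P[fun ω => g (X (n + 1) ω)
          | MeasurableSpace.comap (fun ω => fun i : Fin (n + 1) => X i.1 ω) inferInstance]
        =ᵐ[P] fun ω => Kop K g (X n ω))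
    (hstat : ∀ k n : ℕ,
      Measure.map (fun ω => fun i : Fin n => X (i.1 + k) ω) P
        = Measure.map (fun ω => fun i : Fin n => X i.1 ω) P)
    (M : ℝ) (hM : 0 < M) (p : ℝ≥0∞) (hp : 3 < p)
    (f : ℝ → ℝ) (hf : ClassC M p μ f)
    (hsum : Summable fun k : ℕ => ((k : ℝ) + 1) *
      (alphaCoef (Kop K) μ 3 (k + 1)) ^ (((1:ℝ≥0∞) - 3 / p).toReal)) :
    ∀ c : ℝ → ℝ, ConcaveOn ℝ (Set.Ici (0:ℝ)) c → c 0 = 0 →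
      (∀ x : ℝ, 0 ≤ x → 0 ≤ c x) →
      ∃ B : ℝ, ∀ n : ℕ, 1 ≤ n →
        dC c (Measure.map (fun ω => (n : ℝ) ^ (-(1:ℝ)/2) *
            ∑ i ∈ Finset.range n, (f (X (i + 1) ω) - ∫ y, f y ∂μ)) P)
          (gaussianReal 0 (Real.toNNReal
            ((∫ x, (f x - ∫ y, f y ∂μ) ^ 2 ∂μ) +
              2 * ∑' k : ℕ, ∫ x, (f x - ∫ y, f y ∂μ) * (Kop K)^[k + 1] f x ∂μ)))
          ≤ B * c ((n : ℝ) ^ (-(1:ℝ)/2)) := by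
  intro c hc _ hc0
  have hlaw : ∀ n, Measure.map (X n) P = μ := fun n => by
    have h := congrArg (Measure.map fun z : Fin 1 → ℝ => z 0) (hstat n 1)
    rw [Measure.map_map (measurable_pi_apply 0) (measurable_pi_lambda _ fun i => hXm _),
      Measure.map_map (measurable_pi_apply 0) (measurable_pi_lambda _ fun i => hXm _)] at h
    simpa [Function.comp_def, hX0] using h
  have hX : StatChain P X μ K := ⟨hXm, hinv, hlaw, hMarkov⟩
  obtain ⟨A, hA⟩ := hX.exists_abs_sub_gsm_le hM hp hf hsum
  set v := Real.toNNReal ((∫ x, (f x - ∫ y, f y ∂μ) ^ 2 ∂μ) +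
    2 * ∑' k : ℕ, ∫ x, (f x - ∫ y, f y ∂μ) * (Kop K)^[k + 1] f x ∂μ)
  have hφ : Integrable (fun x => f x - ∫ y, f y ∂μ) μ := hf.1.sub (integrable_const _)
  refine ⟨2 + max A 0, fun n hn => ?_⟩
  have hn0 : (0:ℝ) < n := by exact_mod_cast hn
  set ε := (n : ℝ) ^ (-(1:ℝ)/2) with hε
  have hε0 : 0 < ε := Real.rpow_pos_of_pos hn0 _
  have hnε : n * ε ^ 2 = 1 := by
    rw [hε, ← Real.rpow_natCast, ← Real.rpow_mul hn0.le]
    norm_num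
    rw [Real.rpow_neg_one, mul_inv_cancel₀ hn0.ne']
  set S : Ω → ℝ := fun ω => ε * ∑ i ∈ Finset.range n, (f (X (i + 1) ω) - ∫ y, f y ∂μ) with hS
  have hSi : Integrable S P :=
    (integrable_finsetSum _ fun i _ => (hX.integrable_comp hφ (i + 1)).1).const_mul ε
  have hSm : AEMeasurable S P := hSi.aestronglyMeasurable.aemeasurable
  have : IsProbabilityMeasure (Measure.map S P) := Measure.isProbabilityMeasure_map hSm
  refine dC_le_of_forall_lipschitz hc hc0
    ((integrable_map_measure aestronglyMeasurable_id hSm).2 hSi)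
    (by simpa using integrable_shift_gaussianReal (v := v) (h := fun x => x) measurable_id
          (a := 0) (b := 1) le_rfl zero_le_one (by simp) 0)
    (le_max_right A 0) hε0 fun h hh => ?_
  have h1 := hA n (fun x => h (ε * x) / ε) fun x y => by
    rw [← sub_div, abs_div, abs_of_pos hε0, div_le_iff₀ hε0]
    refine (hh _ _).trans (le_of_eq ?_)
    rw [← mul_sub, abs_mul, abs_of_pos hε0, mul_comm]
  set s : ℝ≥0 := ⟨ε, hε0.le⟩ with hs
  have hv : (n * v) * s ^ 2 = v := by
    have : (n:ℝ≥0) * s ^ 2 = 1 := NNReal.eq (by push_cast; exact hnε)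
    rw [mul_right_comm, this, one_mul]
  have h2 : gsm (n * v) (fun x => h (ε * x) / ε) 0 = (∫ x, h x ∂gaussianReal 0 v) / ε := by
    rw [← gsm_zero_eq, ← hv, gsm_scale, hv]
    simp only [gsm]
    rw [integral_div]
    rfl
  rw [h2, integral_div, ← sub_div, abs_div, abs_of_pos hε0, div_le_iff₀ hε0] at h1
  rw [integral_map hSm (measurable_of_lipschitz hh).aestronglyMeasurable]
  have h3 : ∀ ω, S ω = ε * blk (fun j ω => f (X j ω) - ∫ y, f y ∂μ) 0 n ω := fun ω => by
    simp only [hS, blk, Finset.range_eq_Ico]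
  simp only [h3]
  exact h1.trans (mul_le_mul_of_nonneg_right (le_max_left A 0) hε0.le)

end
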